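/- For every integer n ≥ 0, writing N_i = N(i,11,11n+7) and M_i = M(i,11,11n+7), the following hold: N_0 + 2N_4 + 2M_0 ≥ 2N_3 + N_5 + 2M_1; 3N_0 + N_1 + N_2 + 7N_3 + 4N_5 ≥ 5N_4 + 4M_0 + 7M_1; 4N_1 + 4N_2 + 3N_4 + 4M_1 ≥ 4N_0 + 6N_3 + N_5 + 4M_0; and N_0 + 5N_3 + 2N_4 ≥ 2N_1 + 2N_2 + 4N_5. -/

import Mathlib

/-- `p n`: the number of partitions of `n`. -/
def partitionCount (n : ℕ) : ℕ := Fintype.card (Nat.Partition n)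

/-- The rank of a partition: its largest part minus its number of parts
(the empty partition has rank 0). -/
def partitionRank {n : ℕ} (π : Nat.Partition n) : ℤ :=
  (π.parts.sup : ℤ) - (Multiset.card π.parts : ℤ)

/-- The crank of a partition `π`: if `π` has no parts equal to 1, it is the largest part;
otherwise it is (number of parts larger than the number of ones) − (number of ones). -/
def partitionCrank {n : ℕ} (π : Nat.Partition n) : ℤ :=
  if π.parts.count 1 = 0 then (π.parts.sup : ℤ)
  else ((π.parts.filter fun x => π.parts.count 1 < x).card : ℤ) - (π.parts.count 1 : ℤ)

/-- `rankCount a r n` = `N(a,r,n)`: the number of partitions of `n` whose rank is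
congruent to `a` modulo `r`. -/
def rankCount (a r : ℤ) (n : ℕ) : ℕ :=
  (Finset.univ.filter fun π : Nat.Partition n => partitionRank π % r = a % r).card

/-- `crankCount a n` = `M(a,11,n)`: for `n ≠ 1`, the number of partitions of `n` whose crank
is congruent to `a` modulo 11; at `n = 1` the standard convention `M(0,11,1) = −1`,
`M(1,11,1) = M(10,11,1) = 1`, and `M(a,11,1) = 0` otherwise. -/
def crankCount (a : ℤ) (n : ℕ) : ℤ :=
  if n = 1 then
    if a % 11 = 0 then -1
    else if a % 11 = 1 ∨ a % 11 = 10 then 1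
    else 0
  else ((Finset.univ.filter fun π : Nat.Partition n => partitionCrank π % 11 = a % 11).card : ℤ)

namespace RankCrank

open Filter Topology

/-- The infinite `q`-Pochhammer symbol `(x; P)_∞`. -/
noncomputable def poch (P x : ℂ) : ℂ := ∏' n : ℕ, (1 - x * P ^ n)

theorem summable_poch {P : ℂ} (hP : ‖P‖ < 1) (x : ℂ) :
    Summable fun n : ℕ => ‖-(x * P ^ n)‖ := by
  simpa [norm_mul, norm_pow] using
    (summable_geometric_of_lt_one (norm_nonneg P) hP).mul_left ‖x‖

theorem multipliable_poch {P : ℂ} (hP : ‖P‖ < 1) (x : ℂ) :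
    Multipliable fun n : ℕ => (1 - x * P ^ n) := by
  simpa [sub_eq_add_neg] using multipliable_one_add_of_summable (summable_poch hP x)

theorem poch_eq_mul {P : ℂ} (hP : ‖P‖ < 1) (x : ℂ) :
    poch P x = (1 - x) * poch P (P * x) := by
  have h := (multipliable_poch hP (P * x))
  unfold poch
  rw [tprod_eq_zero_mul' (f := fun n : ℕ => (1 - x * P ^ n))]
  · congr 1
    · simp
    · congr 1; ext n; ring
  · refine h.congr fun n => ?_
    ring

theorem poch_ne_zero {P x : ℂ} (hP : ‖P‖ < 1) (hx : ∀ n : ℕ, x * P ^ n ≠ 1) :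
    poch P x ≠ 0 := by
  have := tprod_one_add_ne_zero_of_summable (f := fun n : ℕ => -(x * P ^ n))
    (fun n => by
      have := hx n
      rw [← sub_eq_add_neg]
      exact sub_ne_zero.mpr (Ne.symm this)) (summable_poch hP x)
  simpa [poch, sub_eq_add_neg] using this

theorem differentiable_poch {P : ℂ} (hP : ‖P‖ < 1) : Differentiable ℂ (poch P) := by
  have key : ∀ R : ℝ, DifferentiableOn ℂ (poch P) (Metric.ball 0 R) := by
    intro R
    have hu : Summable fun n : ℕ => R * ‖P‖ ^ n :=
      (summable_geometric_of_lt_one (norm_nonneg P) hP).mul_left R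
    have h := Summable.hasProdLocallyUniformlyOn_nat_one_add (K := Metric.ball (0 : ℂ) R)
      (f := fun (n : ℕ) (x : ℂ) => -(x * P ^ n)) Metric.isOpen_ball hu
      (Eventually.of_forall fun n x hx => by
        rw [norm_neg, norm_mul, norm_pow]
        have : ‖x‖ ≤ R := by simpa using (Metric.mem_ball.mp hx).le
        gcongr)
      (fun n => by fun_prop)
    have h2 := h.tendstoLocallyUniformlyOn_finsetRange.differentiableOn
      (Eventually.of_forall fun n => by fun_prop) Metric.isOpen_ball
    refine h2.congr fun x _ => ?_
    simp [poch, sub_eq_add_neg]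
  intro x
  exact (key (‖x‖ + 1)).differentiableAt (Metric.isOpen_ball.mem_nhds (by simp))

/-- Holomorphy on the punctured plane. -/
def HolC (f : ℂ → ℂ) : Prop := ∀ w, w ≠ 0 → DifferentiableAt ℂ f w

/-- Membership in the multiplicative lattice `P ^ ℤ`. -/
def Lat (P w : ℂ) : Prop := ∃ m : ℤ, w * P ^ m = 1

theorem countable_lat (P c : ℂ) (hP0 : P ≠ 0) (hc : c ≠ 0) : {w : ℂ | Lat P (w * c)}.Countable := by
  refine (Set.countable_range fun m : ℤ => (P ^ m)⁻¹ * c⁻¹).mono ?_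
  rintro w ⟨m, hm⟩
  refine ⟨m, ?_⟩
  have : P ^ m ≠ 0 := zpow_ne_zero _ hP0
  simp only
  field_simp
  linear_combination -hm

theorem eq_of_eq_off_countable {f g : ℂ → ℂ} {S : Set ℂ} (hS : S.Countable)
    (hf : ∀ w, w ≠ 0 → ContinuousAt f w) (hg : ∀ w, w ≠ 0 → ContinuousAt g w)
    (h : ∀ w, w ≠ 0 → w ∉ S → f w = g w) (w : ℂ) (hw : w ≠ 0) : f w = g w := by
  have hd : Dense (Sᶜ) := hS.dense_compl ℝ
  have h1 : (𝓝[Sᶜ] w).NeBot := mem_closure_iff_nhdsWithin_neBot.mp (hd w)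
  have h2 : Tendsto f (𝓝[Sᶜ] w) (𝓝 (f w)) := (hf w hw).mono_left nhdsWithin_le_nhds
  have h3 : Tendsto g (𝓝[Sᶜ] w) (𝓝 (g w)) := (hg w hw).mono_left nhdsWithin_le_nhds
  refine tendsto_nhds_unique (h2.congr' ?_) h3
  have h4 : ∀ᶠ v in 𝓝[Sᶜ] w, v ≠ 0 := nhdsWithin_le_nhds (isOpen_ne.mem_nhds hw)
  filter_upwards [h4, self_mem_nhdsWithin] with v hv hvS using h v hv hvS

theorem const_of_periodic {P : ℂ} (hP : ‖P‖ < 1) (hP0 : P ≠ 0) {f : ℂ → ℂ} (hf : HolC f)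
    (h : ∀ w, w ≠ 0 → f (P * w) = f w) {w v : ℂ} (hw : w ≠ 0) (hv : v ≠ 0) : f w = f v := by
  have hn : 0 < ‖P‖ := norm_pos_iff.mpr hP0
  have hz : ∀ (m : ℕ) (w : ℂ), w ≠ 0 → f (P ^ m * w) = f w := by
    intro m
    induction m with
    | zero => simp
    | succ m ih =>
      intro w hw
      rw [pow_succ, mul_assoc, ih _ (mul_ne_zero hP0 hw), h w hw]
  have hz' : ∀ (m : ℤ) (w : ℂ), w ≠ 0 → f (P ^ m * w) = f w := by
    intro m w hw
    obtain ⟨k, rfl | rfl⟩ := m.eq_nat_or_neg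
    · simpa using hz k w hw
    · have := hz k (P ^ (-(k : ℤ)) * w) (mul_ne_zero (zpow_ne_zero _ hP0) hw)
      rw [← this, ← mul_assoc, zpow_neg, zpow_natCast, mul_inv_cancel₀ (pow_ne_zero _ hP0), one_mul]
  have hK : IsCompact (Metric.closedBall (0 : ℂ) 1 \ Metric.ball 0 ‖P‖) :=
    (isCompact_closedBall 0 1).diff Metric.isOpen_ball
  have hcont : ContinuousOn f (Metric.closedBall (0 : ℂ) 1 \ Metric.ball 0 ‖P‖) := by
    intro w hw
    refine (hf w ?_).continuousAt.continuousWithinAt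
    rintro rfl
    exact hw.2 (by simpa using hP0)
  obtain ⟨C, hC⟩ := hK.exists_bound_of_continuousOn hcont
  have hg : Differentiable ℂ fun z => f (Complex.exp z) := fun z =>
    (hf _ (Complex.exp_ne_zero z)).comp z Complex.differentiable_exp.differentiableAt
  have hb : Bornology.IsBounded (Set.range fun z => f (Complex.exp z)) := by
    refine isBounded_iff_forall_norm_le.mpr ⟨C, ?_⟩
    rintro _ ⟨z, rfl⟩
    have hez : 0 < ‖Complex.exp z‖ := norm_pos_iff.mpr (Complex.exp_ne_zero z)
    obtain ⟨m, hm1, hm2⟩ := exists_mem_Ioc_zpow (x := ‖Complex.exp z‖) (y := ‖P‖⁻¹) hez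
      ((one_lt_inv₀ hn).mpr hP)
    have e := hz' (m + 1) (Complex.exp z) (Complex.exp_ne_zero z)
    change ‖f (Complex.exp z)‖ ≤ C
    rw [← e]
    apply hC
    rw [inv_zpow, ] at hm1 hm2
    have hp : 0 < ‖P‖ ^ (m + 1) := zpow_pos hn _
    constructor
    · rw [mem_closedBall_zero_iff, norm_mul, norm_zpow]
      calc ‖P‖ ^ (m + 1) * ‖Complex.exp z‖ ≤ ‖P‖ ^ (m + 1) * (‖P‖ ^ (m + 1))⁻¹ := by gcongr
        _ = 1 := mul_inv_cancel₀ hp.ne'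
    · rw [mem_ball_zero_iff, not_lt, norm_mul, norm_zpow]
      calc ‖P‖ = ‖P‖ ^ (m + 1) * (‖P‖ ^ m)⁻¹ := by
            rw [zpow_add_one₀ hn.ne']
            have : ‖P‖ ^ m ≠ 0 := (zpow_pos hn _).ne'
            field_simp
        _ ≤ _ := by gcongr
  have := hg.apply_eq_apply_of_bounded hb (Complex.log w) (Complex.log v)
  simpa [Complex.exp_log hw, Complex.exp_log hv] using this

/-- Division by a function with simple zeros. -/
theorem exists_quotient {N D : ℂ → ℂ} (hN : HolC N) (hD : HolC D)
    (h0 : ∀ w, w ≠ 0 → D w = 0 → N w = 0) (h1 : ∀ w, w ≠ 0 → D w = 0 → deriv D w ≠ 0) :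
    ∃ h, HolC h ∧ ∀ w, w ≠ 0 → N w = h w * D w := by
  classical
  refine ⟨fun w => if D w = 0 then deriv N w / deriv D w else N w / D w, ?_, ?_⟩
  · intro p hp
    by_cases hDp : D p = 0
    · have hNp := h0 p hp hDp
      have hopen : {w : ℂ | w ≠ 0} ∈ 𝓝 p := isOpen_ne.mem_nhds hp
      have dN : DifferentiableAt ℂ (dslope N p) p := by
        have : DifferentiableOn ℂ N {w : ℂ | w ≠ 0} := fun w hw =>
          (hN w hw).differentiableWithinAt
        exact ((Complex.differentiableOn_dslope hopen).mpr this).differentiableAt hopen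
      have dD : DifferentiableAt ℂ (dslope D p) p := by
        have : DifferentiableOn ℂ D {w : ℂ | w ≠ 0} := fun w hw =>
          (hD w hw).differentiableWithinAt
        exact ((Complex.differentiableOn_dslope hopen).mpr this).differentiableAt hopen
      have hne : dslope D p p ≠ 0 := by rw [dslope_same]; exact h1 p hp hDp
      have hev : ∀ᶠ w in 𝓝 p, dslope D p w ≠ 0 := dD.continuousAt.eventually_ne hne
      refine (dN.div dD hne).congr_of_eventuallyEq ?_
      filter_upwards [hev] with w hw
      by_cases hwp : w = p
      · subst hwp; simp [hDp, dslope_same]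
      · have e1 : D w = (w - p) * dslope D p w := by
          have := sub_smul_dslope D p w
          simp only [smul_eq_mul, hDp, sub_zero] at this
          exact this.symm
        have e2 : N w = (w - p) * dslope N p w := by
          have := sub_smul_dslope N p w
          simp only [smul_eq_mul, hNp, sub_zero] at this
          exact this.symm
        have hs : w - p ≠ 0 := sub_ne_zero.mpr hwp
        have : D w ≠ 0 := by rw [e1]; exact mul_ne_zero hs hw
        rw [if_neg this, e1, e2, mul_div_mul_left _ _ hs]
        rfl
    · have hev : ∀ᶠ w in 𝓝 p, D w ≠ 0 := (hD p hp).continuousAt.eventually_ne hDp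
      refine ((hN p hp).div (hD p hp) hDp).congr_of_eventuallyEq ?_
      filter_upwards [hev] with w hw
      rw [if_neg hw]
      rfl
  · intro w hw
    by_cases hDw : D w = 0
    · simp [hDw, h0 w hw hDw]
    · simp [hDw]

/-- Two quasi-periodic functions with the same multiplier are proportional as soon as one of them
vanishes at the (simple) zeros of the other. -/
theorem exists_const_mul {P : ℂ} (hP : ‖P‖ < 1) (hP0 : P ≠ 0) {N D μ : ℂ → ℂ}
    (hN : HolC N) (hD : HolC D)
    (h0 : ∀ w, w ≠ 0 → D w = 0 → N w = 0) (h1 : ∀ w, w ≠ 0 → D w = 0 → deriv D w ≠ 0)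
    (hcount : {w | w ≠ 0 ∧ D w = 0}.Countable) (hμ : ∀ w, w ≠ 0 → μ w ≠ 0)
    (hNP : ∀ w, w ≠ 0 → N (P * w) = μ w * N w) (hDP : ∀ w, w ≠ 0 → D (P * w) = μ w * D w) :
    ∃ c, ∀ w, w ≠ 0 → N w = c * D w := by
  obtain ⟨h, hh, e⟩ := exists_quotient hN hD h0 h1
  have hper : ∀ w, w ≠ 0 → h (P * w) = h w := by
    refine eq_of_eq_off_countable (f := fun w => h (P * w)) hcount ?_
      (fun w hw => (hh w hw).continuousAt) ?_
    · intro w hw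
      exact ContinuousAt.comp (f := fun w => P * w) (hh _ (mul_ne_zero hP0 hw)).continuousAt
        (by fun_prop)
    · intro w hw hS
      have hDw : D w ≠ 0 := fun h => hS ⟨hw, h⟩
      have e1 := e (P * w) (mul_ne_zero hP0 hw)
      rw [hNP w hw, hDP w hw, e w hw] at e1
      have : μ w * D w ≠ 0 := mul_ne_zero (hμ w hw) hDw
      apply mul_right_cancel₀ this
      linear_combination -e1
  refine ⟨h 1, fun w hw => ?_⟩
  rw [e w hw, const_of_periodic hP hP0 hh hper hw one_ne_zero]

section

/-- The regular part of the theta function at `1`. -/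
noncomputable def phi (P w : ℂ) : ℂ := poch P P * poch P (P * w) * poch P (P / w)

/-- The theta function `(P; P)_∞ (w; P)_∞ (P / w; P)_∞`. -/
noncomputable def theta (P w : ℂ) : ℂ := poch P P * poch P w * poch P (P / w)

section
variable {P : ℂ} (hP : ‖P‖ < 1) (hP0 : P ≠ 0)
include hP

theorem theta_eq_phi (w : ℂ) : theta P w = (1 - w) * phi P w := by
  rw [theta, phi, poch_eq_mul hP w]; ring

theorem phi_one : phi P 1 = poch P P ^ 3 := by simp [phi]; ring

theorem phi_inv (w : ℂ) : phi P w⁻¹ = phi P w := by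
  simp [phi, div_eq_mul_inv]; ring

theorem theta_one : theta P 1 = 0 := by simp [theta_eq_phi hP]

theorem theta_inv {w : ℂ} (hw : w ≠ 0) : theta P w⁻¹ = -w⁻¹ * theta P w := by
  rw [theta_eq_phi hP, theta_eq_phi hP, phi_inv hP]; field_simp; ring

theorem holC_poch_div : HolC fun w => poch P (P / w) := fun w hw =>
  (differentiable_poch hP _).comp w (by fun_prop (disch := assumption))

theorem holC_theta : HolC (theta P) := fun w hw =>
  ((differentiable_poch hP w).const_mul _).mul (holC_poch_div hP w hw)

theorem holC_phi : HolC (phi P) := fun w hw =>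
  (((differentiable_poch hP _).comp w (by fun_prop)).const_mul _).mul (holC_poch_div hP w hw)

include hP0

theorem theta_mul {w : ℂ} (hw : w ≠ 0) : theta P (P * w) = -w⁻¹ * theta P w := by
  have e := poch_eq_mul hP w⁻¹
  rw [theta, theta, poch_eq_mul hP w, show P / (P * w) = w⁻¹ by field_simp, e,
    show P * w⁻¹ = P / w by rw [div_eq_mul_inv]]
  field_simp
  ring

theorem poch_self_ne_zero : poch P P ≠ 0 := by
  refine poch_ne_zero hP fun n h => ?_
  have : ‖P ^ (n + 1)‖ < 1 := by
    rw [norm_pow]; exact pow_lt_one₀ (norm_nonneg _) hP (by simp)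
  rw [pow_succ', h] at this
  simp at this

theorem theta_ne_zero {w : ℂ} (hw : w ≠ 0) (h : ¬ Lat P w) : theta P w ≠ 0 := by
  refine mul_ne_zero (mul_ne_zero (poch_self_ne_zero hP hP0) ?_) ?_
  · exact poch_ne_zero hP fun n hn => h ⟨n, by simpa using hn⟩
  · refine poch_ne_zero hP fun n hn => h ⟨-(n + 1 : ℤ), ?_⟩
    rw [zpow_neg, ← Nat.cast_add_one, zpow_natCast]
    have : P ^ (n + 1) ≠ 0 := pow_ne_zero _ hP0
    field_simp at hn ⊢
    rw [pow_succ]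
    linear_combination -hn

omit hP in
theorem lat_iff_mul (w : ℂ) : Lat P (P * w) ↔ Lat P w := by
  constructor
  · rintro ⟨m, h⟩
    exact ⟨m + 1, by rw [zpow_add_one₀ hP0]; linear_combination h⟩
  · rintro ⟨m, h⟩
    refine ⟨m - 1, ?_⟩
    rw [← h, show P ^ m = P ^ (m - 1) * P by rw [← zpow_add_one₀ hP0]; simp]
    ring

theorem lat_induction {p : ℂ → Prop} (h1 : p 1) (h : ∀ w, w ≠ 0 → (p w ↔ p (P * w)))
    {w : ℂ} (hw : Lat P w) : p w := by
  obtain ⟨m, hm⟩ := hw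
  have hz : ∀ n : ℤ, p (P ^ n) := by
    intro n
    induction n with
    | zero => simpa
    | succ n ih =>
      rw [zpow_add_one₀ hP0, mul_comm]
      exact (h _ (zpow_ne_zero _ hP0)).mp ih
    | pred n ih =>
      rw [show P ^ (-(n : ℤ)) = P * P ^ (-(n : ℤ) - 1) by
        rw [← zpow_one_add₀ hP0]; congr 1; ring] at ih
      exact (h _ (zpow_ne_zero _ hP0)).mpr ih
  rw [eq_inv_of_mul_eq_one_left hm, ← zpow_neg]
  exact hz _

theorem theta_eq_zero_iff {w : ℂ} (hw : w ≠ 0) : theta P w = 0 ↔ Lat P w := by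
  refine ⟨fun h => by_contra fun h' => theta_ne_zero hP hP0 hw h' h, fun h => ?_⟩
  refine lat_induction hP hP0 (p := fun w => theta P w = 0) (theta_one hP) (fun w hw => ?_) h
  rw [theta_mul hP hP0 hw]
  simp [hw]

theorem deriv_theta_one : deriv (theta P) 1 = - poch P P ^ 3 := by
  have h : HasDerivAt (fun w => (1 - w) * phi P w) (-1 * phi P 1 + (1 - 1) * deriv (phi P) 1) 1 :=
    ((hasDerivAt_id (1 : ℂ)).const_sub 1).mul (holC_phi hP 1 one_ne_zero).hasDerivAt
  have e : theta P = fun w => (1 - w) * phi P w := funext (theta_eq_phi hP)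
  rw [e, h.deriv, phi_one hP]; ring

theorem deriv_phi_one : deriv (phi P) 1 = 0 := by
  have h := (holC_phi hP 1 one_ne_zero).hasDerivAt
  have h2 : HasDerivAt (fun w => phi P w⁻¹) (deriv (phi P) 1 * (-1)) 1 := by
    have h3 : HasDerivAt (phi P) (deriv (phi P) 1) ((1 : ℂ)⁻¹) := by simpa using h
    have h4 := h3.comp (1 : ℂ) (hasDerivAt_inv (one_ne_zero (α := ℂ)))
    simpa [Function.comp_def] using h4
  have e : (fun w => phi P w⁻¹) = phi P := funext (phi_inv hP)
  rw [e] at h2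
  have := h.unique h2
  linear_combination this / 2

theorem deriv_theta_ne_zero {w : ℂ} (hw : w ≠ 0) (h : theta P w = 0) : deriv (theta P) w ≠ 0 := by
  have key : theta P w = 0 ∧ deriv (theta P) w ≠ 0 := by
    refine lat_induction hP hP0 (p := fun w => theta P w = 0 ∧ deriv (theta P) w ≠ 0) ?_ ?_
      ((theta_eq_zero_iff hP hP0 hw).mp h)
    · refine ⟨theta_one hP, ?_⟩
      rw [deriv_theta_one hP hP0]
      exact neg_ne_zero.mpr (pow_ne_zero _ (poch_self_ne_zero hP hP0))
    · intro w hw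
      have h1 : HasDerivAt (fun w => theta P (P * w)) (deriv (theta P) (P * w) * P) w := by
        have h2 := (holC_theta hP (P * w) (mul_ne_zero hP0 hw)).hasDerivAt
        have h3 : HasDerivAt (fun w : ℂ => P * w) P w := by
          simpa using (hasDerivAt_id w).const_mul P
        exact h2.comp w h3
      have h2 : HasDerivAt (fun w => -w⁻¹ * theta P w)
          (-(-(w ^ 2)⁻¹) * theta P w + -w⁻¹ * deriv (theta P) w) w :=
        (hasDerivAt_inv hw).neg.mul (holC_theta hP w hw).hasDerivAt
      have h3 : (fun w => theta P (P * w)) =ᶠ[𝓝 w] fun w => -w⁻¹ * theta P w := by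
        filter_upwards [isOpen_ne.mem_nhds hw] with v hv using theta_mul hP hP0 hv
      have h4 := (h2.congr_of_eventuallyEq h3).unique h1
      rw [theta_mul hP hP0 hw]
      have hwi : w⁻¹ ≠ 0 := inv_ne_zero hw
      constructor
      · rintro ⟨h5, h6⟩
        refine ⟨by simp [h5], fun h7 => h6 ?_⟩
        rw [h5, h7] at h4
        simpa [hw] using h4
      · rintro ⟨h5, h6⟩
        have h5' : theta P w = 0 := by simpa [hw] using h5
        refine ⟨h5', fun h7 => h6 ?_⟩
        rw [h5', h7] at h4
        simpa [hP0] using h4.symm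
  exact key.2

end

end

section

/-- The partial fraction series with coefficients `c` and poles on the lattice. -/
noncomputable def lam (P : ℂ) (c : ℤ → ℂ) (w : ℂ) : ℂ := ∑' m : ℤ, c m / (1 - w * P ^ m)

section
variable {P : ℂ} (hP : ‖P‖ < 1) (hP0 : P ≠ 0)
include hP hP0

theorem tendsto_zpow_atTop : Tendsto (fun m : ℤ => ‖P ^ m‖) atTop (𝓝 0) := by
  have : Tendsto (fun m : ℤ => ‖P‖ ^ m.toNat) atTop (𝓝 0) :=
    (tendsto_pow_atTop_nhds_zero_of_lt_one (norm_nonneg _) hP).comp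
      (tendsto_atTop_atTop.mpr fun b => ⟨b, fun a ha => by omega⟩)
  refine this.congr' ?_
  filter_upwards [eventually_ge_atTop 0] with m hm
  obtain ⟨k, rfl⟩ := Int.eq_ofNat_of_zero_le hm
  simp

theorem exists_lower_bound {v : ℂ} (hv : v ≠ 0) :
    ∃ ε > 0, ∀ m : ℤ, v * P ^ m ≠ 1 → ε * (1 + ‖P ^ m‖) ≤ ‖1 - v * P ^ m‖ := by
  have hvn : 0 < ‖v‖ := norm_pos_iff.mpr hv
  have hpos : ∀ m : ℤ, 0 < ‖P ^ m‖ := fun m => norm_pos_iff.mpr (zpow_ne_zero _ hP0)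
  have h1 := tendsto_zpow_atTop hP hP0
  have hinv : Tendsto (fun m : ℤ => ‖P ^ (-m)‖) atBot (𝓝 0) := h1.comp tendsto_neg_atBot_atTop
  obtain ⟨δ, hδ, hδ1, hδv⟩ : ∃ δ : ℝ, 0 < δ ∧ δ ≤ 1 / 4 ∧ δ ≤ ‖v‖ / 4 :=
    ⟨min (1/4) (‖v‖/4), by positivity, min_le_left _ _, min_le_right _ _⟩
  have hev : ∀ᶠ m : ℤ in cofinite, δ * (1 + ‖P ^ m‖) ≤ ‖1 - v * P ^ m‖ := by
    rw [Int.cofinite_eq, eventually_sup]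
    constructor
    · filter_upwards [hinv.eventually_lt_const (u := min (‖v‖ / 4) (1)) (by positivity)] with m hm
      have a1 : ‖P ^ (-m)‖ < ‖v‖ / 4 := hm.trans_le (min_le_left _ _)
      have a2 : ‖P ^ (-m)‖ < 1 := hm.trans_le (min_le_right _ _)
      have e : ‖P ^ m‖ * ‖P ^ (-m)‖ = 1 := by
        rw [← norm_mul, ← zpow_add₀ hP0]; simp
      have b : ‖v * P ^ m‖ - 1 ≤ ‖1 - v * P ^ m‖ := by
        have := norm_sub_norm_le (v * P ^ m) 1
        rw [norm_sub_rev] at this; simpa using this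
      rw [norm_mul] at b
      have h0 := hpos m
      have c1 : 1 ≤ ‖P ^ m‖ * (‖v‖ / 4) := by rw [← e]; gcongr
      have c2 : 1 ≤ ‖P ^ m‖ := by nlinarith
      nlinarith
    · filter_upwards [h1.eventually_lt_const (u := min (1 / (4 * ‖v‖)) (1)) (by positivity)] with m hm
      have a1 : ‖P ^ m‖ < 1 / (4 * ‖v‖) := hm.trans_le (min_le_left _ _)
      have a2 : ‖P ^ m‖ < 1 := hm.trans_le (min_le_right _ _)
      have b : 1 - ‖v * P ^ m‖ ≤ ‖1 - v * P ^ m‖ := by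
        have := norm_sub_norm_le 1 (v * P ^ m)
        simpa using this
      rw [norm_mul] at b
      have : ‖v‖ * ‖P ^ m‖ ≤ ‖v‖ * (1 / (4 * ‖v‖)) := by gcongr
      have e2 : ‖v‖ * (1 / (4 * ‖v‖)) = 1 / 4 := by field_simp
      nlinarith
  have hfin : {m : ℤ | ¬ δ * (1 + ‖P ^ m‖) ≤ ‖1 - v * P ^ m‖}.Finite := hev
  obtain ⟨η, hη, hη2⟩ : ∃ η > 0, ∀ m ∈ hfin.toFinset, v * P ^ m ≠ 1 →
      η * (1 + ‖P ^ m‖) ≤ ‖1 - v * P ^ m‖ := by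
    induction hfin.toFinset using Finset.induction_on with
    | empty => exact ⟨1, one_pos, by simp⟩
    | insert a s _ ih =>
      obtain ⟨η, hη, h⟩ := ih
      by_cases ha : v * P ^ a = 1
      · refine ⟨η, hη, fun m hm hne => ?_⟩
        rcases Finset.mem_insert.mp hm with rfl | hm
        · exact absurd ha hne
        · exact h m hm hne
      · have h0 : 0 < ‖1 - v * P ^ a‖ := norm_pos_iff.mpr (sub_ne_zero.mpr (Ne.symm ha))
        refine ⟨min η (‖1 - v * P ^ a‖ / (1 + ‖P ^ a‖)), by positivity, fun m hm hne => ?_⟩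
        rcases Finset.mem_insert.mp hm with rfl | hm
        · calc _ ≤ ‖1 - v * P ^ m‖ / (1 + ‖P ^ m‖) * (1 + ‖P ^ m‖) := by
                gcongr; exact min_le_right _ _
            _ = _ := by field_simp
        · refine le_trans ?_ (h m hm hne)
          gcongr; exact min_le_left _ _
  refine ⟨min δ η, by positivity, fun m hne => ?_⟩
  by_cases hm : δ * (1 + ‖P ^ m‖) ≤ ‖1 - v * P ^ m‖
  · refine le_trans ?_ hm
    gcongr; exact min_le_left _ _
  · refine le_trans ?_ (hη2 m (by simpa using hm) hne)
    gcongr; exact min_le_right _ _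

theorem exists_ball_lower_bound {v : ℂ} (hv : v ≠ 0) :
    ∃ ε > 0, ∀ w ∈ Metric.ball v ε, ∀ m : ℤ, v * P ^ m ≠ 1 → ε ≤ ‖1 - w * P ^ m‖ := by
  obtain ⟨ε, hε, h⟩ := exists_lower_bound hP hP0 hv
  refine ⟨ε / 2, by positivity, fun w hw m hm => ?_⟩
  have h1 := h m hm
  rw [mem_ball_iff_norm] at hw
  have h2 : ‖1 - v * P ^ m‖ ≤ ‖1 - w * P ^ m‖ + ‖w - v‖ * ‖P ^ m‖ := by
    rw [← norm_mul]
    calc _ = ‖(1 - w * P ^ m) + (w - v) * P ^ m‖ := by ring_nf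
      _ ≤ _ := norm_add_le _ _
  have h3 : ‖w - v‖ * ‖P ^ m‖ ≤ ε / 2 * ‖P ^ m‖ := by gcongr
  have := norm_nonneg (P ^ m)
  nlinarith

theorem summable_lam {c : ℤ → ℂ} (hc : Summable c) {v : ℂ} (hv : v ≠ 0)
    (h : ∀ m, c m ≠ 0 → v * P ^ m ≠ 1) : Summable fun m : ℤ => c m / (1 - v * P ^ m) := by
  obtain ⟨ε, hε, hb⟩ := exists_ball_lower_bound hP hP0 hv
  refine Summable.of_norm_bounded (g := fun m => ‖c m‖ * ε⁻¹) (hc.norm.mul_right _) fun m => ?_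
  by_cases hcm : c m = 0
  · simp [hcm]
  · rw [norm_div, div_eq_mul_inv]
    gcongr
    exact hb v (Metric.mem_ball_self hε) m (h m hcm)

theorem differentiableAt_lam {c : ℤ → ℂ} (hc : Summable c) {v : ℂ} (hv : v ≠ 0)
    (h : ∀ m, c m ≠ 0 → v * P ^ m ≠ 1) : DifferentiableAt ℂ (lam P c) v := by
  obtain ⟨ε, hε, hb⟩ := exists_ball_lower_bound hP hP0 hv
  have key : DifferentiableOn ℂ (fun w => ∑' m : ℤ, c m / (1 - w * P ^ m)) (Metric.ball v ε) := by
    refine Complex.differentiableOn_tsum_of_summable_norm (u := fun m => ‖c m‖ * ε⁻¹)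
      (hc.norm.mul_right _) (fun m => ?_) Metric.isOpen_ball fun m w hw => ?_
    · by_cases hcm : c m = 0
      · simp [hcm]
      · intro w hw
        have : 1 - w * P ^ m ≠ 0 := norm_pos_iff.mp (hε.trans_le (hb w hw m (h m hcm)))
        exact (by fun_prop (disch := exact this) :
          DifferentiableAt ℂ (fun w => c m / (1 - w * P ^ m)) w).differentiableWithinAt
    · by_cases hcm : c m = 0
      · simp [hcm]
      · rw [norm_div, div_eq_mul_inv]
        gcongr
        exact hb w hw m (h m hcm)
  exact key.differentiableAt (Metric.ball_mem_nhds v hε)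

theorem zpow_inj {m n : ℤ} (h : P ^ m = P ^ n) : m = n := by
  have h1 : ‖P‖ ^ m = ‖P‖ ^ n := by rw [← norm_zpow, h, norm_zpow]
  exact zpow_right_injective₀ (norm_pos_iff.mpr hP0) hP.ne h1

theorem eventually_not_lat {v : ℂ} (hv : v ≠ 0) : ∀ᶠ w in 𝓝 v, w ≠ v → ¬ Lat P w := by
  obtain ⟨ε, hε, hb⟩ := exists_ball_lower_bound hP hP0 hv
  filter_upwards [Metric.ball_mem_nhds v hε] with w hw hne
  rintro ⟨m, hm⟩
  by_cases h : v * P ^ m = 1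
  · exact hne (mul_right_cancel₀ (zpow_ne_zero m hP0) (hm.trans h.symm))
  · have := hb w hw m h
    rw [hm] at this
    simp at this
    linarith

omit hP hP0 in
theorem lam_split {c : ℤ → ℂ} (n : ℤ) {w : ℂ}
    (hs : Summable fun m : ℤ => c m / (1 - w * P ^ m)) :
    lam P c w = c n / (1 - w * P ^ n) + lam P (fun m => if m = n then 0 else c m) w := by
  rw [lam, hs.tsum_eq_add_tsum_ite n, lam]
  congr 1
  refine tsum_congr fun m => ?_
  split_ifs <;> simp

/-- Multiplying a partial fraction series by a function vanishing on the lattice. -/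
theorem exists_holC_mul_lam {c : ℤ → ℂ} (hc : Summable c) {f : ℂ → ℂ} (hf : HolC f)
    (h0 : ∀ w, Lat P w → f w = 0) :
    ∃ G, HolC G ∧ (∀ w, w ≠ 0 → ¬ Lat P w → G w = f w * lam P c w) ∧ G 1 = - c 0 * deriv f 1 := by
  classical
  have hzp : ∀ m : ℤ, P ^ m ≠ 0 := fun m => zpow_ne_zero m hP0
  refine ⟨fun w => if h : Lat P w then - c h.choose * w * deriv f w else f w * lam P c w,
    fun v hv => ?_, fun w hw h => dif_neg h, ?_⟩
  · have hnear := eventually_not_lat hP hP0 hv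
    have hne0 : ∀ᶠ w in 𝓝 v, w ≠ 0 := isOpen_ne.mem_nhds hv
    by_cases hL : Lat P v
    · obtain ⟨n, hn⟩ := hL
      obtain ⟨q, hq, e⟩ := exists_quotient (N := f) (D := fun w => 1 - w * P ^ n) hf
        (fun w _ => by fun_prop) (fun w _ h => h0 w ⟨n, by linear_combination -h⟩)
        (fun w _ _ => by
          have : HasDerivAt (fun w => 1 - w * P ^ n) (-(1 * P ^ n)) w :=
            ((hasDerivAt_id w).mul_const _).const_sub 1
          rw [this.deriv]; simpa using hzp n)
      have hqv : c n * q v = - c n * v * deriv f v := by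
        have d1 : HasDerivAt (fun w => q w * (1 - w * P ^ n))
            (deriv q v * (1 - v * P ^ n) + q v * (-(1 * P ^ n))) v :=
          (hq v hv).hasDerivAt.mul (((hasDerivAt_id v).mul_const _).const_sub 1)
        have d2 : HasDerivAt f _ v := d1.congr_of_eventuallyEq (by
          filter_upwards [hne0] with w hw using e w hw)
        rw [d2.deriv, hn]
        linear_combination (-c n * q v) * hn
      have hsum : Summable fun m => if m = n then 0 else c m := by
        refine Summable.of_norm_bounded hc.norm fun m => ?_
        split_ifs <;> simp
      have dl : DifferentiableAt ℂ (lam P fun m => if m = n then 0 else c m) v := by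
        refine differentiableAt_lam hP hP0 hsum hv fun m hm h => ?_
        split_ifs at hm with hmn
        · exact hm rfl
        · exact hmn (zpow_inj hP hP0 (mul_left_cancel₀ hv (h.trans hn.symm)))
      have dt : DifferentiableAt ℂ
          (fun w => c n * q w + f w * lam P (fun m => if m = n then 0 else c m) w) v :=
        ((hq v hv).const_mul _).add ((hf v hv).mul dl)
      refine dt.congr_of_eventuallyEq ?_
      filter_upwards [hnear, hne0] with w hw hw0
      by_cases hwv : w = v
      · subst hwv
        have hL : Lat P w := ⟨n, hn⟩
        have hch : hL.choose = n :=
          zpow_inj hP hP0 (mul_left_cancel₀ hv (hL.choose_spec.trans hn.symm))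
        simp only [hL, dif_pos, hch, h0 w hL]
        rw [hqv]; ring
      · have hnl := hw hwv
        rw [dif_neg hnl]
        have h1 : 1 - w * P ^ n ≠ 0 := fun h => hnl ⟨n, by linear_combination -h⟩
        rw [lam_split n (summable_lam hP hP0 hc hw0 fun m _ h => hnl ⟨m, h⟩), e w hw0]
        field_simp
    · have dl : DifferentiableAt ℂ (lam P c) v :=
        differentiableAt_lam hP hP0 hc hv fun m _ h => hL ⟨m, h⟩
      refine ((hf v hv).mul dl).congr_of_eventuallyEq ?_
      filter_upwards [hnear] with w hw
      have : ¬ Lat P w := by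
        by_cases hwv : w = v
        · exact hwv ▸ hL
        · exact hw hwv
      rw [dif_neg this]; rfl
  · have hL : Lat P 1 := ⟨0, by simp⟩
    have hch : hL.choose = 0 := zpow_inj hP hP0 (by simpa using hL.choose_spec)
    simp only [hL, dif_pos, hch]
    ring

end

end

section

/-- Triangular numbers on the integers. -/
def tri (m : ℤ) : ℤ := m * (m + 1) / 2

theorem two_mul_tri (m : ℤ) : 2 * tri m = m * (m + 1) :=
  Int.mul_ediv_cancel' (Int.even_mul_succ_self m).two_dvd

theorem tri_succ (m : ℤ) : tri (m + 1) = tri m + (m + 1) := by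
  have h1 := two_mul_tri m
  have h2 := two_mul_tri (m + 1)
  linarith

theorem tri_neg (m : ℤ) : tri (-m) = tri m - m := by
  have h1 := two_mul_tri m
  have h2 := two_mul_tri (-m)
  linarith

/-- The coefficients of Appell–Lerch sums. -/
noncomputable def gc (P : ℂ) (k : ℕ) (x : ℂ) (m : ℤ) : ℂ := (-x) ^ m * P ^ (k * tri m)

/-- Level `k` Appell–Lerch sums. -/
noncomputable def app (P : ℂ) (k : ℕ) (x w : ℂ) : ℂ := lam P (gc P k x) w

/-- Partial theta-type bilateral sums. -/
noncomputable def tau (P : ℂ) (k : ℕ) (i : ℤ) (x : ℂ) : ℂ := ∑' m : ℤ, gc P k x m * P ^ (-(i * m))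

section
variable {P : ℂ} (hP : ‖P‖ < 1) (hP0 : P ≠ 0)

theorem gc_zero (k : ℕ) (x : ℂ) : gc P k x 0 = 1 := by simp [gc, tri]

include hP0

theorem gc_succ (k : ℕ) {x : ℂ} (hx : x ≠ 0) (m : ℤ) :
    gc P k x (m + 1) = gc P k x m * (-x * P ^ (k * (m + 1))) := by
  rw [gc, gc, tri_succ, zpow_add_one₀ (neg_ne_zero.mpr hx), mul_add, zpow_add₀ hP0]; ring

theorem gc_neg (k : ℕ) {x : ℂ} (m : ℤ) :
    gc P k x (-m) = gc P k (x⁻¹) m * P ^ (-(k * m)) := by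
  rw [gc, gc, tri_neg, mul_sub, sub_eq_add_neg, zpow_add₀ hP0, zpow_neg, ← inv_zpow, inv_neg]; ring

theorem gc_shift (k : ℕ) {x y : ℂ} (i : ℤ) (h : y = x * P ^ (-i)) (m : ℤ) :
    gc P k y m = gc P k x m * P ^ (-(i * m)) := by
  rw [gc, gc, h, show -(x * P ^ (-i)) = (-x) * P ^ (-i) by ring, mul_zpow, ← zpow_mul]
  ring_nf

include hP

theorem summable_gc {k : ℕ} (hk : 0 < k) {x : ℂ} (hx : x ≠ 0) : Summable (gc P k x) := by
  have key : ∀ x : ℂ, x ≠ 0 → Summable fun n : ℕ => gc P k x n := by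
    intro x hx
    refine summable_of_ratio_test_tendsto_lt_one (l := 0) one_pos
      (Eventually.of_forall fun n => ?_) ?_
    · exact mul_ne_zero (zpow_ne_zero _ (neg_ne_zero.mpr hx)) (zpow_ne_zero _ hP0)
    · have h1 : Tendsto (fun n : ℕ => ‖x‖ * ‖P ^ ((n + 1 : ℕ) : ℤ)‖ ^ k) atTop (𝓝 (‖x‖ * 0 ^ k)) := by
        refine (Tendsto.pow ?_ k).const_mul _
        exact (tendsto_zpow_atTop hP hP0).comp
          (tendsto_natCast_atTop_atTop.comp (tendsto_add_atTop_nat 1))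
      rw [zero_pow hk.ne', mul_zero] at h1
      refine h1.congr fun n => ?_
      have hne : gc P k x n ≠ 0 :=
        mul_ne_zero (zpow_ne_zero _ (neg_ne_zero.mpr hx)) (zpow_ne_zero _ hP0)
      rw [Nat.cast_add_one, gc_succ hP0 k hx, norm_mul, mul_div_cancel_left₀ _ (norm_ne_zero_iff.mpr hne),
        norm_mul, norm_neg, ← norm_pow, ← zpow_natCast, ← zpow_mul, mul_comm ((n : ℤ) + 1)]
  refine Summable.of_nat_of_neg (key x hx) ?_
  have h2 := key (x⁻¹ * P ^ (-(k : ℤ))) (mul_ne_zero (inv_ne_zero hx) (zpow_ne_zero _ hP0))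
  refine h2.congr fun n => ?_
  rw [gc_neg hP0, gc_shift hP0 k k rfl]

theorem summable_tau {k : ℕ} (hk : 0 < k) (i : ℤ) {x : ℂ} (hx : x ≠ 0) :
    Summable fun m : ℤ => gc P k x m * P ^ (-(i * m)) := by
  have h2 := summable_gc hP hP0 hk (x := x * P ^ (-i)) (mul_ne_zero hx (zpow_ne_zero _ hP0))
  exact h2.congr fun n => gc_shift hP0 k i rfl n

omit hP in
theorem tau_inv (k : ℕ) (i : ℤ) {x : ℂ} : tau P k i x⁻¹ = tau P k (k - i) x := by
  rw [tau, tau, ← (Equiv.neg ℤ).tsum_eq]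
  refine tsum_congr fun m => ?_
  simp only [Equiv.neg_apply]
  rw [gc_neg hP0, inv_inv, mul_assoc, ← zpow_add₀ hP0]
  ring_nf

omit hP in
theorem tau_self (k : ℕ) {x : ℂ} (hx : x ≠ 0) : tau P k k x = -x * tau P k 0 x := by
  rw [tau, tau, ← (Equiv.addRight (1 : ℤ)).tsum_eq, ← tsum_mul_left]
  refine tsum_congr fun m => ?_
  simp only [Equiv.coe_addRight]
  rw [gc_succ hP0 k hx, mul_assoc, mul_assoc, ← zpow_add₀ hP0]
  simp
  ring

omit hP in
theorem tau_self_inv (k : ℕ) {x : ℂ} (hx : x ≠ 0) : tau P k k x⁻¹ = -x⁻¹ * tau P k k x := by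
  rw [tau_inv hP0, tau_self hP0 k hx, sub_self]
  field_simp

omit hP in
theorem tau_self_one (k : ℕ) : tau P k k 1 = 0 := by
  have := tau_self_inv hP0 k (one_ne_zero (α := ℂ))
  simp only [inv_one] at this
  linear_combination this / 2

/-- The effect of multiplying the elliptic variable by `P`. -/
theorem app_mul {k : ℕ} (hk : 0 < k) {x : ℂ} (hx : x ≠ 0) {w : ℂ} (hw : w ≠ 0) (hL : ¬ Lat P w) :
    app P k x (P * w) = -x⁻¹ * (w ^ k * app P k x w
      + ∑ i ∈ Finset.range k, w ^ (k - (i + 1)) * tau P k (i + 1) x) := by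
  have hsum : Summable fun m : ℤ => gc P k x m / (1 - w * P ^ m) :=
    summable_lam hP hP0 (summable_gc hP hP0 hk hx) hw fun m _ h => hL ⟨m, h⟩
  have e1 : app P k x (P * w) = ∑' m : ℤ, gc P k x (m - 1) / (1 - w * P ^ m) := by
    rw [app, lam, ← (Equiv.subRight (1 : ℤ)).tsum_eq]
    refine tsum_congr fun m => ?_
    simp only [Equiv.subRight_apply]
    rw [show P * w * P ^ (m - 1) = w * P ^ m by rw [zpow_sub_one₀ hP0]; field_simp]
  have e2 : ∀ m : ℤ, gc P k x (m - 1) / (1 - w * P ^ m) = -x⁻¹ * (w ^ k * (gc P k x m / (1 - w * P ^ m))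
      + ∑ i ∈ Finset.range k, w ^ (k - (i + 1)) * (gc P k x m * P ^ (-((i + 1 : ℤ) * m)))) := by
    intro m
    have h1 : gc P k x m = gc P k x (m - 1) * (-x * P ^ (k * m)) := by
      have := gc_succ hP0 k hx (m - 1); simpa using this
    have hu : 1 - w * P ^ m ≠ 0 := fun h => hL ⟨m, by linear_combination -h⟩
    have hp : P ^ m ≠ 0 := zpow_ne_zero m hP0
    set p := P ^ m with hpdef
    have h3 : P ^ ((k : ℤ) * m) = p ^ k := by rw [mul_comm, zpow_mul, zpow_natCast]
    have h4 : ∀ i : ℕ, P ^ (-((i + 1 : ℤ) * m)) = (p ^ (i + 1))⁻¹ := fun i => by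
      rw [zpow_neg, mul_comm, zpow_mul, ← Nat.cast_add_one, zpow_natCast]
    rw [h1, h3]
    simp_rw [h4]
    set g := gc P k x (m - 1)
    have h5 : ∀ k : ℕ, (1 : ℂ) = p ^ k * (w ^ k + (1 - w * p) *
        ∑ i ∈ Finset.range k, w ^ (k - (i + 1)) * (p ^ (i + 1))⁻¹) := by
      intro k
      induction k with
      | zero => simp
      | succ k ih =>
        rw [Finset.sum_range_succ]
        have : ∀ i ∈ Finset.range k, w ^ (k + 1 - (i + 1)) * (p ^ (i + 1))⁻¹
            = w * (w ^ (k - (i + 1)) * (p ^ (i + 1))⁻¹) := by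
          intro i hi
          rw [show k + 1 - (i + 1) = (k - (i + 1)) + 1 by
            have := Finset.mem_range.mp hi; omega, pow_succ]
          ring
        rw [Finset.sum_congr rfl this, ← Finset.mul_sum]
        simp only [Nat.sub_self, pow_zero, one_mul]
        have e : p ^ (k + 1) * (p ^ (k + 1))⁻¹ = 1 := mul_inv_cancel₀ (pow_ne_zero _ hp)
        linear_combination (w * p) * ih - (1 - w * p) * e
    have h6 := h5 k
    have h7 : ∑ i ∈ Finset.range k, w ^ (k - (i + 1)) * (g * (-x * p ^ k) * (p ^ (i + 1))⁻¹)
      = g * (-x * p ^ k) * ∑ i ∈ Finset.range k, w ^ (k - (i + 1)) * (p ^ (i + 1))⁻¹ := by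
      rw [Finset.mul_sum]; exact Finset.sum_congr rfl fun i _ => by ring
    rw [h7]
    generalize ∑ i ∈ Finset.range k, w ^ (k - (i + 1)) * (p ^ (i + 1))⁻¹ = S at h6
    field_simp
    linear_combination g * h6
  rw [e1, tsum_congr e2, tsum_mul_left]
  congr 1
  rw [Summable.tsum_add (hsum.mul_left _) (summable_sum fun i _ => ?_), tsum_mul_left,
    Summable.tsum_finsetSum fun i _ => ?_]
  · congr 1
    refine Finset.sum_congr rfl fun i _ => ?_
    rw [tsum_mul_left, tau]
  · exact_mod_cast (summable_tau hP hP0 hk (i + 1) hx).mul_left _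
  · exact_mod_cast (summable_tau hP hP0 hk (i + 1) hx).mul_left _

/-- Multiplying an Appell–Lerch sum by a function vanishing on the lattice. -/
theorem exists_holC_mul_app {k : ℕ} (hk : 0 < k) {x : ℂ} (hx : x ≠ 0) {f : ℂ → ℂ} (hf : HolC f)
    (h0 : ∀ w, Lat P w → f w = 0) :
    ∃ G, HolC G ∧ (∀ w, w ≠ 0 → ¬ Lat P w → G w = f w * app P k x w) ∧ G 1 = - deriv f 1 := by
  obtain ⟨G, h1, h2, h3⟩ := exists_holC_mul_lam hP hP0 (summable_gc hP hP0 hk hx) hf h0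
  exact ⟨G, h1, h2, by rw [h3, gc_zero]; ring⟩

omit hP in
theorem app_one_inv_inv {x w : ℂ} (hw : w ≠ 0) : app P 1 x⁻¹ w⁻¹ = -w * app P 1 x w := by
  rw [app, lam, ← (Equiv.neg ℤ).tsum_eq, app, lam, ← tsum_mul_left]
  refine tsum_congr fun m => ?_
  simp only [Equiv.neg_apply]
  rw [gc_neg hP0, inv_inv, zpow_neg, zpow_neg, Nat.cast_one, one_mul]
  have hp : P ^ m ≠ 0 := zpow_ne_zero m hP0
  by_cases h : 1 - w * P ^ m = 0
  · have : 1 - w⁻¹ * (P ^ m)⁻¹ = 0 := by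
      rw [← mul_inv, show w * P ^ m = 1 by linear_combination -h]; simp
    rw [h, this]; simp
  · have : 1 - w⁻¹ * (P ^ m)⁻¹ ≠ 0 := by
      intro h'
      rw [← mul_inv, sub_eq_zero, eq_comm, inv_eq_one] at h'
      exact h (by rw [h']; ring)
    rw [mul_div_assoc', div_eq_div_iff this h]
    field_simp
    ring
end

end

section
variable {P : ℂ} (hP : ‖P‖ < 1) (hP0 : P ≠ 0)
include hP

theorem exists_prod_bound : ∃ C : ℝ, 0 < C ∧ ∀ k n : ℕ,
    ‖∏ i ∈ Finset.range n, (1 - P ^ (k + i + 1))‖ ≤ C := by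
  have hs : Summable fun i : ℕ => ‖P‖ ^ i := summable_geometric_of_lt_one (norm_nonneg _) hP
  refine ⟨Real.exp (∑' i : ℕ, ‖P‖ ^ i), Real.exp_pos _, fun k n => ?_⟩
  rw [norm_prod]
  calc ∏ i ∈ Finset.range n, ‖1 - P ^ (k + i + 1)‖
      ≤ ∏ i ∈ Finset.range n, Real.exp (‖P‖ ^ i) := by
        refine Finset.prod_le_prod (fun _ _ => norm_nonneg _) fun i _ => ?_
        calc ‖1 - P ^ (k + i + 1)‖ ≤ ‖(1 : ℂ)‖ + ‖P ^ (k + i + 1)‖ := norm_sub_le _ _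
          _ ≤ 1 + ‖P‖ ^ i := by
            rw [norm_one, norm_pow]
            gcongr 1 + ?_
            exact pow_le_pow_of_le_one (norm_nonneg _) hP.le (by omega)
          _ ≤ _ := by rw [add_comm]; exact Real.add_one_le_exp _
    _ = Real.exp (∑ i ∈ Finset.range n, ‖P‖ ^ i) := (Real.exp_sum _ _).symm
    _ ≤ _ := Real.exp_le_exp.mpr (hs.sum_le_tsum _ fun _ _ => by positivity)

theorem summable_pow_mul_prod (k : ℕ) : Summable
    (fun n ↦ P ^ ((k + 1) * n) * ∏ i ∈ Finset.range (n + 1), (1 - P ^ (k + i + 1))) := by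
  obtain ⟨C, hC, h⟩ := exists_prod_bound hP
  refine Summable.of_norm_bounded (g := fun n => ‖P‖ ^ n * C)
    ((summable_geometric_of_lt_one (norm_nonneg _) hP).mul_right _) fun n => ?_
  rw [norm_mul, norm_pow]
  exact mul_le_mul (pow_le_pow_of_le_one (norm_nonneg _) hP.le (by nlinarith)) (h k (n + 1))
    (norm_nonneg _) (by positivity)

include hP0

/-- The pentagonal number theorem for complex numbers. -/
theorem tau_three_two_one : tau P 3 2 1 = poch P P := by
  have hex : ∀ m : ℤ, gc P 3 1 m * P ^ (-(2 * m)) = (-1) ^ m * P ^ (pentagonal m) := by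
    intro m
    rw [gc, mul_assoc, ← zpow_add₀ hP0, ← zpow_natCast]
    congr 2
    have h1 := two_mul_tri m
    have h2 : 2 * (pentagonal m : ℤ) = m * (3 * m - 1) := two_mul_natCast_pentagonal m
    push_cast
    linarith
  have hs := summable_tau hP hP0 (k := 3) (by norm_num) 2 (one_ne_zero (α := ℂ))
  have hs1 : Summable fun k : ℕ => gc P 3 1 (-(k : ℤ)) * P ^ (-(2 * (-(k : ℤ)))) :=
    (hs.comp_injective (i := fun k : ℕ => -(k : ℤ)) fun a b h => by simpa using h)
  have hs2 : Summable fun k : ℕ => gc P 3 1 ((k : ℤ) + 1) * P ^ (-(2 * ((k : ℤ) + 1))) :=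
    (hs.comp_injective (i := fun k : ℕ => (k : ℤ) + 1) fun a b h => by simpa using h)
  have hterm : ∀ k : ℕ, gc P 3 1 (-(k : ℤ)) * P ^ (-(2 * (-(k : ℤ)))) +
      gc P 3 1 ((k : ℤ) + 1) * P ^ (-(2 * ((k : ℤ) + 1))) =
      (-1) ^ k * (P ^ pentagonal (-k) - P ^ pentagonal (k + 1)) := by
    intro k
    rw [hex, hex, zpow_neg, zpow_add_one₀ (by norm_num), zpow_natCast, ← inv_pow]
    norm_num
    ring
  have hl : tau P 3 2 1 = ∑' k : ℕ, (-1) ^ k * (P ^ pentagonal (-k) - P ^ pentagonal (k + 1)) := by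
    rw [tau, ← (Equiv.neg ℤ).tsum_eq]
    simp only [Equiv.neg_apply]
    rw [tsum_of_nat_of_neg_add_one (f := fun m : ℤ => gc P 3 1 (-m) * P ^ (-(2 * (-m)))) hs1
      (by simpa using hs2), ← hs1.tsum_add (by simpa using hs2)]
    refine tsum_congr fun k => ?_
    rw [← hterm k, neg_neg]
  have hr : poch P P = ∏' n : ℕ, (1 - P ^ (n + 1)) := by
    rw [poch]; simp_rw [pow_succ']
  rw [hl, hr]
  refine (Pentagonal.tprod_one_sub_pow ?_ (summable_pow_mul_prod hP) ?_ ?_ ?_).symm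
  · exact tendsto_pow_atTop_nhds_zero_of_norm_lt_one hP
  · intro k
    refine (multipliable_poch hP (P ^ (k + 1))).congr fun n => ?_
    rw [← pow_add]; ring_nf
  · exact (hs1.add (by simpa using hs2)).congr hterm
  · obtain ⟨C, hC, h⟩ := exists_prod_bound hP
    have hg := summable_geometric_of_lt_one (norm_nonneg _) hP
    have h0 : Tendsto (fun k : ℕ => ‖P‖ ^ k * ∑' n : ℕ, ‖P‖ ^ n * C) atTop (𝓝 (0 * ∑' n : ℕ, ‖P‖ ^ n * C)) :=
      (tendsto_pow_atTop_nhds_zero_of_lt_one (norm_nonneg _) hP).mul_const _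
    rw [zero_mul] at h0
    refine squeeze_zero_norm (fun k => ?_) h0
    rw [norm_mul, norm_mul, norm_pow, norm_pow, norm_neg, norm_one, one_pow, one_mul]
    refine mul_le_mul ?_ ?_ (norm_nonneg _) (by positivity)
    · refine pow_le_pow_of_le_one (norm_nonneg _) hP.le ?_
      rw [Nat.le_div_iff_mul_le (by norm_num)]; nlinarith
    · refine tsum_of_norm_bounded (hg.mul_right C).hasSum fun n => ?_
      rw [norm_mul, norm_pow]
      exact mul_le_mul (pow_le_pow_of_le_one (norm_nonneg _) hP.le (by nlinarith)) (h k (n + 1))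
        (norm_nonneg _) (by positivity)

end

section

/-- The logarithmic derivative `z θ'(z) / θ(z)`. -/
noncomputable def ell (P z : ℂ) : ℂ := z * deriv (theta P) z / theta P z

theorem HolC.mul {f g : ℂ → ℂ} (hf : HolC f) (hg : HolC g) : HolC fun w => f w * g w :=
  fun w hw => (hf w hw).mul (hg w hw)

theorem HolC.comp_mul {f : ℂ → ℂ} (hf : HolC f) {a : ℂ} (ha : a ≠ 0) : HolC fun w => f (w * a) :=
  fun w hw => (hf (w * a) (mul_ne_zero hw ha)).comp w (by fun_prop)

theorem HolC.continuousAt {f : ℂ → ℂ} (hf : HolC f) (w : ℂ) (hw : w ≠ 0) : ContinuousAt f w :=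
  (hf w hw).continuousAt

theorem countable_lat' (P : ℂ) (hP0 : P ≠ 0) : {w : ℂ | Lat P w}.Countable := by
  simpa using countable_lat P 1 hP0 one_ne_zero

section
variable {P : ℂ} (hP : ‖P‖ < 1) (hP0 : P ≠ 0)

theorem lat_inv {w : ℂ} : Lat P w⁻¹ ↔ Lat P w := by
  have key : ∀ w, Lat P w → Lat P w⁻¹ := by
    rintro w ⟨m, h⟩
    exact ⟨-m, by rw [zpow_neg, ← mul_inv, h, inv_one]⟩
  exact ⟨fun h => by simpa using key _ h, key w⟩

include hP

include hP0

theorem deriv_theta_mul {g : ℂ → ℂ} (hg : HolC g) :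
    deriv (fun w => theta P w * g w) 1 = - poch P P ^ 3 * g 1 := by
  have h := (holC_theta hP 1 one_ne_zero).hasDerivAt.mul (hg 1 one_ne_zero).hasDerivAt
  have h' : deriv (fun w => theta P w * g w) 1 = _ := h.deriv
  rw [h', deriv_theta_one hP hP0, theta_one hP]
  ring

theorem theta_of_lat {w : ℂ} (h : Lat P w) : theta P w = 0 := by
  have hw : w ≠ 0 := by rintro rfl; obtain ⟨m, hm⟩ := h; simp at hm
  exact (theta_eq_zero_iff hP hP0 hw).mpr h

/-- An Appell–Lerch sum times a theta product containing `θ(w)`. -/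
theorem exists_holC_theta_mul_app {k : ℕ} (hk : 0 < k) {x : ℂ} (hx : x ≠ 0) {g : ℂ → ℂ} (hg : HolC g) :
    ∃ G, HolC G ∧ (∀ w, w ≠ 0 → ¬ Lat P w → G w = theta P w * g w * app P k x w) ∧
      G 1 = poch P P ^ 3 * g 1 := by
  obtain ⟨G, h1, h2, h3⟩ := exists_holC_mul_app hP hP0 hk hx ((holC_theta hP).mul hg)
    (fun w h => by rw [theta_of_lat hP hP0 h, zero_mul])
  exact ⟨G, h1, h2, by rw [h3, deriv_theta_mul hP hP0 hg]; ring⟩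

theorem rank_pair_aux {z : ℂ} (hz : z ≠ 0) (h1 : ¬ Lat P z) (h2 : ¬ Lat P (z ^ 2)) (c : ℂ)
    (hc : c * poch P P = z * tau P 3 2 (z ^ 3) + z ^ 2 * tau P 3 2 (z ^ 3)⁻¹) :
    c * theta P z = z * theta P (z ^ 2) ∧
    ∀ w, w ≠ 0 → ¬ Lat P w → ¬ Lat P (w * z) → ¬ Lat P (w * z⁻¹) →
      theta P (w * z) * theta P w * theta P (w * z⁻¹) *
        (z ^ 3 * app P 3 (z ^ 3) (w * z) + app P 3 (z ^ 3)⁻¹ (w * z⁻¹) - c * app P 3 1 w)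
        = poch P P ^ 3 * theta P (z ^ 2) * theta P z := by
  have hθ := holC_theta hP
  have hzi : z⁻¹ ≠ 0 := inv_ne_zero hz
  have hz2 : z ^ 2 ≠ 0 := pow_ne_zero _ hz
  have hz3 : z ^ 3 ≠ 0 := pow_ne_zero _ hz
  obtain ⟨G1, a1, b1, c1⟩ := exists_holC_theta_mul_app hP hP0 (k := 3) (by norm_num) hz3
    ((hθ.comp_mul hzi).mul (hθ.comp_mul (inv_ne_zero hz2)))
  obtain ⟨G2, a2, b2, c2⟩ := exists_holC_theta_mul_app hP hP0 (k := 3) (by norm_num) (inv_ne_zero hz3)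
    ((hθ.comp_mul hz).mul (hθ.comp_mul hz2))
  obtain ⟨G3, a3, b3, c3⟩ := exists_holC_theta_mul_app hP hP0 (k := 3) (by norm_num) (one_ne_zero)
    ((hθ.comp_mul hz).mul (hθ.comp_mul hzi))
  simp only [one_mul] at c1 c2 c3
  set H : ℂ → ℂ := fun w => z ^ 3 * G1 (w * z) + G2 (w * z⁻¹) - c * G3 w with hH
  have hHol : HolC H := fun w hw =>
    (((a1.comp_mul hz w hw).const_mul _).add (a2.comp_mul hzi w hw)).sub ((a3 w hw).const_mul _)
  have hoff : ∀ w, w ≠ 0 → ¬ Lat P w → ¬ Lat P (w * z) → ¬ Lat P (w * z⁻¹) →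
      H w = theta P (w * z) * theta P w * theta P (w * z⁻¹) *
        (z ^ 3 * app P 3 (z ^ 3) (w * z) + app P 3 (z ^ 3)⁻¹ (w * z⁻¹) - c * app P 3 1 w) := by
    intro w hw n0 n1 n2
    simp only [hH]
    rw [b1 _ (mul_ne_zero hw hz) n1, b2 _ (mul_ne_zero hw hzi) n2, b3 _ hw n0]
    rw [show w * z * z⁻¹ = w by field_simp, show w * z * (z ^ 2)⁻¹ = w * z⁻¹ by field_simp,
      show w * z⁻¹ * z = w by field_simp, show w * z⁻¹ * z ^ 2 = w * z by field_simp]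
    ring
  have hper : ∀ w, w ≠ 0 → H (P * w) = H w := by
    refine eq_of_eq_off_countable (f := fun w => H (P * w))
      (((countable_lat' P hP0).union (countable_lat P z hP0 hz)).union
        (countable_lat P z⁻¹ hP0 hzi)) ?_ (hHol.continuousAt) ?_
    · intro w hw
      have := (hHol.comp_mul hP0).continuousAt w hw
      simpa only [mul_comm P] using this
    · intro w hw hS
      simp only [Set.mem_union, Set.mem_ofPred_eq, not_or] at hS
      obtain ⟨⟨n0, n1⟩, n2⟩ := hS
      have hwz := mul_ne_zero hw hz
      have hwz' := mul_ne_zero hw hzi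
      have e0 : P * w ≠ 0 := mul_ne_zero hP0 hw
      rw [hoff _ e0 (by rwa [lat_iff_mul hP0]) (by rwa [mul_assoc, lat_iff_mul hP0])
        (by rwa [mul_assoc, lat_iff_mul hP0]), hoff w hw n0 n1 n2]
      simp only [mul_assoc P]
      rw [theta_mul hP hP0 hwz, theta_mul hP hP0 hw, theta_mul hP hP0 hwz',
        app_mul hP hP0 (by norm_num) hz3 hwz n1, app_mul hP hP0 (by norm_num) (inv_ne_zero hz3) hwz' n2,
        app_mul hP hP0 (by norm_num) one_ne_zero hw n0]
      simp only [Finset.sum_range_succ, Finset.sum_range_zero, Nat.cast_zero, Nat.cast_one,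
        Nat.cast_ofNat, zero_add, pow_zero, Nat.reduceAdd, Nat.reduceSub, Int.reduceAdd, inv_inv]
      have t1 : tau P 3 1 (z ^ 3) = tau P 3 2 (z ^ 3)⁻¹ := by rw [tau_inv hP0]; norm_num
      have t2 : tau P 3 1 (z ^ 3)⁻¹ = tau P 3 2 (z ^ 3) := by rw [tau_inv hP0]; norm_num
      have t3 : tau P 3 1 1 = poch P P := by
        rw [← tau_three_two_one hP hP0, ← inv_one, tau_inv hP0, inv_one]; norm_num
      have t4 : tau P 3 3 1 = 0 := by exact_mod_cast tau_self_one hP0 3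
      have t5 : tau P 3 3 (z ^ 3)⁻¹ = -(z ^ 3)⁻¹ * tau P 3 3 (z ^ 3) := by
        exact_mod_cast tau_self_inv hP0 3 hz3
      rw [t1, t2, t3, t4, t5, tau_three_two_one hP hP0]
      set A1 := app P 3 (z ^ 3) (w * z)
      set A2 := app P 3 (z ^ 3)⁻¹ (w * z⁻¹)
      set A3 := app P 3 1 w
      set u := tau P 3 2 (z ^ 3)
      set v := tau P 3 2 (z ^ 3)⁻¹
      set J := poch P P
      have hcu : u = (c * J - z ^ 2 * v) / z := by field_simp; linear_combination -hc
      rw [hcu]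
      field_simp
      ring
  have hnl : ¬ Lat P z⁻¹ := by rwa [lat_inv]
  have hv1 : H 1 = c * z⁻¹ * theta P z ^ 2 * poch P P ^ 3 * (1) := by
    simp only [hH, one_mul]
    rw [b1 _ hz h1, b2 _ hzi hnl, c3, mul_inv_cancel₀ hz, inv_mul_cancel₀ hz, theta_one hP,
      theta_inv hP hz]
    ring
  have hv2 : H z = poch P P ^ 3 * theta P (z ^ 2) * theta P z := by
    simp only [hH]
    rw [← sq, b1 _ hz2 h2, b3 _ hz h1, mul_inv_cancel₀ hz, c2, mul_inv_cancel₀ hz2, theta_one hP]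
    ring
  have hcon : H 1 = H z := const_of_periodic hP hP0 hHol hper one_ne_zero hz
  have hJ : poch P P ≠ 0 := poch_self_ne_zero hP hP0
  have hz0 : theta P z ≠ 0 := theta_ne_zero hP hP0 hz h1
  constructor
  · rw [hv1, hv2] at hcon
    have : poch P P ^ 3 * theta P z * (c * theta P z) = poch P P ^ 3 * theta P z * (z * theta P (z ^ 2)) := by
      field_simp at hcon ⊢
      linear_combination hcon
    exact mul_left_cancel₀ (mul_ne_zero (pow_ne_zero 3 hJ) hz0) this
  · intro w hw n0 n1 n2
    rw [← hoff w hw n0 n1 n2, ← hv2, const_of_periodic hP hP0 hHol hper hw hz]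

theorem rank_coeff {z : ℂ} (hz : z ≠ 0) (h1 : ¬ Lat P z) (h2 : ¬ Lat P (z ^ 2)) :
    z * tau P 3 2 (z ^ 3) + z ^ 2 * tau P 3 2 (z ^ 3)⁻¹ =
      z * theta P (z ^ 2) / theta P z * poch P P := by
  have hJ : poch P P ≠ 0 := poch_self_ne_zero hP hP0
  have hz0 : theta P z ≠ 0 := theta_ne_zero hP hP0 hz h1
  have := (rank_pair_aux hP hP0 hz h1 h2
    ((z * tau P 3 2 (z ^ 3) + z ^ 2 * tau P 3 2 (z ^ 3)⁻¹) / poch P P) (by field_simp)).1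
  rw [← this]; field_simp

/-- The combination of three level three Appell–Lerch sums is a theta quotient. -/
theorem rank_pair {z : ℂ} (hz : z ≠ 0) (h1 : ¬ Lat P z) (h2 : ¬ Lat P (z ^ 2)) {w : ℂ}
    (hw : w ≠ 0) (n0 : ¬ Lat P w) (n1 : ¬ Lat P (w * z)) (n2 : ¬ Lat P (w * z⁻¹)) :
    z ^ 3 * app P 3 (z ^ 3) (w * z) + app P 3 (z ^ 3)⁻¹ (w * z⁻¹) =
      z * theta P (z ^ 2) / theta P z * app P 3 1 w +
      poch P P ^ 3 * theta P (z ^ 2) * theta P z /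
        (theta P (w * z) * theta P w * theta P (w * z⁻¹)) := by
  have hJ : poch P P ≠ 0 := poch_self_ne_zero hP hP0
  have hz0 : theta P z ≠ 0 := theta_ne_zero hP hP0 hz h1
  obtain ⟨e1, e2⟩ := rank_pair_aux hP hP0 hz h1 h2
    ((z * tau P 3 2 (z ^ 3) + z ^ 2 * tau P 3 2 (z ^ 3)⁻¹) / poch P P) (by field_simp)
  have e3 := e2 w hw n0 n1 n2
  rw [← e3, ← e1]
  have q0 := theta_ne_zero hP hP0 hw n0
  have q1 := theta_ne_zero hP hP0 (mul_ne_zero hw hz) n1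
  have q2 := theta_ne_zero hP hP0 (mul_ne_zero hw (inv_ne_zero hz)) n2
  rw [mul_div_cancel_left₀ _ (mul_ne_zero (mul_ne_zero q1 q0) q2), mul_div_cancel_right₀ _ hz0]
  ring

theorem crank_middle {w : ℂ} (hw : w ≠ 0) (n0 : ¬ Lat P w) :
    app P 1 1 w = poch P P ^ 3 / theta P w := by
  obtain ⟨G, a, b, c⟩ := exists_holC_theta_mul_app hP hP0 (k := 1) (by norm_num) (one_ne_zero)
    (g := fun _ => 1) (fun w hw => by fun_prop)
  have hper : ∀ w, w ≠ 0 → G (P * w) = G w := by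
    refine eq_of_eq_off_countable (f := fun w => G (P * w)) (countable_lat' P hP0) ?_
      (a.continuousAt) ?_
    · intro w hw
      have := (a.comp_mul hP0).continuousAt w hw
      simpa only [mul_comm P] using this
    · intro w hw hS
      rw [b _ (mul_ne_zero hP0 hw) (by rwa [lat_iff_mul hP0]), b w hw hS, theta_mul hP hP0 hw,
        app_mul hP hP0 (by norm_num) one_ne_zero hw hS]
      have t4 : tau P 1 1 1 = 0 := by exact_mod_cast tau_self_one hP0 1
      simp [t4]
      field_simp
  have := const_of_periodic hP hP0 a hper hw one_ne_zero
  rw [b w hw n0, c] at this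
  have q0 := theta_ne_zero hP hP0 hw n0
  field_simp
  linear_combination this

theorem crank_pair {z : ℂ} (hz : z ≠ 0) (h1 : ¬ Lat P z) (h2 : ¬ Lat P (z ^ 2)) {w : ℂ}
    (hw : w ≠ 0) (n1 : ¬ Lat P (w * z)) (n2 : ¬ Lat P (w * z⁻¹)) :
    z * app P 1 z (w * z) + app P 1 z⁻¹ (w * z⁻¹) =
      poch P P ^ 3 * theta P (z ^ 2) * theta P w /
        (theta P z * theta P (w * z) * theta P (w * z⁻¹)) := by
  have hθ := holC_theta hP
  have hzi : z⁻¹ ≠ 0 := inv_ne_zero hz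
  have hz2 : z ^ 2 ≠ 0 := pow_ne_zero _ hz
  obtain ⟨G1, a1, b1, c1⟩ := exists_holC_theta_mul_app hP hP0 (k := 1) (by norm_num) hz
    (hθ.comp_mul (inv_ne_zero hz2))
  obtain ⟨G2, a2, b2, c2⟩ := exists_holC_theta_mul_app hP hP0 (k := 1) (by norm_num) hzi
    (hθ.comp_mul hz2)
  simp only [one_mul] at c1 c2
  set H : ℂ → ℂ := fun w => z * G1 (w * z) + G2 (w * z⁻¹) with hH
  have hHol : HolC H := fun w hw =>
    (((a1.comp_mul hz w hw).const_mul _).add (a2.comp_mul hzi w hw))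
  have hoff : ∀ w, w ≠ 0 → ¬ Lat P (w * z) → ¬ Lat P (w * z⁻¹) →
      H w = theta P (w * z) * theta P (w * z⁻¹) *
        (z * app P 1 z (w * z) + app P 1 z⁻¹ (w * z⁻¹)) := by
    intro w hw n1 n2
    simp only [hH]
    rw [b1 _ (mul_ne_zero hw hz) n1, b2 _ (mul_ne_zero hw hzi) n2]
    rw [show w * z * (z ^ 2)⁻¹ = w * z⁻¹ by field_simp,
      show w * z⁻¹ * z ^ 2 = w * z by field_simp]
    ring
  have hper : ∀ w, w ≠ 0 → H (P * w) = -w⁻¹ * H w := by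
    refine eq_of_eq_off_countable (f := fun w => H (P * w)) (g := fun w => -w⁻¹ * H w)
      ((countable_lat P z hP0 hz).union (countable_lat P z⁻¹ hP0 hzi)) ?_ ?_ ?_
    · intro w hw
      have := (hHol.comp_mul hP0).continuousAt w hw
      simpa only [mul_comm P] using this
    · intro w hw
      have := hHol.continuousAt w hw
      fun_prop (disch := assumption)
    · intro w hw hS
      simp only [Set.mem_union, Set.mem_ofPred_eq, not_or] at hS
      obtain ⟨n1, n2⟩ := hS
      have hwz := mul_ne_zero hw hz
      have hwz' := mul_ne_zero hw hzi
      have e0 : P * w ≠ 0 := mul_ne_zero hP0 hw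
      rw [hoff _ e0 (by rwa [mul_assoc, lat_iff_mul hP0])
        (by rwa [mul_assoc, lat_iff_mul hP0]), hoff w hw n1 n2]
      simp only [mul_assoc P]
      rw [theta_mul hP hP0 hwz, theta_mul hP hP0 hwz',
        app_mul hP hP0 (by norm_num) hz hwz n1, app_mul hP hP0 (by norm_num) hzi hwz' n2]
      simp only [Finset.sum_range_succ, Finset.sum_range_zero, Nat.cast_zero,
        zero_add, pow_zero, Nat.sub_self, inv_inv]
      have t5 : tau P 1 1 z⁻¹ = -z⁻¹ * tau P 1 1 z := by
        exact_mod_cast tau_self_inv hP0 1 hz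
      rw [t5]
      field_simp
      ring
  have hnl : ¬ Lat P z⁻¹ := by rwa [lat_inv]
  have hH1 : H 1 = 0 := by
    rw [hoff 1 one_ne_zero (by simpa using h1) (by simpa using hnl)]
    simp only [one_mul]
    rw [app_one_inv_inv hP0 hz]
    ring
  have hzero : ∀ w, w ≠ 0 → theta P w = 0 → H w = 0 := by
    intro w hw h
    refine lat_induction hP hP0 (p := fun w => H w = 0) hH1 (fun w hw => ?_)
      ((theta_eq_zero_iff hP hP0 hw).mp h)
    rw [hper w hw]; simp [hw]
  obtain ⟨C, hC⟩ := exists_const_mul hP hP0 hHol hθ hzero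
    (fun w hw h => deriv_theta_ne_zero hP hP0 hw h)
    ((countable_lat' P hP0).mono fun w h => (theta_eq_zero_iff hP hP0 h.1).mp h.2)
    (μ := fun w => -w⁻¹) (fun w hw => by simpa using hw) hper (fun w hw => theta_mul hP hP0 hw)
  have hz0 : theta P z ≠ 0 := theta_ne_zero hP hP0 hz h1
  have hv : H z = poch P P ^ 3 * theta P (z ^ 2) := by
    simp only [hH]
    rw [← sq, b1 _ hz2 h2, mul_inv_cancel₀ hz, c2, mul_inv_cancel₀ hz2, theta_one hP]
    ring
  have hCz := hC z hz
  rw [hv] at hCz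
  have q1 := theta_ne_zero hP hP0 (mul_ne_zero hw hz) n1
  have q2 := theta_ne_zero hP hP0 (mul_ne_zero hw hzi) n2
  have e := hoff w hw n1 n2
  rw [hC w hw] at e
  set X := z * app P 1 z (w * z) + app P 1 z⁻¹ (w * z⁻¹)
  rw [hCz, eq_div_iff (mul_ne_zero (mul_ne_zero hz0 q1) q2)]
  linear_combination -theta P z * e

end

end

section

/-- An Appell–Lerch sum with the term of index `0` removed. -/
noncomputable def appz (P : ℂ) (k : ℕ) (x w : ℂ) : ℂ :=
  lam P (fun m => if m = 0 then 0 else gc P k x m) w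

theorem eq_of_eventually_slope {g h : ℂ → ℂ} {z h' : ℂ} (hz : z ≠ 0) (hg : ContinuousAt g z)
    (hh : HasDerivAt h h' z) (h1 : h z = 1)
    (H : ∀ᶠ w in 𝓝[≠] z, g w = (h w - 1) / (1 - w * z⁻¹)) : g z = -z * h' := by
  have a : Tendsto g (𝓝[≠] z) (𝓝 (g z)) := hg.tendsto.mono_left nhdsWithin_le_nhds
  have b : Tendsto (fun w => -z * slope h z w) (𝓝[≠] z) (𝓝 (-z * h')) :=
    (hasDerivAt_iff_tendsto_slope.mp hh).const_mul _
  refine tendsto_nhds_unique a (b.congr' ?_)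
  filter_upwards [H, self_mem_nhdsWithin] with w hw hne
  have hne' : w - z ≠ 0 := sub_ne_zero.mpr hne
  have : 1 - w * z⁻¹ = -(w - z) / z := by field_simp; ring
  rw [hw, slope_def_field, h1, this]
  field_simp

section
variable {P : ℂ} (hP : ‖P‖ < 1) (hP0 : P ≠ 0)
include hP hP0

omit hP0 in
theorem hasDerivAt_theta {w : ℂ} (hw : w ≠ 0) : HasDerivAt (theta P) (deriv (theta P) w) w :=
  (holC_theta hP w hw).hasDerivAt

theorem app_split {k : ℕ} (hk : 0 < k) {x w : ℂ} (hx : x ≠ 0) (hw : w ≠ 0) (h : ¬ Lat P w) :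
    app P k x w = (1 - w)⁻¹ + appz P k x w := by
  have h' : ∀ m, gc P k x m ≠ 0 → w * P ^ m ≠ 1 := fun m _ e => h ⟨m, e⟩
  rw [app, lam_split 0 (summable_lam hP hP0 (summable_gc hP hP0 hk hx) hw h')]
  simp [appz, gc_zero]

theorem differentiableAt_app {k : ℕ} (hk : 0 < k) {x w : ℂ} (hx : x ≠ 0) (hw : w ≠ 0)
    (h : ¬ Lat P w) : DifferentiableAt ℂ (app P k x) w :=
  differentiableAt_lam hP hP0 (summable_gc hP hP0 hk hx) hw (fun m _ e => h ⟨m, e⟩)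

theorem differentiableAt_appz {k : ℕ} (hk : 0 < k) {x : ℂ} (hx : x ≠ 0) :
    DifferentiableAt ℂ (appz P k x) 1 := by
  refine differentiableAt_lam hP hP0 ?_ one_ne_zero ?_
  · refine Summable.of_norm_bounded (summable_gc hP hP0 hk hx).norm fun m => ?_
    split_ifs <;> simp
  · intro m hm e
    have h0 : m ≠ 0 := fun h => hm (by simp [h])
    exact h0 (zpow_inj hP hP0 (by simpa using e))

theorem phi_ne_zero_one : phi P 1 ≠ 0 := by
  rw [phi_one hP]; exact pow_ne_zero _ (poch_self_ne_zero hP hP0)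

omit hP hP0 in
theorem hasDerivAt_mul_right (z a : ℂ) : HasDerivAt (fun w : ℂ => w * a) a z := by
  simpa using (hasDerivAt_id z).mul_const a

theorem pole_limit {z : ℂ} (hz : z ≠ 0) (h2 : ¬ Lat P (z ^ 2)) {g N : ℂ → ℂ} {N' : ℂ}
    (hg : ContinuousAt g z) (hN : HasDerivAt N N' z) (hNz : N z = poch P P ^ 3 * theta P (z ^ 2))
    (H : ∀ w, w ≠ 0 → ¬ Lat P w → ¬ Lat P (w * z) → ¬ Lat P (w * z⁻¹) →
      g w + (1 - w * z⁻¹)⁻¹ = N w / (theta P (w * z) * theta P (w * z⁻¹))) :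
    g z = ell P (z ^ 2) - z * N' / N z := by
  have hzi : z⁻¹ ≠ 0 := inv_ne_zero hz
  have hz2 : z ^ 2 ≠ 0 := pow_ne_zero _ hz
  have q2 := theta_ne_zero hP hP0 hz2 h2
  have hJ : poch P P ≠ 0 := poch_self_ne_zero hP hP0
  have hφ := phi_ne_zero_one hP hP0
  have e1 : z * z = z ^ 2 := (sq z).symm
  have e2 : z * z⁻¹ = 1 := mul_inv_cancel₀ hz
  have dz := hasDerivAt_mul_right z z
  have dzi := hasDerivAt_mul_right z z⁻¹
  have t2 : HasDerivAt (fun w => theta P (w * z)) (deriv (theta P) (z ^ 2) * z) z := by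
    have := hasDerivAt_theta hP (w := z * z) (by rwa [e1])
    rw [← e1]; exact HasDerivAt.comp (h := fun w => w * z) z this dz
  have t3 : HasDerivAt (fun w => phi P (w * z⁻¹)) (0 * z⁻¹) z := by
    have := (holC_phi hP (z * z⁻¹) (by rw [e2]; exact one_ne_zero)).hasDerivAt
    rw [show deriv (phi P) (z * z⁻¹) = 0 by rw [e2, deriv_phi_one hP hP0]] at this
    exact HasDerivAt.comp (h := fun w => w * z⁻¹) z this dzi
  have hd : HasDerivAt (fun w => theta P (w * z) * phi P (w * z⁻¹)) _ z := t2.mul t3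
  have hne : theta P (z * z) * phi P (z * z⁻¹) ≠ 0 := by
    rw [e1, e2]; exact mul_ne_zero q2 hφ
  have hh : HasDerivAt (fun w => N w / (theta P (w * z) * phi P (w * z⁻¹))) _ z := hN.div hd hne
  have key := eq_of_eventually_slope hz hg hh ?_ ?_
  · rw [key, e1, e2, ell, hNz, phi_one hP]
    field_simp
    ring
  · rw [e1, e2, phi_one hP, hNz]
    field_simp
  · have n1 : ∀ᶠ w in 𝓝 z, w ≠ z → ¬ Lat P w := eventually_not_lat hP hP0 hz
    have n2 : ∀ᶠ w in 𝓝 z, w * z ≠ z * z → ¬ Lat P (w * z) :=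
      dz.continuousAt.eventually (eventually_not_lat hP hP0 (mul_ne_zero hz hz))
    have n3 : ∀ᶠ w in 𝓝 z, w * z⁻¹ ≠ z * z⁻¹ → ¬ Lat P (w * z⁻¹) :=
      dzi.continuousAt.eventually (eventually_not_lat hP hP0 (mul_ne_zero hz hzi))
    have n4 : ∀ᶠ w in 𝓝 z, w ≠ 0 := eventually_ne_nhds hz
    filter_upwards [nhdsWithin_le_nhds n1, nhdsWithin_le_nhds n2, nhdsWithin_le_nhds n3,
      nhdsWithin_le_nhds n4, self_mem_nhdsWithin] with w a1 a2 a3 a4 a5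
    have b1 := a1 a5
    have b2 := a2 (fun h => a5 (mul_right_cancel₀ hz h))
    have b3 := a3 (fun h => a5 (mul_right_cancel₀ hzi h))
    have hp := H w a4 b1 b2 b3
    have hs : (1 : ℂ) - w * z⁻¹ ≠ 0 := fun h => b3 ⟨0, by simp; linear_combination -h⟩
    have q3 := theta_ne_zero hP hP0 (mul_ne_zero a4 hzi) b3
    rw [theta_eq_phi hP (w * z⁻¹)] at hp q3
    have q4 := right_ne_zero_of_mul q3
    have q6 := theta_ne_zero hP hP0 (mul_ne_zero a4 hz) b2
    rw [eq_div_iff hs, eq_sub_of_add_eq hp]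
    generalize phi P (w * z⁻¹) = F at *
    generalize 1 - w * z⁻¹ = S at *
    field_simp

theorem continuousAt_pole_sum {z : ℂ} (hz : z ≠ 0) (h2 : ¬ Lat P (z ^ 2)) {k : ℕ} (hk : 0 < k) {x y : ℂ}
    (hx : x ≠ 0) (hy : y ≠ 0) :
    ContinuousAt (fun w => x * app P k x (w * z) + appz P k y (w * z⁻¹)) z := by
  have c1 : ContinuousAt (fun w => app P k x (w * z)) z := by
    have := (differentiableAt_app hP hP0 hk hx (w := z * z)
      (by rw [← sq]; exact pow_ne_zero _ hz) (by rwa [← sq])).continuousAt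
    exact ContinuousAt.comp (f := fun w => w * z) this (hasDerivAt_mul_right z z).continuousAt
  have c2 : ContinuousAt (fun w => appz P k y (w * z⁻¹)) z := by
    have := (differentiableAt_appz hP hP0 hk hy).continuousAt
    rw [← mul_inv_cancel₀ hz] at this
    exact ContinuousAt.comp (f := fun w => w * z⁻¹) this (hasDerivAt_mul_right z z⁻¹).continuousAt
  exact (c1.const_mul _).add c2

/-- The excluded value of `rank_pair`, in which one of the Appell–Lerch sums has a pole. -/
theorem rank_pole {z : ℂ} (hz : z ≠ 0) (h1 : ¬ Lat P z) (h2 : ¬ Lat P (z ^ 2)) :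
    z ^ 3 * app P 3 (z ^ 3) (z ^ 2) + appz P 3 (z ^ 3)⁻¹ 1 =
      z * theta P (z ^ 2) / theta P z * app P 3 1 z + (ell P (z ^ 2) + ell P z) := by
  have hz3 : z ^ 3 ≠ 0 := pow_ne_zero _ hz
  have hz3i := inv_ne_zero hz3
  have q1 := theta_ne_zero hP hP0 hz h1
  have q2 := theta_ne_zero hP hP0 (pow_ne_zero 2 hz) h2
  have hJ : poch P P ≠ 0 := poch_self_ne_zero hP hP0
  have c3 := (differentiableAt_app hP hP0 (k := 3) (by norm_num) one_ne_zero hz h1).continuousAt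
  have key := pole_limit hP hP0 hz h2
    (g := fun w => (z ^ 3 * app P 3 (z ^ 3) (w * z) + appz P 3 (z ^ 3)⁻¹ (w * z⁻¹)) -
      z * theta P (z ^ 2) / theta P z * app P 3 1 w)
    (N := fun w => poch P P ^ 3 * theta P (z ^ 2) * theta P z / theta P w)
    ((continuousAt_pole_sum hP hP0 hz h2 (by norm_num) hz3 hz3i).sub (c3.const_mul _))
    ((hasDerivAt_const z _).div (hasDerivAt_theta hP hz) q1) (by field_simp) ?_
  · simp only [← sq, mul_inv_cancel₀ hz] at key
    rw [sub_eq_iff_eq_add] at key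
    rw [key, add_comm, ell, ell]
    congr 1
    field_simp
    ring
  · intro w hw n0 n1 n2
    have hp := rank_pair hP hP0 hz h1 h2 hw n0 n1 n2
    have q0 := theta_ne_zero hP hP0 hw n0
    rw [app_split hP hP0 (by norm_num) hz3i (mul_ne_zero hw (inv_ne_zero hz)) n2] at hp
    have e : poch P P ^ 3 * theta P (z ^ 2) * theta P z / theta P w /
        (theta P (w * z) * theta P (w * z⁻¹)) = poch P P ^ 3 * theta P (z ^ 2) * theta P z /
        (theta P (w * z) * theta P w * theta P (w * z⁻¹)) := by
      rw [div_div]; congr 1; ring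
    rw [e]
    linear_combination hp

/-- The excluded value of `crank_pair`, in which one of the Appell–Lerch sums has a pole. -/
theorem crank_pole {z : ℂ} (hz : z ≠ 0) (h1 : ¬ Lat P z) (h2 : ¬ Lat P (z ^ 2)) :
    z * app P 1 z (z ^ 2) + appz P 1 z⁻¹ 1 = ell P (z ^ 2) - ell P z := by
  have hzi := inv_ne_zero hz
  have q1 := theta_ne_zero hP hP0 hz h1
  have q2 := theta_ne_zero hP hP0 (pow_ne_zero 2 hz) h2
  have hJ : poch P P ≠ 0 := poch_self_ne_zero hP hP0
  have key := pole_limit hP hP0 hz h2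
    (g := fun w => z * app P 1 z (w * z) + appz P 1 z⁻¹ (w * z⁻¹))
    (N := fun w => poch P P ^ 3 * theta P (z ^ 2) / theta P z * theta P w)
    (continuousAt_pole_sum hP hP0 hz h2 (by norm_num) hz hzi)
    ((hasDerivAt_theta hP hz).const_mul _) (by field_simp) ?_
  · simp only [← sq, mul_inv_cancel₀ hz] at key
    rw [key, ell, ell]
    field_simp
  · intro w hw n0 n1 n2
    have hp := crank_pair hP hP0 hz h1 h2 hw n1 n2
    rw [app_split hP hP0 (by norm_num) hzi (mul_ne_zero hw hzi) n2] at hp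
    have e : poch P P ^ 3 * theta P (z ^ 2) / theta P z * theta P w /
        (theta P (w * z) * theta P (w * z⁻¹)) = poch P P ^ 3 * theta P (z ^ 2) * theta P w /
        (theta P z * theta P (w * z) * theta P (w * z⁻¹)) := by
      rw [div_mul_eq_mul_div, div_div, mul_assoc (theta P z)]
    rw [e]
    linear_combination hp

end

end

section
variable {P : ℂ} (hP : ‖P‖ < 1) (hP0 : P ≠ 0)
include hP hP0

omit hP0 in
theorem holC_deriv_theta : HolC (deriv (theta P)) := by
  intro w hw
  have h : DifferentiableOn ℂ (theta P) {0}ᶜ := fun v hv => (holC_theta hP v hv).differentiableWithinAt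
  exact ((h.deriv isOpen_compl_singleton) w hw).differentiableAt (isOpen_compl_singleton.mem_nhds hw)

theorem mul_deriv_theta_mul {w : ℂ} (hw : w ≠ 0) :
    P * w * deriv (theta P) (P * w) = -w⁻¹ * (w * deriv (theta P) w - theta P w) := by
  have h1 : HasDerivAt (fun v => theta P (P * v)) (deriv (theta P) (P * w) * P) w := by
    have := HasDerivAt.comp w (h₂ := theta P) (h := fun v => P * v)
      (holC_theta hP (P * w) (mul_ne_zero hP0 hw)).hasDerivAt ((hasDerivAt_id w).const_mul P)
    rwa [mul_one] at this
  have h2 : HasDerivAt (fun v => -v⁻¹ * theta P v)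
      (-(-(w ^ 2)⁻¹) * theta P w + -w⁻¹ * deriv (theta P) w) w :=
    (hasDerivAt_inv hw).neg.mul (holC_theta hP w hw).hasDerivAt
  have h3 : (fun v => theta P (P * v)) =ᶠ[𝓝 w] fun v => -v⁻¹ * theta P v := by
    filter_upwards [isOpen_compl_singleton.mem_nhds hw] with v hv
    exact theta_mul hP hP0 hv
  have := h1.unique (h2.congr_of_eventuallyEq h3)
  rw [mul_assoc, mul_comm P, mul_assoc, this]
  field_simp
  ring

theorem ell_mul {w : ℂ} (hw : w ≠ 0) (h : ¬ Lat P w) : ell P (P * w) = ell P w - 1 := by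
  have q := theta_ne_zero hP hP0 hw h
  rw [ell, ell, mul_deriv_theta_mul hP hP0 hw, theta_mul hP hP0 hw]
  field_simp

theorem ell_inv {w : ℂ} (hw : w ≠ 0) (h : ¬ Lat P w) : ell P w⁻¹ = 1 - ell P w := by
  have q := theta_ne_zero hP hP0 hw h
  have hwi := inv_ne_zero hw
  have h1 : HasDerivAt (fun v => theta P v⁻¹) (deriv (theta P) w⁻¹ * (-(w ^ 2)⁻¹)) w :=
    (holC_theta hP w⁻¹ hwi).hasDerivAt.comp w (hasDerivAt_inv hw)
  have h2 : HasDerivAt (fun v => -v⁻¹ * theta P v)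
      (-(-(w ^ 2)⁻¹) * theta P w + -w⁻¹ * deriv (theta P) w) w :=
    (hasDerivAt_inv hw).neg.mul (holC_theta hP w hw).hasDerivAt
  have h3 : (fun v => theta P v⁻¹) =ᶠ[𝓝 w] fun v => -v⁻¹ * theta P v := by
    filter_upwards [isOpen_compl_singleton.mem_nhds hw] with v hv
    exact theta_inv hP hv
  have h4 := h1.unique (h2.congr_of_eventuallyEq h3)
  have h5 : w⁻¹ * deriv (theta P) w⁻¹ = -w⁻¹ * (theta P w - w * deriv (theta P) w) := by
    have : deriv (theta P) w⁻¹ = -(w ^ 2) * (deriv (theta P) w⁻¹ * (-(w ^ 2)⁻¹)) := by field_simp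
    rw [this, h4]; field_simp; ring
  rw [ell, ell, h5, theta_inv hP hw]
  field_simp

/-- A holomorphic function with the multiplier and the zeros of `θ(wb)θ(wc)`. -/
theorem exists_const_mul_theta_mul_theta {b c : ℂ} (hb : b ≠ 0) (hc : c ≠ 0)
    (hbc : ¬ Lat P (c * b⁻¹)) (hcb : ¬ Lat P (b * c⁻¹)) {N : ℂ → ℂ} (hN : HolC N)
    (hper : ∀ w, w ≠ 0 → N (P * w) = (w * b)⁻¹ * (w * c)⁻¹ * N w)
    (h1 : N b⁻¹ = 0) (h2 : N c⁻¹ = 0) :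
    ∃ C, ∀ w, w ≠ 0 → N w = C * (theta P (w * b) * theta P (w * c)) := by
  have hθ := holC_theta hP
  have hz : ∀ b, b ≠ 0 → N b⁻¹ = 0 → ∀ w, Lat P (w * b) → N w = 0 := by
    intro b hb h0 w hw
    have key := lat_induction hP hP0 (p := fun v => N (v * b⁻¹) = 0) (by simpa using h0)
      (fun v hv => by
        have hv' : v * b⁻¹ ≠ 0 := mul_ne_zero hv (inv_ne_zero hb)
        rw [mul_assoc P, hper _ hv']
        have : (v * b⁻¹ * (b : ℂ))⁻¹ ≠ 0 := inv_ne_zero (mul_ne_zero hv' hb)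
        simp_all) hw
    simpa [hb] using key
  refine exists_const_mul hP hP0 (D := fun w => theta P (w * b) * theta P (w * c))
    (μ := fun w => (w * b)⁻¹ * (w * c)⁻¹) hN
    ((hθ.comp_mul hb).mul (hθ.comp_mul hc)) ?_ ?_ ?_ ?_ hper ?_
  · intro w hw h
    rcases mul_eq_zero.mp h with h | h
    · exact hz b hb h1 w ((theta_eq_zero_iff hP hP0 (mul_ne_zero hw hb)).mp h)
    · exact hz c hc h2 w ((theta_eq_zero_iff hP hP0 (mul_ne_zero hw hc)).mp h)
  · intro w hw h
    have e : ∀ b, b ≠ 0 → HasDerivAt (fun w => theta P (w * b)) (deriv (theta P) (w * b) * b) w :=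
      fun b hb => HasDerivAt.comp w (h₂ := theta P) (h := fun v => v * b)
        (holC_theta hP (w * b) (mul_ne_zero hw hb)).hasDerivAt (hasDerivAt_mul_right w b)
    have hd : deriv (fun w => theta P (w * b) * theta P (w * c)) w = _ := ((e b hb).mul (e c hc)).deriv
    rw [hd]
    have key : ∀ b c, b ≠ 0 → c ≠ 0 → ¬ Lat P (c * b⁻¹) → theta P (w * b) = 0 →
        theta P (w * c) ≠ 0 := by
      intro b c hb hc hn h h'
      obtain ⟨m, hm⟩ := (theta_eq_zero_iff hP hP0 (mul_ne_zero hw hb)).mp h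
      obtain ⟨n, hn'⟩ := (theta_eq_zero_iff hP hP0 (mul_ne_zero hw hc)).mp h'
      refine hn ⟨n - m, ?_⟩
      rw [zpow_sub₀ hP0]
      have : P ^ m ≠ 0 := zpow_ne_zero _ hP0
      field_simp
      have e1 : c * P ^ n = w⁻¹ := by field_simp; linear_combination hn'
      have e2 : b * P ^ m = w⁻¹ := by field_simp; linear_combination hm
      rw [e1, e2]
    rcases mul_eq_zero.mp h with h | h
    · rw [h, zero_mul, add_zero]
      exact mul_ne_zero (mul_ne_zero (deriv_theta_ne_zero hP hP0 (mul_ne_zero hw hb) h) hb)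
        (key b c hb hc hbc h)
    · rw [h, mul_zero, zero_add]
      exact mul_ne_zero (key c b hc hb hcb h)
        (mul_ne_zero (deriv_theta_ne_zero hP hP0 (mul_ne_zero hw hc) h) hc)
  · refine ((countable_lat P b hP0 hb).union (countable_lat P c hP0 hc)).mono ?_
    rintro w ⟨hw, h⟩
    rcases mul_eq_zero.mp h with h | h
    · exact Or.inl ((theta_eq_zero_iff hP hP0 (mul_ne_zero hw hb)).mp h)
    · exact Or.inr ((theta_eq_zero_iff hP hP0 (mul_ne_zero hw hc)).mp h)
  · intro w hw
    exact mul_ne_zero (inv_ne_zero (mul_ne_zero hw hb)) (inv_ne_zero (mul_ne_zero hw hc))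
  · intro w hw
    simp only [mul_assoc P]
    rw [theta_mul hP hP0 (mul_ne_zero hw hb), theta_mul hP hP0 (mul_ne_zero hw hc)]
    ring

/-- The Lambert series addition formula. -/
theorem ell_add {a b c : ℂ} (ha : a ≠ 0) (hb : b ≠ 0) (hc : c ≠ 0)
    (na : ¬ Lat P a) (nb : ¬ Lat P b) (nc : ¬ Lat P c) (nabc : ¬ Lat P (a * b * c))
    (nbc : ¬ Lat P (b * c)) (hbc : ¬ Lat P (c * b⁻¹)) (hcb : ¬ Lat P (b * c⁻¹)) :
    ell P a + ell P b + ell P c - ell P (a * b * c) - 1 =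
      - (poch P P ^ 3 * theta P (b * c) * theta P (a * b) * theta P (a * c) /
        (theta P a * theta P b * theta P c * theta P (a * b * c))) := by
  have hθ := holC_theta hP
  have hθ' := holC_deriv_theta hP
  have hbc0 := mul_ne_zero hb hc
  have tb := theta_ne_zero hP hP0 hb nb
  have tc := theta_ne_zero hP hP0 hc nc
  have ta := theta_ne_zero hP hP0 ha na
  have tabc := theta_ne_zero hP hP0 (mul_ne_zero (mul_ne_zero ha hb) hc) nabc
  have tbc := theta_ne_zero hP hP0 hbc0 nbc
  have hid : HolC fun w => w := fun w _ => differentiableAt_id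
  set N : ℂ → ℂ := fun w => w * deriv (theta P) w * theta P (w * (b * c)) +
    (ell P b + ell P c - 1) * (theta P w * theta P (w * (b * c))) -
    theta P w * (w * (b * c) * deriv (theta P) (w * (b * c))) with hN
  have hNh : HolC N := fun w hw =>
    (((hid.mul hθ').mul (hθ.comp_mul hbc0) w hw).add
      ((hθ.mul (hθ.comp_mul hbc0) w hw).const_mul _)).sub
      (hθ.mul ((hid.mul hθ').comp_mul hbc0) w hw)
  have hoff : ∀ w, w ≠ 0 → ¬ Lat P w → ¬ Lat P (w * (b * c)) → N w =
      theta P w * theta P (w * (b * c)) * (ell P w + ell P b + ell P c - ell P (w * (b * c)) - 1) := by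
    intro w hw n1 n2
    have q1 := theta_ne_zero hP hP0 hw n1
    have q2 := theta_ne_zero hP hP0 (mul_ne_zero hw hbc0) n2
    simp only [hN]
    rw [show ell P w = w * deriv (theta P) w / theta P w from rfl,
      show ell P (w * (b * c)) = w * (b * c) * deriv (theta P) (w * (b * c)) / theta P (w * (b * c)) from rfl]
    generalize theta P (w * (b * c)) = X at *
    field_simp
    ring
  have hper : ∀ w, w ≠ 0 → N (P * w) = (w * b)⁻¹ * (w * c)⁻¹ * N w := by
    intro w hw
    have h1 := mul_deriv_theta_mul hP hP0 hw
    have h2 := mul_deriv_theta_mul hP hP0 (mul_ne_zero hw hbc0)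
    have h3 := theta_mul hP hP0 hw
    have h4 := theta_mul hP hP0 (mul_ne_zero hw hbc0)
    simp only [hN]
    rw [mul_assoc P w (b * c), mul_assoc P w, mul_assoc P (w * (b * c))] at *
    rw [h3, h4]
    rw [show P * (w * deriv (theta P) (P * w)) * (-(w * (b * c))⁻¹ * theta P (w * (b * c))) =
      -(w * (b * c))⁻¹ * theta P (w * (b * c)) * (P * (w * deriv (theta P) (P * w))) by ring, h1, h2]
    generalize theta P (w * (b * c)) = X
    generalize deriv (theta P) (w * (b * c)) = Y
    field_simp
    ring
  have hNb : N b⁻¹ = 0 := by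
    have hbi := inv_ne_zero hb
    have e : b⁻¹ * (b * c) = c := by field_simp
    rw [hoff _ hbi (by rwa [lat_inv]) (by rwa [e]), e, ell_inv hP hP0 hb nb]
    ring
  have hNc : N c⁻¹ = 0 := by
    have hci := inv_ne_zero hc
    have e : c⁻¹ * (b * c) = b := by field_simp
    rw [hoff _ hci (by rwa [lat_inv]) (by rwa [e]), e, ell_inv hP hP0 hc nc]
    ring
  obtain ⟨C, hC⟩ := exists_const_mul_theta_mul_theta hP hP0 hb hc hbc hcb hNh hper hNb hNc
  have e1 := hC 1 one_ne_zero
  simp only [hN, theta_one hP, deriv_theta_one hP hP0, one_mul, zero_mul, mul_zero, sub_zero,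
    add_zero] at e1
  have e2 := hC a ha
  rw [hoff a ha na (by rwa [← mul_assoc]), ← mul_assoc a b c] at e2
  have : C = -(poch P P ^ 3 * theta P (b * c)) / (theta P b * theta P c) := by
    field_simp
    linear_combination -e1
  rw [this] at e2
  have e3 : ell P a + ell P b + ell P c - ell P (a * b * c) - 1 =
    theta P a * theta P (a * b * c) * (ell P a + ell P b + ell P c - ell P (a * b * c) - 1) /
      (theta P a * theta P (a * b * c)) := by field_simp
  rw [e3, e2]
  field_simp

/-- The antisymmetric product of theta functions entering the three-term relation. -/
noncomputable def brak (P x y : ℂ) : ℂ := x⁻¹ * theta P (x * y) * theta P (x * y⁻¹)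

omit hP0 in
theorem brak_swap {x y : ℂ} (hx : x ≠ 0) (hy : y ≠ 0) : brak P y x = - brak P x y := by
  have e : y * x⁻¹ = (x * y⁻¹)⁻¹ := by field_simp
  rw [brak, brak, e, theta_inv hP (mul_ne_zero hx (inv_ne_zero hy)), mul_comm y x]
  field_simp

/-- Weierstrass' three-term relation. -/
theorem brak_three_term {w a b c : ℂ} (hw : w ≠ 0) (ha : a ≠ 0) (hb : b ≠ 0) (hc : c ≠ 0)
    (h2 : ¬ Lat P (c ^ 2)) (n1 : ¬ Lat P (a * c)) (n2 : ¬ Lat P (a * c⁻¹)) :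
    brak P w a * brak P b c + brak P w b * brak P c a + brak P w c * brak P a b = 0 := by
  have hθ := holC_theta hP
  have hci := inv_ne_zero hc
  set N : ℂ → ℂ := fun w => theta P (w * a) * theta P (w * a⁻¹) * brak P b c +
    theta P (w * b) * theta P (w * b⁻¹) * brak P c a with hN
  have hNh : HolC N := fun w hw =>
    (((hθ.comp_mul ha).mul (hθ.comp_mul (inv_ne_zero ha)) w hw).mul_const _).add
    (((hθ.comp_mul hb).mul (hθ.comp_mul (inv_ne_zero hb)) w hw).mul_const _)
  have hNc : N c = 0 := by
    have e1 : N c = c * (brak P c a * brak P b c + brak P c b * brak P c a) := by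
      simp only [hN, brak]; field_simp
    rw [e1, brak_swap hP hb hc]; ring
  have hNci : N c⁻¹ = 0 := by
    have e : ∀ a, a ≠ 0 → theta P (c⁻¹ * a) * theta P (c⁻¹ * a⁻¹) =
        (c ^ 2)⁻¹ * (theta P (c * a) * theta P (c * a⁻¹)) := by
      intro a ha
      rw [show c⁻¹ * a = (c * a⁻¹)⁻¹ by field_simp, show c⁻¹ * a⁻¹ = (c * a)⁻¹ by field_simp,
        theta_inv hP (mul_ne_zero hc ha), theta_inv hP (mul_ne_zero hc (inv_ne_zero ha))]
      field_simp
    have e1 : N c⁻¹ = (c ^ 2)⁻¹ * N c := by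
      simp only [hN]; rw [e a ha, e b hb]; ring
    rw [e1, hNc, mul_zero]
  have hper : ∀ w, w ≠ 0 → N (P * w) = (w * c)⁻¹ * (w * c⁻¹)⁻¹ * N w := by
    intro w hw
    have e : ∀ a, a ≠ 0 → theta P (P * w * a) * theta P (P * w * a⁻¹) =
        (w * c)⁻¹ * (w * c⁻¹)⁻¹ * (theta P (w * a) * theta P (w * a⁻¹)) := by
      intro a ha
      simp only [mul_assoc P]
      rw [theta_mul hP hP0 (mul_ne_zero hw ha), theta_mul hP hP0 (mul_ne_zero hw (inv_ne_zero ha))]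
      field_simp
    simp only [hN]
    rw [e a ha, e b hb]; ring
  obtain ⟨C, hC⟩ := exists_const_mul_theta_mul_theta hP hP0 hc hci
    (by rw [show c⁻¹ * c⁻¹ = (c ^ 2)⁻¹ by field_simp]; rwa [lat_inv])
    (by rwa [inv_inv, ← sq]) hNh hper hNci (by rwa [inv_inv])
  have key : ∀ w, w ≠ 0 → brak P w a * brak P b c + brak P w b * brak P c a = C * brak P w c := by
    intro w hw
    have := hC w hw
    simp only [hN] at this
    simp only [brak] at this ⊢
    linear_combination w⁻¹ * this
  have e := key a ha
  have e0 : brak P a a = 0 := by simp [brak, ha, theta_one hP]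
  have hne : brak P a c ≠ 0 := by
    refine mul_ne_zero (mul_ne_zero (inv_ne_zero ha) ?_) ?_
    · exact theta_ne_zero hP hP0 (mul_ne_zero ha hc) n1
    · exact theta_ne_zero hP hP0 (mul_ne_zero ha hci) n2
  have eC : C = - brak P a b := by
    have : C * brak P a c = - brak P a b * brak P a c := by
      rw [← e, e0, brak_swap hP ha hc]; ring
    exact mul_right_cancel₀ hne this
  rw [key w hw, eC]; ring

end

section

theorem norm_sq_lt_one {P : ℂ} (hP : ‖P‖ < 1) : ‖P ^ 2‖ < 1 := by
  rw [norm_pow]; exact pow_lt_one₀ (norm_nonneg _) hP two_ne_zero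

theorem poch_mul_neg {P : ℂ} (hP : ‖P‖ < 1) (x : ℂ) :
    poch P x * poch P (-x) = poch (P ^ 2) (x ^ 2) := by
  unfold poch
  rw [← (multipliable_poch hP x).tprod_mul (multipliable_poch hP (-x))]
  congr 1; ext n; ring

theorem poch_eq_poch_sq {P : ℂ} (hP : ‖P‖ < 1) (x : ℂ) :
    poch P x = poch (P ^ 2) x * poch (P ^ 2) (P * x) := by
  unfold poch
  have h1 : (fun n : ℕ => 1 - x * (P ^ 2) ^ n) = fun n => 1 - x * P ^ (2 * n) := by
    ext n; rw [pow_mul]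
  have h2 : (fun n : ℕ => 1 - P * x * (P ^ 2) ^ n) = fun n => 1 - x * P ^ (2 * n + 1) := by
    ext n; rw [← pow_mul]; ring
  have m1 := multipliable_poch (norm_sq_lt_one hP) x
  have m2 := multipliable_poch (norm_sq_lt_one hP) (P * x)
  rw [h1] at m1
  rw [h2] at m2
  rw [h1, h2]
  exact (tprod_even_mul_odd (f := fun n : ℕ => 1 - x * P ^ n) m1 m2).symm

section
variable {P r : ℂ} (hP : ‖P‖ < 1) (hP0 : P ≠ 0) (hr : r ^ 2 = P)
include hP hP0 hr

/-- The duplication formula for theta functions. -/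
theorem theta_double {w : ℂ} (hw : w ≠ 0) :
    theta P w * theta P (-w) * theta P (w * r) * theta P (-(w * r)) =
      poch P P ^ 3 * theta P (w ^ 2) := by
  have hr0 : r ≠ 0 := by rintro rfl; simp at hr; exact hP0 hr.symm
  have a1 := poch_mul_neg hP w
  have a2 := poch_mul_neg hP (w * r)
  have a3 := poch_mul_neg hP (P / w)
  have a4 := poch_mul_neg hP (P / (w * r))
  have b1 := poch_eq_poch_sq hP (w ^ 2)
  have b2 := poch_eq_poch_sq hP (P / w ^ 2)
  rw [show (w * r) ^ 2 = P * w ^ 2 by rw [← hr]; ring] at a2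
  rw [show (P / w) ^ 2 = P * (P / w ^ 2) by ring] at a3
  rw [show (P / (w * r)) ^ 2 = P / w ^ 2 by rw [div_pow, mul_pow, hr]; field_simp] at a4
  simp only [theta, div_neg]
  rw [b1, b2, ← a1, ← a2, ← a3, ← a4]
  ring

theorem theta_half_periods : theta P (-1) * theta P r * theta P (-r) = 2 * poch P P ^ 3 := by
  have hr0 : r ≠ 0 := by rintro rfl; simp at hr; exact hP0 hr.symm
  have hJ := poch_self_ne_zero hP hP0
  have a1 := poch_mul_neg hP P
  have a2 := poch_mul_neg hP r
  have b1 := poch_eq_poch_sq hP P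
  rw [hr] at a2
  rw [← sq, ← a1, ← a2] at b1
  have b2 : poch P r * poch P (-r) * poch P (-P) = 1 :=
    mul_left_cancel₀ hJ (by linear_combination -b1)
  have c1 := poch_eq_mul hP (-1)
  have e1 : P / r = r := by rw [← hr]; field_simp
  simp only [theta, div_neg, div_one, e1, c1, mul_neg, mul_one]
  linear_combination 2 * poch P P ^ 3 * (poch P r * poch P (-r) * poch P (-P) + 1) * b2

end

/-- The normalized quotient `⟨a,b⟩/(⟨a,1⟩⟨b,1⟩)` (a difference of `℘`-values). -/
noncomputable def hq (P a b : ℂ) : ℂ := brak P a b / (brak P a 1 * brak P b 1)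

section
variable {P : ℂ} (hP : ‖P‖ < 1) (hP0 : P ≠ 0)
include hP hP0

omit hP hP0 in
theorem brak_one (a : ℂ) : brak P a 1 = a⁻¹ * theta P a ^ 2 := by
  simp [brak]; ring

theorem brak_one_ne_zero {a : ℂ} (ha : a ≠ 0) (n : ¬ Lat P a) : brak P a 1 ≠ 0 := by
  rw [brak_one]
  exact mul_ne_zero (inv_ne_zero ha) (pow_ne_zero _ (theta_ne_zero hP hP0 ha n))

theorem hq_sub {a b c : ℂ} (ha : a ≠ 0) (hb : b ≠ 0) (hc : c ≠ 0) (na : ¬ Lat P a)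
    (nb : ¬ Lat P b) (nc : ¬ Lat P c) (nc2 : ¬ Lat P (c ^ 2)) :
    hq P a b = hq P c b - hq P c a := by
  have h := brak_three_term hP hP0 (w := a) (a := 1) (b := b) (c := c) ha one_ne_zero hb hc nc2
    (by rwa [one_mul]) (by rw [one_mul]; rwa [lat_inv])
  rw [brak_swap hP hc hb, brak_swap hP hc ha, brak_swap hP hb one_ne_zero] at h
  have qa := brak_one_ne_zero hP hP0 ha na
  have qb := brak_one_ne_zero hP hP0 hb nb
  have qc := brak_one_ne_zero hP hP0 hc nc
  simp only [hq]
  field_simp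
  linear_combination h

section
variable {r : ℂ} (hr : r ^ 2 = P)
include hr

theorem theta_div_half {a : ℂ} (ha : a ≠ 0) : theta P (a * r⁻¹) = -(a * r⁻¹) * theta P (a * r) := by
  have hr0 : r ≠ 0 := by rintro rfl; simp at hr; exact hP0 hr.symm
  have e : P * (a * r⁻¹) = a * r := by rw [← hr]; field_simp
  have h := theta_mul hP hP0 (mul_ne_zero ha (inv_ne_zero hr0))
  rw [e] at h
  rw [h]
  field_simp

theorem hq_half_periods_prod {a : ℂ} (ha : a ≠ 0) (na : ¬ Lat P a) (n1 : ¬ Lat P (-1 : ℂ))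
    (n2 : ¬ Lat P r) (n3 : ¬ Lat P (-r)) :
    4 * (hq P a (-1) * hq P a r * hq P a (-r)) * theta P a ^ 8 = -(a ^ 2 * theta P (a ^ 2) ^ 2) := by
  have hr0 : r ≠ 0 := by rintro rfl; simp at hr; exact hP0 hr.symm
  have hnr0 : -r ≠ 0 := neg_ne_zero.mpr hr0
  have hr' : (-r) ^ 2 = P := by rw [neg_sq, hr]
  have qa := theta_ne_zero hP hP0 ha na
  have q1 := theta_ne_zero hP hP0 (by norm_num) n1
  have q2 := theta_ne_zero hP hP0 hr0 n2
  have q3 := theta_ne_zero hP hP0 hnr0 n3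
  have d := theta_double hP hP0 hr ha
  have p := theta_half_periods hP hP0 hr
  have e1 := theta_div_half hP hP0 hr ha
  have e2 := theta_div_half hP hP0 hr' ha
  have hJ := poch_self_ne_zero hP hP0
  simp only [hq, brak_one]
  simp only [brak]
  rw [e1, e2, show a * (-1 : ℂ)⁻¹ = -a by norm_num, show a * (-1 : ℂ) = -a by ring, mul_neg]
  generalize theta P (-r) = X3 at *
  generalize theta P r = X2 at *
  generalize theta P (-1) = X1 at *
  generalize theta P (-(a * r)) = Y3 at *
  generalize theta P (a * r) = Y2 at *
  generalize theta P (-a) = Y1 at *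
  generalize theta P (a ^ 2) = Y at *
  generalize theta P a = Y0 at *
  generalize poch P P = J at *
  field_simp
  have k1 : Y0 * Y1 * Y2 * Y3 * (X1 * X2 * X3) = 2 * J ^ 6 * Y := by rw [d, p]; ring
  have k2 : (Y0 * Y1 * Y2 * Y3) ^ 2 * 4 = Y ^ 2 * (X1 * X2 * X3) ^ 2 := by rw [d, p]; ring
  linear_combination -k2

theorem hq_half_periods_disc (n1 : ¬ Lat P (-1 : ℂ)) (n2 : ¬ Lat P r) (n3 : ¬ Lat P (-r)) :
    16 * poch P P ^ 12 * (hq P (-1) r * hq P (-1) (-r) * hq P r (-r)) ^ 2 = P := by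
  have hr0 : r ≠ 0 := by rintro rfl; simp at hr; exact hP0 hr.symm
  have hnr0 : -r ≠ 0 := neg_ne_zero.mpr hr0
  have q1 := theta_ne_zero hP hP0 (by norm_num) n1
  have q2 := theta_ne_zero hP hP0 hr0 n2
  have q3 := theta_ne_zero hP hP0 hnr0 n3
  have p := theta_half_periods hP hP0 hr
  have f1 : theta P (-r⁻¹) = r⁻¹ * theta P (-r) := by
    rw [show -r⁻¹ = (-r)⁻¹ by field_simp, theta_inv hP hnr0]; field_simp
  have f2 : theta P r⁻¹ = -r⁻¹ * theta P r := theta_inv hP hr0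
  have f3 : theta P (-P) = theta P (-1) := by
    rw [show -P = P * (-1) by ring, theta_mul hP hP0 (by norm_num)]; norm_num
  simp only [hq, brak_one]
  simp only [brak]
  rw [show (-1 : ℂ) * r = -r by ring, show (-1 : ℂ) * -r = r by ring,
    show (-1 : ℂ) * r⁻¹ = -r⁻¹ by ring, show (-1 : ℂ) * (-r)⁻¹ = r⁻¹ by field_simp,
    show r * -r = -P by rw [← hr]; ring, show r * (-r)⁻¹ = -1 by field_simp, f1, f2, f3]
  generalize theta P (-r) = X3 at *
  generalize theta P r = X2 at *
  generalize theta P (-1) = X1 at *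
  have k : (X1 * X2 * X3) ^ 4 = 16 * poch P P ^ 12 := by rw [p]; ring
  rw [← k, ← hr]
  field_simp

end
end

end

section

/-- The normalized theta value at the `n`-th power of `Q = s ^ 22`, with nome `s ^ 242`. -/
noncomputable def tv (s : ℂ) (n : ℤ) : ℂ := s ^ (n * (n - 11)) * theta (s ^ 242) (s ^ (22 * n))

/-- The normalized logarithmic derivative of theta at the `n`-th power of `s ^ 22`. -/
noncomputable def lv (s : ℂ) (n : ℤ) : ℂ := ell (s ^ 242) (s ^ (22 * n)) + n / 11 - 1 / 2

section
variable {s : ℂ} (hs : ‖s‖ < 1) (hs0 : s ≠ 0)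
include hs hs0

omit hs0 in
theorem norm_pow_lt_one {k : ℕ} (hk : k ≠ 0) : ‖s ^ k‖ < 1 := by
  rw [norm_pow]; exact pow_lt_one₀ (norm_nonneg _) hs hk

omit hs0 in
theorem zpow_eq_one_iff_zero {k : ℤ} : s ^ k = 1 ↔ k = 0 := by
  refine ⟨fun h => ?_, fun h => by simp [h]⟩
  have h1 : ‖s‖ ^ k = 1 := by rw [← norm_zpow, h, norm_one]
  exact (zpow_eq_one_iff_right₀ (norm_nonneg s) hs.ne).mp h1

theorem lat_zpow {n : ℤ} : Lat (s ^ 242) (s ^ (22 * n)) ↔ 11 ∣ n := by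
  constructor
  · rintro ⟨m, hm⟩
    rw [← zpow_natCast, ← zpow_mul, ← zpow_add₀ hs0, zpow_eq_one_iff_zero hs] at hm
    push_cast at hm
    omega
  · rintro ⟨m, rfl⟩
    refine ⟨-m, ?_⟩
    rw [← zpow_natCast, ← zpow_mul, ← zpow_add₀ hs0, zpow_eq_one_iff_zero hs]
    push_cast
    ring

theorem tv_neg (n : ℤ) : tv s (-n) = - tv s n := by
  have e : s ^ (22 * -n) = (s ^ (22 * n))⁻¹ := by rw [mul_neg, zpow_neg]
  have k : s ^ (-n * (-n - 11)) * s ^ (-(22 * n)) = s ^ (n * (n - 11)) := by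
    rw [← zpow_add₀ hs0]; congr 1; ring
  rw [tv, tv, e, theta_inv (norm_pow_lt_one hs (by norm_num)) (zpow_ne_zero _ hs0), ← zpow_neg]
  linear_combination -theta (s ^ 242) (s ^ (22 * n)) * k

theorem tv_add (n : ℤ) : tv s (n + 11) = - tv s n := by
  have e : s ^ (22 * (n + 11)) = s ^ 242 * s ^ (22 * n) := by
    rw [← zpow_natCast, ← zpow_add₀ hs0]; congr 1; push_cast; ring
  rw [tv, tv, e, theta_mul (norm_pow_lt_one hs (by norm_num)) (pow_ne_zero _ hs0)
    (zpow_ne_zero _ hs0), ← zpow_neg,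
    neg_mul, mul_neg, ← mul_assoc, ← zpow_add₀ hs0]
  congr 3
  ring

theorem tv_sub_eleven (n : ℤ) : tv s (11 - n) = tv s n := by
  rw [show (11 - n : ℤ) = -n + 11 by ring, tv_add hs hs0, tv_neg hs hs0, neg_neg]

theorem tv_ne_zero {n : ℤ} (h : ¬ (11 : ℤ) ∣ n) : tv s n ≠ 0 :=
  mul_ne_zero (zpow_ne_zero _ hs0) (theta_ne_zero (norm_pow_lt_one hs (by norm_num))
    (pow_ne_zero _ hs0) (zpow_ne_zero _ hs0) (by rwa [lat_zpow hs hs0]))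

theorem lv_neg {n : ℤ} (h : ¬ (11 : ℤ) ∣ n) : lv s (-n) = - lv s n := by
  have e : s ^ (22 * -n) = (s ^ (22 * n))⁻¹ := by rw [mul_neg, zpow_neg]
  rw [lv, lv, e, ell_inv (norm_pow_lt_one hs (by norm_num)) (pow_ne_zero _ hs0)
    (zpow_ne_zero _ hs0) (by rwa [lat_zpow hs hs0])]
  push_cast
  ring

theorem lv_add {n : ℤ} (h : ¬ (11 : ℤ) ∣ n) : lv s (n + 11) = lv s n := by
  have e : s ^ (22 * (n + 11)) = s ^ 242 * s ^ (22 * n) := by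
    rw [← zpow_natCast, ← zpow_add₀ hs0]; congr 1; push_cast; ring
  rw [lv, lv, e, ell_mul (norm_pow_lt_one hs (by norm_num)) (pow_ne_zero _ hs0)
    (zpow_ne_zero _ hs0) (by rwa [lat_zpow hs hs0])]
  push_cast
  ring

theorem lv_sub_eleven {n : ℤ} (h : ¬ (11 : ℤ) ∣ n) : lv s (11 - n) = - lv s n := by
  rw [show (11 - n : ℤ) = -n + 11 by ring, lv_add hs hs0 (by omega), lv_neg hs hs0 h]

omit hs in
theorem tv_mul_tv (x y : ℤ) : tv s (x + y) * tv s (x - y) =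
    s ^ (2 * x ^ 2 + 2 * y ^ 2) * brak (s ^ 242) (s ^ (22 * x)) (s ^ (22 * y)) := by
  have e1 : s ^ (22 * x) * s ^ (22 * y) = s ^ (22 * (x + y)) := by
    rw [← zpow_add₀ hs0]; congr 1; ring
  have e2 : s ^ (22 * x) * (s ^ (22 * y))⁻¹ = s ^ (22 * (x - y)) := by
    rw [← zpow_neg, ← zpow_add₀ hs0]; congr 1; ring
  have e3 : s ^ ((x + y) * (x + y - 11)) * s ^ ((x - y) * (x - y - 11)) =
      s ^ (2 * x ^ 2 + 2 * y ^ 2) * (s ^ (22 * x))⁻¹ := by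
    rw [← zpow_neg, ← zpow_add₀ hs0, ← zpow_add₀ hs0]; congr 1; ring
  rw [tv, tv, brak, e1, e2]
  linear_combination theta (s ^ 242) (s ^ (22 * (x + y))) * theta (s ^ 242) (s ^ (22 * (x - y))) * e3

theorem tv_three_term (w a b c : ℤ) (hc : ¬ (11 : ℤ) ∣ c) (n1 : ¬ (11 : ℤ) ∣ a + c)
    (n2 : ¬ (11 : ℤ) ∣ a - c) :
    tv s (w + a) * tv s (w - a) * (tv s (b + c) * tv s (b - c)) +
    tv s (w + b) * tv s (w - b) * (tv s (c + a) * tv s (c - a)) +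
    tv s (w + c) * tv s (w - c) * (tv s (a + b) * tv s (a - b)) = 0 := by
  have z : ∀ n : ℤ, s ^ (22 * n) ≠ 0 := fun n => zpow_ne_zero _ hs0
  have h := brak_three_term (norm_pow_lt_one hs (by norm_num)) (pow_ne_zero 242 hs0) (z w) (z a)
    (z b) (z c)
    (by
      rw [show (s ^ (22 * c)) ^ 2 = s ^ (22 * (2 * c)) by
        rw [sq, ← zpow_add₀ hs0]; congr 1; ring, lat_zpow hs hs0]
      omega)
    (by rwa [← zpow_add₀ hs0, ← mul_add, lat_zpow hs hs0])
    (by rwa [← zpow_neg, ← zpow_add₀ hs0, ← sub_eq_add_neg, ← mul_sub, lat_zpow hs hs0])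
  simp only [tv_mul_tv hs0]
  simp only [zpow_add₀ hs0]
  linear_combination s ^ (2 * w ^ 2) * s ^ (2 * a ^ 2) * s ^ (2 * b ^ 2) * s ^ (2 * c ^ 2) * h

theorem lv_add_lv (a b c : ℤ) (na : ¬ (11 : ℤ) ∣ a) (nb : ¬ (11 : ℤ) ∣ b) (nc : ¬ (11 : ℤ) ∣ c)
    (nabc : ¬ (11 : ℤ) ∣ a + b + c) (nbc : ¬ (11 : ℤ) ∣ b + c) (nbc' : ¬ (11 : ℤ) ∣ b - c) :
    lv s a + lv s b + lv s c - lv s (a + b + c) =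
      - (poch (s ^ 242) (s ^ 242) ^ 3 * tv s (b + c) * tv s (a + b) * tv s (a + c) /
        (tv s a * tv s b * tv s c * tv s (a + b + c))) := by
  have z : ∀ n : ℤ, s ^ (22 * n) ≠ 0 := fun n => zpow_ne_zero _ hs0
  have ad : ∀ m n : ℤ, s ^ (22 * m) * s ^ (22 * n) = s ^ (22 * (m + n)) := fun m n => by
    rw [← zpow_add₀ hs0, mul_add]
  have sb : ∀ m n : ℤ, s ^ (22 * m) * (s ^ (22 * n))⁻¹ = s ^ (22 * (m - n)) := fun m n => by
    rw [← zpow_neg, ← zpow_add₀ hs0, mul_sub, sub_eq_add_neg]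
  have h := ell_add (norm_pow_lt_one hs (by norm_num)) (pow_ne_zero 242 hs0) (z a) (z b) (z c)
    (by rwa [lat_zpow hs hs0]) (by rwa [lat_zpow hs hs0]) (by rwa [lat_zpow hs hs0])
    (by rwa [ad, ad, lat_zpow hs hs0]) (by rwa [ad, lat_zpow hs hs0])
    (by rw [sb, lat_zpow hs hs0]; omega) (by rwa [sb, lat_zpow hs hs0])
  rw [ad, ad, ad, ad] at h
  have e1 : lv s a + lv s b + lv s c - lv s (a + b + c) =
      ell (s ^ 242) (s ^ (22 * a)) + ell (s ^ 242) (s ^ (22 * b)) + ell (s ^ 242) (s ^ (22 * c)) -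
        ell (s ^ 242) (s ^ (22 * (a + b + c))) - 1 := by
    simp only [lv]; push_cast; ring
  rw [e1, h]
  congr 1
  simp only [tv]
  have q : ∀ n : ℤ, ¬ (11 : ℤ) ∣ n → theta (s ^ 242) (s ^ (22 * n)) ≠ 0 := fun n hn =>
    theta_ne_zero (norm_pow_lt_one hs (by norm_num)) (pow_ne_zero _ hs0) (z n)
      (by rwa [lat_zpow hs hs0])
  have z' : ∀ n : ℤ, s ^ n ≠ 0 := fun n => zpow_ne_zero _ hs0
  have key : s ^ ((b + c) * (b + c - 11)) * s ^ ((a + b) * (a + b - 11)) * s ^ ((a + c) * (a + c - 11)) =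
      s ^ (a * (a - 11)) * s ^ (b * (b - 11)) * s ^ (c * (c - 11)) *
        s ^ ((a + b + c) * (a + b + c - 11)) := by
    simp only [← zpow_add₀ hs0]; congr 1; ring
  have := q a na; have := q b nb; have := q c nc; have := q _ nabc
  have := z' (a * (a - 11)); have := z' (b * (b - 11)); have := z' (c * (c - 11))
  have := z' ((a + b + c) * (a + b + c - 11))
  rw [div_eq_div_iff (by simp_all) (by simp_all)]
  linear_combination -(poch (s ^ 242) (s ^ 242) ^ 3 * theta (s ^ 242) (s ^ (22 * (b + c))) *
    theta (s ^ 242) (s ^ (22 * (a + b))) * theta (s ^ 242) (s ^ (22 * (a + c))) *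
    theta (s ^ 242) (s ^ (22 * a)) * theta (s ^ 242) (s ^ (22 * b)) *
    theta (s ^ 242) (s ^ (22 * c)) * theta (s ^ 242) (s ^ (22 * (a + b + c)))) * key

end

end

/-- Five nonzero numbers satisfying three instances of the three-term relation. -/
structure ThetaRel (t1 t2 t3 t4 t5 : ℂ) : Prop where
  h1 : t1 ≠ 0
  h2 : t2 ≠ 0
  h3 : t3 ≠ 0
  h4 : t4 ≠ 0
  h5 : t5 ≠ 0
  r1 : t3 ^ 2 * t4 * t5 = t1 ^ 2 * t2 * t3 + t2 * t4 * t5 ^ 2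
  r2 : t3 * t5 ^ 3 + t1 ^ 3 * t2 = t4 ^ 3 * t5
  r3 : t1 ^ 2 * t3 * t4 + t1 * t3 * t5 ^ 2 = t2 ^ 2 * t4 * t5

/-- Coordinates on the elliptic curve `y ^ 2 + y = x ^ 3 - x ^ 2`. -/
structure Coord (t1 t2 t3 t4 t5 x u y z : ℂ) : Prop extends ThetaRel t1 t2 t3 t4 t5 where
  ex : x = t3 * t4 * t5 / (t1 ^ 2 * t2)
  eu : u = t4 * t5 ^ 2 / (t1 ^ 2 * t3)
  ey : y = t3 * t5 ^ 3 / (t1 ^ 3 * t2)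
  ez : z = t2 * t4 * t5 ^ 2 / t1 ^ 4
  xu : u = x - 1
  xz : z = x + y
  curve : y ^ 2 + y = x ^ 3 - x ^ 2

theorem ThetaRel.coord {t1 t2 t3 t4 t5 : ℂ} (h : ThetaRel t1 t2 t3 t4 t5) :
    Coord t1 t2 t3 t4 t5 (t3 * t4 * t5 / (t1 ^ 2 * t2)) (t4 * t5 ^ 2 / (t1 ^ 2 * t3))
      (t3 * t5 ^ 3 / (t1 ^ 3 * t2)) (t2 * t4 * t5 ^ 2 / t1 ^ 4) := by
  obtain ⟨h1, h2, h3, h4, h5, r1, r2, r3⟩ := h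
  have e1 : t4 * t5 ^ 2 / (t1 ^ 2 * t3) = t3 * t4 * t5 / (t1 ^ 2 * t2) - 1 := by
    field_simp; linear_combination -r1
  have e2 : t3 * t5 ^ 3 / (t1 ^ 3 * t2) + 1 = t4 ^ 3 * t5 / (t1 ^ 3 * t2) := by
    field_simp; linear_combination r2
  refine ⟨⟨h1, h2, h3, h4, h5, r1, r2, r3⟩, rfl, rfl, rfl, rfl, e1, ?_, ?_⟩
  · field_simp; linear_combination -r3
  · have e3 : ∀ x y : ℂ, y * (y + 1) = x ^ 2 * (x - 1) → y ^ 2 + y = x ^ 3 - x ^ 2 := fun x y h => by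
      linear_combination h
    refine e3 _ _ ?_
    rw [← e1, e2]
    field_simp

theorem Coord.ne {t1 t2 t3 t4 t5 x u y z : ℂ} (h : Coord t1 t2 t3 t4 t5 x u y z) :
    x ≠ 0 ∧ u ≠ 0 ∧ y ≠ 0 ∧ z ≠ 0 := by
  obtain ⟨⟨h1, h2, h3, h4, h5, -, -, -⟩, rfl, rfl, rfl, rfl, -, -, -⟩ := h
  simp_all

theorem cubic_disc (p1 p2 p3 e1 e2 e3 : ℂ) (h1 : p1 + p2 + p3 = e1)
    (h2 : p1 * p2 + p1 * p3 + p2 * p3 = e2) (h3 : p1 * p2 * p3 = e3) :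
    ((p2 - p1) * (p3 - p1) * (p3 - p2)) ^ 2 =
      e1 ^ 2 * e2 ^ 2 - 4 * e2 ^ 3 - 4 * e1 ^ 3 * e3 - 27 * e3 ^ 2 + 18 * e1 * e2 * e3 := by
  subst h1 h2 h3; ring

theorem tate_disc (b c p1 p2 p3 : ℂ) (hb : b ≠ 0) (hc : c ≠ 0) (hbc : b ≠ c)
    (h0 : 4 * (p1 * p2 * p3) = -b ^ 2)
    (h1 : 4 * ((b + p1) * (b + p2) * (b + p3)) = -(b * c) ^ 2)
    (h2 : 4 * ((c + p1) * (c + p2) * (c + p3)) = -(b + (c - 1) * c) ^ 2) :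
    16 * ((p2 - p1) * (p3 - p1) * (p3 - p2)) ^ 2 =
      b ^ 3 * (b - 16 * b ^ 2 + 20 * b * c - 8 * b * c ^ 2 - c * (c + 1) ^ 3) := by
  have k1 : 4 * (b ^ 2 + (p1 + p2 + p3) * b + (p1 * p2 + p1 * p3 + p2 * p3)) = b - b * c ^ 2 :=
    mul_left_cancel₀ hb (by linear_combination h1 - h0)
  have k2 : 4 * (c ^ 2 + (p1 + p2 + p3) * c + (p1 * p2 + p1 * p3 + p2 * p3)) =
      -(2 * b * (c - 1) + (c - 1) ^ 2 * c) :=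
    mul_left_cancel₀ hc (by linear_combination h2 - h0)
  have e1 : p1 + p2 + p3 = -(b + c) - (c - 1) ^ 2 / 4 :=
    mul_left_cancel₀ (sub_ne_zero.mpr hbc) (by linear_combination (k1 - k2) / 4)
  have e2 : p1 * p2 + p1 * p3 + p2 * p3 = b * c - b * (c - 1) / 2 := by
    linear_combination k1 / 4 - b * e1
  have e3 : p1 * p2 * p3 = -b ^ 2 / 4 := by linear_combination h0 / 4
  rw [cubic_disc p1 p2 p3 _ _ _ e1 e2 e3]
  ring

theorem tate_disc_eq {x u y z b c : ℂ} (hz : z ≠ 0)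
    (xu : u = x - 1) (xz : z = x + y) (h : y ^ 2 + y = x ^ 3 - x ^ 2)
    (hb : b = x ^ 3 * u * y / z ^ 4) (hc : c = x ^ 2 * u ^ 2 / z ^ 3) :
    z ^ 10 * (b - 16 * b ^ 2 + 20 * b * c - 8 * b * c ^ 2 - c * (c + 1) ^ 3) =
      x ^ 2 * u ^ 4 * y * (x ^ 2 * y - 3 * x ^ 3 - 4 * x * y + 2 * x ^ 2 + y) := by
  have e : ∀ X : ℂ, z ^ 2 * X = 0 → X = 0 := fun X hX =>
    (mul_eq_zero.mp hX).resolve_left (pow_ne_zero _ hz)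
  have key : z ^ 12 * (b - 16 * b ^ 2 + 20 * b * c - 8 * b * c ^ 2 - c * (c + 1) ^ 3) =
      x ^ 3 * u * y * z ^ 8 - 16 * (x ^ 3 * u * y) ^ 2 * z ^ 4 +
      20 * (x ^ 3 * u * y) * (x ^ 2 * u ^ 2) * z ^ 5 - 8 * (x ^ 3 * u * y) * (x ^ 2 * u ^ 2) ^ 2 * z ^ 2
      - (x ^ 2 * u ^ 2) * (x ^ 2 * u ^ 2 + z ^ 3) ^ 3 := by
    rw [hb, hc]; field_simp
  refine sub_eq_zero.mp (e _ ?_)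
  subst xu xz
  linear_combination key + ((-1*x^6 + 4*x^7 - 9*x^8 + 13*x^9 - 13*x^10 + 9*x^11 - 4*x^12 + 1*x^13) + (-1*x^4 + 6*x^5 - 18*x^6 + 39*x^7 - 94*x^8 + 129*x^9 - 78*x^10 + 17*x^11)*y + (-2*x^3 + 16*x^4 - 52*x^5 + 105*x^6 - 228*x^7 + 286*x^8 - 151*x^9 + 26*x^10)*y^2 + (-1*x^2 + 10*x^3 - 40*x^4 + 95*x^5 - 224*x^6 + 255*x^7 - 106*x^8 + 11*x^9)*y^3 + (1*x^2 - 10*x^3 + 41*x^4 - 124*x^5 + 125*x^6 - 33*x^7)*y^4 + (-1*x^2 + 10*x^3 - 45*x^4 + 43*x^5 - 7*x^6)*y^5 + (1*x^2 - 10*x^3 + 10*x^4 - 1*x^5)*y^6 + (-1*x^2 + 1*x^3)*y^7) * h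

theorem Coord.disc {t1 t2 t3 t4 t5 x u y z : ℂ} (C : Coord t1 t2 t3 t4 t5 x u y z) {P J p1 p2 p3 : ℂ}
    (h0 : 4 * (p1 * p2 * p3) * t1 ^ 8 = -t2 ^ 2)
    (h1 : 4 * ((t3 * t1 / (t2 ^ 2 * t1 ^ 2) + p1) * (t3 * t1 / (t2 ^ 2 * t1 ^ 2) + p2) *
      (t3 * t1 / (t2 ^ 2 * t1 ^ 2) + p3)) * t2 ^ 8 = -t4 ^ 2)
    (h2 : 4 * ((t4 * t2 / (t3 ^ 2 * t1 ^ 2) + p1) * (t4 * t2 / (t3 ^ 2 * t1 ^ 2) + p2) *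
      (t4 * t2 / (t3 ^ 2 * t1 ^ 2) + p3)) * t3 ^ 8 = -t5 ^ 2)
    (hd : 16 * J ^ 12 * ((p2 - p1) * (p3 - p1) * (p3 - p2)) ^ 2 = P) :
    t2 ^ 2 * t3 ^ 4 * t4 ^ 2 * t5 ^ 4 * P * (x * u) =
      J ^ 12 * (x ^ 2 * y - 3 * x ^ 3 - 4 * x * y + 2 * x ^ 2 + y) := by
  obtain ⟨hx, hu, hy, hz⟩ := C.ne
  obtain ⟨⟨n1, n2, n3, n4, n5, -, -, -⟩, ex, eu, ey, ez, xu, xz, h⟩ := C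
  obtain ⟨l, hl⟩ : ∃ l, l = t2 ^ 3 / (t1 ^ 3 * t3) := ⟨_, rfl⟩
  have hl0 : l ≠ 0 := by rw [hl]; simp_all
  obtain ⟨b, hb⟩ : ∃ b, b = x ^ 3 * u * y / z ^ 4 := ⟨_, rfl⟩
  obtain ⟨c, hc⟩ : ∃ c, c = x ^ 2 * u ^ 2 / z ^ 3 := ⟨_, rfl⟩
  have hb0 : b ≠ 0 := by rw [hb]; simp_all
  have hc0 : c ≠ 0 := by rw [hc]; simp_all
  have hbc : b ≠ c := by
    intro hbc
    have : u ^ 2 * y = 0 := by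
      have e : x ^ 2 * u * (x * y - u * z) = 0 := by
        rw [hb, hc] at hbc; field_simp at hbc
        linear_combination x ^ 2 * u * hbc
      have e2 : x * y - u * z = 0 :=
        (mul_eq_zero.mp e).resolve_left (mul_ne_zero (pow_ne_zero _ hx) hu)
      rw [xu, xz] at e2
      rw [xu]
      linear_combination h - (x + y) * e2
    simp_all
  have d2 : t3 * t1 / (t2 ^ 2 * t1 ^ 2) = l ^ 2 * b := by
    rw [hb, hl, ex, eu, ey, ez]; field_simp
  have d3 : t4 * t2 / (t3 ^ 2 * t1 ^ 2) = l ^ 2 * c := by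
    rw [hc, hl, ex, eu, ez]; field_simp
  obtain ⟨v1, hv1⟩ : ∃ v, v = p1 / l ^ 2 := ⟨_, rfl⟩
  obtain ⟨v2, hv2⟩ : ∃ v, v = p2 / l ^ 2 := ⟨_, rfl⟩
  obtain ⟨v3, hv3⟩ : ∃ v, v = p3 / l ^ 2 := ⟨_, rfl⟩
  obtain rfl : p1 = l ^ 2 * v1 := by rw [hv1]; field_simp
  obtain rfl : p2 = l ^ 2 * v2 := by rw [hv2]; field_simp
  obtain rfl : p3 = l ^ 2 * v3 := by rw [hv3]; field_simp
  rw [d2] at h1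
  rw [d3] at h2
  have q1 : t2 ^ 2 = l ^ 6 * b ^ 2 * t1 ^ 8 := by rw [hb, hl, ex, eu, ey, ez]; field_simp
  have q2 : t4 ^ 2 = l ^ 6 * (b * c) ^ 2 * t2 ^ 8 := by rw [hb, hc, hl, ex, eu, ey, ez]; field_simp
  have q3 : b + (c - 1) * c = -(x ^ 2 * u ^ 4 * y / z ^ 6) := by
    have n1 : x * y * z ^ 2 + u * (x ^ 2 * u ^ 2 - z ^ 3) + u ^ 3 * y = 0 := by
      rw [xu, xz]; linear_combination (-1 + 3 * x - x ^ 2 + y) * h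
    have n2 : b + (c - 1) * c + x ^ 2 * u ^ 4 * y / z ^ 6 =
        x ^ 2 * u / z ^ 6 * (x * y * z ^ 2 + u * (x ^ 2 * u ^ 2 - z ^ 3) + u ^ 3 * y) := by
      rw [hb, hc]; field_simp
    rw [n1, mul_zero] at n2
    linear_combination n2
  have q4 : t5 ^ 2 = l ^ 6 * (b + (c - 1) * c) ^ 2 * t3 ^ 8 := by
    rw [q3, hl, ex, eu, ey, ez]; field_simp
  have l6 : l ^ 6 ≠ 0 := pow_ne_zero _ hl0
  have k := tate_disc b c v1 v2 v3 hb0 hc0 hbc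
    (mul_left_cancel₀ (mul_ne_zero l6 (pow_ne_zero 8 n1)) (by linear_combination h0 - q1))
    (mul_left_cancel₀ (mul_ne_zero l6 (pow_ne_zero 8 n2)) (by linear_combination h1 - q2))
    (mul_left_cancel₀ (mul_ne_zero l6 (pow_ne_zero 8 n3)) (by linear_combination h2 - q4))
  have eP : P = J ^ 12 * l ^ 12 * (b ^ 3 * (b - 16 * b ^ 2 + 20 * b * c - 8 * b * c ^ 2 - c * (c + 1) ^ 3)) := by
    rw [← k, ← hd]; ring
  have m : t2 ^ 2 * t3 ^ 4 * t4 ^ 2 * t5 ^ 4 * l ^ 12 * b ^ 3 * (x * u) * (x ^ 2 * u ^ 4 * y) = z ^ 10 := by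
    rw [hb, hl, ex, eu, ey, ez]; field_simp
  have w := tate_disc_eq hz xu xz h hb hc
  refine mul_left_cancel₀ (mul_ne_zero (mul_ne_zero (pow_ne_zero 2 hx) (pow_ne_zero 4 hu)) hy) ?_
  rw [eP]
  linear_combination J ^ 12 * w + J ^ 12 * (b - 16 * b ^ 2 + 20 * b * c - 8 * b * c ^ 2 - c * (c + 1) ^ 3) * m

section
variable {s : ℂ} (hs : ‖s‖ < 1) (hs0 : s ≠ 0)
include hs hs0

theorem thetaRel_tv : ThetaRel (tv s 1) (tv s 2) (tv s 3) (tv s 4) (tv s 5) := by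
  have k1 : tv s (-1) = - tv s 1 := tv_neg hs hs0 1
  have k2 : tv s (-2) = - tv s 2 := tv_neg hs hs0 2
  have k3 : tv s (-3) = - tv s 3 := tv_neg hs hs0 3
  have k4 : tv s (-4) = - tv s 4 := tv_neg hs hs0 4
  have k5 : tv s (-5) = - tv s 5 := tv_neg hs hs0 5
  have k6 : tv s 6 = tv s 5 := tv_sub_eleven hs hs0 5
  have k7 : tv s 7 = tv s 4 := tv_sub_eleven hs hs0 4
  have k8 : tv s 8 = tv s 3 := tv_sub_eleven hs hs0 3
  have k9 : tv s 9 = tv s 2 := tv_sub_eleven hs hs0 2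
  have w1 := tv_three_term hs hs0 0 1 3 5 (by norm_num) (by norm_num) (by norm_num)
  have w2 := tv_three_term hs hs0 0 1 4 5 (by norm_num) (by norm_num) (by norm_num)
  have w3 := tv_three_term hs hs0 0 1 2 5 (by norm_num) (by norm_num) (by norm_num)
  norm_num [k1, k2, k3, k4, k5, k6, k7, k8, k9] at w1 w2 w3
  refine ⟨tv_ne_zero hs hs0 (by norm_num), tv_ne_zero hs hs0 (by norm_num),
    tv_ne_zero hs hs0 (by norm_num), tv_ne_zero hs hs0 (by norm_num),
    tv_ne_zero hs hs0 (by norm_num), ?_, ?_, ?_⟩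
  · linear_combination -w1
  · linear_combination w2
  · linear_combination w3

theorem hq_zpow {m n : ℤ} (hm : ¬ (11 : ℤ) ∣ m) (hn : ¬ (11 : ℤ) ∣ n) :
    hq (s ^ 242) (s ^ (22 * m)) (s ^ (22 * n)) =
      tv s (m + n) * tv s (m - n) / (tv s m ^ 2 * tv s n ^ 2) := by
  have e : ∀ x y : ℤ, brak (s ^ 242) (s ^ (22 * x)) (s ^ (22 * y)) =
      s ^ (-(2 * x ^ 2 + 2 * y ^ 2)) * (tv s (x + y) * tv s (x - y)) := fun x y => by
    rw [tv_mul_tv hs0, ← mul_assoc, ← zpow_add₀ hs0, neg_add_cancel, zpow_zero, one_mul]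
  have e1 : ∀ x : ℤ, brak (s ^ 242) (s ^ (22 * x)) 1 = s ^ (-(2 * x ^ 2)) * tv s x ^ 2 := fun x => by
    have := e x 0
    rw [mul_zero, zpow_zero, add_zero, sub_zero] at this
    rw [this, ← sq]; norm_num
  have t1 := tv_ne_zero hs hs0 hm
  have t2 := tv_ne_zero hs hs0 hn
  rw [hq, e, e1, e1, neg_add, zpow_add₀ hs0]
  have s1 := zpow_ne_zero (-(2 * m ^ 2)) hs0
  have s2 := zpow_ne_zero (-(2 * n ^ 2)) hs0
  field_simp

omit hs0 in
theorem not_lat_neg_one : ¬ Lat (s ^ 242) (-1 : ℂ) := by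
  rintro ⟨m, hm⟩
  have h : ‖s‖ ^ (242 * m) = 1 := by
    have := congrArg norm hm
    rwa [norm_mul, norm_neg, norm_one, one_mul, ← zpow_natCast, ← zpow_mul, norm_zpow] at this
  rw [zpow_eq_one_iff_right₀ (norm_nonneg s) hs.ne] at h
  have : m = 0 := by omega
  subst this
  norm_num at hm

theorem not_lat_half {r : ℂ} (hr : ‖r‖ = ‖s‖ ^ 121) : ¬ Lat (s ^ 242) r := by
  rintro ⟨m, hm⟩
  have h : ‖s‖ ^ (121 + 242 * m) = 1 := by
    have := congrArg norm hm
    rw [norm_mul, hr, norm_one, ← zpow_natCast s, ← zpow_mul, norm_zpow, ← zpow_natCast,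
      ← zpow_add₀ (norm_ne_zero_iff.mpr hs0)] at this
    exact_mod_cast this
  rw [zpow_eq_one_iff_right₀ (norm_nonneg s) hs.ne] at h
  omega

/-- The discriminant relation between the theta values and `J ^ 12 / P`. -/
theorem tv_disc {x u y z : ℂ} (C : Coord (tv s 1) (tv s 2) (tv s 3) (tv s 4) (tv s 5) x u y z) :
    tv s 2 ^ 2 * tv s 3 ^ 4 * tv s 4 ^ 2 * tv s 5 ^ 4 * s ^ 242 * (x * u) =
      poch (s ^ 242) (s ^ 242) ^ 12 * (x ^ 2 * y - 3 * x ^ 3 - 4 * x * y + 2 * x ^ 2 + y) := by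
  have hP : ‖s ^ 242‖ < 1 := norm_pow_lt_one hs (by norm_num)
  have hP0 : s ^ 242 ≠ 0 := pow_ne_zero _ hs0
  have hr : (s ^ 121) ^ 2 = s ^ 242 := by ring
  have hr0 : s ^ 121 ≠ 0 := pow_ne_zero _ hs0
  have n1 := not_lat_neg_one hs
  have n2 : ¬ Lat (s ^ 242) (s ^ 121) := not_lat_half hs hs0 (by rw [norm_pow])
  have n3 : ¬ Lat (s ^ 242) (-s ^ 121) := not_lat_half hs hs0 (by rw [norm_neg, norm_pow])
  have hn : ∀ n : ℤ, ¬ (11 : ℤ) ∣ n → ¬ Lat (s ^ 242) (s ^ (22 * n)) := fun n h => by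
    rwa [lat_zpow hs hs0]
  have hz : ∀ n : ℤ, s ^ (22 * n) ≠ 0 := fun n => zpow_ne_zero _ hs0
  have hsq : (s ^ (22 * (1 : ℤ))) ^ 2 = s ^ (22 * (2 : ℤ)) := by
    rw [← zpow_natCast, ← zpow_mul]; norm_num
  have key : ∀ n : ℤ, ¬ (11 : ℤ) ∣ n →
      4 * (hq (s ^ 242) (s ^ (22 * n)) (-1) * hq (s ^ 242) (s ^ (22 * n)) (s ^ 121) *
        hq (s ^ 242) (s ^ (22 * n)) (-s ^ 121)) * tv s n ^ 8 = - tv s (2 * n) ^ 2 := fun n h => by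
    have h := hq_half_periods_prod hP hP0 hr (hz n) (hn n h) n1 n2 n3
    have e : (s ^ (22 * n)) ^ 2 = s ^ (22 * (2 * n)) := by
      rw [← zpow_natCast, ← zpow_mul]; congr 1; push_cast; ring
    have e2 : (s ^ (n * (n - 11))) ^ 8 * (s ^ (22 * n)) ^ 2 = (s ^ (2 * n * (2 * n - 11))) ^ 2 := by
      rw [← zpow_natCast, ← zpow_natCast, ← zpow_natCast, ← zpow_mul, ← zpow_mul, ← zpow_mul,
        ← zpow_add₀ hs0]; congr 1; push_cast; ring
    rw [tv, tv, mul_pow, mul_pow, ← e2, ← e]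
    linear_combination (s ^ (n * (n - 11))) ^ 8 * h
  have sub : ∀ n : ℤ, ¬ (11 : ℤ) ∣ n → ∀ w : ℂ, w ≠ 0 → ¬ Lat (s ^ 242) w →
      hq (s ^ 242) (s ^ (22 * n)) w = tv s (n + 1) * tv s (n - 1) / (tv s n ^ 2 * tv s 1 ^ 2) +
        hq (s ^ 242) (s ^ (22 * (1 : ℤ))) w := fun n h w hw nw => by
    rw [hq_sub hP hP0 (hz n) hw (hz 1) (hn n h) nw (hn 1 (by norm_num))
      (by rw [hsq]; exact hn 2 (by norm_num)), hq_zpow hs hs0 (by norm_num) h,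
      show (1 : ℤ) - n = -(n - 1) by ring, tv_neg hs hs0, add_comm 1 n]
    ring
  have dif : ∀ v w : ℂ, v ≠ 0 → w ≠ 0 → ¬ Lat (s ^ 242) v → ¬ Lat (s ^ 242) w →
      hq (s ^ 242) v w = hq (s ^ 242) (s ^ (22 * (1 : ℤ))) w - hq (s ^ 242) (s ^ (22 * (1 : ℤ))) v :=
    fun v w hv hw nv nw => hq_sub hP hP0 hv hw (hz 1) nv nw (hn 1 (by norm_num))
      (by rw [hsq]; exact hn 2 (by norm_num))
  have hd := hq_half_periods_disc hP hP0 hr n1 n2 n3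
  have hm : (-1 : ℂ) ≠ 0 := by norm_num
  have hr' : -s ^ 121 ≠ 0 := neg_ne_zero.mpr hr0
  rw [dif _ _ hm hr0 n1 n2, dif _ _ hm hr' n1 n3, dif _ _ hr0 hr' n2 n3] at hd
  have k1 := key 1 (by norm_num)
  have k2 := key 2 (by norm_num)
  have k3 := key 3 (by norm_num)
  rw [sub 2 (by norm_num) _ hm n1, sub 2 (by norm_num) _ hr0 n2, sub 2 (by norm_num) _ hr' n3] at k2
  rw [sub 3 (by norm_num) _ hm n1, sub 3 (by norm_num) _ hr0 n2, sub 3 (by norm_num) _ hr' n3] at k3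
  have t6 : tv s 6 = tv s 5 := tv_sub_eleven hs hs0 5
  norm_num [t6] at k1 k2 k3 hd
  exact C.disc (p1 := hq (s ^ 242) (s ^ 22) (-1)) (p2 := hq (s ^ 242) (s ^ 22) (s ^ 121))
    (p3 := hq (s ^ 242) (s ^ 22) (-s ^ 121)) (by linear_combination k1) (by linear_combination k2) (by linear_combination k3)
    (by linear_combination hd)

end

/-- Multiplication of elements graded by powers of `ρ`, where `ρ ^ 11` is a scalar. -/
theorem graded_mul {ρ U : ℂ} (h : ρ ^ 11 = U) (a0 a2 a6 a7 a8 a10 b0 b1 b2 b3 b4 b5 b6 b7 b8 b9 b10 c0 c1 c2 c3 c4 c5 c6 c7 c8 c9 c10 : ℂ)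
    (h0 : c0 = a0 * b0 + U * (a2 * b9) + U * (a6 * b5) + U * (a7 * b4) + U * (a8 * b3) + U * (a10 * b1))
    (h1 : c1 = a0 * b1 + U * (a2 * b10) + U * (a6 * b6) + U * (a7 * b5) + U * (a8 * b4) + U * (a10 * b2))
    (h2 : c2 = a0 * b2 + a2 * b0 + U * (a6 * b7) + U * (a7 * b6) + U * (a8 * b5) + U * (a10 * b3))
    (h3 : c3 = a0 * b3 + a2 * b1 + U * (a6 * b8) + U * (a7 * b7) + U * (a8 * b6) + U * (a10 * b4))
    (h4 : c4 = a0 * b4 + a2 * b2 + U * (a6 * b9) + U * (a7 * b8) + U * (a8 * b7) + U * (a10 * b5))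
    (h5 : c5 = a0 * b5 + a2 * b3 + U * (a6 * b10) + U * (a7 * b9) + U * (a8 * b8) + U * (a10 * b6))
    (h6 : c6 = a0 * b6 + a2 * b4 + a6 * b0 + U * (a7 * b10) + U * (a8 * b9) + U * (a10 * b7))
    (h7 : c7 = a0 * b7 + a2 * b5 + a6 * b1 + a7 * b0 + U * (a8 * b10) + U * (a10 * b8))
    (h8 : c8 = a0 * b8 + a2 * b6 + a6 * b2 + a7 * b1 + a8 * b0 + U * (a10 * b9))
    (h9 : c9 = a0 * b9 + a2 * b7 + a6 * b3 + a7 * b2 + a8 * b1 + U * (a10 * b10))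
    (h10 : c10 = a0 * b10 + a2 * b8 + a6 * b4 + a7 * b3 + a8 * b2 + a10 * b0)
    : (a0 + a2 * ρ ^ 2 + a6 * ρ ^ 6 + a7 * ρ ^ 7 + a8 * ρ ^ 8 + a10 * ρ ^ 10) *
      (b0 + b1 * ρ + b2 * ρ ^ 2 + b3 * ρ ^ 3 + b4 * ρ ^ 4 + b5 * ρ ^ 5 + b6 * ρ ^ 6 + b7 * ρ ^ 7 + b8 * ρ ^ 8 + b9 * ρ ^ 9 + b10 * ρ ^ 10) =
      c0 + c1 * ρ + c2 * ρ ^ 2 + c3 * ρ ^ 3 + c4 * ρ ^ 4 + c5 * ρ ^ 5 + c6 * ρ ^ 6 + c7 * ρ ^ 7 + c8 * ρ ^ 8 + c9 * ρ ^ 9 + c10 * ρ ^ 10 := by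
  rw [h0, h1, h2, h3, h4, h5, h6, h7, h8, h9, h10]
  linear_combination (a2 * b9 + a2 * b10 * ρ + a6 * b5 + a6 * b6 * ρ + a6 * b7 * ρ ^ 2 + a6 * b8 * ρ ^ 3 + a6 * b9 * ρ ^ 4 + a6 * b10 * ρ ^ 5 + a7 * b4 + a7 * b5 * ρ + a7 * b6 * ρ ^ 2 + a7 * b7 * ρ ^ 3 + a7 * b8 * ρ ^ 4 + a7 * b9 * ρ ^ 5 + a7 * b10 * ρ ^ 6 + a8 * b3 + a8 * b4 * ρ + a8 * b5 * ρ ^ 2 + a8 * b6 * ρ ^ 3 + a8 * b7 * ρ ^ 4 + a8 * b8 * ρ ^ 5 + a8 * b9 * ρ ^ 6 + a8 * b10 * ρ ^ 7 + a10 * b1 + a10 * b2 * ρ + a10 * b3 * ρ ^ 2 + a10 * b4 * ρ ^ 3 + a10 * b5 * ρ ^ 4 + a10 * b6 * ρ ^ 5 + a10 * b7 * ρ ^ 6 + a10 * b8 * ρ ^ 7 + a10 * b9 * ρ ^ 8 + a10 * b10 * ρ ^ 9) * h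

theorem vec11_0 (a0 a1 a2 a3 a4 a5 a6 a7 a8 a9 a10 : ℂ) : (![a0, a1, a2, a3, a4, a5, a6, a7, a8, a9, a10] : Fin 11 → ℂ) 0 = a0 := rfl
theorem vec11_1 (a0 a1 a2 a3 a4 a5 a6 a7 a8 a9 a10 : ℂ) : (![a0, a1, a2, a3, a4, a5, a6, a7, a8, a9, a10] : Fin 11 → ℂ) 1 = a1 := rfl
theorem vec11_2 (a0 a1 a2 a3 a4 a5 a6 a7 a8 a9 a10 : ℂ) : (![a0, a1, a2, a3, a4, a5, a6, a7, a8, a9, a10] : Fin 11 → ℂ) 2 = a2 := rfl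
theorem vec11_3 (a0 a1 a2 a3 a4 a5 a6 a7 a8 a9 a10 : ℂ) : (![a0, a1, a2, a3, a4, a5, a6, a7, a8, a9, a10] : Fin 11 → ℂ) 3 = a3 := rfl
theorem vec11_4 (a0 a1 a2 a3 a4 a5 a6 a7 a8 a9 a10 : ℂ) : (![a0, a1, a2, a3, a4, a5, a6, a7, a8, a9, a10] : Fin 11 → ℂ) 4 = a4 := rfl
theorem vec11_5 (a0 a1 a2 a3 a4 a5 a6 a7 a8 a9 a10 : ℂ) : (![a0, a1, a2, a3, a4, a5, a6, a7, a8, a9, a10] : Fin 11 → ℂ) 5 = a5 := rfl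
theorem vec11_6 (a0 a1 a2 a3 a4 a5 a6 a7 a8 a9 a10 : ℂ) : (![a0, a1, a2, a3, a4, a5, a6, a7, a8, a9, a10] : Fin 11 → ℂ) 6 = a6 := rfl
theorem vec11_7 (a0 a1 a2 a3 a4 a5 a6 a7 a8 a9 a10 : ℂ) : (![a0, a1, a2, a3, a4, a5, a6, a7, a8, a9, a10] : Fin 11 → ℂ) 7 = a7 := rfl
theorem vec11_8 (a0 a1 a2 a3 a4 a5 a6 a7 a8 a9 a10 : ℂ) : (![a0, a1, a2, a3, a4, a5, a6, a7, a8, a9, a10] : Fin 11 → ℂ) 8 = a8 := rfl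
theorem vec11_9 (a0 a1 a2 a3 a4 a5 a6 a7 a8 a9 a10 : ℂ) : (![a0, a1, a2, a3, a4, a5, a6, a7, a8, a9, a10] : Fin 11 → ℂ) 9 = a9 := rfl
theorem vec11_10 (a0 a1 a2 a3 a4 a5 a6 a7 a8 a9 a10 : ℂ) : (![a0, a1, a2, a3, a4, a5, a6, a7, a8, a9, a10] : Fin 11 → ℂ) 10 = a10 := rfl

/-- The sum of theta quotients representing the Euler product. -/
noncomputable def eulerT (t1 t2 t3 t4 t5 : ℂ) : ℂ :=
  1 - t2 / t1 + t4 / t2 - t5 / t3 + t3 / t4 - t1 / t5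

theorem Coord.mon_a {t1 t2 t3 t4 t5 x u y z : ℂ} (C : Coord t1 t2 t3 t4 t5 x u y z) :
    t1 * t2 * t4 ^ 8 / (t3 * t5 ^ 8 * x * u) * (t2 * t4 / (t1 ^ 2 * t3)) = (x * z / y ^ 3) * (t4 / t5) ^ 5 := by
  obtain ⟨⟨h1, h2, h3, h4, h5, -, -, -⟩, ex, eu, ey, ez, -, -, -⟩ := C
  rw [ex, eu, ey, ez]; field_simp

theorem Coord.mon_b {t1 t2 t3 t4 t5 x u y z : ℂ} (C : Coord t1 t2 t3 t4 t5 x u y z) :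
    t1 * t2 * t4 ^ 8 / (t3 * t5 ^ 8 * x * u) * (t3 ^ 2 * t4 / (t1 * t2 ^ 2 * t5)) = (x ^ 2 / (u * y ^ 2)) * (t4 / t5) ^ 6 := by
  obtain ⟨⟨h1, h2, h3, h4, h5, -, -, -⟩, ex, eu, ey, ez, -, -, -⟩ := C
  rw [ex, eu, ey]; field_simp

theorem Coord.mon_c {t1 t2 t3 t4 t5 x u y z : ℂ} (C : Coord t1 t2 t3 t4 t5 x u y z) :
    t1 * t2 * t4 ^ 8 / (t3 * t5 ^ 8 * x * u) * (t4 / (t1 * t2)) = (x / y ^ 2) * (t4 / t5) ^ 6 := by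
  obtain ⟨⟨h1, h2, h3, h4, h5, -, -, -⟩, ex, eu, ey, ez, -, -, -⟩ := C
  rw [ex, eu, ey]; field_simp

theorem Coord.mon_d {t1 t2 t3 t4 t5 x u y z : ℂ} (C : Coord t1 t2 t3 t4 t5 x u y z) :
    t1 * t2 * t4 ^ 8 / (t3 * t5 ^ 8 * x * u) * (t3 * t5 / (t1 * t2 * t4)) = (1 / (x * u)) * (t4 / t5) ^ 7 := by
  obtain ⟨⟨h1, h2, h3, h4, h5, -, -, -⟩, ex, eu, ey, ez, -, -, -⟩ := C
  rw [ex, eu]; field_simp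

theorem Coord.mon_e {t1 t2 t3 t4 t5 x u y z : ℂ} (C : Coord t1 t2 t3 t4 t5 x u y z) :
    t1 * t2 * t4 ^ 8 / (t3 * t5 ^ 8 * x * u) * (t3 / (t1 * t2)) = (1 / (x * u)) * (t4 / t5) ^ 8 := by
  obtain ⟨⟨h1, h2, h3, h4, h5, -, -, -⟩, ex, eu, ey, ez, -, -, -⟩ := C
  rw [ex, eu]; field_simp

theorem Coord.mon_f {t1 t2 t3 t4 t5 x u y z : ℂ} (C : Coord t1 t2 t3 t4 t5 x u y z) :
    t1 * t2 * t4 ^ 8 / (t3 * t5 ^ 8 * x * u) * (t4 * t5 / (t1 * t3 ^ 2)) = (u / y ^ 2) * (t4 / t5) ^ 6 := by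
  obtain ⟨⟨h1, h2, h3, h4, h5, -, -, -⟩, ex, eu, ey, ez, -, -, -⟩ := C
  rw [ex, eu, ey]; field_simp

theorem Coord.mon_g {t1 t2 t3 t4 t5 x u y z : ℂ} (C : Coord t1 t2 t3 t4 t5 x u y z) :
    t1 * t2 * t4 ^ 8 / (t3 * t5 ^ 8 * x * u) * (t5 / (t1 * t3)) = (1 / x ^ 2) * (t4 / t5) ^ 8 := by
  obtain ⟨⟨h1, h2, h3, h4, h5, -, -, -⟩, ex, eu, ey, ez, -, -, -⟩ := C
  rw [ex, eu]; field_simp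

theorem Coord.mon_h {t1 t2 t3 t4 t5 x u y z : ℂ} (C : Coord t1 t2 t3 t4 t5 x u y z) :
    t1 * t2 * t4 ^ 8 / (t3 * t5 ^ 8 * x * u) * (1 / t1) = (x ^ 5 * z / y ^ 6) * (t4 / t5) ^ 0 := by
  obtain ⟨⟨h1, h2, h3, h4, h5, -, -, -⟩, ex, eu, ey, ez, -, -, -⟩ := C
  rw [ex, eu, ey, ez]; field_simp

theorem Coord.mon_i {t1 t2 t3 t4 t5 x u y z : ℂ} (C : Coord t1 t2 t3 t4 t5 x u y z) :
    t1 * t2 * t4 ^ 8 / (t3 * t5 ^ 8 * x * u) * (t4 / (t1 * t5)) = (x ^ 5 * z / y ^ 6) * (t4 / t5) ^ 1 := by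
  obtain ⟨⟨h1, h2, h3, h4, h5, -, -, -⟩, ex, eu, ey, ez, -, -, -⟩ := C
  rw [ex, eu, ey, ez]; field_simp

theorem Coord.mon_j {t1 t2 t3 t4 t5 x u y z : ℂ} (C : Coord t1 t2 t3 t4 t5 x u y z) :
    t1 * t2 * t4 ^ 8 / (t3 * t5 ^ 8 * x * u) * (t3 * t5 / (t1 * t4 ^ 2)) = (x ^ 3 * z / (u * y ^ 4)) * (t4 / t5) ^ 1 := by
  obtain ⟨⟨h1, h2, h3, h4, h5, -, -, -⟩, ex, eu, ey, ez, -, -, -⟩ := C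
  rw [ex, eu, ey, ez]; field_simp

theorem Coord.mon_k {t1 t2 t3 t4 t5 x u y z : ℂ} (C : Coord t1 t2 t3 t4 t5 x u y z) :
    t1 * t2 * t4 ^ 8 / (t3 * t5 ^ 8 * x * u) * (t2 * t4 / (t1 * t3 * t5)) = (x ^ 2 * z / y ^ 4) * (t4 / t5) ^ 4 := by
  obtain ⟨⟨h1, h2, h3, h4, h5, -, -, -⟩, ex, eu, ey, ez, -, -, -⟩ := C
  rw [ex, eu, ey, ez]; field_simp

theorem Coord.mon_l {t1 t2 t3 t4 t5 x u y z : ℂ} (C : Coord t1 t2 t3 t4 t5 x u y z) :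
    t1 * t2 * t4 ^ 8 / (t3 * t5 ^ 8 * x * u) * (t2 / (t1 * t4)) = (z / (u * y ^ 2)) * (t4 / t5) ^ 5 := by
  obtain ⟨⟨h1, h2, h3, h4, h5, -, -, -⟩, ex, eu, ey, ez, -, -, -⟩ := C
  rw [ex, eu, ey, ez]; field_simp

theorem Coord.mon_m {t1 t2 t3 t4 t5 x u y z : ℂ} (C : Coord t1 t2 t3 t4 t5 x u y z) :
    t1 * t2 * t4 ^ 8 / (t3 * t5 ^ 8 * x * u) * (t5 ^ 2 / (t2 ^ 2 * t3)) = (u / (y * z)) * (t4 / t5) ^ 6 := by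
  obtain ⟨⟨h1, h2, h3, h4, h5, -, -, -⟩, ex, eu, ey, ez, -, -, -⟩ := C
  rw [ex, eu, ey, ez]; field_simp

theorem Coord.mon_n {t1 t2 t3 t4 t5 x u y z : ℂ} (C : Coord t1 t2 t3 t4 t5 x u y z) :
    t1 * t2 * t4 ^ 8 / (t3 * t5 ^ 8 * x * u) * (t4 ^ 2 / (t2 ^ 2 * t5)) = (x ^ 7 * u / y ^ 7) * (t4 / t5) ^ 0 := by
  obtain ⟨⟨h1, h2, h3, h4, h5, -, -, -⟩, ex, eu, ey, ez, -, -, -⟩ := C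
  rw [ex, eu, ey]; field_simp

theorem Coord.mon_o {t1 t2 t3 t4 t5 x u y z : ℂ} (C : Coord t1 t2 t3 t4 t5 x u y z) :
    t1 * t2 * t4 ^ 8 / (t3 * t5 ^ 8 * x * u) * (t3 * t4 / (t2 ^ 2 * t5)) = (x ^ 5 / y ^ 5) * (t4 / t5) ^ 2 := by
  obtain ⟨⟨h1, h2, h3, h4, h5, -, -, -⟩, ex, eu, ey, ez, -, -, -⟩ := C
  rw [ex, eu, ey]; field_simp

theorem Coord.mon_p {t1 t2 t3 t4 t5 x u y z : ℂ} (C : Coord t1 t2 t3 t4 t5 x u y z) :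
    t1 * t2 * t4 ^ 8 / (t3 * t5 ^ 8 * x * u) * (t5 ^ 2 / (t2 * t3 ^ 2)) = (u * y / (x ^ 3 * z)) * (t4 / t5) ^ 9 := by
  obtain ⟨⟨h1, h2, h3, h4, h5, -, -, -⟩, ex, eu, ey, ez, -, -, -⟩ := C
  rw [ex, eu, ey, ez]; field_simp

theorem Coord.mon_q {t1 t2 t3 t4 t5 x u y z : ℂ} (C : Coord t1 t2 t3 t4 t5 x u y z) :
    t1 * t2 * t4 ^ 8 / (t3 * t5 ^ 8 * x * u) * (t5 / (t2 * t3)) = (x ^ 4 * u / y ^ 5) * (t4 / t5) ^ 1 := by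
  obtain ⟨⟨h1, h2, h3, h4, h5, -, -, -⟩, ex, eu, ey, ez, -, -, -⟩ := C
  rw [ex, eu, ey]; field_simp

theorem Coord.mon_r {t1 t2 t3 t4 t5 x u y z : ℂ} (C : Coord t1 t2 t3 t4 t5 x u y z) :
    t1 * t2 * t4 ^ 8 / (t3 * t5 ^ 8 * x * u) * (t5 / (t2 * t4)) = (x ^ 2 / y ^ 3) * (t4 / t5) ^ 3 := by
  obtain ⟨⟨h1, h2, h3, h4, h5, -, -, -⟩, ex, eu, ey, ez, -, -, -⟩ := C
  rw [ex, eu, ey]; field_simp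

theorem Coord.mon_s {t1 t2 t3 t4 t5 x u y z : ℂ} (C : Coord t1 t2 t3 t4 t5 x u y z) :
    t1 * t2 * t4 ^ 8 / (t3 * t5 ^ 8 * x * u) * (t4 / (t2 * t5)) = (x ^ 2 / y ^ 3) * (t4 / t5) ^ 5 := by
  obtain ⟨⟨h1, h2, h3, h4, h5, -, -, -⟩, ex, eu, ey, ez, -, -, -⟩ := C
  rw [ex, eu, ey]; field_simp

theorem Coord.mon_t {t1 t2 t3 t4 t5 x u y z : ℂ} (C : Coord t1 t2 t3 t4 t5 x u y z) :
    t1 * t2 * t4 ^ 8 / (t3 * t5 ^ 8 * x * u) * (1 / t3) = (1 / (x * y)) * (t4 / t5) ^ 7 := by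
  obtain ⟨⟨h1, h2, h3, h4, h5, -, -, -⟩, ex, eu, ey, ez, -, -, -⟩ := C
  rw [ex, eu, ey]; field_simp

theorem Coord.mon_u {t1 t2 t3 t4 t5 x u y z : ℂ} (C : Coord t1 t2 t3 t4 t5 x u y z) :
    t1 * t2 * t4 ^ 8 / (t3 * t5 ^ 8 * x * u) * (1 / t4) = (y / (x ^ 3 * u)) * (t4 / t5) ^ 9 := by
  obtain ⟨⟨h1, h2, h3, h4, h5, -, -, -⟩, ex, eu, ey, ez, -, -, -⟩ := C
  rw [ex, eu, ey]; field_simp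

theorem Coord.mon_v {t1 t2 t3 t4 t5 x u y z : ℂ} (C : Coord t1 t2 t3 t4 t5 x u y z) :
    t1 * t2 * t4 ^ 8 / (t3 * t5 ^ 8 * x * u) * (1 / t5) = (y / (x ^ 3 * u)) * (t4 / t5) ^ 10 := by
  obtain ⟨⟨h1, h2, h3, h4, h5, -, -, -⟩, ex, eu, ey, ez, -, -, -⟩ := C
  rw [ex, eu, ey]; field_simp

theorem Coord.mon_w {t1 t2 t3 t4 t5 x u y z : ℂ} (C : Coord t1 t2 t3 t4 t5 x u y z) :
    t1 * t2 * t4 ^ 8 / (t3 * t5 ^ 8 * x * u) * (t1 * t5 / (t2 * t3 ^ 2)) = (u / (x ^ 2 * z)) * (t4 / t5) ^ 8 := by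
  obtain ⟨⟨h1, h2, h3, h4, h5, -, -, -⟩, ex, eu, ey, ez, -, -, -⟩ := C
  rw [ex, eu, ez]; field_simp

theorem Coord.mon_x {t1 t2 t3 t4 t5 x u y z : ℂ} (C : Coord t1 t2 t3 t4 t5 x u y z) :
    t1 * t2 * t4 ^ 8 / (t3 * t5 ^ 8 * x * u) * (t1 * t5 / (t2 * t3 * t4)) = (y ^ 2 / (x ^ 4 * z)) * (t4 / t5) ^ 10 := by
  obtain ⟨⟨h1, h2, h3, h4, h5, -, -, -⟩, ex, eu, ey, ez, -, -, -⟩ := C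
  rw [ex, eu, ey, ez]; field_simp

theorem Coord.mon_y {t1 t2 t3 t4 t5 x u y z : ℂ} (C : Coord t1 t2 t3 t4 t5 x u y z) :
    t1 * t2 * t4 ^ 8 / (t3 * t5 ^ 8 * x * u) * (t1 / (t3 * t4)) = (1 / y ^ 2) * (t4 / t5) ^ 5 := by
  obtain ⟨⟨h1, h2, h3, h4, h5, -, -, -⟩, ex, eu, ey, ez, -, -, -⟩ := C
  rw [ex, eu, ey]; field_simp

theorem Coord.mon_z {t1 t2 t3 t4 t5 x u y z : ℂ} (C : Coord t1 t2 t3 t4 t5 x u y z) :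
    t1 * t2 * t4 ^ 8 / (t3 * t5 ^ 8 * x * u) * (t1 * t2 / (t3 * t4 * t5)) = (x ^ 4 * z / y ^ 6) * (t4 / t5) ^ 0 := by
  obtain ⟨⟨h1, h2, h3, h4, h5, -, -, -⟩, ex, eu, ey, ez, -, -, -⟩ := C
  rw [ex, eu, ey, ez]; field_simp

theorem Coord.mon_aa {t1 t2 t3 t4 t5 x u y z : ℂ} (C : Coord t1 t2 t3 t4 t5 x u y z) :
    t1 * t2 * t4 ^ 8 / (t3 * t5 ^ 8 * x * u) * (t1 * t2 ^ 2 / (t3 * t4 * t5 ^ 2)) = (z / (x * u * y ^ 2)) * (t4 / t5) ^ 6 := by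
  obtain ⟨⟨h1, h2, h3, h4, h5, -, -, -⟩, ex, eu, ey, ez, -, -, -⟩ := C
  rw [ex, eu, ey, ez]; field_simp

theorem Coord.eulerT_graded {t1 t2 t3 t4 t5 x u y z : ℂ} (C : Coord t1 t2 t3 t4 t5 x u y z) :
    eulerT t1 t2 t3 t4 t5 =
    (1) + (y ^ 2 / (x ^ 2 * u)) * (t4 / t5) ^ 2 + (y ^ 4 / (x ^ 4 * z)) * (t4 / t5) ^ 6 + (-(y ^
    5 / (x ^ 6 * u))) * (t4 / t5) ^ 7 + (-(y ^ 6 / (x ^ 7 * z))) * (t4 / t5) ^ 8 + (-(y ^ 7 / (x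
    ^ 8 * u * z))) * (t4 / t5) ^ 10 := by
  obtain ⟨⟨h1, h2, h3, h4, h5, -, -, -⟩, ex, eu, ey, ez, -, -, -⟩ := C
  have e2 : t3 / t4 = y ^ 2 / (x ^ 2 * u) * (t4 / t5) ^ 2 := by rw [ex, eu, ey]; field_simp
  have e6 : t4 / t2 = y ^ 4 / (x ^ 4 * z) * (t4 / t5) ^ 6 := by rw [ex, ey, ez]; field_simp
  have e7 : t2 / t1 = y ^ 5 / (x ^ 6 * u) * (t4 / t5) ^ 7 := by rw [ex, eu, ey]; field_simp
  have e8 : t5 / t3 = y ^ 6 / (x ^ 7 * z) * (t4 / t5) ^ 8 := by rw [ex, ey, ez]; field_simp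
  have e10 : t1 / t5 = y ^ 7 / (x ^ 8 * u * z) * (t4 / t5) ^ 10 := by rw [ex, eu, ey, ez]; field_simp
  rw [eulerT]
  linear_combination e2 + e6 - e7 - e8 - e10

theorem sum_fin_eleven (ρ : ℂ) (b : Fin 11 → ℂ) : ∑ r : Fin 11, ρ ^ (r : ℕ) * b r =
    b 0 + b 1 * ρ + b 2 * ρ ^ 2 + b 3 * ρ ^ 3 + b 4 * ρ ^ 4 + b 5 * ρ ^ 5 + b 6 * ρ ^ 6 + b 7 * ρ ^ 7 +
    b 8 * ρ ^ 8 + b 9 * ρ ^ 9 + b 10 * ρ ^ 10 := by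
  simp [Fin.sum_univ_succ]
  ring

/-- The theta quotients in the non-mock part of line 0. -/
noncomputable def thetaPart0 (t1 t2 t3 t4 t5 : ℂ) : ℂ :=
    2 * (1 / t3) - 2 * (t3 / (t1 * t2)) + 2 * (t3 * t4 / (t2 ^ 2 * t5)) - 2 * (t1 * t5 / (t2 * t3
    * t4)) + 2 * (t2 * t4 / (t1 ^ 2 * t3)) - 8 * (t3 * t5 / (t1 * t2 * t4)) + 2 * (t4 / (t1 *
    t5)) - 4 * (1 / t4) + 4 * (t1 / (t3 * t4)) - 2 * (t2 * t4 / (t1 * t3 * t5)) + 4 * (1 / t1) -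
    4 * (t1 * t5 / (t2 * t3 ^ 2)) - 3 * (t1 * t2 / (t3 * t4 * t5)) - 3 * (1 / t5) - 3 * (t3 * t5
    / (t1 * t4 ^ 2)) + 3 * (t5 / (t2 * t4)) + 6 * (t2 / (t1 * t4)) - 6 * (t5 / (t2 * t3)) + 6 *
    (t5 ^ 2 / (t2 * t3 ^ 2)) - 2 * (t4 ^ 2 / (t2 ^ 2 * t5)) + 2 * (t5 / (t1 * t3)) - 2 * (t4 /
    (t2 * t5)) + 6 * (t4 / (t1 * t2)) - 2 * (t4 * t5 / (t1 * t3 ^ 2)) - 3 * (t5 ^ 2 / (t2 ^ 2 *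
    t3)) - 2 * (t1 * t2 ^ 2 / (t3 * t4 * t5 ^ 2))

noncomputable def comp0 (x u y z : ℂ) : Fin 11 → ℂ := ![(3 * x ^ 3 - 6 * x * y - 23 * x ^ 2 + 4 * y + 20 * x - 4) * (x ^ 5 * z / (u * y ^ 5)),
    (-3 * x ^ 2 * y + 13 * x ^ 3 + 6 * x * y - 31 * x ^ 2 + y + 14 * x + 1) * (x ^ 3 * z / (u * y ^ 4)),
    (x ^ 3 - x * y + 8 * x ^ 2 - 3 * y - 7 * x) * (x ^ 3 * z / (u * y ^ 4)),
    (3 * x ^ 3 - 10 * x * y - 5 * x ^ 2 + 3 * y + 5 * x - 2) * (x ^ 2 * z / (u * y ^ 3)),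
    (x ^ 3 - x * y - 3 * x ^ 2 - 3 * y - 7 * x) * (x / y ^ 2),
    (3 * x ^ 2 * y - 10 * x ^ 3 - 4 * x * y + 16 * x ^ 2 + 5 * y - 8 * x + 2) * (x * z / (u ^ 2 * y ^ 2)),
    (-2 * x ^ 3 + 12 * x * y - 6 * x ^ 2 - 8 * y + 13 * x - 5) * (z / (u ^ 2 * y)),
    11,
    (x ^ 3 - x * y - 3 * x ^ 2 + 8 * y + 4 * x) * (1 / (x * u)),
    (-2 * x ^ 2 * y + 7 * x ^ 3 + 18 * x * y - 7 * x ^ 2 - 5 * y + 4 * x) * (y / (x ^ 3 * u)),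
    (2 * x ^ 2 * y - 7 * x ^ 3 - 2 * x * y + 12 * x ^ 2 - 2 * y - 10 * x + 3) * (y ^ 2 / (x ^ 3 * u ^ 2))]

theorem comp0_mul_a {x u y z : ℂ} (hx : x ≠ 0) (hu : u ≠ 0) (hy : y ≠ 0) (hz : z ≠ 0)
    (xu : u = x - 1) (xz : z = x + y) (h : y ^ 2 + y = x ^ 3 - x ^ 2) :
    (x ^ 2 * y - 3 * x ^ 3 - 4 * x * y + 2 * x ^ 2 + y) * (4 * (x ^ 5 * z / y ^ 6) - 3 * (x ^ 4 *
    z / y ^ 6) - 2 * (x ^ 7 * u / y ^ 7)) =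
    (1) * comp0 x u y z 0 + x ^ 9 * u * z / y ^ 8 * ((y ^ 2 / (x ^ 2 * u)) * comp0 x u y z 9) + x
    ^ 9 * u * z / y ^ 8 * ((y ^ 4 / (x ^ 4 * z)) * comp0 x u y z 5) + x ^ 9 * u * z / y ^ 8 *
    ((-(y ^ 5 / (x ^ 6 * u))) * comp0 x u y z 4) + x ^ 9 * u * z / y ^ 8 * ((-(y ^ 6 / (x ^ 7 *
    z))) * comp0 x u y z 3) + x ^ 9 * u * z / y ^ 8 * ((-(y ^ 7 / (x ^ 8 * u * z))) * comp0 x u y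
    z 1) := by
  simp only [comp0, vec11_0, vec11_1, vec11_2, vec11_3, vec11_4, vec11_5, vec11_6, vec11_7, vec11_8, vec11_9, vec11_10]
  field_simp
  subst xu xz
  linear_combination -((4 * x ^ 3 - 10 * x ^ 4 + 6 * x ^ 5) + (-6 * x + 7 * x ^ 2 + 8 * x ^ 3 - 2
  * x ^ 4) * y + (-6 + 5 * x + 6 * x ^ 2) * y ^ 2) * h

theorem comp0_mul_b {x u y z : ℂ} (hx : x ≠ 0) (hu : u ≠ 0) (hy : y ≠ 0) (hz : z ≠ 0)
    (xu : u = x - 1) (xz : z = x + y) (h : y ^ 2 + y = x ^ 3 - x ^ 2) :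
    (x ^ 2 * y - 3 * x ^ 3 - 4 * x * y + 2 * x ^ 2 + y) * (2 * (x ^ 5 * z / y ^ 6) - 3 * (x ^ 3 *
    z / (u * y ^ 4)) - 6 * (x ^ 4 * u / y ^ 5)) =
    (1) * comp0 x u y z 1 + x ^ 9 * u * z / y ^ 8 * ((y ^ 2 / (x ^ 2 * u)) * comp0 x u y z 10) +
    x ^ 9 * u * z / y ^ 8 * ((y ^ 4 / (x ^ 4 * z)) * comp0 x u y z 6) + x ^ 9 * u * z / y ^ 8 *
    ((-(y ^ 5 / (x ^ 6 * u))) * comp0 x u y z 5) + x ^ 9 * u * z / y ^ 8 * ((-(y ^ 6 / (x ^ 7 *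
    z))) * comp0 x u y z 4) + x ^ 9 * u * z / y ^ 8 * ((-(y ^ 7 / (x ^ 8 * u * z))) * comp0 x u y
    z 2) := by
  simp only [comp0, vec11_0, vec11_1, vec11_2, vec11_3, vec11_4, vec11_5, vec11_6, vec11_7, vec11_8, vec11_9, vec11_10]
  field_simp
  subst xu xz
  linear_combination -((-4 * x ^ 3 + 10 * x ^ 4 - 6 * x ^ 5) + (-14 * x + 43 * x ^ 2 - 51 * x ^ 3
  + 16 * x ^ 4) * y + (-4 + 3 * x - 4 * x ^ 2 - 1 * x ^ 3) * y ^ 2) * h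

theorem comp0_mul_c {x u y z : ℂ} (hx : x ≠ 0) (hu : u ≠ 0) (hy : y ≠ 0) (hz : z ≠ 0)
    (xu : u = x - 1) (xz : z = x + y) (h : y ^ 2 + y = x ^ 3 - x ^ 2) :
    (x ^ 2 * y - 3 * x ^ 3 - 4 * x * y + 2 * x ^ 2 + y) * (2 * (x ^ 5 / y ^ 5)) =
    (1) * comp0 x u y z 2 + (y ^ 2 / (x ^ 2 * u)) * comp0 x u y z 0 + x ^ 9 * u * z / y ^ 8 * ((y
    ^ 4 / (x ^ 4 * z)) * comp0 x u y z 7) + x ^ 9 * u * z / y ^ 8 * ((-(y ^ 5 / (x ^ 6 * u))) *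
    comp0 x u y z 6) + x ^ 9 * u * z / y ^ 8 * ((-(y ^ 6 / (x ^ 7 * z))) * comp0 x u y z 5) + x ^
    9 * u * z / y ^ 8 * ((-(y ^ 7 / (x ^ 8 * u * z))) * comp0 x u y z 3) := by
  simp only [comp0, vec11_0, vec11_1, vec11_2, vec11_3, vec11_4, vec11_5, vec11_6, vec11_7, vec11_8, vec11_9, vec11_10]
  field_simp
  subst xu xz
  linear_combination -((-4 * x ^ 2 + 10 * x ^ 3 - 6 * x ^ 4) + (21 * x - 31 * x ^ 2 + 2 * x ^ 3)
  * y + (12 - 18 * x) * y ^ 2) * h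

theorem comp0_mul_d {x u y z : ℂ} (hx : x ≠ 0) (hu : u ≠ 0) (hy : y ≠ 0) (hz : z ≠ 0)
    (xu : u = x - 1) (xz : z = x + y) (h : y ^ 2 + y = x ^ 3 - x ^ 2) :
    (x ^ 2 * y - 3 * x ^ 3 - 4 * x * y + 2 * x ^ 2 + y) * (3 * (x ^ 2 / y ^ 3)) =
    (1) * comp0 x u y z 3 + (y ^ 2 / (x ^ 2 * u)) * comp0 x u y z 1 + x ^ 9 * u * z / y ^ 8 * ((y
    ^ 4 / (x ^ 4 * z)) * comp0 x u y z 8) + x ^ 9 * u * z / y ^ 8 * ((-(y ^ 5 / (x ^ 6 * u))) *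
    comp0 x u y z 7) + x ^ 9 * u * z / y ^ 8 * ((-(y ^ 6 / (x ^ 7 * z))) * comp0 x u y z 6) + x ^
    9 * u * z / y ^ 8 * ((-(y ^ 7 / (x ^ 8 * u * z))) * comp0 x u y z 4) := by
  simp only [comp0, vec11_0, vec11_1, vec11_2, vec11_3, vec11_4, vec11_5, vec11_6, vec11_7, vec11_8, vec11_9, vec11_10]
  field_simp
  subst xu xz
  linear_combination -((4 * x ^ 2 - 7 * x ^ 3 + 4 * x ^ 4 - 1 * x ^ 5) + (-2 * x + 11 * x ^ 2 -
  12 * x ^ 3) * y + (1 + 6 * x - 3 * x ^ 2) * y ^ 2) * h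

theorem comp0_mul_e {x u y z : ℂ} (hx : x ≠ 0) (hu : u ≠ 0) (hy : y ≠ 0) (hz : z ≠ 0)
    (xu : u = x - 1) (xz : z = x + y) (h : y ^ 2 + y = x ^ 3 - x ^ 2) :
    (x ^ 2 * y - 3 * x ^ 3 - 4 * x * y + 2 * x ^ 2 + y) * (-2 * (x ^ 2 * z / y ^ 4)) =
    (1) * comp0 x u y z 4 + (y ^ 2 / (x ^ 2 * u)) * comp0 x u y z 2 + x ^ 9 * u * z / y ^ 8 * ((y
    ^ 4 / (x ^ 4 * z)) * comp0 x u y z 9) + x ^ 9 * u * z / y ^ 8 * ((-(y ^ 5 / (x ^ 6 * u))) *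
    comp0 x u y z 8) + x ^ 9 * u * z / y ^ 8 * ((-(y ^ 6 / (x ^ 7 * z))) * comp0 x u y z 7) + x ^
    9 * u * z / y ^ 8 * ((-(y ^ 7 / (x ^ 8 * u * z))) * comp0 x u y z 5) := by
  simp only [comp0, vec11_0, vec11_1, vec11_2, vec11_3, vec11_4, vec11_5, vec11_6, vec11_7, vec11_8, vec11_9, vec11_10]
  field_simp
  subst xu xz
  linear_combination -((4 * x ^ 2 - 10 * x ^ 3 + 6 * x ^ 4) + (-1 * x + 1 * x ^ 2 - 2 * x ^ 3) *
  y + (-3 - 1 * x) * y ^ 2) * h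

theorem comp0_mul_f {x u y z : ℂ} (hx : x ≠ 0) (hu : u ≠ 0) (hy : y ≠ 0) (hz : z ≠ 0)
    (xu : u = x - 1) (xz : z = x + y) (h : y ^ 2 + y = x ^ 3 - x ^ 2) :
    (x ^ 2 * y - 3 * x ^ 3 - 4 * x * y + 2 * x ^ 2 + y) * (2 * (x * z / y ^ 3) + 4 * (1 / y ^ 2)
    + 6 * (z / (u * y ^ 2)) - 2 * (x ^ 2 / y ^ 3)) =
    (1) * comp0 x u y z 5 + (y ^ 2 / (x ^ 2 * u)) * comp0 x u y z 3 + x ^ 9 * u * z / y ^ 8 * ((y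
    ^ 4 / (x ^ 4 * z)) * comp0 x u y z 10) + x ^ 9 * u * z / y ^ 8 * ((-(y ^ 5 / (x ^ 6 * u))) *
    comp0 x u y z 9) + x ^ 9 * u * z / y ^ 8 * ((-(y ^ 6 / (x ^ 7 * z))) * comp0 x u y z 8) + x ^
    9 * u * z / y ^ 8 * ((-(y ^ 7 / (x ^ 8 * u * z))) * comp0 x u y z 6) := by
  simp only [comp0, vec11_0, vec11_1, vec11_2, vec11_3, vec11_4, vec11_5, vec11_6, vec11_7, vec11_8, vec11_9, vec11_10]
  field_simp
  subst xu xz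
  linear_combination -((-4 + 24 * x - 21 * x ^ 2 + 2 * x ^ 3) * y + (3 - 10 * x) * y ^ 2) * h

theorem comp0_mul_g {x u y z : ℂ} (hx : x ≠ 0) (hu : u ≠ 0) (hy : y ≠ 0) (hz : z ≠ 0)
    (xu : u = x - 1) (xz : z = x + y) (h : y ^ 2 + y = x ^ 3 - x ^ 2) :
    (x ^ 2 * y - 3 * x ^ 3 - 4 * x * y + 2 * x ^ 2 + y) * (6 * (x / y ^ 2) - 2 * (u / y ^ 2) - 3
    * (u / (y * z)) - 2 * (z / (x * u * y ^ 2))) =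
    (1) * comp0 x u y z 6 + (y ^ 2 / (x ^ 2 * u)) * comp0 x u y z 4 + (y ^ 4 / (x ^ 4 * z)) *
    comp0 x u y z 0 + x ^ 9 * u * z / y ^ 8 * ((-(y ^ 5 / (x ^ 6 * u))) * comp0 x u y z 10) + x ^
    9 * u * z / y ^ 8 * ((-(y ^ 6 / (x ^ 7 * z))) * comp0 x u y z 9) + x ^ 9 * u * z / y ^ 8 *
    ((-(y ^ 7 / (x ^ 8 * u * z))) * comp0 x u y z 7) := by
  simp only [comp0, vec11_0, vec11_1, vec11_2, vec11_3, vec11_4, vec11_5, vec11_6, vec11_7, vec11_8, vec11_9, vec11_10]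
  field_simp
  subst xu xz
  linear_combination -((-8 * x ^ 2 + 8 * x ^ 3 + 14 * x ^ 4 - 12 * x ^ 5) + (-8 * x + 21 * x ^ 2
  - 3 * x ^ 3 - 2 * x ^ 4) * y + (3 - 8 * x + 13 * x ^ 2 - 2 * x ^ 3) * y ^ 2) * h

theorem comp0_mul_h {x u y z : ℂ} (hx : x ≠ 0) (hu : u ≠ 0) (hy : y ≠ 0) (hz : z ≠ 0)
    (xu : u = x - 1) (xz : z = x + y) (h : y ^ 2 + y = x ^ 3 - x ^ 2) :
    (x ^ 2 * y - 3 * x ^ 3 - 4 * x * y + 2 * x ^ 2 + y) * (2 * (1 / (x * y)) - 8 * (1 / (x * u)))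
    =
    (1) * comp0 x u y z 7 + (y ^ 2 / (x ^ 2 * u)) * comp0 x u y z 5 + (y ^ 4 / (x ^ 4 * z)) *
    comp0 x u y z 1 + (-(y ^ 5 / (x ^ 6 * u))) * comp0 x u y z 0 + x ^ 9 * u * z / y ^ 8 * ((-(y
    ^ 6 / (x ^ 7 * z))) * comp0 x u y z 10) + x ^ 9 * u * z / y ^ 8 * ((-(y ^ 7 / (x ^ 8 * u *
    z))) * comp0 x u y z 8) := by
  simp only [comp0, vec11_0, vec11_1, vec11_2, vec11_3, vec11_4, vec11_5, vec11_6, vec11_7, vec11_8, vec11_9, vec11_10]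
  field_simp
  subst xu xz
  linear_combination -((-7 * x + 12 * x ^ 2 - 5 * x ^ 3) + (9 - 14 * x + 9 * x ^ 2) * y) * h

theorem comp0_mul_i {x u y z : ℂ} (hx : x ≠ 0) (hu : u ≠ 0) (hy : y ≠ 0) (hz : z ≠ 0)
    (xu : u = x - 1) (xz : z = x + y) (h : y ^ 2 + y = x ^ 3 - x ^ 2) :
    (x ^ 2 * y - 3 * x ^ 3 - 4 * x * y + 2 * x ^ 2 + y) * (-2 * (1 / (x * u)) - 4 * (u / (x ^ 2 *
    z)) + 2 * (1 / x ^ 2)) =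
    (1) * comp0 x u y z 8 + (y ^ 2 / (x ^ 2 * u)) * comp0 x u y z 6 + (y ^ 4 / (x ^ 4 * z)) *
    comp0 x u y z 2 + (-(y ^ 5 / (x ^ 6 * u))) * comp0 x u y z 1 + (-(y ^ 6 / (x ^ 7 * z))) *
    comp0 x u y z 0 + x ^ 9 * u * z / y ^ 8 * ((-(y ^ 7 / (x ^ 8 * u * z))) * comp0 x u y z 9) := by
  simp only [comp0, vec11_0, vec11_1, vec11_2, vec11_3, vec11_4, vec11_5, vec11_6, vec11_7, vec11_8, vec11_9, vec11_10]
  field_simp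
  subst xu xz
  linear_combination -((4 * x - 24 * x ^ 2 + 44 * x ^ 3 - 34 * x ^ 4 + 10 * x ^ 5) + (9 * x - 27
  * x ^ 2 + 25 * x ^ 3 - 3 * x ^ 4) * y + (1 - 3 * x + 3 * x ^ 2 + 3 * x ^ 3) * y ^ 2) * h

theorem comp0_mul_j {x u y z : ℂ} (hx : x ≠ 0) (hu : u ≠ 0) (hy : y ≠ 0) (hz : z ≠ 0)
    (xu : u = x - 1) (xz : z = x + y) (h : y ^ 2 + y = x ^ 3 - x ^ 2) :
    (x ^ 2 * y - 3 * x ^ 3 - 4 * x * y + 2 * x ^ 2 + y) * (-4 * (y / (x ^ 3 * u)) + 6 * (u * y /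
    (x ^ 3 * z))) =
    (1) * comp0 x u y z 9 + (y ^ 2 / (x ^ 2 * u)) * comp0 x u y z 7 + (y ^ 4 / (x ^ 4 * z)) *
    comp0 x u y z 3 + (-(y ^ 5 / (x ^ 6 * u))) * comp0 x u y z 2 + (-(y ^ 6 / (x ^ 7 * z))) *
    comp0 x u y z 1 + x ^ 9 * u * z / y ^ 8 * ((-(y ^ 7 / (x ^ 8 * u * z))) * comp0 x u y z 10) := by
  simp only [comp0, vec11_0, vec11_1, vec11_2, vec11_3, vec11_4, vec11_5, vec11_6, vec11_7, vec11_8, vec11_9, vec11_10]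
  field_simp
  subst xu xz
  linear_combination -((7 * x - 34 * x ^ 2 + 52 * x ^ 3 - 21 * x ^ 4) + (1 + 8 * x - 8 * x ^ 2 +
  3 * x ^ 3) * y) * h

theorem comp0_mul_k {x u y z : ℂ} (hx : x ≠ 0) (hu : u ≠ 0) (hy : y ≠ 0) (hz : z ≠ 0)
    (xu : u = x - 1) (xz : z = x + y) (h : y ^ 2 + y = x ^ 3 - x ^ 2) :
    (x ^ 2 * y - 3 * x ^ 3 - 4 * x * y + 2 * x ^ 2 + y) * (-2 * (y ^ 2 / (x ^ 4 * z)) - 3 * (y /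
    (x ^ 3 * u))) =
    (1) * comp0 x u y z 10 + (y ^ 2 / (x ^ 2 * u)) * comp0 x u y z 8 + (y ^ 4 / (x ^ 4 * z)) *
    comp0 x u y z 4 + (-(y ^ 5 / (x ^ 6 * u))) * comp0 x u y z 3 + (-(y ^ 6 / (x ^ 7 * z))) *
    comp0 x u y z 2 + (-(y ^ 7 / (x ^ 8 * u * z))) * comp0 x u y z 0 := by
  simp only [comp0, vec11_0, vec11_1, vec11_2, vec11_3, vec11_4, vec11_5, vec11_6, vec11_7, vec11_8, vec11_9, vec11_10]
  field_simp
  subst xu xz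
  linear_combination -((-6 * x ^ 2 + 9 * x ^ 3) + (2 - 17 * x + 29 * x ^ 2 - 1 * x ^ 3) * y + (-3
  + 10 * x) * y ^ 2) * h

theorem eulerT_mul_comp0 {t1 t2 t3 t4 t5 x u y z : ℂ} (C : Coord t1 t2 t3 t4 t5 x u y z) :
    eulerT t1 t2 t3 t4 t5 * ∑ r : Fin 11, (t4 / t5) ^ (r : ℕ) * comp0 x u y z r =
    (x ^ 2 * y - 3 * x ^ 3 - 4 * x * y + 2 * x ^ 2 + y) *
    (t1 * t2 * t4 ^ 8 / (t3 * t5 ^ 8 * x * u) * thetaPart0 t1 t2 t3 t4 t5) := by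
  obtain ⟨hx, hu, hy, hz⟩ := C.ne
  have hU : (t4 / t5) ^ 11 = x ^ 9 * u * z / y ^ 8 := by
    rw [C.ex, C.eu, C.ey, C.ez]; obtain ⟨⟨h1, h2, h3, h4, h5, -, -, -⟩, -, -, -, -, -, -, -⟩ := C; field_simp
  have G := graded_mul hU _ _ _ _ _ _ _ _ _ _ _ _ _ _ _ _ _ _ _ _ _ _ _ _ _ _ _ _
    (comp0_mul_a hx hu hy hz C.xu C.xz C.curve)
    (comp0_mul_b hx hu hy hz C.xu C.xz C.curve)
    (comp0_mul_c hx hu hy hz C.xu C.xz C.curve)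
    (comp0_mul_d hx hu hy hz C.xu C.xz C.curve)
    (comp0_mul_e hx hu hy hz C.xu C.xz C.curve)
    (comp0_mul_f hx hu hy hz C.xu C.xz C.curve)
    (comp0_mul_g hx hu hy hz C.xu C.xz C.curve)
    (comp0_mul_h hx hu hy hz C.xu C.xz C.curve)
    (comp0_mul_i hx hu hy hz C.xu C.xz C.curve)
    (comp0_mul_j hx hu hy hz C.xu C.xz C.curve)
    (comp0_mul_k hx hu hy hz C.xu C.xz C.curve)
  have K := C.eulerT_graded
  have kt := C.mon_t
  have ke := C.mon_e
  have ko := C.mon_o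
  have kx := C.mon_x
  have ka := C.mon_a
  have kd := C.mon_d
  have ki := C.mon_i
  have ku := C.mon_u
  have ky := C.mon_y
  have kk := C.mon_k
  have kh := C.mon_h
  have kw := C.mon_w
  have kz := C.mon_z
  have kv := C.mon_v
  have kj := C.mon_j
  have kr := C.mon_r
  have kl := C.mon_l
  have kq := C.mon_q
  have kp := C.mon_p
  have kn := C.mon_n
  have kg := C.mon_g
  have ks := C.mon_s
  have kc := C.mon_c
  have kf := C.mon_f
  have km := C.mon_m
  have kaa := C.mon_aa
  rw [sum_fin_eleven, K, G, thetaPart0]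
  generalize t4 / t5 = ρ at *
  generalize t1 * t2 * t4 ^ 8 / (t3 * t5 ^ 8 * x * u) = κ at *
  linear_combination (x ^ 2 * y - 3 * x ^ 3 - 4 * x * y + 2 * x ^ 2 + y) * (- 2 * kt + 2 * ke - 2
  * ko + 2 * kx - 2 * ka + 8 * kd - 2 * ki + 4 * ku - 4 * ky + 2 * kk - 4 * kh + 4 * kw + 3 * kz
  + 3 * kv + 3 * kj - 3 * kr - 6 * kl + 6 * kq - 6 * kp + 2 * kn - 2 * kg + 2 * ks - 6 * kc + 2 *
  kf + 3 * km + 2 * kaa)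

/-- The theta quotients in the non-mock part of line 1. -/
noncomputable def thetaPart1 (t1 t2 t3 t4 t5 : ℂ) : ℂ :=
    5 * (1 / t3) - 5 * (t3 / (t1 * t2)) + 5 * (t3 * t4 / (t2 ^ 2 * t5)) - 5 * (t1 * t5 / (t2 * t3
    * t4)) - 6 * (t2 * t4 / (t1 ^ 2 * t3)) + 7 * (t3 * t5 / (t1 * t2 * t4)) - 6 * (t4 / (t1 *
    t5)) - (1 / t4) - 12 * (t1 / (t3 * t4)) + 19 * (t2 * t4 / (t1 * t3 * t5)) - 12 * (1 / t1) +
    12 * (t1 * t5 / (t2 * t3 ^ 2)) + 9 * (t1 * t2 / (t3 * t4 * t5)) - 8 * (1 / t5) + 9 * (t3 * t5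
    / (t1 * t4 ^ 2)) - 9 * (t5 / (t2 * t4)) - (t2 / (t1 * t4)) + (t5 / (t2 * t3)) - (t5 ^ 2 / (t2
    * t3 ^ 2)) - 7 * (t4 ^ 2 / (t2 ^ 2 * t5)) + 7 * (t5 / (t1 * t3)) - 7 * (t4 / (t2 * t5)) - 9 *
    (t4 / (t1 * t2)) + 10 * (t3 ^ 2 * t4 / (t1 * t2 ^ 2 * t5)) + 4 * (t4 * t5 / (t1 * t3 ^ 2)) -
    3 * (t1 * t2 ^ 2 / (t3 * t4 * t5 ^ 2))

noncomputable def comp1 (x u y z : ℂ) : Fin 11 → ℂ := ![(-x ^ 3 - 6 * x * y + 51 * x ^ 2 + 15 * y - 77 * x + 31) * (x ^ 5 * z / (u * y ^ 5)),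
    (8 * x ^ 3 - 20 * x * y - 3 * x ^ 2 + 17 * y - 24 * x + 17) * (x ^ 3 * z / (u * y ^ 4)),
    (x ^ 2 * y + 5 * x ^ 3 - 12 * x * y - 44 * x ^ 2 + 10 * y + 32 * x) * (x ^ 3 * z / (u * y ^ 4)),
    (3 * x * y + 3 * x ^ 2 + 9 * y - 19 * x + 15) * (x ^ 2 * z / (u * y ^ 3)),
    (7 * x ^ 2 * y - 23 * x ^ 3 - 15 * x * y + 64 * x ^ 2 + 13 * y - 63 * x + 22) * (x * z / (u ^ 2 * y ^ 2)),
    (-11 * x ^ 2 * y + 49 * x ^ 3 + 14 * x * y - 95 * x ^ 2 - 2 * y + 50 * x - 4) * (x * z / (u ^ 2 * y ^ 2)),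
    (6 * x ^ 3 - 25 * x * y + 18 * x ^ 2 + 24 * y - 50 * x + 26) * (z / (u ^ 2 * y)),
    11 * (u ^ 2 / z),
    (-3 * x ^ 2 * y + 15 * x ^ 3 + 28 * x * y - 35 * x ^ 2 - 21 * y + 46 * x - 22) * (y / (x ^ 2 * u ^ 2)),
    (8 * x ^ 2 * y - 16 * x ^ 3 - 29 * x * y + 25 * x ^ 2 + 6 * y - 12 * x) * (y / (x ^ 3 * u)),
    (-6 * x ^ 2 * y + 20 * x ^ 3 + 31 * x * y - 31 * x ^ 2 - 18 * y + 39 * x - 21) * (y ^ 2 / (x ^ 3 * u ^ 2))]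

theorem comp1_mul_a {x u y z : ℂ} (hx : x ≠ 0) (hu : u ≠ 0) (hy : y ≠ 0) (hz : z ≠ 0)
    (xu : u = x - 1) (xz : z = x + y) (h : y ^ 2 + y = x ^ 3 - x ^ 2) :
    (x ^ 2 * y - 3 * x ^ 3 - 4 * x * y + 2 * x ^ 2 + y) * (-12 * (x ^ 5 * z / y ^ 6) + 9 * (x ^ 4
    * z / y ^ 6) - 7 * (x ^ 7 * u / y ^ 7)) =
    (1) * comp1 x u y z 0 + x ^ 9 * u * z / y ^ 8 * ((y ^ 2 / (x ^ 2 * u)) * comp1 x u y z 9) + x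
    ^ 9 * u * z / y ^ 8 * ((y ^ 4 / (x ^ 4 * z)) * comp1 x u y z 5) + x ^ 9 * u * z / y ^ 8 *
    ((-(y ^ 5 / (x ^ 6 * u))) * comp1 x u y z 4) + x ^ 9 * u * z / y ^ 8 * ((-(y ^ 6 / (x ^ 7 *
    z))) * comp1 x u y z 3) + x ^ 9 * u * z / y ^ 8 * ((-(y ^ 7 / (x ^ 8 * u * z))) * comp1 x u y
    z 1) := by
  simp only [comp1, vec11_0, vec11_1, vec11_2, vec11_3, vec11_4, vec11_5, vec11_6, vec11_7, vec11_8, vec11_9, vec11_10]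
  field_simp
  subst xu xz
  linear_combination -((-14 * x ^ 3 + 49 * x ^ 4 - 56 * x ^ 5 + 21 * x ^ 6) + (-7 * x + 26 * x ^
  2 - 41 * x ^ 3 + 29 * x ^ 4 - 7 * x ^ 5) * y + (-7 + 20 * x - 26 * x ^ 2 + 8 * x ^ 3) * y ^ 2 +
  (-13 + 15 * x - 7 * x ^ 2) * y ^ 3) * h

theorem comp1_mul_b {x u y z : ℂ} (hx : x ≠ 0) (hu : u ≠ 0) (hy : y ≠ 0) (hz : z ≠ 0)
    (xu : u = x - 1) (xz : z = x + y) (h : y ^ 2 + y = x ^ 3 - x ^ 2) :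
    (x ^ 2 * y - 3 * x ^ 3 - 4 * x * y + 2 * x ^ 2 + y) * (-6 * (x ^ 5 * z / y ^ 6) + 9 * (x ^ 3
    * z / (u * y ^ 4)) + 1 * (x ^ 4 * u / y ^ 5)) =
    (1) * comp1 x u y z 1 + x ^ 9 * u * z / y ^ 8 * ((y ^ 2 / (x ^ 2 * u)) * comp1 x u y z 10) +
    x ^ 9 * u * z / y ^ 8 * ((y ^ 4 / (x ^ 4 * z)) * comp1 x u y z 6) + x ^ 9 * u * z / y ^ 8 *
    ((-(y ^ 5 / (x ^ 6 * u))) * comp1 x u y z 5) + x ^ 9 * u * z / y ^ 8 * ((-(y ^ 6 / (x ^ 7 *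
    z))) * comp1 x u y z 4) + x ^ 9 * u * z / y ^ 8 * ((-(y ^ 7 / (x ^ 8 * u * z))) * comp1 x u y
    z 2) := by
  simp only [comp1, vec11_0, vec11_1, vec11_2, vec11_3, vec11_4, vec11_5, vec11_6, vec11_7, vec11_8, vec11_9, vec11_10]
  field_simp
  subst xu xz
  linear_combination -((12 * x ^ 3 - 30 * x ^ 4 + 18 * x ^ 5) + (6 * x - 47 * x ^ 2 + 44 * x ^ 3
  + 3 * x ^ 4) * y + (5 - 52 * x + 64 * x ^ 2 - 11 * x ^ 3) * y ^ 2) * h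

theorem comp1_mul_c {x u y z : ℂ} (hx : x ≠ 0) (hu : u ≠ 0) (hy : y ≠ 0) (hz : z ≠ 0)
    (xu : u = x - 1) (xz : z = x + y) (h : y ^ 2 + y = x ^ 3 - x ^ 2) :
    (x ^ 2 * y - 3 * x ^ 3 - 4 * x * y + 2 * x ^ 2 + y) * (5 * (x ^ 5 / y ^ 5)) =
    (1) * comp1 x u y z 2 + (y ^ 2 / (x ^ 2 * u)) * comp1 x u y z 0 + x ^ 9 * u * z / y ^ 8 * ((y
    ^ 4 / (x ^ 4 * z)) * comp1 x u y z 7) + x ^ 9 * u * z / y ^ 8 * ((-(y ^ 5 / (x ^ 6 * u))) *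
    comp1 x u y z 6) + x ^ 9 * u * z / y ^ 8 * ((-(y ^ 6 / (x ^ 7 * z))) * comp1 x u y z 5) + x ^
    9 * u * z / y ^ 8 * ((-(y ^ 7 / (x ^ 8 * u * z))) * comp1 x u y z 3) := by
  simp only [comp1, vec11_0, vec11_1, vec11_2, vec11_3, vec11_4, vec11_5, vec11_6, vec11_7, vec11_8, vec11_9, vec11_10]
  field_simp
  subst xu xz
  linear_combination -((-10 * x ^ 3 + 25 * x ^ 4 - 15 * x ^ 5) + (22 * x - 90 * x ^ 2 + 94 * x ^
  3 - 21 * x ^ 4) * y + (11 - 56 * x + 55 * x ^ 2 + 5 * x ^ 3) * y ^ 2 + (-9 + 19 * x) * y ^ 3) *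
  h

theorem comp1_mul_d {x u y z : ℂ} (hx : x ≠ 0) (hu : u ≠ 0) (hy : y ≠ 0) (hz : z ≠ 0)
    (xu : u = x - 1) (xz : z = x + y) (h : y ^ 2 + y = x ^ 3 - x ^ 2) :
    (x ^ 2 * y - 3 * x ^ 3 - 4 * x * y + 2 * x ^ 2 + y) * (-9 * (x ^ 2 / y ^ 3)) =
    (1) * comp1 x u y z 3 + (y ^ 2 / (x ^ 2 * u)) * comp1 x u y z 1 + x ^ 9 * u * z / y ^ 8 * ((y
    ^ 4 / (x ^ 4 * z)) * comp1 x u y z 8) + x ^ 9 * u * z / y ^ 8 * ((-(y ^ 5 / (x ^ 6 * u))) *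
    comp1 x u y z 7) + x ^ 9 * u * z / y ^ 8 * ((-(y ^ 6 / (x ^ 7 * z))) * comp1 x u y z 6) + x ^
    9 * u * z / y ^ 8 * ((-(y ^ 7 / (x ^ 8 * u * z))) * comp1 x u y z 4) := by
  simp only [comp1, vec11_0, vec11_1, vec11_2, vec11_3, vec11_4, vec11_5, vec11_6, vec11_7, vec11_8, vec11_9, vec11_10]
  field_simp
  subst xu xz
  linear_combination -((15 * x - 51 * x ^ 2 + 29 * x ^ 3) + (17 - 20 * x) * y) * h

theorem comp1_mul_e {x u y z : ℂ} (hx : x ≠ 0) (hu : u ≠ 0) (hy : y ≠ 0) (hz : z ≠ 0)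
    (xu : u = x - 1) (xz : z = x + y) (h : y ^ 2 + y = x ^ 3 - x ^ 2) :
    (x ^ 2 * y - 3 * x ^ 3 - 4 * x * y + 2 * x ^ 2 + y) * (19 * (x ^ 2 * z / y ^ 4)) =
    (1) * comp1 x u y z 4 + (y ^ 2 / (x ^ 2 * u)) * comp1 x u y z 2 + x ^ 9 * u * z / y ^ 8 * ((y
    ^ 4 / (x ^ 4 * z)) * comp1 x u y z 9) + x ^ 9 * u * z / y ^ 8 * ((-(y ^ 5 / (x ^ 6 * u))) *
    comp1 x u y z 8) + x ^ 9 * u * z / y ^ 8 * ((-(y ^ 6 / (x ^ 7 * z))) * comp1 x u y z 7) + x ^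
    9 * u * z / y ^ 8 * ((-(y ^ 7 / (x ^ 8 * u * z))) * comp1 x u y z 5) := by
  simp only [comp1, vec11_0, vec11_1, vec11_2, vec11_3, vec11_4, vec11_5, vec11_6, vec11_7, vec11_8, vec11_9, vec11_10]
  field_simp
  subst xu xz
  linear_combination -((-38 * x ^ 3 + 95 * x ^ 4 - 57 * x ^ 5) + (11 * x - 47 * x ^ 2 + 103 * x ^
  3 - 79 * x ^ 4) * y + (68 * x - 80 * x ^ 2) * y ^ 2 + (44 - 55 * x + 11 * x ^ 2) * y ^ 3) * h

theorem comp1_mul_f {x u y z : ℂ} (hx : x ≠ 0) (hu : u ≠ 0) (hy : y ≠ 0) (hz : z ≠ 0)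
    (xu : u = x - 1) (xz : z = x + y) (h : y ^ 2 + y = x ^ 3 - x ^ 2) :
    (x ^ 2 * y - 3 * x ^ 3 - 4 * x * y + 2 * x ^ 2 + y) * (-6 * (x * z / y ^ 3) - 12 * (1 / y ^
    2) - 1 * (z / (u * y ^ 2)) - 7 * (x ^ 2 / y ^ 3)) =
    (1) * comp1 x u y z 5 + (y ^ 2 / (x ^ 2 * u)) * comp1 x u y z 3 + x ^ 9 * u * z / y ^ 8 * ((y
    ^ 4 / (x ^ 4 * z)) * comp1 x u y z 10) + x ^ 9 * u * z / y ^ 8 * ((-(y ^ 5 / (x ^ 6 * u))) *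
    comp1 x u y z 9) + x ^ 9 * u * z / y ^ 8 * ((-(y ^ 6 / (x ^ 7 * z))) * comp1 x u y z 8) + x ^
    9 * u * z / y ^ 8 * ((-(y ^ 7 / (x ^ 8 * u * z))) * comp1 x u y z 6) := by
  simp only [comp1, vec11_0, vec11_1, vec11_2, vec11_3, vec11_4, vec11_5, vec11_6, vec11_7, vec11_8, vec11_9, vec11_10]
  field_simp
  subst xu xz
  linear_combination -((26 * x ^ 2 - 65 * x ^ 3 + 39 * x ^ 4) + (-10 - 20 * x + 46 * x ^ 2 - 15 *
  x ^ 3) * y + (9 + 3 * x) * y ^ 2) * h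

theorem comp1_mul_g {x u y z : ℂ} (hx : x ≠ 0) (hu : u ≠ 0) (hy : y ≠ 0) (hz : z ≠ 0)
    (xu : u = x - 1) (xz : z = x + y) (h : y ^ 2 + y = x ^ 3 - x ^ 2) :
    (x ^ 2 * y - 3 * x ^ 3 - 4 * x * y + 2 * x ^ 2 + y) * (-9 * (x / y ^ 2) + 10 * (x ^ 2 / (u *
    y ^ 2)) + 4 * (u / y ^ 2) - 3 * (z / (x * u * y ^ 2))) =
    (1) * comp1 x u y z 6 + (y ^ 2 / (x ^ 2 * u)) * comp1 x u y z 4 + (y ^ 4 / (x ^ 4 * z)) *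
    comp1 x u y z 0 + x ^ 9 * u * z / y ^ 8 * ((-(y ^ 5 / (x ^ 6 * u))) * comp1 x u y z 10) + x ^
    9 * u * z / y ^ 8 * ((-(y ^ 6 / (x ^ 7 * z))) * comp1 x u y z 9) + x ^ 9 * u * z / y ^ 8 *
    ((-(y ^ 7 / (x ^ 8 * u * z))) * comp1 x u y z 7) := by
  simp only [comp1, vec11_0, vec11_1, vec11_2, vec11_3, vec11_4, vec11_5, vec11_6, vec11_7, vec11_8, vec11_9, vec11_10]
  field_simp
  subst xu xz
  linear_combination -((-2 * x ^ 2 + 3 * x ^ 3 - 8 * x ^ 4 + 22 * x ^ 5 - 15 * x ^ 6) + (-4 * x -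
  41 * x ^ 2 + 99 * x ^ 3 - 45 * x ^ 4 - 9 * x ^ 5) * y + (9 - 64 * x + 125 * x ^ 2 - 71 * x ^ 3
  + 6 * x ^ 4) * y ^ 2 + (13 - 15 * x + 7 * x ^ 2) * y ^ 3) * h

theorem comp1_mul_h {x u y z : ℂ} (hx : x ≠ 0) (hu : u ≠ 0) (hy : y ≠ 0) (hz : z ≠ 0)
    (xu : u = x - 1) (xz : z = x + y) (h : y ^ 2 + y = x ^ 3 - x ^ 2) :
    (x ^ 2 * y - 3 * x ^ 3 - 4 * x * y + 2 * x ^ 2 + y) * (5 * (1 / (x * y)) + 7 * (1 / (x * u)))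
    =
    (1) * comp1 x u y z 7 + (y ^ 2 / (x ^ 2 * u)) * comp1 x u y z 5 + (y ^ 4 / (x ^ 4 * z)) *
    comp1 x u y z 1 + (-(y ^ 5 / (x ^ 6 * u))) * comp1 x u y z 0 + x ^ 9 * u * z / y ^ 8 * ((-(y
    ^ 6 / (x ^ 7 * z))) * comp1 x u y z 10) + x ^ 9 * u * z / y ^ 8 * ((-(y ^ 7 / (x ^ 8 * u *
    z))) * comp1 x u y z 8) := by
  simp only [comp1, vec11_0, vec11_1, vec11_2, vec11_3, vec11_4, vec11_5, vec11_6, vec11_7, vec11_8, vec11_9, vec11_10]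
  field_simp
  subst xu xz
  linear_combination -((10 * x - 35 * x ^ 2 + 40 * x ^ 3 - 15 * x ^ 4) + (21 - 55 * x + 66 * x ^
  2 - 31 * x ^ 3) * y + (13 - 7 * x - 5 * x ^ 2) * y ^ 2) * h

theorem comp1_mul_i {x u y z : ℂ} (hx : x ≠ 0) (hu : u ≠ 0) (hy : y ≠ 0) (hz : z ≠ 0)
    (xu : u = x - 1) (xz : z = x + y) (h : y ^ 2 + y = x ^ 3 - x ^ 2) :
    (x ^ 2 * y - 3 * x ^ 3 - 4 * x * y + 2 * x ^ 2 + y) * (-5 * (1 / (x * u)) + 12 * (u / (x ^ 2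
    * z)) + 7 * (1 / x ^ 2)) =
    (1) * comp1 x u y z 8 + (y ^ 2 / (x ^ 2 * u)) * comp1 x u y z 6 + (y ^ 4 / (x ^ 4 * z)) *
    comp1 x u y z 2 + (-(y ^ 5 / (x ^ 6 * u))) * comp1 x u y z 1 + (-(y ^ 6 / (x ^ 7 * z))) *
    comp1 x u y z 0 + x ^ 9 * u * z / y ^ 8 * ((-(y ^ 7 / (x ^ 8 * u * z))) * comp1 x u y z 9) := by
  simp only [comp1, vec11_0, vec11_1, vec11_2, vec11_3, vec11_4, vec11_5, vec11_6, vec11_7, vec11_8, vec11_9, vec11_10]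
  field_simp
  subst xu xz
  linear_combination -((-12 * x + 117 * x ^ 2 - 254 * x ^ 3 + 196 * x ^ 4 - 47 * x ^ 5) + (38 * x
  - 63 * x ^ 2 + 23 * x ^ 3 + 1 * x ^ 4) * y + (17 - 13 * x - 5 * x ^ 2) * y ^ 2) * h

theorem comp1_mul_j {x u y z : ℂ} (hx : x ≠ 0) (hu : u ≠ 0) (hy : y ≠ 0) (hz : z ≠ 0)
    (xu : u = x - 1) (xz : z = x + y) (h : y ^ 2 + y = x ^ 3 - x ^ 2) :
    (x ^ 2 * y - 3 * x ^ 3 - 4 * x * y + 2 * x ^ 2 + y) * (-1 * (y / (x ^ 3 * u)) - 1 * (u * y /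
    (x ^ 3 * z))) =
    (1) * comp1 x u y z 9 + (y ^ 2 / (x ^ 2 * u)) * comp1 x u y z 7 + (y ^ 4 / (x ^ 4 * z)) *
    comp1 x u y z 3 + (-(y ^ 5 / (x ^ 6 * u))) * comp1 x u y z 2 + (-(y ^ 6 / (x ^ 7 * z))) *
    comp1 x u y z 1 + x ^ 9 * u * z / y ^ 8 * ((-(y ^ 7 / (x ^ 8 * u * z))) * comp1 x u y z 10) := by
  simp only [comp1, vec11_0, vec11_1, vec11_2, vec11_3, vec11_4, vec11_5, vec11_6, vec11_7, vec11_8, vec11_9, vec11_10]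
  field_simp
  subst xu xz
  linear_combination -((16 * x - 51 * x ^ 2 + 33 * x ^ 3 + 3 * x ^ 4) + (17 - 47 * x + 32 * x ^ 2
  - 1 * x ^ 3) * y) * h

theorem comp1_mul_k {x u y z : ℂ} (hx : x ≠ 0) (hu : u ≠ 0) (hy : y ≠ 0) (hz : z ≠ 0)
    (xu : u = x - 1) (xz : z = x + y) (h : y ^ 2 + y = x ^ 3 - x ^ 2) :
    (x ^ 2 * y - 3 * x ^ 3 - 4 * x * y + 2 * x ^ 2 + y) * (-5 * (y ^ 2 / (x ^ 4 * z)) - 8 * (y /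
    (x ^ 3 * u))) =
    (1) * comp1 x u y z 10 + (y ^ 2 / (x ^ 2 * u)) * comp1 x u y z 8 + (y ^ 4 / (x ^ 4 * z)) *
    comp1 x u y z 4 + (-(y ^ 5 / (x ^ 6 * u))) * comp1 x u y z 3 + (-(y ^ 6 / (x ^ 7 * z))) *
    comp1 x u y z 2 + (-(y ^ 7 / (x ^ 8 * u * z))) * comp1 x u y z 0 := by
  simp only [comp1, vec11_0, vec11_1, vec11_2, vec11_3, vec11_4, vec11_5, vec11_6, vec11_7, vec11_8, vec11_9, vec11_10]
  field_simp
  subst xu xz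
  linear_combination -((16 * x ^ 2 - 40 * x ^ 3 + 24 * x ^ 4) + (-5 + 39 * x - 68 * x ^ 2 + 38 *
  x ^ 3) * y + (-12 + 22 * x - 6 * x ^ 2) * y ^ 2) * h

theorem eulerT_mul_comp1 {t1 t2 t3 t4 t5 x u y z : ℂ} (C : Coord t1 t2 t3 t4 t5 x u y z) :
    eulerT t1 t2 t3 t4 t5 * ∑ r : Fin 11, (t4 / t5) ^ (r : ℕ) * comp1 x u y z r =
    (x ^ 2 * y - 3 * x ^ 3 - 4 * x * y + 2 * x ^ 2 + y) *
    (t1 * t2 * t4 ^ 8 / (t3 * t5 ^ 8 * x * u) * thetaPart1 t1 t2 t3 t4 t5) := by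
  obtain ⟨hx, hu, hy, hz⟩ := C.ne
  have hU : (t4 / t5) ^ 11 = x ^ 9 * u * z / y ^ 8 := by
    rw [C.ex, C.eu, C.ey, C.ez]; obtain ⟨⟨h1, h2, h3, h4, h5, -, -, -⟩, -, -, -, -, -, -, -⟩ := C; field_simp
  have G := graded_mul hU _ _ _ _ _ _ _ _ _ _ _ _ _ _ _ _ _ _ _ _ _ _ _ _ _ _ _ _
    (comp1_mul_a hx hu hy hz C.xu C.xz C.curve)
    (comp1_mul_b hx hu hy hz C.xu C.xz C.curve)
    (comp1_mul_c hx hu hy hz C.xu C.xz C.curve)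
    (comp1_mul_d hx hu hy hz C.xu C.xz C.curve)
    (comp1_mul_e hx hu hy hz C.xu C.xz C.curve)
    (comp1_mul_f hx hu hy hz C.xu C.xz C.curve)
    (comp1_mul_g hx hu hy hz C.xu C.xz C.curve)
    (comp1_mul_h hx hu hy hz C.xu C.xz C.curve)
    (comp1_mul_i hx hu hy hz C.xu C.xz C.curve)
    (comp1_mul_j hx hu hy hz C.xu C.xz C.curve)
    (comp1_mul_k hx hu hy hz C.xu C.xz C.curve)
  have K := C.eulerT_graded
  have kt := C.mon_t
  have ke := C.mon_e
  have ko := C.mon_o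
  have kx := C.mon_x
  have ka := C.mon_a
  have kd := C.mon_d
  have ki := C.mon_i
  have ku := C.mon_u
  have ky := C.mon_y
  have kk := C.mon_k
  have kh := C.mon_h
  have kw := C.mon_w
  have kz := C.mon_z
  have kv := C.mon_v
  have kj := C.mon_j
  have kr := C.mon_r
  have kl := C.mon_l
  have kq := C.mon_q
  have kp := C.mon_p
  have kn := C.mon_n
  have kg := C.mon_g
  have ks := C.mon_s
  have kc := C.mon_c
  have kb := C.mon_b
  have kf := C.mon_f
  have kaa := C.mon_aa
  rw [sum_fin_eleven, K, G, thetaPart1]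
  generalize t4 / t5 = ρ at *
  generalize t1 * t2 * t4 ^ 8 / (t3 * t5 ^ 8 * x * u) = κ at *
  linear_combination (x ^ 2 * y - 3 * x ^ 3 - 4 * x * y + 2 * x ^ 2 + y) * (- 5 * kt + 5 * ke - 5
  * ko + 5 * kx + 6 * ka - 7 * kd + 6 * ki + 1 * ku + 12 * ky - 19 * kk + 12 * kh - 12 * kw - 9 *
  kz + 8 * kv - 9 * kj + 9 * kr + 1 * kl - 1 * kq + 1 * kp + 7 * kn - 7 * kg + 7 * ks + 9 * kc -
  10 * kb - 4 * kf + 3 * kaa)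

/-- The theta quotients in the non-mock part of line 2. -/
noncomputable def thetaPart2 (t1 t2 t3 t4 t5 : ℂ) : ℂ :=
    -12 * (1 / t3) + 12 * (t3 / (t1 * t2)) - 12 * (t3 * t4 / (t2 ^ 2 * t5)) + 12 * (t1 * t5 / (t2
    * t3 * t4)) + 10 * (t2 * t4 / (t1 ^ 2 * t3)) + 2 * (t3 * t5 / (t1 * t2 * t4)) + 10 * (t4 /
    (t1 * t5)) - 6 * (1 / t4) + 9 * (t1 / (t3 * t4)) - 13 * (t2 * t4 / (t1 * t3 * t5)) + 9 * (1 /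
    t1) - 9 * (t1 * t5 / (t2 * t3 ^ 2)) - 4 * (t1 * t2 / (t3 * t4 * t5)) + 16 * (1 / t5) - 4 *
    (t3 * t5 / (t1 * t4 ^ 2)) + 4 * (t5 / (t2 * t4)) - 12 * (t2 / (t1 * t4)) + 12 * (t5 / (t2 *
    t3)) - 12 * (t5 ^ 2 / (t2 * t3 ^ 2)) + 4 * (t4 ^ 2 / (t2 ^ 2 * t5)) - 4 * (t5 / (t1 * t3)) +
    4 * (t4 / (t2 * t5)) - 15 * (t3 ^ 2 * t4 / (t1 * t2 ^ 2 * t5)) - 7 * (t4 * t5 / (t1 * t3 ^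
    2)) + 4 * (t5 ^ 2 / (t2 ^ 2 * t3)) + 9 * (t1 * t2 ^ 2 / (t3 * t4 * t5 ^ 2))

noncomputable def comp2 (x u y z : ℂ) : Fin 11 → ℂ := ![(-8 * x ^ 3 + 39 * x * y - 11 * x ^ 2 - 48 * y + 65 * x - 43) * (x ^ 5 * z / (u * y ^ 5)),
    (4 * x ^ 2 * y - 22 * x ^ 3 + 22 * x * y + 44 * x ^ 2 - 25 * y + 10 * x - 25) * (x ^ 3 * z / (u * y ^ 4)),
    (4 * x * y - 18 * x ^ 2 + y + 59 * x - 35) * (x ^ 4 * z / (u * y ^ 4)),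
    (-4 * x ^ 3 + 18 * x * y + 4 * x ^ 2 - 23 * y + 20 * x - 18) * (x ^ 2 * z / (u * y ^ 3)),
    (-10 * x ^ 2 * y + 39 * x ^ 3 + 27 * x * y - 95 * x ^ 2 - 16 * y + 76 * x - 20) * (x * z / (u ^ 2 * y ^ 2)),
    (7 * x ^ 2 * y - 29 * x ^ 3 - x * y + 68 * x ^ 2 - 11 * y - 46 * x + 7) * (x * z / (u ^ 2 * y ^ 2)),
    (x ^ 3 + 5 * x * y - 30 * x ^ 2 - 7 * y + 54 * x - 25) * (z / (u ^ 2 * y)),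
    11 * (u / x),
    (5 * x ^ 2 * y - 12 * x ^ 3 - 27 * x * y + 30 * x ^ 2 + 17 * y - 47 * x + 24) * (y / (x ^ 2 * u ^ 2)),
    (-2 * x ^ 2 * y + 11 * x ^ 3 + 3 * x * y - 19 * x ^ 2 + 5 * y + 9 * x) * (y / (x ^ 3 * u)),
    (10 * x ^ 2 * y - 28 * x ^ 3 - 53 * x * y + 47 * x ^ 2 + 37 * y - 47 * x + 22) * (y ^ 2 / (x ^ 3 * u ^ 2))]

theorem comp2_mul_a {x u y z : ℂ} (hx : x ≠ 0) (hu : u ≠ 0) (hy : y ≠ 0) (hz : z ≠ 0)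
    (xu : u = x - 1) (xz : z = x + y) (h : y ^ 2 + y = x ^ 3 - x ^ 2) :
    (x ^ 2 * y - 3 * x ^ 3 - 4 * x * y + 2 * x ^ 2 + y) * (9 * (x ^ 5 * z / y ^ 6) - 4 * (x ^ 4 *
    z / y ^ 6) + 4 * (x ^ 7 * u / y ^ 7)) =
    (1) * comp2 x u y z 0 + x ^ 9 * u * z / y ^ 8 * ((y ^ 2 / (x ^ 2 * u)) * comp2 x u y z 9) + x
    ^ 9 * u * z / y ^ 8 * ((y ^ 4 / (x ^ 4 * z)) * comp2 x u y z 5) + x ^ 9 * u * z / y ^ 8 *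
    ((-(y ^ 5 / (x ^ 6 * u))) * comp2 x u y z 4) + x ^ 9 * u * z / y ^ 8 * ((-(y ^ 6 / (x ^ 7 *
    z))) * comp2 x u y z 3) + x ^ 9 * u * z / y ^ 8 * ((-(y ^ 7 / (x ^ 8 * u * z))) * comp2 x u y
    z 1) := by
  simp only [comp2, vec11_0, vec11_1, vec11_2, vec11_3, vec11_4, vec11_5, vec11_6, vec11_7, vec11_8, vec11_9, vec11_10]
  field_simp
  subst xu xz
  linear_combination -((8 * x ^ 3 - 28 * x ^ 4 + 32 * x ^ 5 - 12 * x ^ 6) + (-3 * x + 4 * x ^ 2 +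
  17 * x ^ 3 - 22 * x ^ 4 + 4 * x ^ 5) * y + (-3 + 16 * x - 10 * x ^ 2 - 4 * x ^ 3) * y ^ 2 + (16
  - 27 * x + 10 * x ^ 2) * y ^ 3) * h

theorem comp2_mul_b {x u y z : ℂ} (hx : x ≠ 0) (hu : u ≠ 0) (hy : y ≠ 0) (hz : z ≠ 0)
    (xu : u = x - 1) (xz : z = x + y) (h : y ^ 2 + y = x ^ 3 - x ^ 2) :
    (x ^ 2 * y - 3 * x ^ 3 - 4 * x * y + 2 * x ^ 2 + y) * (10 * (x ^ 5 * z / y ^ 6) - 4 * (x ^ 3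
    * z / (u * y ^ 4)) + 12 * (x ^ 4 * u / y ^ 5)) =
    (1) * comp2 x u y z 1 + x ^ 9 * u * z / y ^ 8 * ((y ^ 2 / (x ^ 2 * u)) * comp2 x u y z 10) +
    x ^ 9 * u * z / y ^ 8 * ((y ^ 4 / (x ^ 4 * z)) * comp2 x u y z 6) + x ^ 9 * u * z / y ^ 8 *
    ((-(y ^ 5 / (x ^ 6 * u))) * comp2 x u y z 5) + x ^ 9 * u * z / y ^ 8 * ((-(y ^ 6 / (x ^ 7 *
    z))) * comp2 x u y z 4) + x ^ 9 * u * z / y ^ 8 * ((-(y ^ 7 / (x ^ 8 * u * z))) * comp2 x u y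
    z 2) := by
  simp only [comp2, vec11_0, vec11_1, vec11_2, vec11_3, vec11_4, vec11_5, vec11_6, vec11_7, vec11_8, vec11_9, vec11_10]
  field_simp
  subst xu xz
  linear_combination -((-20 * x ^ 3 + 50 * x ^ 4 - 30 * x ^ 5) + (17 * x - 40 * x ^ 2 + 79 * x ^
  3 - 57 * x ^ 4) * y + (5 + 64 * x - 91 * x ^ 2 + 21 * x ^ 3) * y ^ 2) * h

theorem comp2_mul_c {x u y z : ℂ} (hx : x ≠ 0) (hu : u ≠ 0) (hy : y ≠ 0) (hz : z ≠ 0)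
    (xu : u = x - 1) (xz : z = x + y) (h : y ^ 2 + y = x ^ 3 - x ^ 2) :
    (x ^ 2 * y - 3 * x ^ 3 - 4 * x * y + 2 * x ^ 2 + y) * (-12 * (x ^ 5 / y ^ 5)) =
    (1) * comp2 x u y z 2 + (y ^ 2 / (x ^ 2 * u)) * comp2 x u y z 0 + x ^ 9 * u * z / y ^ 8 * ((y
    ^ 4 / (x ^ 4 * z)) * comp2 x u y z 7) + x ^ 9 * u * z / y ^ 8 * ((-(y ^ 5 / (x ^ 6 * u))) *
    comp2 x u y z 6) + x ^ 9 * u * z / y ^ 8 * ((-(y ^ 6 / (x ^ 7 * z))) * comp2 x u y z 5) + x ^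
    9 * u * z / y ^ 8 * ((-(y ^ 7 / (x ^ 8 * u * z))) * comp2 x u y z 3) := by
  simp only [comp2, vec11_0, vec11_1, vec11_2, vec11_3, vec11_4, vec11_5, vec11_6, vec11_7, vec11_8, vec11_9, vec11_10]
  field_simp
  subst xu xz
  linear_combination -((24 * x ^ 2 - 60 * x ^ 3 + 36 * x ^ 4) + (-11 - 7 * x + 35 * x ^ 2 - 12 *
  x ^ 3) * y + (-41 + 34 * x) * y ^ 2) * h

theorem comp2_mul_d {x u y z : ℂ} (hx : x ≠ 0) (hu : u ≠ 0) (hy : y ≠ 0) (hz : z ≠ 0)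
    (xu : u = x - 1) (xz : z = x + y) (h : y ^ 2 + y = x ^ 3 - x ^ 2) :
    (x ^ 2 * y - 3 * x ^ 3 - 4 * x * y + 2 * x ^ 2 + y) * (4 * (x ^ 2 / y ^ 3)) =
    (1) * comp2 x u y z 3 + (y ^ 2 / (x ^ 2 * u)) * comp2 x u y z 1 + x ^ 9 * u * z / y ^ 8 * ((y
    ^ 4 / (x ^ 4 * z)) * comp2 x u y z 8) + x ^ 9 * u * z / y ^ 8 * ((-(y ^ 5 / (x ^ 6 * u))) *
    comp2 x u y z 7) + x ^ 9 * u * z / y ^ 8 * ((-(y ^ 6 / (x ^ 7 * z))) * comp2 x u y z 6) + x ^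
    9 * u * z / y ^ 8 * ((-(y ^ 7 / (x ^ 8 * u * z))) * comp2 x u y z 4) := by
  simp only [comp2, vec11_0, vec11_1, vec11_2, vec11_3, vec11_4, vec11_5, vec11_6, vec11_7, vec11_8, vec11_9, vec11_10]
  field_simp
  subst xu xz
  linear_combination -((-5 * x + 6 * x ^ 2 + 5 * x ^ 3) + (-25 + 22 * x + 4 * x ^ 2) * y) * h

theorem comp2_mul_e {x u y z : ℂ} (hx : x ≠ 0) (hu : u ≠ 0) (hy : y ≠ 0) (hz : z ≠ 0)
    (xu : u = x - 1) (xz : z = x + y) (h : y ^ 2 + y = x ^ 3 - x ^ 2) :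
    (x ^ 2 * y - 3 * x ^ 3 - 4 * x * y + 2 * x ^ 2 + y) * (-13 * (x ^ 2 * z / y ^ 4)) =
    (1) * comp2 x u y z 4 + (y ^ 2 / (x ^ 2 * u)) * comp2 x u y z 2 + x ^ 9 * u * z / y ^ 8 * ((y
    ^ 4 / (x ^ 4 * z)) * comp2 x u y z 9) + x ^ 9 * u * z / y ^ 8 * ((-(y ^ 5 / (x ^ 6 * u))) *
    comp2 x u y z 8) + x ^ 9 * u * z / y ^ 8 * ((-(y ^ 6 / (x ^ 7 * z))) * comp2 x u y z 7) + x ^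
    9 * u * z / y ^ 8 * ((-(y ^ 7 / (x ^ 8 * u * z))) * comp2 x u y z 5) := by
  simp only [comp2, vec11_0, vec11_1, vec11_2, vec11_3, vec11_4, vec11_5, vec11_6, vec11_7, vec11_8, vec11_9, vec11_10]
  field_simp
  subst xu xz
  linear_combination -((26 * x ^ 2 - 65 * x ^ 3 + 39 * x ^ 4) + (-11 + 11 * x + 1 * x ^ 2 + 15 *
  x ^ 3) * y + (-33 + 55 * x - 11 * x ^ 2) * y ^ 2) * h

theorem comp2_mul_f {x u y z : ℂ} (hx : x ≠ 0) (hu : u ≠ 0) (hy : y ≠ 0) (hz : z ≠ 0)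
    (xu : u = x - 1) (xz : z = x + y) (h : y ^ 2 + y = x ^ 3 - x ^ 2) :
    (x ^ 2 * y - 3 * x ^ 3 - 4 * x * y + 2 * x ^ 2 + y) * (10 * (x * z / y ^ 3) + 9 * (1 / y ^ 2)
    - 12 * (z / (u * y ^ 2)) + 4 * (x ^ 2 / y ^ 3)) =
    (1) * comp2 x u y z 5 + (y ^ 2 / (x ^ 2 * u)) * comp2 x u y z 3 + x ^ 9 * u * z / y ^ 8 * ((y
    ^ 4 / (x ^ 4 * z)) * comp2 x u y z 10) + x ^ 9 * u * z / y ^ 8 * ((-(y ^ 5 / (x ^ 6 * u))) *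
    comp2 x u y z 9) + x ^ 9 * u * z / y ^ 8 * ((-(y ^ 6 / (x ^ 7 * z))) * comp2 x u y z 8) + x ^
    9 * u * z / y ^ 8 * ((-(y ^ 7 / (x ^ 8 * u * z))) * comp2 x u y z 6) := by
  simp only [comp2, vec11_0, vec11_1, vec11_2, vec11_3, vec11_4, vec11_5, vec11_6, vec11_7, vec11_8, vec11_9, vec11_10]
  field_simp
  subst xu xz
  linear_combination -((-28 * x ^ 2 + 70 * x ^ 3 - 42 * x ^ 4) + (15 - 11 * x - 17 * x ^ 2 + 12 *
  x ^ 3) * y + (-23 + 18 * x) * y ^ 2) * h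

theorem comp2_mul_g {x u y z : ℂ} (hx : x ≠ 0) (hu : u ≠ 0) (hy : y ≠ 0) (hz : z ≠ 0)
    (xu : u = x - 1) (xz : z = x + y) (h : y ^ 2 + y = x ^ 3 - x ^ 2) :
    (x ^ 2 * y - 3 * x ^ 3 - 4 * x * y + 2 * x ^ 2 + y) * (-15 * (x ^ 2 / (u * y ^ 2)) - 7 * (u /
    y ^ 2) + 4 * (u / (y * z)) + 9 * (z / (x * u * y ^ 2))) =
    (1) * comp2 x u y z 6 + (y ^ 2 / (x ^ 2 * u)) * comp2 x u y z 4 + (y ^ 4 / (x ^ 4 * z)) *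
    comp2 x u y z 0 + x ^ 9 * u * z / y ^ 8 * ((-(y ^ 5 / (x ^ 6 * u))) * comp2 x u y z 10) + x ^
    9 * u * z / y ^ 8 * ((-(y ^ 6 / (x ^ 7 * z))) * comp2 x u y z 9) + x ^ 9 * u * z / y ^ 8 *
    ((-(y ^ 7 / (x ^ 8 * u * z))) * comp2 x u y z 7) := by
  simp only [comp2, vec11_0, vec11_1, vec11_2, vec11_3, vec11_4, vec11_5, vec11_6, vec11_7, vec11_8, vec11_9, vec11_10]
  field_simp
  subst xu xz
  linear_combination -((-4 * x ^ 2 - 18 * x ^ 3 + 108 * x ^ 4 - 152 * x ^ 5 + 66 * x ^ 6) + (-12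
  * x + 91 * x ^ 2 - 120 * x ^ 3 + 1 * x ^ 4 + 40 * x ^ 5) * y + (-4 + 61 * x - 133 * x ^ 2 + 87
  * x ^ 3 - 10 * x ^ 4) * y ^ 2 + (-16 + 27 * x - 10 * x ^ 2) * y ^ 3) * h

theorem comp2_mul_h {x u y z : ℂ} (hx : x ≠ 0) (hu : u ≠ 0) (hy : y ≠ 0) (hz : z ≠ 0)
    (xu : u = x - 1) (xz : z = x + y) (h : y ^ 2 + y = x ^ 3 - x ^ 2) :
    (x ^ 2 * y - 3 * x ^ 3 - 4 * x * y + 2 * x ^ 2 + y) * (-12 * (1 / (x * y)) + 2 * (1 / (x *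
    u))) =
    (1) * comp2 x u y z 7 + (y ^ 2 / (x ^ 2 * u)) * comp2 x u y z 5 + (y ^ 4 / (x ^ 4 * z)) *
    comp2 x u y z 1 + (-(y ^ 5 / (x ^ 6 * u))) * comp2 x u y z 0 + x ^ 9 * u * z / y ^ 8 * ((-(y
    ^ 6 / (x ^ 7 * z))) * comp2 x u y z 10) + x ^ 9 * u * z / y ^ 8 * ((-(y ^ 7 / (x ^ 8 * u *
    z))) * comp2 x u y z 8) := by
  simp only [comp2, vec11_0, vec11_1, vec11_2, vec11_3, vec11_4, vec11_5, vec11_6, vec11_7, vec11_8, vec11_9, vec11_10]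
  field_simp
  subst xu xz
  linear_combination -((-24 + 84 * x - 96 * x ^ 2 + 36 * x ^ 3) + (-59 + 86 * x - 32 * x ^ 2) *
  y) * h

theorem comp2_mul_i {x u y z : ℂ} (hx : x ≠ 0) (hu : u ≠ 0) (hy : y ≠ 0) (hz : z ≠ 0)
    (xu : u = x - 1) (xz : z = x + y) (h : y ^ 2 + y = x ^ 3 - x ^ 2) :
    (x ^ 2 * y - 3 * x ^ 3 - 4 * x * y + 2 * x ^ 2 + y) * (12 * (1 / (x * u)) - 9 * (u / (x ^ 2 *
    z)) - 4 * (1 / x ^ 2)) =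
    (1) * comp2 x u y z 8 + (y ^ 2 / (x ^ 2 * u)) * comp2 x u y z 6 + (y ^ 4 / (x ^ 4 * z)) *
    comp2 x u y z 2 + (-(y ^ 5 / (x ^ 6 * u))) * comp2 x u y z 1 + (-(y ^ 6 / (x ^ 7 * z))) *
    comp2 x u y z 0 + x ^ 9 * u * z / y ^ 8 * ((-(y ^ 7 / (x ^ 8 * u * z))) * comp2 x u y z 9) := by
  simp only [comp2, vec11_0, vec11_1, vec11_2, vec11_3, vec11_4, vec11_5, vec11_6, vec11_7, vec11_8, vec11_9, vec11_10]
  field_simp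
  subst xu xz
  linear_combination -((9 * x - 96 * x ^ 2 + 203 * x ^ 3 - 137 * x ^ 4 + 21 * x ^ 5) + (-49 * x +
  90 * x ^ 2 - 24 * x ^ 3 - 19 * x ^ 4) * y + (-25 + 40 * x - 13 * x ^ 2 - 4 * x ^ 3) * y ^ 2) *
  h

theorem comp2_mul_j {x u y z : ℂ} (hx : x ≠ 0) (hu : u ≠ 0) (hy : y ≠ 0) (hz : z ≠ 0)
    (xu : u = x - 1) (xz : z = x + y) (h : y ^ 2 + y = x ^ 3 - x ^ 2) :
    (x ^ 2 * y - 3 * x ^ 3 - 4 * x * y + 2 * x ^ 2 + y) * (-6 * (y / (x ^ 3 * u)) - 12 * (u * y /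
    (x ^ 3 * z))) =
    (1) * comp2 x u y z 9 + (y ^ 2 / (x ^ 2 * u)) * comp2 x u y z 7 + (y ^ 4 / (x ^ 4 * z)) *
    comp2 x u y z 3 + (-(y ^ 5 / (x ^ 6 * u))) * comp2 x u y z 2 + (-(y ^ 6 / (x ^ 7 * z))) *
    comp2 x u y z 1 + x ^ 9 * u * z / y ^ 8 * ((-(y ^ 7 / (x ^ 8 * u * z))) * comp2 x u y z 10) := by
  simp only [comp2, vec11_0, vec11_1, vec11_2, vec11_3, vec11_4, vec11_5, vec11_6, vec11_7, vec11_8, vec11_9, vec11_10]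
  field_simp
  subst xu xz
  linear_combination -((-37 * x + 131 * x ^ 2 - 139 * x ^ 3 + 40 * x ^ 4) + (-25 + 47 * x - 19 *
  x ^ 2 - 8 * x ^ 3) * y) * h

theorem comp2_mul_k {x u y z : ℂ} (hx : x ≠ 0) (hu : u ≠ 0) (hy : y ≠ 0) (hz : z ≠ 0)
    (xu : u = x - 1) (xz : z = x + y) (h : y ^ 2 + y = x ^ 3 - x ^ 2) :
    (x ^ 2 * y - 3 * x ^ 3 - 4 * x * y + 2 * x ^ 2 + y) * (12 * (y ^ 2 / (x ^ 4 * z)) + 16 * (y /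
    (x ^ 3 * u))) =
    (1) * comp2 x u y z 10 + (y ^ 2 / (x ^ 2 * u)) * comp2 x u y z 8 + (y ^ 4 / (x ^ 4 * z)) *
    comp2 x u y z 4 + (-(y ^ 5 / (x ^ 6 * u))) * comp2 x u y z 3 + (-(y ^ 6 / (x ^ 7 * z))) *
    comp2 x u y z 2 + (-(y ^ 7 / (x ^ 8 * u * z))) * comp2 x u y z 0 := by
  simp only [comp2, vec11_0, vec11_1, vec11_2, vec11_3, vec11_4, vec11_5, vec11_6, vec11_7, vec11_8, vec11_9, vec11_10]
  field_simp
  subst xu xz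
  linear_combination -((-32 * x ^ 2 + 80 * x ^ 3 - 48 * x ^ 4) + (12 - 122 * x + 214 * x ^ 2 -
  109 * x ^ 3) * y + (-6 + 14 * x - 13 * x ^ 2) * y ^ 2) * h

theorem eulerT_mul_comp2 {t1 t2 t3 t4 t5 x u y z : ℂ} (C : Coord t1 t2 t3 t4 t5 x u y z) :
    eulerT t1 t2 t3 t4 t5 * ∑ r : Fin 11, (t4 / t5) ^ (r : ℕ) * comp2 x u y z r =
    (x ^ 2 * y - 3 * x ^ 3 - 4 * x * y + 2 * x ^ 2 + y) *
    (t1 * t2 * t4 ^ 8 / (t3 * t5 ^ 8 * x * u) * thetaPart2 t1 t2 t3 t4 t5) := by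
  obtain ⟨hx, hu, hy, hz⟩ := C.ne
  have hU : (t4 / t5) ^ 11 = x ^ 9 * u * z / y ^ 8 := by
    rw [C.ex, C.eu, C.ey, C.ez]; obtain ⟨⟨h1, h2, h3, h4, h5, -, -, -⟩, -, -, -, -, -, -, -⟩ := C; field_simp
  have G := graded_mul hU _ _ _ _ _ _ _ _ _ _ _ _ _ _ _ _ _ _ _ _ _ _ _ _ _ _ _ _
    (comp2_mul_a hx hu hy hz C.xu C.xz C.curve)
    (comp2_mul_b hx hu hy hz C.xu C.xz C.curve)
    (comp2_mul_c hx hu hy hz C.xu C.xz C.curve)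
    (comp2_mul_d hx hu hy hz C.xu C.xz C.curve)
    (comp2_mul_e hx hu hy hz C.xu C.xz C.curve)
    (comp2_mul_f hx hu hy hz C.xu C.xz C.curve)
    (comp2_mul_g hx hu hy hz C.xu C.xz C.curve)
    (comp2_mul_h hx hu hy hz C.xu C.xz C.curve)
    (comp2_mul_i hx hu hy hz C.xu C.xz C.curve)
    (comp2_mul_j hx hu hy hz C.xu C.xz C.curve)
    (comp2_mul_k hx hu hy hz C.xu C.xz C.curve)
  have K := C.eulerT_graded
  have kt := C.mon_t
  have ke := C.mon_e
  have ko := C.mon_o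
  have kx := C.mon_x
  have ka := C.mon_a
  have kd := C.mon_d
  have ki := C.mon_i
  have ku := C.mon_u
  have ky := C.mon_y
  have kk := C.mon_k
  have kh := C.mon_h
  have kw := C.mon_w
  have kz := C.mon_z
  have kv := C.mon_v
  have kj := C.mon_j
  have kr := C.mon_r
  have kl := C.mon_l
  have kq := C.mon_q
  have kp := C.mon_p
  have kn := C.mon_n
  have kg := C.mon_g
  have ks := C.mon_s
  have kb := C.mon_b
  have kf := C.mon_f
  have km := C.mon_m
  have kaa := C.mon_aa
  rw [sum_fin_eleven, K, G, thetaPart2]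
  generalize t4 / t5 = ρ at *
  generalize t1 * t2 * t4 ^ 8 / (t3 * t5 ^ 8 * x * u) = κ at *
  linear_combination (x ^ 2 * y - 3 * x ^ 3 - 4 * x * y + 2 * x ^ 2 + y) * (12 * kt - 12 * ke +
  12 * ko - 12 * kx - 10 * ka - 2 * kd - 10 * ki + 6 * ku - 9 * ky + 13 * kk - 9 * kh + 9 * kw +
  4 * kz - 16 * kv + 4 * kj - 4 * kr + 12 * kl - 12 * kq + 12 * kp - 4 * kn + 4 * kg - 4 * ks +
  15 * kb + 7 * kf - 4 * km - 9 * kaa)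

/-- The theta quotients in the non-mock part of line 3. -/
noncomputable def thetaPart3 (t1 t2 t3 t4 t5 : ℂ) : ℂ :=
    4 * (1 / t3) - 4 * (t3 / (t1 * t2)) + 4 * (t3 * t4 / (t2 ^ 2 * t5)) - 4 * (t1 * t5 / (t2 * t3
    * t4)) - 7 * (t2 * t4 / (t1 ^ 2 * t3)) + 7 * (t3 * t5 / (t1 * t2 * t4)) - 7 * (t4 / (t1 *
    t5)) + 7 * (1 / t4) - 3 * (t1 / (t3 * t4)) + 3 * (t2 * t4 / (t1 * t3 * t5)) - 3 * (1 / t1) +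
    3 * (t1 * t5 / (t2 * t3 ^ 2)) - 6 * (t1 * t2 / (t3 * t4 * t5)) + 6 * (1 / t5) - 6 * (t3 * t5
    / (t1 * t4 ^ 2)) + 6 * (t5 / (t2 * t4)) + 5 * (t4 / (t1 * t2)) + 2 * (t3 ^ 2 * t4 / (t1 * t2
    ^ 2 * t5)) + (t5 ^ 2 / (t2 ^ 2 * t3)) + 3 * (t1 * t2 ^ 2 / (t3 * t4 * t5 ^ 2))

noncomputable def comp3 (x u y z : ℂ) : Fin 11 → ℂ := ![(x ^ 3 - 8 * x * y + 12 * x ^ 2 + 20 * y - 14 * x + 9) * (x ^ 5 * z / (u * y ^ 5)),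
    (x ^ 2 * y - 2 * x ^ 3 - 6 * x * y - 2 * x ^ 2 + 6 * y + 3 * x + 6) * (x ^ 3 * z / (u * y ^ 4)),
    (-2 * x ^ 2 * y + 8 * x ^ 3 + 6 * x * y - 21 * x ^ 2 - 8 * y + 8 * x) * (x ^ 3 * z / (u * y ^ 4)),
    (-x ^ 3 + x * y + 14 * x ^ 2 + 3 * y - 15 * x) * (x ^ 2 * z / (u * y ^ 3)),
    (4 * x ^ 2 * y - 12 * x ^ 3 - 17 * x * y + 18 * x ^ 2 + 12 * y - 12 * x + 6) * (x * z / (u ^ 2 * y ^ 2)),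
    (-x ^ 3 + 8 * x * y - 12 * x ^ 2 - 9 * y + 25 * x - 9) * (z / (u ^ 2 * y)),
    (-4 * x ^ 3 + 13 * x * y + 21 * x ^ 2 - 16 * y - 18 * x + 1) * (z / (u ^ 2 * y)),
    11 * (z / (x * u)),
    (2 * x ^ 2 * y - 4 * x ^ 3 - 11 * x * y - 3 * x ^ 2 + 4 * y + 7 * x - 5) * (y / (x ^ 2 * u ^ 2)),
    (3 * x ^ 2 * y - 7 * x ^ 3 - 14 * x * y - 3 * y - 3 * x) * (y / (x ^ 3 * u)),
    (-7 * x ^ 2 * y + 21 * x ^ 3 + 34 * x * y - 30 * x ^ 2 - 22 * y + 17 * x - 3) * (y ^ 2 / (x ^ 3 * u ^ 2))]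

theorem comp3_mul_a {x u y z : ℂ} (hx : x ≠ 0) (hu : u ≠ 0) (hy : y ≠ 0) (hz : z ≠ 0)
    (xu : u = x - 1) (xz : z = x + y) (h : y ^ 2 + y = x ^ 3 - x ^ 2) :
    (x ^ 2 * y - 3 * x ^ 3 - 4 * x * y + 2 * x ^ 2 + y) * (-3 * (x ^ 5 * z / y ^ 6) - 6 * (x ^ 4
    * z / y ^ 6)) =
    (1) * comp3 x u y z 0 + x ^ 9 * u * z / y ^ 8 * ((y ^ 2 / (x ^ 2 * u)) * comp3 x u y z 9) + x
    ^ 9 * u * z / y ^ 8 * ((y ^ 4 / (x ^ 4 * z)) * comp3 x u y z 5) + x ^ 9 * u * z / y ^ 8 *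
    ((-(y ^ 5 / (x ^ 6 * u))) * comp3 x u y z 4) + x ^ 9 * u * z / y ^ 8 * ((-(y ^ 6 / (x ^ 7 *
    z))) * comp3 x u y z 3) + x ^ 9 * u * z / y ^ 8 * ((-(y ^ 7 / (x ^ 8 * u * z))) * comp3 x u y
    z 1) := by
  simp only [comp3, vec11_0, vec11_1, vec11_2, vec11_3, vec11_4, vec11_5, vec11_6, vec11_7, vec11_8, vec11_9, vec11_10]
  field_simp
  subst xu xz
  linear_combination -((12 - 24 * x + 3 * x ^ 2 + 9 * x ^ 3) + (-12 + 17 * x - 4 * x ^ 2) * y) *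
  h

theorem comp3_mul_b {x u y z : ℂ} (hx : x ≠ 0) (hu : u ≠ 0) (hy : y ≠ 0) (hz : z ≠ 0)
    (xu : u = x - 1) (xz : z = x + y) (h : y ^ 2 + y = x ^ 3 - x ^ 2) :
    (x ^ 2 * y - 3 * x ^ 3 - 4 * x * y + 2 * x ^ 2 + y) * (-7 * (x ^ 5 * z / y ^ 6) - 6 * (x ^ 3
    * z / (u * y ^ 4))) =
    (1) * comp3 x u y z 1 + x ^ 9 * u * z / y ^ 8 * ((y ^ 2 / (x ^ 2 * u)) * comp3 x u y z 10) +
    x ^ 9 * u * z / y ^ 8 * ((y ^ 4 / (x ^ 4 * z)) * comp3 x u y z 6) + x ^ 9 * u * z / y ^ 8 *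
    ((-(y ^ 5 / (x ^ 6 * u))) * comp3 x u y z 5) + x ^ 9 * u * z / y ^ 8 * ((-(y ^ 6 / (x ^ 7 *
    z))) * comp3 x u y z 4) + x ^ 9 * u * z / y ^ 8 * ((-(y ^ 7 / (x ^ 8 * u * z))) * comp3 x u y
    z 2) := by
  simp only [comp3, vec11_0, vec11_1, vec11_2, vec11_3, vec11_4, vec11_5, vec11_6, vec11_7, vec11_8, vec11_9, vec11_10]
  field_simp
  subst xu xz
  linear_combination -((14 * x ^ 2 - 35 * x ^ 3 + 21 * x ^ 4) + (-17 * x + 22 * x ^ 2 - 3 * x ^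
  3) * y + (9 - 8 * x) * y ^ 2) * h

theorem comp3_mul_c {x u y z : ℂ} (hx : x ≠ 0) (hu : u ≠ 0) (hy : y ≠ 0) (hz : z ≠ 0)
    (xu : u = x - 1) (xz : z = x + y) (h : y ^ 2 + y = x ^ 3 - x ^ 2) :
    (x ^ 2 * y - 3 * x ^ 3 - 4 * x * y + 2 * x ^ 2 + y) * (4 * (x ^ 5 / y ^ 5)) =
    (1) * comp3 x u y z 2 + (y ^ 2 / (x ^ 2 * u)) * comp3 x u y z 0 + x ^ 9 * u * z / y ^ 8 * ((y
    ^ 4 / (x ^ 4 * z)) * comp3 x u y z 7) + x ^ 9 * u * z / y ^ 8 * ((-(y ^ 5 / (x ^ 6 * u))) *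
    comp3 x u y z 6) + x ^ 9 * u * z / y ^ 8 * ((-(y ^ 6 / (x ^ 7 * z))) * comp3 x u y z 5) + x ^
    9 * u * z / y ^ 8 * ((-(y ^ 7 / (x ^ 8 * u * z))) * comp3 x u y z 3) := by
  simp only [comp3, vec11_0, vec11_1, vec11_2, vec11_3, vec11_4, vec11_5, vec11_6, vec11_7, vec11_8, vec11_9, vec11_10]
  field_simp
  subst xu xz
  linear_combination -((-8 * x ^ 3 + 20 * x ^ 4 - 12 * x ^ 5) + (-9 * x + 49 * x ^ 2 - 33 * x ^ 3
  + 4 * x ^ 4) * y + (-9 + 53 * x - 29 * x ^ 2) * y ^ 2) * h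

theorem comp3_mul_d {x u y z : ℂ} (hx : x ≠ 0) (hu : u ≠ 0) (hy : y ≠ 0) (hz : z ≠ 0)
    (xu : u = x - 1) (xz : z = x + y) (h : y ^ 2 + y = x ^ 3 - x ^ 2) :
    (x ^ 2 * y - 3 * x ^ 3 - 4 * x * y + 2 * x ^ 2 + y) * (6 * (x ^ 2 / y ^ 3)) =
    (1) * comp3 x u y z 3 + (y ^ 2 / (x ^ 2 * u)) * comp3 x u y z 1 + x ^ 9 * u * z / y ^ 8 * ((y
    ^ 4 / (x ^ 4 * z)) * comp3 x u y z 8) + x ^ 9 * u * z / y ^ 8 * ((-(y ^ 5 / (x ^ 6 * u))) *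
    comp3 x u y z 7) + x ^ 9 * u * z / y ^ 8 * ((-(y ^ 6 / (x ^ 7 * z))) * comp3 x u y z 6) + x ^
    9 * u * z / y ^ 8 * ((-(y ^ 7 / (x ^ 8 * u * z))) * comp3 x u y z 4) := by
  simp only [comp3, vec11_0, vec11_1, vec11_2, vec11_3, vec11_4, vec11_5, vec11_6, vec11_7, vec11_8, vec11_9, vec11_10]
  field_simp
  subst xu xz
  linear_combination -((-5 * x + 28 * x ^ 2 - 17 * x ^ 3) + (6 - 6 * x + 1 * x ^ 2) * y) * h

theorem comp3_mul_e {x u y z : ℂ} (hx : x ≠ 0) (hu : u ≠ 0) (hy : y ≠ 0) (hz : z ≠ 0)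
    (xu : u = x - 1) (xz : z = x + y) (h : y ^ 2 + y = x ^ 3 - x ^ 2) :
    (x ^ 2 * y - 3 * x ^ 3 - 4 * x * y + 2 * x ^ 2 + y) * (3 * (x ^ 2 * z / y ^ 4)) =
    (1) * comp3 x u y z 4 + (y ^ 2 / (x ^ 2 * u)) * comp3 x u y z 2 + x ^ 9 * u * z / y ^ 8 * ((y
    ^ 4 / (x ^ 4 * z)) * comp3 x u y z 9) + x ^ 9 * u * z / y ^ 8 * ((-(y ^ 5 / (x ^ 6 * u))) *
    comp3 x u y z 8) + x ^ 9 * u * z / y ^ 8 * ((-(y ^ 6 / (x ^ 7 * z))) * comp3 x u y z 7) + x ^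
    9 * u * z / y ^ 8 * ((-(y ^ 7 / (x ^ 8 * u * z))) * comp3 x u y z 5) := by
  simp only [comp3, vec11_0, vec11_1, vec11_2, vec11_3, vec11_4, vec11_5, vec11_6, vec11_7, vec11_8, vec11_9, vec11_10]
  field_simp
  subst xu xz
  linear_combination -((-6 * x ^ 2 + 15 * x ^ 3 - 9 * x ^ 4) + (3 * x - 7 * x ^ 2 + 1 * x ^ 3) *
  y + (9 - 8 * x) * y ^ 2) * h

theorem comp3_mul_f {x u y z : ℂ} (hx : x ≠ 0) (hu : u ≠ 0) (hy : y ≠ 0) (hz : z ≠ 0)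
    (xu : u = x - 1) (xz : z = x + y) (h : y ^ 2 + y = x ^ 3 - x ^ 2) :
    (x ^ 2 * y - 3 * x ^ 3 - 4 * x * y + 2 * x ^ 2 + y) * (-7 * (x * z / y ^ 3) - 3 * (1 / y ^
    2)) =
    (1) * comp3 x u y z 5 + (y ^ 2 / (x ^ 2 * u)) * comp3 x u y z 3 + x ^ 9 * u * z / y ^ 8 * ((y
    ^ 4 / (x ^ 4 * z)) * comp3 x u y z 10) + x ^ 9 * u * z / y ^ 8 * ((-(y ^ 5 / (x ^ 6 * u))) *
    comp3 x u y z 9) + x ^ 9 * u * z / y ^ 8 * ((-(y ^ 6 / (x ^ 7 * z))) * comp3 x u y z 8) + x ^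
    9 * u * z / y ^ 8 * ((-(y ^ 7 / (x ^ 8 * u * z))) * comp3 x u y z 6) := by
  simp only [comp3, vec11_0, vec11_1, vec11_2, vec11_3, vec11_4, vec11_5, vec11_6, vec11_7, vec11_8, vec11_9, vec11_10]
  field_simp
  subst xu xz
  linear_combination -((14 * x ^ 2 - 35 * x ^ 3 + 21 * x ^ 4) + (-2 - 15 * x + 28 * x ^ 2 - 7 * x
  ^ 3) * y + (-6 + 9 * x) * y ^ 2) * h

theorem comp3_mul_g {x u y z : ℂ} (hx : x ≠ 0) (hu : u ≠ 0) (hy : y ≠ 0) (hz : z ≠ 0)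
    (xu : u = x - 1) (xz : z = x + y) (h : y ^ 2 + y = x ^ 3 - x ^ 2) :
    (x ^ 2 * y - 3 * x ^ 3 - 4 * x * y + 2 * x ^ 2 + y) * (5 * (x / y ^ 2) + 2 * (x ^ 2 / (u * y
    ^ 2)) + 1 * (u / (y * z)) + 3 * (z / (x * u * y ^ 2))) =
    (1) * comp3 x u y z 6 + (y ^ 2 / (x ^ 2 * u)) * comp3 x u y z 4 + (y ^ 4 / (x ^ 4 * z)) *
    comp3 x u y z 0 + x ^ 9 * u * z / y ^ 8 * ((-(y ^ 5 / (x ^ 6 * u))) * comp3 x u y z 10) + x ^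
    9 * u * z / y ^ 8 * ((-(y ^ 6 / (x ^ 7 * z))) * comp3 x u y z 9) + x ^ 9 * u * z / y ^ 8 *
    ((-(y ^ 7 / (x ^ 8 * u * z))) * comp3 x u y z 7) := by
  simp only [comp3, vec11_0, vec11_1, vec11_2, vec11_3, vec11_4, vec11_5, vec11_6, vec11_7, vec11_8, vec11_9, vec11_10]
  field_simp
  subst xu xz
  linear_combination -((-6 * x ^ 2 + 25 * x ^ 3 - 48 * x ^ 4 + 50 * x ^ 5 - 21 * x ^ 6) + (-13 *
  x + 44 * x ^ 2 - 41 * x ^ 3 + 28 * x ^ 4 - 18 * x ^ 5) * y + (-6 + 23 * x + 7 * x ^ 2 - 32 * x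
  ^ 3 + 7 * x ^ 4) * y ^ 2 + (12 - 17 * x + 4 * x ^ 2) * y ^ 3) * h

theorem comp3_mul_h {x u y z : ℂ} (hx : x ≠ 0) (hu : u ≠ 0) (hy : y ≠ 0) (hz : z ≠ 0)
    (xu : u = x - 1) (xz : z = x + y) (h : y ^ 2 + y = x ^ 3 - x ^ 2) :
    (x ^ 2 * y - 3 * x ^ 3 - 4 * x * y + 2 * x ^ 2 + y) * (4 * (1 / (x * y)) + 7 * (1 / (x * u)))
    =
    (1) * comp3 x u y z 7 + (y ^ 2 / (x ^ 2 * u)) * comp3 x u y z 5 + (y ^ 4 / (x ^ 4 * z)) *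
    comp3 x u y z 1 + (-(y ^ 5 / (x ^ 6 * u))) * comp3 x u y z 0 + x ^ 9 * u * z / y ^ 8 * ((-(y
    ^ 6 / (x ^ 7 * z))) * comp3 x u y z 10) + x ^ 9 * u * z / y ^ 8 * ((-(y ^ 7 / (x ^ 8 * u *
    z))) * comp3 x u y z 8) := by
  simp only [comp3, vec11_0, vec11_1, vec11_2, vec11_3, vec11_4, vec11_5, vec11_6, vec11_7, vec11_8, vec11_9, vec11_10]
  field_simp
  subst xu xz
  linear_combination -((8 * x - 28 * x ^ 2 + 32 * x ^ 3 - 12 * x ^ 4) + (28 * x - 32 * x ^ 2 + 7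
  * x ^ 3) * y + (-9 + 8 * x) * y ^ 2) * h

theorem comp3_mul_i {x u y z : ℂ} (hx : x ≠ 0) (hu : u ≠ 0) (hy : y ≠ 0) (hz : z ≠ 0)
    (xu : u = x - 1) (xz : z = x + y) (h : y ^ 2 + y = x ^ 3 - x ^ 2) :
    (x ^ 2 * y - 3 * x ^ 3 - 4 * x * y + 2 * x ^ 2 + y) * (-4 * (1 / (x * u)) + 3 * (u / (x ^ 2 *
    z))) =
    (1) * comp3 x u y z 8 + (y ^ 2 / (x ^ 2 * u)) * comp3 x u y z 6 + (y ^ 4 / (x ^ 4 * z)) *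
    comp3 x u y z 2 + (-(y ^ 5 / (x ^ 6 * u))) * comp3 x u y z 1 + (-(y ^ 6 / (x ^ 7 * z))) *
    comp3 x u y z 0 + x ^ 9 * u * z / y ^ 8 * ((-(y ^ 7 / (x ^ 8 * u * z))) * comp3 x u y z 9) := by
  simp only [comp3, vec11_0, vec11_1, vec11_2, vec11_3, vec11_4, vec11_5, vec11_6, vec11_7, vec11_8, vec11_9, vec11_10]
  field_simp
  subst xu xz
  linear_combination -((-3 * x + 32 * x ^ 2 - 59 * x ^ 3 + 35 * x ^ 4 - 5 * x ^ 5) + (14 * x - 36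
  * x ^ 2 + 13 * x ^ 3 + 6 * x ^ 4) * y + (6 - 28 * x + 20 * x ^ 2 - 1 * x ^ 3) * y ^ 2) * h

theorem comp3_mul_j {x u y z : ℂ} (hx : x ≠ 0) (hu : u ≠ 0) (hy : y ≠ 0) (hz : z ≠ 0)
    (xu : u = x - 1) (xz : z = x + y) (h : y ^ 2 + y = x ^ 3 - x ^ 2) :
    (x ^ 2 * y - 3 * x ^ 3 - 4 * x * y + 2 * x ^ 2 + y) * (7 * (y / (x ^ 3 * u))) =
    (1) * comp3 x u y z 9 + (y ^ 2 / (x ^ 2 * u)) * comp3 x u y z 7 + (y ^ 4 / (x ^ 4 * z)) *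
    comp3 x u y z 3 + (-(y ^ 5 / (x ^ 6 * u))) * comp3 x u y z 2 + (-(y ^ 6 / (x ^ 7 * z))) *
    comp3 x u y z 1 + x ^ 9 * u * z / y ^ 8 * ((-(y ^ 7 / (x ^ 8 * u * z))) * comp3 x u y z 10) := by
  simp only [comp3, vec11_0, vec11_1, vec11_2, vec11_3, vec11_4, vec11_5, vec11_6, vec11_7, vec11_8, vec11_9, vec11_10]
  field_simp
  subst xu xz
  linear_combination -((6 + 7 * x + 1 * x ^ 2 + 1 * x ^ 3)) * h

theorem comp3_mul_k {x u y z : ℂ} (hx : x ≠ 0) (hu : u ≠ 0) (hy : y ≠ 0) (hz : z ≠ 0)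
    (xu : u = x - 1) (xz : z = x + y) (h : y ^ 2 + y = x ^ 3 - x ^ 2) :
    (x ^ 2 * y - 3 * x ^ 3 - 4 * x * y + 2 * x ^ 2 + y) * (-4 * (y ^ 2 / (x ^ 4 * z)) + 6 * (y /
    (x ^ 3 * u))) =
    (1) * comp3 x u y z 10 + (y ^ 2 / (x ^ 2 * u)) * comp3 x u y z 8 + (y ^ 4 / (x ^ 4 * z)) *
    comp3 x u y z 4 + (-(y ^ 5 / (x ^ 6 * u))) * comp3 x u y z 3 + (-(y ^ 6 / (x ^ 7 * z))) *
    comp3 x u y z 2 + (-(y ^ 7 / (x ^ 8 * u * z))) * comp3 x u y z 0 := by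
  simp only [comp3, vec11_0, vec11_1, vec11_2, vec11_3, vec11_4, vec11_5, vec11_6, vec11_7, vec11_8, vec11_9, vec11_10]
  field_simp
  subst xu xz
  linear_combination -((-12 * x ^ 2 + 30 * x ^ 3 - 18 * x ^ 4) + (-4 + 23 * x - 23 * x ^ 2 - 1 *
  x ^ 3) * y + (7 - 13 * x + 1 * x ^ 2) * y ^ 2) * h

theorem eulerT_mul_comp3 {t1 t2 t3 t4 t5 x u y z : ℂ} (C : Coord t1 t2 t3 t4 t5 x u y z) :
    eulerT t1 t2 t3 t4 t5 * ∑ r : Fin 11, (t4 / t5) ^ (r : ℕ) * comp3 x u y z r =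
    (x ^ 2 * y - 3 * x ^ 3 - 4 * x * y + 2 * x ^ 2 + y) *
    (t1 * t2 * t4 ^ 8 / (t3 * t5 ^ 8 * x * u) * thetaPart3 t1 t2 t3 t4 t5) := by
  obtain ⟨hx, hu, hy, hz⟩ := C.ne
  have hU : (t4 / t5) ^ 11 = x ^ 9 * u * z / y ^ 8 := by
    rw [C.ex, C.eu, C.ey, C.ez]; obtain ⟨⟨h1, h2, h3, h4, h5, -, -, -⟩, -, -, -, -, -, -, -⟩ := C; field_simp
  have G := graded_mul hU _ _ _ _ _ _ _ _ _ _ _ _ _ _ _ _ _ _ _ _ _ _ _ _ _ _ _ _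
    (comp3_mul_a hx hu hy hz C.xu C.xz C.curve)
    (comp3_mul_b hx hu hy hz C.xu C.xz C.curve)
    (comp3_mul_c hx hu hy hz C.xu C.xz C.curve)
    (comp3_mul_d hx hu hy hz C.xu C.xz C.curve)
    (comp3_mul_e hx hu hy hz C.xu C.xz C.curve)
    (comp3_mul_f hx hu hy hz C.xu C.xz C.curve)
    (comp3_mul_g hx hu hy hz C.xu C.xz C.curve)
    (comp3_mul_h hx hu hy hz C.xu C.xz C.curve)
    (comp3_mul_i hx hu hy hz C.xu C.xz C.curve)
    (comp3_mul_j hx hu hy hz C.xu C.xz C.curve)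
    (comp3_mul_k hx hu hy hz C.xu C.xz C.curve)
  have K := C.eulerT_graded
  have kt := C.mon_t
  have ke := C.mon_e
  have ko := C.mon_o
  have kx := C.mon_x
  have ka := C.mon_a
  have kd := C.mon_d
  have ki := C.mon_i
  have ku := C.mon_u
  have ky := C.mon_y
  have kk := C.mon_k
  have kh := C.mon_h
  have kw := C.mon_w
  have kz := C.mon_z
  have kv := C.mon_v
  have kj := C.mon_j
  have kr := C.mon_r
  have kc := C.mon_c
  have kb := C.mon_b
  have km := C.mon_m
  have kaa := C.mon_aa
  rw [sum_fin_eleven, K, G, thetaPart3]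
  generalize t4 / t5 = ρ at *
  generalize t1 * t2 * t4 ^ 8 / (t3 * t5 ^ 8 * x * u) = κ at *
  linear_combination (x ^ 2 * y - 3 * x ^ 3 - 4 * x * y + 2 * x ^ 2 + y) * (- 4 * kt + 4 * ke - 4
  * ko + 4 * kx + 7 * ka - 7 * kd + 7 * ki - 7 * ku + 3 * ky - 3 * kk + 3 * kh - 3 * kw + 6 * kz
  - 6 * kv + 6 * kj - 6 * kr - 5 * kc - 2 * kb - 1 * km - 3 * kaa)

section

/-- The terms of the bilateral sums `∑ (-1)^n q^(n(kn+1)/2 + bn) / (1 - q^(11 * n))`, `q = s²`. The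
term `n = 0` vanishes. -/
noncomputable def bt (s : ℂ) (k : ℕ) (b n : ℤ) : ℂ :=
  (-1) ^ n * s ^ (k * n ^ 2 + (2 * b + 1) * n) / (1 - s ^ (22 * n))

theorem summable_of_residues {f : ℤ → ℂ} (c : ℤ)
    (h : ∀ i : Fin 11, Summable fun m : ℤ => f (11 * m + (c + (i : ℕ)))) : Summable f := by
  let e : ℤ ≃ ℤ × Fin 11 := (Equiv.subRight c).trans (Int.divModEquiv 11)
  let e' : Fin 11 × ℤ ≃ ℤ := (Equiv.prodComm _ _).trans e.symm
  have he : ∀ i m, e' (i, m) = 11 * m + (c + (i : ℕ)) := by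
    intro i m
    simp [e', e, Int.divModEquiv]
    ring
  rw [← e'.summable_iff]
  apply Summable.of_norm
  rw [summable_prod_of_nonneg (fun _ => norm_nonneg _)]
  refine ⟨fun i => ?_, Summable.of_finite⟩
  simpa [he] using (h i).norm

theorem tsum_residues {f : ℤ → ℂ} (hf : Summable f) (c : ℤ) :
    ∑' n, f n = ∑ i : Fin 11, ∑' m : ℤ, f (11 * m + (c + (i : ℕ))) := by
  let e : ℤ ≃ ℤ × Fin 11 := (Equiv.subRight c).trans (Int.divModEquiv 11)
  let e' : Fin 11 × ℤ ≃ ℤ := (Equiv.prodComm _ _).trans e.symm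
  have he : ∀ i m, e' (i, m) = 11 * m + (c + (i : ℕ)) := by
    intro i m
    simp [e', e, Int.divModEquiv]
    ring
  rw [← e'.tsum_eq, Summable.tsum_prod (f := fun p => f (e' p)) ((e'.summable_iff).2 hf),
    tsum_fintype]
  simp [he]

theorem sum_fin_eleven_symm (G : ℤ → ℂ) : ∑ i : Fin 11, G (-5 + (i : ℕ)) =
    G 0 + ∑ a ∈ Finset.Icc (1 : ℤ) 5, (G a + G (-a)) := by
  rw [show Finset.Icc (1 : ℤ) 5 = {1, 2, 3, 4, 5} from by decide]
  simp [Fin.sum_univ_succ]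
  ring

variable {s : ℂ} (hs : ‖s‖ < 1) (hs0 : s ≠ 0)
include hs hs0

omit hs in
theorem bt_eq (k : ℕ) {b j : ℤ} (hb : 2 * (k * j + b) + 1 = 11 * k) (a m : ℤ) :
    bt s k b (11 * m + (j + a)) = (-1) ^ (j + a) * s ^ (k * (a ^ 2 + 11 * a + 11 * j - j ^ 2)) *
      (gc (s ^ 242) k (s ^ (22 * (k * a))) m / (1 - s ^ (22 * (j + a)) * (s ^ 242) ^ m)) := by
  have e1 : (-s ^ (22 * (k * a)) : ℂ) ^ m = (-1) ^ m * s ^ (22 * (k * a) * m) := by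
    rw [← neg_one_mul, mul_zpow, ← zpow_mul]
  have e2 : ((-1 : ℂ) ^ (11 * m + (j + a))) = (-1) ^ (j + a) * (-1) ^ m := by
    rw [zpow_add₀ (by norm_num), zpow_mul, mul_comm]; norm_num
  have e3 : s ^ (22 * (j + a)) * (s ^ 242) ^ m = s ^ (22 * (11 * m + (j + a))) := by
    rw [← zpow_natCast s, ← zpow_mul, ← zpow_add₀ hs0]; congr 1; push_cast; ring
  have e4 : (s ^ 242) ^ (k * tri m) = s ^ (121 * k * (m * (m + 1))) := by
    rw [← zpow_natCast s, ← zpow_mul, ← two_mul_tri]; congr 1; push_cast; ring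
  have e5 : s ^ (k * (11 * m + (j + a)) ^ 2 + (2 * b + 1) * (11 * m + (j + a))) =
      s ^ (k * (a ^ 2 + 11 * a + 11 * j - j ^ 2)) * (s ^ (22 * (k * a) * m) *
        s ^ (121 * k * (m * (m + 1)))) := by
    rw [← zpow_add₀ hs0, ← zpow_add₀ hs0]; congr 1
    linear_combination (11 * m + (j + a)) * hb
  rw [bt, gc, e1, e2, e3, e4, e5]
  ring

theorem summable_app_one {k : ℕ} (hk : 0 < k) {x w : ℂ} (hx : x ≠ 0) (hw : w ≠ 0) :
    Summable fun m : ℤ => gc (s ^ 242) k x m / (1 - w * (s ^ 242) ^ m) := by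
  have hP := norm_pow_lt_one hs (k := 242) (by norm_num)
  have hP0 : s ^ 242 ≠ 0 := pow_ne_zero _ hs0
  classical
  have h1 : Summable fun m : ℤ => if w * (s ^ 242) ^ m = 1 then 0 else gc (s ^ 242) k x m := by
    apply Summable.of_norm
    refine Summable.of_nonneg_of_le (fun _ => norm_nonneg _) (fun m => ?_)
      (summable_gc hP hP0 hk hx).norm
    split_ifs <;> simp
  refine (summable_lam hP hP0 h1 hw ?_).congr fun m => ?_
  · intro m hm h
    simp [h] at hm
  · split_ifs with h
    · simp [h]
    · rfl

omit hs hs0 in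
theorem app_at_one {k : ℕ} {x : ℂ} : app (s ^ 242) k x 1 = appz (s ^ 242) k x 1 := by
  rw [app, appz, lam, lam]
  refine tsum_congr fun m => ?_
  split_ifs with h
  · simp [h]
  · rfl

theorem tsum_bt {k : ℕ} (hk : 0 < k) {b j : ℤ} (hb : 2 * (k * j + b) + 1 = 11 * k) :
    Summable (bt s k b) ∧ ∑' n, bt s k b n =
      (-1) ^ j * s ^ (k * (11 * j - j ^ 2)) * app (s ^ 242) k 1 (s ^ (22 * j)) +
      ∑ a ∈ Finset.Icc (1 : ℤ) 5, (-1) ^ (j + a) * s ^ (k * (a ^ 2 - 11 * a + 11 * j - j ^ 2)) *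
        ((s ^ (22 * a)) ^ k * app (s ^ 242) k ((s ^ (22 * a)) ^ k) (s ^ (22 * j) * s ^ (22 * a)) +
          app (s ^ 242) k ((s ^ (22 * a)) ^ k)⁻¹ (s ^ (22 * j) * (s ^ (22 * a))⁻¹)) := by
  have hS : Summable (bt s k b) := by
    refine summable_of_residues (j + -5) fun i => ?_
    simp only [add_assoc j]
    simp only [bt_eq hs0 k hb]
    exact (summable_app_one hs hs0 hk (zpow_ne_zero _ hs0) (zpow_ne_zero _ hs0)).mul_left _
  refine ⟨hS, ?_⟩
  rw [tsum_residues hS (j + -5)]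
  simp only [add_assoc j]
  simp only [bt_eq hs0 k hb, tsum_mul_left]
  rw [sum_fin_eleven_symm (fun a => (-1) ^ (j + a) * s ^ (k * (a ^ 2 + 11 * a + 11 * j - j ^ 2)) *
      ∑' m : ℤ, gc (s ^ 242) k (s ^ (22 * (k * a))) m / (1 - s ^ (22 * (j + a)) * (s ^ 242) ^ m))]
  have hx : ∀ a : ℤ, (s ^ (22 * a)) ^ k = s ^ (22 * (k * a)) := by
    intro a; rw [← zpow_natCast, ← zpow_mul]; congr 1; ring
  congr 1
  · simp [app, lam]
  · refine Finset.sum_congr rfl fun a _ => ?_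
    have h1 : ((s ^ (22 * a)) ^ k)⁻¹ = s ^ (22 * (k * -a)) := by
      rw [hx, ← zpow_neg]; congr 1; ring
    have h2 : s ^ (22 * j) * (s ^ (22 * a))⁻¹ = s ^ (22 * (j + -a)) := by
      rw [← zpow_neg, ← zpow_add₀ hs0]; congr 1; ring
    have h3 : s ^ (22 * j) * s ^ (22 * a) = s ^ (22 * (j + a)) := by
      rw [← zpow_add₀ hs0]; congr 1; ring
    have h4 : s ^ (k * (a ^ 2 + 11 * a + 11 * j - j ^ 2)) =
        s ^ (k * (a ^ 2 - 11 * a + 11 * j - j ^ 2)) * s ^ (22 * (k * a)) := by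
      rw [← zpow_add₀ hs0]; congr 1; ring
    have h5 : ((-1 : ℂ)) ^ (j + -a) = (-1) ^ (j + a) := by
      rw [show j + -a = (j + a) + 2 * (-a) by ring, zpow_add₀ (by norm_num), zpow_mul]; norm_num
    have h6 : ((k : ℤ) * ((-a) ^ 2 + 11 * -a + 11 * j - j ^ 2)) =
        k * (a ^ 2 - 11 * a + 11 * j - j ^ 2) := by ring
    rw [h1, h2, h3, h5, h6, hx, h4, app, app, lam, lam]
    ring

omit hs in
/-- The translation between `theta` and its normalisation. -/
theorem theta_eq_tv (n : ℤ) : theta (s ^ 242) (s ^ (22 * n)) = s ^ (-(n * (n - 11))) * tv s n := by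
  rw [tv, ← mul_assoc, ← zpow_add₀ hs0]; simp

end

section

variable {s : ℂ} (hs : ‖s‖ < 1) (hs0 : s ≠ 0)
include hs hs0

omit hs hs0 in
theorem ell_eq_lv (n : ℤ) : ell (s ^ 242) (s ^ (22 * n)) = lv s n - n / 11 + 1 / 2 := by
  rw [lv]; ring

theorem rank_pair_tv {j a : ℤ} (ha : ¬ (11 : ℤ) ∣ a) (h2 : ¬ (11 : ℤ) ∣ 2 * a)
    (hj : ¬ (11 : ℤ) ∣ j) (h3 : ¬ (11 : ℤ) ∣ j + a) (h4 : ¬ (11 : ℤ) ∣ j - a) :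
    (-1) ^ (j + a) * s ^ (((3 : ℕ) : ℤ) * (a ^ 2 - 11 * a + 11 * j - j ^ 2)) *
      ((s ^ (22 * a)) ^ 3 * app (s ^ 242) 3 ((s ^ (22 * a)) ^ 3) (s ^ (22 * j) * s ^ (22 * a)) +
        app (s ^ 242) 3 ((s ^ (22 * a)) ^ 3)⁻¹ (s ^ (22 * j) * (s ^ (22 * a))⁻¹)) =
    (-1) ^ j * s ^ (((3 : ℕ) : ℤ) * (11 * j - j ^ 2)) * app (s ^ 242) 3 1 (s ^ (22 * j)) *
      ((-1) ^ a * (tv s (2 * a) / tv s a)) +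
    poch (s ^ 242) (s ^ 242) ^ 3 * ((-1) ^ (j + a) *
      (tv s (2 * a) * tv s a / (tv s (j + a) * tv s j * tv s (j - a)))) := by
  have hP := norm_pow_lt_one hs (k := 242) (by norm_num)
  have hP0 : s ^ 242 ≠ 0 := pow_ne_zero _ hs0
  have e1 : (s ^ (22 * a)) ^ 2 = s ^ (22 * (2 * a)) := by
    rw [← zpow_natCast, ← zpow_mul]; congr 1; ring
  have e2 : s ^ (22 * j) * s ^ (22 * a) = s ^ (22 * (j + a)) := by
    rw [← zpow_add₀ hs0]; congr 1; ring
  have e3 : s ^ (22 * j) * (s ^ (22 * a))⁻¹ = s ^ (22 * (j - a)) := by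
    rw [← zpow_neg, ← zpow_add₀ hs0]; congr 1; ring
  rw [rank_pair hP hP0 (z := s ^ (22 * a)) (w := s ^ (22 * j)) (zpow_ne_zero _ hs0)
    (by rwa [lat_zpow hs hs0]) (by rwa [e1, lat_zpow hs hs0]) (zpow_ne_zero _ hs0)
    (by rwa [lat_zpow hs hs0]) (by rwa [e2, lat_zpow hs hs0]) (by rwa [e3, lat_zpow hs hs0]),
    e1, e2, e3, theta_eq_tv hs0, theta_eq_tv hs0, theta_eq_tv hs0, theta_eq_tv hs0, theta_eq_tv hs0,
    zpow_add₀ (by norm_num : (-1 : ℂ) ≠ 0)]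
  have k1 : s ^ (((3 : ℕ) : ℤ) * (a ^ 2 - 11 * a + 11 * j - j ^ 2)) =
      s ^ (((3 : ℕ) : ℤ) * (11 * j - j ^ 2)) * s ^ (3 * a ^ 2 - 33 * a) := by
    rw [← zpow_add₀ hs0]; congr 1; push_cast; ring
  have k2 : s ^ (3 * a ^ 2 - 33 * a) * (s ^ (22 * a) * s ^ (-(2 * a * (2 * a - 11))) /
      s ^ (-(a * (a - 11)))) = 1 := by
    rw [← zpow_add₀ hs0, ← zpow_sub₀ hs0, ← zpow_add₀ hs0]
    convert zpow_zero s using 2; ring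
  have k3 : s ^ (((3 : ℕ) : ℤ) * (11 * j - j ^ 2)) * s ^ (3 * a ^ 2 - 33 * a) *
      (s ^ (-(2 * a * (2 * a - 11))) * s ^ (-(a * (a - 11))) /
      (s ^ (-((j + a) * (j + a - 11))) * s ^ (-(j * (j - 11))) *
        s ^ (-((j - a) * (j - a - 11))))) = 1 := by
    rw [← zpow_add₀ hs0, ← zpow_add₀ hs0, ← zpow_add₀ hs0, ← zpow_add₀ hs0, ← zpow_sub₀ hs0,
      ← zpow_add₀ hs0]
    convert zpow_zero s using 2; push_cast; ring
  rw [k1]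
  generalize app (s ^ 242) 3 1 (s ^ (22 * j)) = A
  generalize s ^ (-(2 * a * (2 * a - 11))) = X1 at *
  generalize s ^ (-(a * (a - 11))) = X2 at *
  generalize s ^ (-((j + a) * (j + a - 11))) = X3 at *
  generalize s ^ (-((j - a) * (j - a - 11))) = X4 at *
  generalize s ^ (-(j * (j - 11))) = X5 at *
  generalize s ^ (((3 : ℕ) : ℤ) * (11 * j - j ^ 2)) = Y1 at *
  generalize s ^ (3 * a ^ 2 - 33 * a) = Y2 at *
  generalize s ^ (22 * a) = Z at *
  generalize ((-1 : ℂ) ^ j) = ej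
  generalize ((-1 : ℂ) ^ a) = ea
  linear_combination (ej * ea * Y1 * A * (tv s (2 * a) / tv s a)) * k2 +
    (ej * ea * poch (s ^ 242) (s ^ 242) ^ 3 *
      (tv s (2 * a) * tv s a / (tv s (j + a) * tv s j * tv s (j - a)))) * k3

theorem rank_pole_tv {j : ℤ} (hj : ¬ (11 : ℤ) ∣ j) (h2 : ¬ (11 : ℤ) ∣ 2 * j) :
    (-1) ^ (j + j) * s ^ (((3 : ℕ) : ℤ) * (j ^ 2 - 11 * j + 11 * j - j ^ 2)) *
      ((s ^ (22 * j)) ^ 3 * app (s ^ 242) 3 ((s ^ (22 * j)) ^ 3) (s ^ (22 * j) * s ^ (22 * j)) +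
        app (s ^ 242) 3 ((s ^ (22 * j)) ^ 3)⁻¹ (s ^ (22 * j) * (s ^ (22 * j))⁻¹)) =
    (-1) ^ j * s ^ (((3 : ℕ) : ℤ) * (11 * j - j ^ 2)) * app (s ^ 242) 3 1 (s ^ (22 * j)) *
      ((-1) ^ j * (tv s (2 * j) / tv s j)) + (lv s (2 * j) + lv s j - 3 * j / 11 + 1) := by
  have hP := norm_pow_lt_one hs (k := 242) (by norm_num)
  have hP0 : s ^ 242 ≠ 0 := pow_ne_zero _ hs0
  have e1 : (s ^ (22 * j)) ^ 2 = s ^ (22 * (2 * j)) := by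
    rw [← zpow_natCast, ← zpow_mul]; congr 1; ring
  have e0 : s ^ (22 * j) ≠ 0 := zpow_ne_zero _ hs0
  have := rank_pole hP hP0 e0 (by rwa [lat_zpow hs hs0]) (by rwa [e1, lat_zpow hs hs0])
  rw [mul_inv_cancel₀ e0, ← sq (s ^ (22 * j)), app_at_one, this, e1, theta_eq_tv hs0,
    theta_eq_tv hs0, ell_eq_lv, ell_eq_lv,
    show ((3 : ℕ) : ℤ) * (j ^ 2 - 11 * j + 11 * j - j ^ 2) = 0 by ring,
    zpow_add₀ (by norm_num : (-1 : ℂ) ≠ 0)]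
  have k2 : s ^ (((3 : ℕ) : ℤ) * (11 * j - j ^ 2)) =
      s ^ (22 * j) * s ^ (-(2 * j * (2 * j - 11))) / s ^ (-(j * (j - 11))) := by
    rw [← zpow_add₀ hs0, ← zpow_sub₀ hs0]
    congr 1; push_cast; ring
  have k3 : ((-1 : ℂ) ^ j) * (-1) ^ j = 1 := by
    rw [← zpow_add₀ (by norm_num), ← two_mul, zpow_mul]; norm_num
  rw [k2]
  generalize ((-1 : ℂ) ^ j) = ej at *
  push_cast
  rw [zpow_zero]
  linear_combination (lv s (2 * j) + lv s j - 3 * (j : ℂ) / 11 + 1) * k3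

theorem crank_pair_tv {j a : ℤ} (ha : ¬ (11 : ℤ) ∣ a) (h2 : ¬ (11 : ℤ) ∣ 2 * a)
    (h3 : ¬ (11 : ℤ) ∣ j + a) (h4 : ¬ (11 : ℤ) ∣ j - a) :
    (-1) ^ (j + a) * s ^ (((1 : ℕ) : ℤ) * (a ^ 2 - 11 * a + 11 * j - j ^ 2)) *
      ((s ^ (22 * a)) ^ 1 * app (s ^ 242) 1 ((s ^ (22 * a)) ^ 1) (s ^ (22 * j) * s ^ (22 * a)) +
        app (s ^ 242) 1 ((s ^ (22 * a)) ^ 1)⁻¹ (s ^ (22 * j) * (s ^ (22 * a))⁻¹)) =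
    poch (s ^ 242) (s ^ 242) ^ 3 * ((-1) ^ (j + a) *
      (tv s (2 * a) * tv s j / (tv s a * tv s (j + a) * tv s (j - a)))) := by
  have hP := norm_pow_lt_one hs (k := 242) (by norm_num)
  have hP0 : s ^ 242 ≠ 0 := pow_ne_zero _ hs0
  have e1 : (s ^ (22 * a)) ^ 2 = s ^ (22 * (2 * a)) := by
    rw [← zpow_natCast, ← zpow_mul]; congr 1; ring
  have e2 : s ^ (22 * j) * s ^ (22 * a) = s ^ (22 * (j + a)) := by
    rw [← zpow_add₀ hs0]; congr 1; ring
  have e3 : s ^ (22 * j) * (s ^ (22 * a))⁻¹ = s ^ (22 * (j - a)) := by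
    rw [← zpow_neg, ← zpow_add₀ hs0]; congr 1; ring
  rw [pow_one, crank_pair hP hP0 (z := s ^ (22 * a)) (w := s ^ (22 * j)) (zpow_ne_zero _ hs0)
    (by rwa [lat_zpow hs hs0]) (by rwa [e1, lat_zpow hs hs0]) (zpow_ne_zero _ hs0)
    (by rwa [e2, lat_zpow hs hs0]) (by rwa [e3, lat_zpow hs hs0]),
    e1, e2, e3, theta_eq_tv hs0, theta_eq_tv hs0, theta_eq_tv hs0, theta_eq_tv hs0, theta_eq_tv hs0]
  have k3 : s ^ (((1 : ℕ) : ℤ) * (a ^ 2 - 11 * a + 11 * j - j ^ 2)) *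
      (s ^ (-(2 * a * (2 * a - 11))) * s ^ (-(j * (j - 11))) /
      (s ^ (-(a * (a - 11))) * s ^ (-((j + a) * (j + a - 11))) *
        s ^ (-((j - a) * (j - a - 11))))) = 1 := by
    rw [← zpow_add₀ hs0, ← zpow_add₀ hs0, ← zpow_add₀ hs0, ← zpow_sub₀ hs0,
      ← zpow_add₀ hs0]
    convert zpow_zero s using 2; push_cast; ring
  generalize s ^ (-(2 * a * (2 * a - 11))) = X1 at *
  generalize s ^ (-(a * (a - 11))) = X2 at *
  generalize s ^ (-((j + a) * (j + a - 11))) = X3 at *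
  generalize s ^ (-((j - a) * (j - a - 11))) = X4 at *
  generalize s ^ (-(j * (j - 11))) = X5 at *
  generalize s ^ (((1 : ℕ) : ℤ) * (a ^ 2 - 11 * a + 11 * j - j ^ 2)) = Y1 at *
  linear_combination ((-1) ^ (j + a) * poch (s ^ 242) (s ^ 242) ^ 3 *
      (tv s (2 * a) * tv s j / (tv s a * tv s (j + a) * tv s (j - a)))) * k3

theorem crank_pole_tv {j : ℤ} (hj : ¬ (11 : ℤ) ∣ j) (h2 : ¬ (11 : ℤ) ∣ 2 * j) :
    (-1) ^ (j + j) * s ^ (((1 : ℕ) : ℤ) * (j ^ 2 - 11 * j + 11 * j - j ^ 2)) *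
      ((s ^ (22 * j)) ^ 1 * app (s ^ 242) 1 ((s ^ (22 * j)) ^ 1) (s ^ (22 * j) * s ^ (22 * j)) +
        app (s ^ 242) 1 ((s ^ (22 * j)) ^ 1)⁻¹ (s ^ (22 * j) * (s ^ (22 * j))⁻¹)) =
    lv s (2 * j) - lv s j - j / 11 := by
  have hP := norm_pow_lt_one hs (k := 242) (by norm_num)
  have hP0 : s ^ 242 ≠ 0 := pow_ne_zero _ hs0
  have e1 : (s ^ (22 * j)) ^ 2 = s ^ (22 * (2 * j)) := by
    rw [← zpow_natCast, ← zpow_mul]; congr 1; ring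
  have e0 : s ^ (22 * j) ≠ 0 := zpow_ne_zero _ hs0
  have := crank_pole hP hP0 e0 (by rwa [lat_zpow hs hs0]) (by rwa [e1, lat_zpow hs hs0])
  rw [pow_one, mul_inv_cancel₀ e0, ← sq (s ^ (22 * j)), app_at_one, this, e1, ell_eq_lv, ell_eq_lv,
    show ((1 : ℕ) : ℤ) * (j ^ 2 - 11 * j + 11 * j - j ^ 2) = 0 by ring,
    zpow_add₀ (by norm_num : (-1 : ℂ) ≠ 0)]
  have k3 : ((-1 : ℂ) ^ j) * (-1) ^ j = 1 := by
    rw [← zpow_add₀ (by norm_num), ← two_mul, zpow_mul]; norm_num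
  push_cast
  rw [k3, zpow_zero]
  ring

theorem crank_middle_tv {j : ℤ} (hj : ¬ (11 : ℤ) ∣ j) :
    (-1) ^ j * s ^ (((1 : ℕ) : ℤ) * (11 * j - j ^ 2)) * app (s ^ 242) 1 1 (s ^ (22 * j)) =
      poch (s ^ 242) (s ^ 242) ^ 3 * ((-1) ^ j / tv s j) := by
  have hP := norm_pow_lt_one hs (k := 242) (by norm_num)
  have hP0 : s ^ 242 ≠ 0 := pow_ne_zero _ hs0
  rw [crank_middle hP hP0 (zpow_ne_zero _ hs0) (by rwa [lat_zpow hs hs0]), theta_eq_tv hs0,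
    show ((1 : ℕ) : ℤ) * (11 * j - j ^ 2) = -(j * (j - 11)) by push_cast; ring]
  have := zpow_ne_zero (-(j * (j - 11))) hs0
  have := tv_ne_zero hs hs0 hj
  field_simp

end

section

variable {s : ℂ} (hs : ‖s‖ < 1) (hs0 : s ≠ 0)
include hs hs0

theorem tv_ten_eight_six : tv s 6 = tv s 5 ∧ tv s 7 = tv s 4 ∧ tv s 8 = tv s 3 ∧ tv s 9 = tv s 2 ∧
    tv s 10 = tv s 1 := by
  refine ⟨?_, ?_, ?_, ?_, ?_⟩
  · exact tv_sub_eleven hs hs0 5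
  · exact tv_sub_eleven hs hs0 4
  · exact tv_sub_eleven hs hs0 3
  · exact tv_sub_eleven hs hs0 2
  · exact tv_sub_eleven hs hs0 1

theorem eulerT_eq_sum : eulerT (tv s 1) (tv s 2) (tv s 3) (tv s 4) (tv s 5) =
    1 + ∑ a ∈ Finset.Icc (1 : ℤ) 5, (-1) ^ a * (tv s (2 * a) / tv s a) := by
  obtain ⟨h6, h7, h8, h9, h10⟩ := tv_ten_eight_six hs hs0
  rw [show Finset.Icc (1 : ℤ) 5 = {1, 2, 3, 4, 5} from by decide, eulerT]
  norm_num [h6, h8, h10]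
  ring

/-- The mock theta part of the bilateral sums. -/
noncomputable def mockTerm (s : ℂ) (j : ℤ) : ℂ :=
  (-1) ^ j * s ^ (((3 : ℕ) : ℤ) * (11 * j - j ^ 2)) * app (s ^ 242) 3 1 (s ^ (22 * j))

theorem tsum_bt_rank {j b : ℤ} (hj : j ∈ Finset.Icc (1 : ℤ) 5) (hb : 3 * j + b = 16) :
    ∑' n, bt s 3 b n = mockTerm s j * eulerT (tv s 1) (tv s 2) (tv s 3) (tv s 4) (tv s 5) +
      (lv s (2 * j) + lv s j - 3 * j / 11 + 1) + poch (s ^ 242) (s ^ 242) ^ 3 *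
      ∑ a ∈ (Finset.Icc (1 : ℤ) 5).erase j, (-1) ^ (j + a) *
        (tv s (2 * a) * tv s a / (tv s (j + a) * tv s j * tv s (j - a))) := by
  have hb' : 2 * (((3 : ℕ) : ℤ) * j + b) + 1 = 11 * ((3 : ℕ) : ℤ) := by push_cast; linarith
  have hj' := Finset.mem_Icc.1 hj
  have hp := fun a (ha : a ∈ (Finset.Icc (1 : ℤ) 5).erase j) => by
    obtain ⟨h1, h2⟩ := Finset.mem_erase.1 ha
    have := Finset.mem_Icc.1 h2
    exact rank_pair_tv hs hs0 (a := a) (j := j) (by omega) (by omega) (by omega) (by omega) (by omega)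
  rw [(tsum_bt hs hs0 (by norm_num) hb').2, eulerT_eq_sum hs hs0, mockTerm,
    ← Finset.add_sum_erase _ _ hj, ← Finset.add_sum_erase _ _ hj,
    rank_pole_tv hs hs0 (by omega) (by omega), Finset.sum_congr rfl hp,
    Finset.sum_add_distrib, ← Finset.mul_sum, ← Finset.mul_sum]
  ring

theorem tsum_bt_crank {j b : ℤ} (hj : j ∈ Finset.Icc (1 : ℤ) 5) (hb : j + b = 5) :
    ∑' n, bt s 1 b n = (lv s (2 * j) - lv s j - j / 11) + poch (s ^ 242) (s ^ 242) ^ 3 *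
      ((-1) ^ j / tv s j + ∑ a ∈ (Finset.Icc (1 : ℤ) 5).erase j, (-1) ^ (j + a) *
        (tv s (2 * a) * tv s j / (tv s a * tv s (j + a) * tv s (j - a)))) := by
  have hb' : 2 * (((1 : ℕ) : ℤ) * j + b) + 1 = 11 * ((1 : ℕ) : ℤ) := by push_cast; linarith
  have hj' := Finset.mem_Icc.1 hj
  have hp := fun a (ha : a ∈ (Finset.Icc (1 : ℤ) 5).erase j) => by
    obtain ⟨h1, h2⟩ := Finset.mem_erase.1 ha
    have := Finset.mem_Icc.1 h2
    exact crank_pair_tv hs hs0 (a := a) (j := j) (by omega) (by omega) (by omega) (by omega)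
  rw [(tsum_bt hs hs0 (by norm_num) hb').2,
    ← Finset.add_sum_erase _ _ hj, crank_middle_tv hs hs0 (by omega),
    crank_pole_tv hs hs0 (by omega) (by omega), Finset.sum_congr rfl hp,
    ← Finset.mul_sum]
  ring

end

section

variable {s : ℂ} (hs : ‖s‖ < 1) (hs0 : s ≠ 0)
include hs hs0

theorem lv_six_eight_ten : lv s 6 = -lv s 5 ∧ lv s 8 = -lv s 3 ∧ lv s 10 = -lv s 1 := by
  refine ⟨?_, ?_, ?_⟩
  · exact lv_sub_eleven hs hs0 (n := 5) (by norm_num)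
  · exact lv_sub_eleven hs hs0 (n := 3) (by norm_num)
  · exact lv_sub_eleven hs hs0 (n := 1) (by norm_num)

theorem tv_one_five_ne_zero : tv s 1 ≠ 0 ∧ tv s 2 ≠ 0 ∧ tv s 3 ≠ 0 ∧ tv s 4 ≠ 0 ∧ tv s 5 ≠ 0 := by
  refine ⟨?_, ?_, ?_, ?_, ?_⟩ <;> exact tv_ne_zero hs hs0 (by norm_num)

theorem tsum_bt_rank_one : ∑' n, bt s 3 13 n = mockTerm s 1 *
    eulerT (tv s 1) (tv s 2) (tv s 3) (tv s 4) (tv s 5) + ((lv s 2) + lv s 1 + (8/11)) +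
    poch (s ^ 242) (s ^ 242) ^ 3 * ((tv s 2 * tv s 4 / (tv s 1 ^ 2 * tv s 3)) - (tv s 3 * tv s 5 / (tv s 1 * tv s 2 * tv s 4)) + (tv s 4 / (tv s 1 * tv s 5)) - (1 / tv s 4)) := by
  obtain ⟨h6, h7, h8, h9, h10⟩ := tv_ten_eight_six hs hs0
  obtain ⟨l6, l8, l10⟩ := lv_six_eight_ten hs hs0
  obtain ⟨n1, n2, n3, n4, n5⟩ := tv_one_five_ne_zero hs hs0
  rw [tsum_bt_rank hs hs0 (j := 1) (by decide) (by norm_num),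
    show (Finset.Icc (1 : ℤ) 5).erase 1 = {2, 3, 4, 5} from by decide]
  norm_num [h6, h7, h8, h9, h10, l6, l8, l10, tv_neg hs hs0, -mul_eq_mul_left_iff]
  field_simp
  ring

theorem tsum_bt_rank_two : ∑' n, bt s 3 10 n = mockTerm s 2 *
    eulerT (tv s 1) (tv s 2) (tv s 3) (tv s 4) (tv s 5) + ((lv s 4) + lv s 2 + (5/11)) +
    poch (s ^ 242) (s ^ 242) ^ 3 * (-(1 / tv s 3) + (tv s 3 / (tv s 1 * tv s 2)) - (tv s 3 * tv s 4 / (tv s 2 ^ 2 * tv s 5)) + (tv s 1 * tv s 5 / (tv s 2 * tv s 3 * tv s 4))) := by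
  obtain ⟨h6, h7, h8, h9, h10⟩ := tv_ten_eight_six hs hs0
  obtain ⟨l6, l8, l10⟩ := lv_six_eight_ten hs hs0
  obtain ⟨n1, n2, n3, n4, n5⟩ := tv_one_five_ne_zero hs hs0
  rw [tsum_bt_rank hs hs0 (j := 2) (by decide) (by norm_num),
    show (Finset.Icc (1 : ℤ) 5).erase 2 = {1, 3, 4, 5} from by decide]
  norm_num [h6, h7, h8, h9, h10, l6, l8, l10, tv_neg hs hs0, -mul_eq_mul_left_iff]
  field_simp
  ring

theorem tsum_bt_rank_three : ∑' n, bt s 3 7 n = mockTerm s 3 *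
    eulerT (tv s 1) (tv s 2) (tv s 3) (tv s 4) (tv s 5) + ((-lv s 5) + lv s 3 + (2/11)) +
    poch (s ^ 242) (s ^ 242) ^ 3 * ((tv s 1 / (tv s 3 * tv s 4)) - (tv s 2 * tv s 4 / (tv s 1 * tv s 3 * tv s 5)) + (1 / tv s 1) - (tv s 1 * tv s 5 / (tv s 2 * tv s 3 ^ 2))) := by
  obtain ⟨h6, h7, h8, h9, h10⟩ := tv_ten_eight_six hs hs0
  obtain ⟨l6, l8, l10⟩ := lv_six_eight_ten hs hs0
  obtain ⟨n1, n2, n3, n4, n5⟩ := tv_one_five_ne_zero hs hs0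
  rw [tsum_bt_rank hs hs0 (j := 3) (by decide) (by norm_num),
    show (Finset.Icc (1 : ℤ) 5).erase 3 = {1, 2, 4, 5} from by decide]
  norm_num [h6, h7, h8, h9, h10, l6, l8, l10, tv_neg hs hs0, -mul_eq_mul_left_iff]
  field_simp
  ring

theorem tsum_bt_rank_four : ∑' n, bt s 3 4 n = mockTerm s 4 *
    eulerT (tv s 1) (tv s 2) (tv s 3) (tv s 4) (tv s 5) + ((-lv s 3) + lv s 4 + (-1/11)) +
    poch (s ^ 242) (s ^ 242) ^ 3 * (-(tv s 1 * tv s 2 / (tv s 3 * tv s 4 * tv s 5)) + (1 / tv s 5) - (tv s 3 * tv s 5 / (tv s 1 * tv s 4 ^ 2)) + (tv s 5 / (tv s 2 * tv s 4))) := by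
  obtain ⟨h6, h7, h8, h9, h10⟩ := tv_ten_eight_six hs hs0
  obtain ⟨l6, l8, l10⟩ := lv_six_eight_ten hs hs0
  obtain ⟨n1, n2, n3, n4, n5⟩ := tv_one_five_ne_zero hs hs0
  rw [tsum_bt_rank hs hs0 (j := 4) (by decide) (by norm_num),
    show (Finset.Icc (1 : ℤ) 5).erase 4 = {1, 2, 3, 5} from by decide]
  norm_num [h6, h7, h8, h9, h10, l6, l8, l10, tv_neg hs hs0, -mul_eq_mul_left_iff]
  field_simp
  ring

theorem tsum_bt_crank_four : ∑' n, bt s 1 1 n = ((-lv s 3) - lv s 4 - (4/11)) +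
    poch (s ^ 242) (s ^ 242) ^ 3 * ((1 / tv s 4) - (tv s 2 * tv s 4 / (tv s 1 * tv s 3 * tv s 5)) + (tv s 4 ^ 2 / (tv s 2 ^ 2 * tv s 5)) - (tv s 5 / (tv s 1 * tv s 3)) + (tv s 4 / (tv s 2 * tv s 5))) := by
  obtain ⟨h6, h7, h8, h9, h10⟩ := tv_ten_eight_six hs hs0
  obtain ⟨l6, l8, l10⟩ := lv_six_eight_ten hs hs0
  obtain ⟨n1, n2, n3, n4, n5⟩ := tv_one_five_ne_zero hs hs0
  rw [tsum_bt_crank hs hs0 (j := 4) (by decide) (by norm_num),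
    show (Finset.Icc (1 : ℤ) 5).erase 4 = {1, 2, 3, 5} from by decide]
  norm_num [h6, h7, h8, h9, h10, l6, l8, l10, tv_neg hs hs0, -mul_eq_mul_left_iff]
  field_simp
  ring

theorem tsum_bt_crank_five : ∑' n, bt s 1 0 n = ((-lv s 1) - lv s 5 - (5/11)) +
    poch (s ^ 242) (s ^ 242) ^ 3 * (-(1 / tv s 5) + (tv s 2 / (tv s 1 * tv s 4)) - (tv s 5 / (tv s 2 * tv s 3)) + (tv s 5 ^ 2 / (tv s 2 * tv s 3 ^ 2)) - (tv s 3 * tv s 5 / (tv s 1 * tv s 2 * tv s 4))) := by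
  obtain ⟨h6, h7, h8, h9, h10⟩ := tv_ten_eight_six hs hs0
  obtain ⟨l6, l8, l10⟩ := lv_six_eight_ten hs hs0
  obtain ⟨n1, n2, n3, n4, n5⟩ := tv_one_five_ne_zero hs hs0
  rw [tsum_bt_crank hs hs0 (j := 5) (by decide) (by norm_num),
    show (Finset.Icc (1 : ℤ) 5).erase 5 = {1, 2, 3, 4} from by decide]
  norm_num [h6, h7, h8, h9, h10, l6, l8, l10, tv_neg hs hs0, -mul_eq_mul_left_iff]
  field_simp
  ring

theorem lambert_1_2_3 : lv s 1 + lv s 2 + lv s 3 + lv s 5 =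
    poch (s ^ 242) (s ^ 242) ^ 3 * -(tv s 4 / (tv s 1 * tv s 2)) := by
  obtain ⟨h6, h7, h8, h9, h10⟩ := tv_ten_eight_six hs hs0
  obtain ⟨l6, l8, l10⟩ := lv_six_eight_ten hs hs0
  obtain ⟨n1, n2, n3, n4, n5⟩ := tv_one_five_ne_zero hs hs0
  have h := lv_add_lv hs hs0 1 2 3 (by norm_num) (by norm_num) (by norm_num) (by norm_num)
    (by norm_num) (by norm_num)
  have l9 : lv s 9 = -lv s 2 := lv_sub_eleven hs hs0 (n := 2) (by norm_num)
  have l7 : lv s 7 = -lv s 4 := lv_sub_eleven hs hs0 (n := 4) (by norm_num)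
  have l16 : lv s 16 = lv s 5 := lv_add hs hs0 (n := 5) (by norm_num)
  have t13 : tv s 13 = -tv s 2 := tv_add hs hs0 2
  have t16 : tv s 16 = -tv s 5 := tv_add hs hs0 5
  norm_num [h6, h7, h8, h9, h10, l6, l7, l8, l9, l10, l16, t13, t16] at h
  have : (lv s 1 + lv s 2 + lv s 3 + lv s 5 : ℂ) = _ := (by ring : _ = _).trans h
  rw [this]
  field_simp

theorem lambert_1_2_6 : lv s 1 + 2 * lv s 2 - lv s 5 =
    poch (s ^ 242) (s ^ 242) ^ 3 * -(tv s 3 ^ 2 * tv s 4 / (tv s 1 * tv s 2 ^ 2 * tv s 5)) := by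
  obtain ⟨h6, h7, h8, h9, h10⟩ := tv_ten_eight_six hs hs0
  obtain ⟨l6, l8, l10⟩ := lv_six_eight_ten hs hs0
  obtain ⟨n1, n2, n3, n4, n5⟩ := tv_one_five_ne_zero hs hs0
  have h := lv_add_lv hs hs0 1 2 6 (by norm_num) (by norm_num) (by norm_num) (by norm_num)
    (by norm_num) (by norm_num)
  have l9 : lv s 9 = -lv s 2 := lv_sub_eleven hs hs0 (n := 2) (by norm_num)
  have l7 : lv s 7 = -lv s 4 := lv_sub_eleven hs hs0 (n := 4) (by norm_num)
  have l16 : lv s 16 = lv s 5 := lv_add hs hs0 (n := 5) (by norm_num)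
  have t13 : tv s 13 = -tv s 2 := tv_add hs hs0 2
  have t16 : tv s 16 = -tv s 5 := tv_add hs hs0 5
  norm_num [h6, h7, h8, h9, h10, l6, l7, l8, l9, l10, l16, t13, t16] at h
  have : (lv s 1 + 2 * lv s 2 - lv s 5 : ℂ) = _ := (by ring : _ = _).trans h
  rw [this]
  field_simp

theorem lambert_1_3_4 : lv s 1 + 2 * lv s 3 + lv s 4 =
    poch (s ^ 242) (s ^ 242) ^ 3 * -(tv s 4 * tv s 5 / (tv s 1 * tv s 3 ^ 2)) := by
  obtain ⟨h6, h7, h8, h9, h10⟩ := tv_ten_eight_six hs hs0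
  obtain ⟨l6, l8, l10⟩ := lv_six_eight_ten hs hs0
  obtain ⟨n1, n2, n3, n4, n5⟩ := tv_one_five_ne_zero hs hs0
  have h := lv_add_lv hs hs0 1 3 4 (by norm_num) (by norm_num) (by norm_num) (by norm_num)
    (by norm_num) (by norm_num)
  have l9 : lv s 9 = -lv s 2 := lv_sub_eleven hs hs0 (n := 2) (by norm_num)
  have l7 : lv s 7 = -lv s 4 := lv_sub_eleven hs hs0 (n := 4) (by norm_num)
  have l16 : lv s 16 = lv s 5 := lv_add hs hs0 (n := 5) (by norm_num)
  have t13 : tv s 13 = -tv s 2 := tv_add hs hs0 2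
  have t16 : tv s 16 = -tv s 5 := tv_add hs hs0 5
  norm_num [h6, h7, h8, h9, h10, l6, l7, l8, l9, l10, l16, t13, t16] at h
  have : (lv s 1 + 2 * lv s 3 + lv s 4 : ℂ) = _ := (by ring : _ = _).trans h
  rw [this]
  field_simp

theorem lambert_2_3_4 : 2 * lv s 2 + lv s 3 + lv s 4 =
    poch (s ^ 242) (s ^ 242) ^ 3 * -(tv s 5 ^ 2 / (tv s 2 ^ 2 * tv s 3)) := by
  obtain ⟨h6, h7, h8, h9, h10⟩ := tv_ten_eight_six hs hs0
  obtain ⟨l6, l8, l10⟩ := lv_six_eight_ten hs hs0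
  obtain ⟨n1, n2, n3, n4, n5⟩ := tv_one_five_ne_zero hs hs0
  have h := lv_add_lv hs hs0 2 3 4 (by norm_num) (by norm_num) (by norm_num) (by norm_num)
    (by norm_num) (by norm_num)
  have l9 : lv s 9 = -lv s 2 := lv_sub_eleven hs hs0 (n := 2) (by norm_num)
  have l7 : lv s 7 = -lv s 4 := lv_sub_eleven hs hs0 (n := 4) (by norm_num)
  have l16 : lv s 16 = lv s 5 := lv_add hs hs0 (n := 5) (by norm_num)
  have t13 : tv s 13 = -tv s 2 := tv_add hs hs0 2
  have t16 : tv s 16 = -tv s 5 := tv_add hs hs0 5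
  norm_num [h6, h7, h8, h9, h10, l6, l7, l8, l9, l10, l16, t13, t16] at h
  have : (2 * lv s 2 + lv s 3 + lv s 4 : ℂ) = _ := (by ring : _ = _).trans h
  rw [this]
  field_simp

theorem lambert_3_6_7 : lv s 3 - lv s 4 - 2 * lv s 5 =
    poch (s ^ 242) (s ^ 242) ^ 3 * -(tv s 1 * tv s 2 ^ 2 / (tv s 3 * tv s 4 * tv s 5 ^ 2)) := by
  obtain ⟨h6, h7, h8, h9, h10⟩ := tv_ten_eight_six hs hs0
  obtain ⟨l6, l8, l10⟩ := lv_six_eight_ten hs hs0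
  obtain ⟨n1, n2, n3, n4, n5⟩ := tv_one_five_ne_zero hs hs0
  have h := lv_add_lv hs hs0 3 6 7 (by norm_num) (by norm_num) (by norm_num) (by norm_num)
    (by norm_num) (by norm_num)
  have l9 : lv s 9 = -lv s 2 := lv_sub_eleven hs hs0 (n := 2) (by norm_num)
  have l7 : lv s 7 = -lv s 4 := lv_sub_eleven hs hs0 (n := 4) (by norm_num)
  have l16 : lv s 16 = lv s 5 := lv_add hs hs0 (n := 5) (by norm_num)
  have t13 : tv s 13 = -tv s 2 := tv_add hs hs0 2
  have t16 : tv s 16 = -tv s 5 := tv_add hs hs0 5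
  norm_num [h6, h7, h8, h9, h10, l6, l7, l8, l9, l10, l16, t13, t16] at h
  have : (lv s 3 - lv s 4 - 2 * lv s 5 : ℂ) = _ := (by ring : _ = _).trans h
  rw [this]
  field_simp

theorem line_0 : -2 * (∑' n, bt s 3 10 n) + 2 * (∑' n, bt s 3 13 n) + 4 * (∑' n, bt s 3 7 n) + 3 * (∑' n, bt s 3 4 n) + 6 * (∑' n, bt s 1 0 n) - 2 * (∑' n, bt s 1 1 n) + 1 =
    (-2 * mockTerm s 2 + 2 * mockTerm s 1 + 4 * mockTerm s 3 + 3 * mockTerm s 4) *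
    eulerT (tv s 1) (tv s 2) (tv s 3) (tv s 4) (tv s 5) + poch (s ^ 242) (s ^ 242) ^ 3 *
    thetaPart0 (tv s 1) (tv s 2) (tv s 3) (tv s 4) (tv s 5) := by
  rw [tsum_bt_rank_one hs hs0, tsum_bt_rank_two hs hs0, tsum_bt_rank_three hs hs0, tsum_bt_rank_four hs hs0, tsum_bt_crank_four hs hs0, tsum_bt_crank_five hs hs0, thetaPart0]
  linear_combination -6 * lambert_1_2_3 hs hs0 + 2 * lambert_1_3_4 hs hs0 + 3 * lambert_2_3_4 hs hs0 + 2 * lambert_3_6_7 hs hs0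

theorem line_1 : -5 * (∑' n, bt s 3 10 n) - 6 * (∑' n, bt s 3 13 n) - 12 * (∑' n, bt s 3 7 n) - 9 * (∑' n, bt s 3 4 n) - 1 * (∑' n, bt s 1 0 n) - 7 * (∑' n, bt s 1 1 n) + 5 =
    (-5 * mockTerm s 2 - 6 * mockTerm s 1 - 12 * mockTerm s 3 - 9 * mockTerm s 4) *
    eulerT (tv s 1) (tv s 2) (tv s 3) (tv s 4) (tv s 5) + poch (s ^ 242) (s ^ 242) ^ 3 *
    thetaPart1 (tv s 1) (tv s 2) (tv s 3) (tv s 4) (tv s 5) := by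
  rw [tsum_bt_rank_one hs hs0, tsum_bt_rank_two hs hs0, tsum_bt_rank_three hs hs0, tsum_bt_rank_four hs hs0, tsum_bt_crank_four hs hs0, tsum_bt_crank_five hs hs0, thetaPart1]
  linear_combination 9 * lambert_1_2_3 hs hs0 - 10 * lambert_1_2_6 hs hs0 - 4 * lambert_1_3_4 hs hs0 + 3 * lambert_3_6_7 hs hs0

theorem line_2 : 12 * (∑' n, bt s 3 10 n) + 10 * (∑' n, bt s 3 13 n) + 9 * (∑' n, bt s 3 7 n) + 4 * (∑' n, bt s 3 4 n) - 12 * (∑' n, bt s 1 0 n) + 4 * (∑' n, bt s 1 1 n) - 18 =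
    (12 * mockTerm s 2 + 10 * mockTerm s 1 + 9 * mockTerm s 3 + 4 * mockTerm s 4) *
    eulerT (tv s 1) (tv s 2) (tv s 3) (tv s 4) (tv s 5) + poch (s ^ 242) (s ^ 242) ^ 3 *
    thetaPart2 (tv s 1) (tv s 2) (tv s 3) (tv s 4) (tv s 5) := by
  rw [tsum_bt_rank_one hs hs0, tsum_bt_rank_two hs hs0, tsum_bt_rank_three hs hs0, tsum_bt_rank_four hs hs0, tsum_bt_crank_four hs hs0, tsum_bt_crank_five hs hs0, thetaPart2]
  linear_combination 15 * lambert_1_2_6 hs hs0 + 7 * lambert_1_3_4 hs hs0 - 4 * lambert_2_3_4 hs hs0 - 9 * lambert_3_6_7 hs hs0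

theorem line_3 : -4 * (∑' n, bt s 3 10 n) - 7 * (∑' n, bt s 3 13 n) - 3 * (∑' n, bt s 3 7 n) + 6 * (∑' n, bt s 3 4 n) + 8 =
    (-4 * mockTerm s 2 - 7 * mockTerm s 1 - 3 * mockTerm s 3 + 6 * mockTerm s 4) *
    eulerT (tv s 1) (tv s 2) (tv s 3) (tv s 4) (tv s 5) + poch (s ^ 242) (s ^ 242) ^ 3 *
    thetaPart3 (tv s 1) (tv s 2) (tv s 3) (tv s 4) (tv s 5) := by
  rw [tsum_bt_rank_one hs hs0, tsum_bt_rank_two hs hs0, tsum_bt_rank_three hs hs0, tsum_bt_rank_four hs hs0, thetaPart3]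
  linear_combination -5 * lambert_1_2_3 hs hs0 - 2 * lambert_1_2_6 hs hs0 - 1 * lambert_2_3_4 hs hs0 - 3 * lambert_3_6_7 hs hs0

end

section

variable {s : ℂ} (hs : ‖s‖ < 1) (hs0 : s ≠ 0)
include hs hs0

/-- The `11`-dissection of Euler's product. -/
theorem euler_dissection : poch (s ^ 2) (s ^ 2) = s ^ 10 * poch (s ^ 242) (s ^ 242) *
    eulerT (tv s 1) (tv s 2) (tv s 3) (tv s 4) (tv s 5) := by
  have hP := norm_pow_lt_one hs (k := 242) (by norm_num)
  have hP0 : s ^ 242 ≠ 0 := pow_ne_zero _ hs0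
  have hq := norm_pow_lt_one hs (k := 2) (by norm_num)
  have hq0 : s ^ 2 ≠ 0 := pow_ne_zero _ hs0
  have hsum := summable_tau hq hq0 (k := 3) (by norm_num) 2 (x := 1) one_ne_zero
  have key : ∀ a m : ℤ, gc (s ^ 2) 3 1 (11 * m + (2 + a)) * (s ^ 2) ^ (-(2 * (11 * m + (2 + a)))) =
      (-1) ^ a * s ^ (3 * a ^ 2 + 11 * a + 10) * (gc (s ^ 242) 3 (s ^ (66 * a)) m *
        (s ^ 242) ^ (-(1 * m))) := by
    intro a m
    have e1 : (-s ^ (66 * a) : ℂ) ^ m = (-1) ^ m * s ^ (66 * a * m) := by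
      rw [← neg_one_mul, mul_zpow, ← zpow_mul]
    have e2 : ((-1 : ℂ) ^ (11 * m + (2 + a))) = (-1) ^ a * (-1) ^ m := by
      rw [zpow_add₀ (by norm_num), zpow_mul, zpow_add₀ (by norm_num)]; norm_num [mul_comm]
    have e4 : (s ^ 242) ^ (((3 : ℕ) : ℤ) * tri m) = s ^ (363 * (m * (m + 1))) := by
      rw [← zpow_natCast s, ← zpow_mul, ← two_mul_tri]; congr 1; push_cast; ring
    have e5 : (s ^ 2) ^ (((3 : ℕ) : ℤ) * tri (11 * m + (2 + a))) *
        (s ^ 2) ^ (-(2 * (11 * m + (2 + a)))) =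
        s ^ (3 * a ^ 2 + 11 * a + 10) * (s ^ (66 * a * m) * s ^ (363 * (m * (m + 1))) *
          (s ^ 242) ^ (-(1 * m))) := by
      rw [← zpow_natCast s, ← zpow_natCast s, ← zpow_mul, ← zpow_mul, ← zpow_mul, ← zpow_add₀ hs0,
        ← zpow_add₀ hs0, ← zpow_add₀ hs0, ← zpow_add₀ hs0]
      congr 1
      have := two_mul_tri (11 * m + (2 + a))
      push_cast
      linear_combination 3 * this
    rw [gc, gc, e1, e2, e4]
    linear_combination ((-1) ^ a * (-1) ^ m) * e5
  have hpair : ∀ a ∈ Finset.Icc (1 : ℤ) 5,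
      ((-1) ^ a * s ^ (3 * a ^ 2 + 11 * a + 10) * tau (s ^ 242) 3 1 (s ^ (66 * a)) +
      (-1) ^ (-a) * s ^ (3 * (-a) ^ 2 + 11 * -a + 10) * tau (s ^ 242) 3 1 (s ^ (66 * -a))) =
      s ^ 10 * poch (s ^ 242) (s ^ 242) * ((-1) ^ a * (tv s (2 * a) / tv s a)) := by
    intro a ha
    have ha := Finset.mem_Icc.1 ha
    have e1 : (s ^ (22 * a)) ^ 2 = s ^ (22 * (2 * a)) := by
      rw [← zpow_natCast, ← zpow_mul]; congr 1; ring
    have e3 : (s ^ (22 * a)) ^ 3 = s ^ (66 * a) := by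
      rw [← zpow_natCast, ← zpow_mul]; congr 1; push_cast; ring
    have h := rank_coeff hP hP0 (z := s ^ (22 * a)) (zpow_ne_zero _ hs0)
      (by rw [lat_zpow hs hs0]; omega) (by rw [e1, lat_zpow hs hs0]; omega)
    rw [e1, e3, theta_eq_tv hs0, theta_eq_tv hs0] at h
    have t1 : tau (s ^ 242) 3 1 (s ^ (66 * a)) = tau (s ^ 242) 3 2 (s ^ (66 * a))⁻¹ := by
      rw [tau_inv hP0]; norm_num
    have t2 : tau (s ^ 242) 3 1 (s ^ (66 * -a)) = tau (s ^ 242) 3 2 (s ^ (66 * a)) := by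
      rw [mul_neg, zpow_neg, tau_inv hP0]; norm_num
    have m1 : ((-1 : ℂ)) ^ (-a) = (-1) ^ a := by
      rw [zpow_neg, ← inv_zpow]; norm_num
    have k1 : s ^ (3 * a ^ 2 + 11 * a + 10) = s ^ (3 * a ^ 2 - 33 * a + 10) * s ^ (22 * (2 * a)) := by
      rw [← zpow_add₀ hs0]; congr 1; ring
    have k2 : s ^ (3 * (-a) ^ 2 + 11 * -a + 10) = s ^ (3 * a ^ 2 - 33 * a + 10) * s ^ (22 * a) := by
      rw [← zpow_add₀ hs0]; congr 1; ring
    have k3 : s ^ (3 * a ^ 2 - 33 * a + 10) * (s ^ (22 * a) * s ^ (-(2 * a * (2 * a - 11))) /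
        s ^ (-(a * (a - 11)))) = s ^ 10 := by
      rw [← zpow_natCast s 10, ← zpow_add₀ hs0, ← zpow_sub₀ hs0, ← zpow_add₀ hs0]
      congr 1; push_cast; ring
    rw [t1, t2, m1, k1, k2]
    linear_combination ((-1) ^ a * s ^ (3 * a ^ 2 - 33 * a + 10)) * h +
      ((-1) ^ a * poch (s ^ 242) (s ^ 242) * (tv s (2 * a) / tv s a)) * k3
  rw [← tau_three_two_one hq hq0, tau, tsum_residues hsum (2 + -5)]
  simp only [add_assoc (2 : ℤ)]
  simp only [key, tsum_mul_left]
  rw [sum_fin_eleven_symm (fun a => (-1) ^ a * s ^ (3 * a ^ 2 + 11 * a + 10) *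
      ∑' m : ℤ, gc (s ^ 242) 3 (s ^ (66 * a)) m * (s ^ 242) ^ (-(1 * m)))]
  have := Finset.sum_congr rfl hpair
  simp only [tau] at this
  rw [this, ← Finset.mul_sum, eulerT_eq_sum hs hs0]
  have h0 : tau (s ^ 242) 3 1 1 = poch (s ^ 242) (s ^ 242) := by
    have := tau_inv (P := s ^ 242) hP0 3 2 (x := 1)
    norm_num at this
    rw [← this, tau_three_two_one hP hP0]
  simp only [tau] at h0
  norm_num [h0]
  norm_num at h0
  rw [h0]
  norm_cast
  ring

end

section

theorem sum_root_pow {ζ : ℂ} (hζ : IsPrimitiveRoot ζ 11) (k : ℕ) :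
    ∑ i ∈ Finset.range 11, (ζ ^ i) ^ k = if 11 ∣ k then 11 else 0 := by
  have h : ∀ i, (ζ ^ i) ^ k = (ζ ^ k) ^ i := fun i => by rw [← pow_mul, ← pow_mul, mul_comm]
  simp only [h]
  split_ifs with hk
  · have : ζ ^ k = 1 := hζ.pow_eq_one_iff_dvd k |>.mpr hk
    simp [this]
  · have hc : Nat.Coprime k 11 :=
      ((Nat.Prime.coprime_iff_not_dvd (by norm_num)).mpr hk).symm
    exact (hζ.pow_of_coprime k hc).geom_sum_eq_zero (by norm_num)

/-- Extraction of the terms with index `7` modulo `11` from a power series whose values at the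
eleven rotations of a point are known. -/
theorem hasSum_residue_seven {D : ℕ → ℂ} {s a b c d : ℂ} {g : Fin 11 → ℂ}
    (h : ∀ η : ℂ, η ^ 11 = 1 → HasSum (fun n => D n * (η * s) ^ (2 * n))
      (η ^ 9 * a + b + η ^ 7 * c + η ^ 8 * d + ∑ r : Fin 11, (η ^ 2) ^ (r : ℕ) * g r)) :
    HasSum (fun m => D (11 * m + 7) * s ^ (2 * (11 * m + 7))) (g 7) := by
  obtain ⟨ζ, hζ⟩ : ∃ ζ : ℂ, IsPrimitiveRoot ζ 11 :=
    ⟨_, Complex.isPrimitiveRoot_exp 11 (by norm_num)⟩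
  have key := sum_root_pow hζ
  have H := hasSum_sum (s := Finset.range 11) fun i _ =>
    (h (ζ ^ i) (by rw [← pow_mul, mul_comm, pow_mul, hζ.pow_eq_one, one_pow])).mul_left
      ((ζ ^ i) ^ 8)
  have hl : ∀ n, ∑ i ∈ Finset.range 11, (ζ ^ i) ^ 8 * (D n * (ζ ^ i * s) ^ (2 * n)) =
      if 11 ∣ 8 + 2 * n then 11 * (D n * s ^ (2 * n)) else 0 := by
    intro n
    have : ∀ i ∈ Finset.range 11, (ζ ^ i) ^ 8 * (D n * (ζ ^ i * s) ^ (2 * n)) =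
        (D n * s ^ (2 * n)) * (ζ ^ i) ^ (8 + 2 * n) := fun i _ => by rw [mul_pow, pow_add]; ring
    rw [Finset.sum_congr rfl this, ← Finset.mul_sum, key]
    split_ifs <;> ring
  have hr : ∑ i ∈ Finset.range 11, (ζ ^ i) ^ 8 * ((ζ ^ i) ^ 9 * a + b + (ζ ^ i) ^ 7 * c +
      (ζ ^ i) ^ 8 * d + ∑ r : Fin 11, ((ζ ^ i) ^ 2) ^ (r : ℕ) * g r) = 11 * g 7 := by
    have e : ∀ i ∈ Finset.range 11, (ζ ^ i) ^ 8 * ((ζ ^ i) ^ 9 * a + b + (ζ ^ i) ^ 7 * c +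
      (ζ ^ i) ^ 8 * d + ∑ r : Fin 11, ((ζ ^ i) ^ 2) ^ (r : ℕ) * g r) =
        (ζ ^ i) ^ 17 * a + (ζ ^ i) ^ 8 * b + (ζ ^ i) ^ 15 * c + (ζ ^ i) ^ 16 * d +
        ∑ r : Fin 11, (ζ ^ i) ^ (8 + 2 * (r : ℕ)) * g r := by
      intro i _
      have : ∀ r : Fin 11, (ζ ^ i) ^ (8 + 2 * (r : ℕ)) * g r =
          (ζ ^ i) ^ 8 * (((ζ ^ i) ^ 2) ^ (r : ℕ) * g r) := fun r => by
        rw [pow_add, pow_mul]; ring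
      simp only [this, ← Finset.mul_sum]
      ring
    rw [Finset.sum_congr rfl e]
    simp only [Finset.sum_add_distrib, ← Finset.sum_mul]
    rw [Finset.sum_comm]
    simp only [← Finset.sum_mul, key]
    simp [Fin.sum_univ_succ]
  simp only [hl, hr] at H
  have inj : Function.Injective fun m : ℕ => 11 * m + 7 := fun m n h => by
    simp only at h; omega
  have H2 := (inj.hasSum_iff (f := fun n => if 11 ∣ 8 + 2 * n then 11 * (D n * s ^ (2 * n)) else 0)
    (a := 11 * g 7) (fun n hn => by
      rw [if_neg]
      intro hd
      apply hn
      exact ⟨n / 11, by simp only; omega⟩)).mpr H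
  have e : ((fun n => if 11 ∣ 8 + 2 * n then 11 * (D n * s ^ (2 * n)) else 0) ∘
      fun m : ℕ => 11 * m + 7) = fun m => 11 * (D (11 * m + 7) * s ^ (2 * (11 * m + 7))) := by
    funext m
    simp only [Function.comp]
    rw [if_pos (by omega)]
  rw [e] at H2
  exact (hasSum_mul_left_iff (by norm_num : (11 : ℂ) ≠ 0)).mp H2

section
variable {s η : ℂ} (hη : η ^ 11 = 1)
include hη

theorem root_ne_zero : η ≠ 0 := by rintro rfl; norm_num at hη

theorem root_zpow_mul (k : ℤ) : η ^ (11 * k) = 1 := by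
  rw [zpow_mul]; norm_cast; rw [hη]; simp

theorem root_pow_period : (η * s) ^ 242 = s ^ 242 := by
  rw [mul_pow, show η ^ 242 = (η ^ 11) ^ 22 by ring, hη]; simp

theorem root_zpow_period (n : ℤ) : (η * s) ^ (22 * n) = s ^ (22 * n) := by
  rw [mul_zpow, show 22 * n = 11 * (2 * n) by ring, root_zpow_mul hη, one_mul]

theorem tv_root (n : ℤ) : tv (η * s) n = η ^ (n ^ 2) * tv s n := by
  have h0 := root_ne_zero hη
  rw [tv, tv, root_pow_period hη, root_zpow_period hη, mul_zpow,
    show n * (n - 11) = n ^ 2 + 11 * (-n) by ring, zpow_add₀ h0, root_zpow_mul hη]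
  ring

theorem mockTerm_root (j : ℤ) : mockTerm (η * s) j = η ^ (-3 * j ^ 2) * mockTerm s j := by
  have h0 := root_ne_zero hη
  have e : ((3 : ℕ) : ℤ) * (11 * j - j ^ 2) = -3 * j ^ 2 + 11 * (3 * j) := by push_cast; ring
  rw [mockTerm, mockTerm, root_pow_period hη, root_zpow_period hη, mul_zpow, e, zpow_add₀ h0,
    root_zpow_mul hη]
  ring

theorem root_zpow_congr {a : ℤ} {b : ℕ} (k : ℤ) (h : a = b + 11 * k) : η ^ a = η ^ b := by
  rw [h, zpow_add₀ (root_ne_zero hη), root_zpow_mul hη, mul_one, zpow_natCast]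

end

/-- The contribution of the theta quotients to a combination of rank and crank generating
functions. -/
theorem quotient_eq {s : ℂ} (hs : ‖s‖ < 1) (hs0 : s ≠ 0) {T : ℂ} {S x u y z : ℂ}
    (he : eulerT (tv s 1) (tv s 2) (tv s 3) (tv s 4) (tv s 5) ≠ 0)
    (C : Coord (tv s 1) (tv s 2) (tv s 3) (tv s 4) (tv s 5) x u y z)
    (h : eulerT (tv s 1) (tv s 2) (tv s 3) (tv s 4) (tv s 5) * S =
      (x ^ 2 * y - 3 * x ^ 3 - 4 * x * y + 2 * x ^ 2 + y) *
      (tv s 1 * tv s 2 * tv s 4 ^ 8 / (tv s 3 * tv s 5 ^ 8 * x * u) * T)) :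
    poch (s ^ 242) (s ^ 242) ^ 2 * T / eulerT (tv s 1) (tv s 2) (tv s 3) (tv s 4) (tv s 5) =
      poch (s ^ 242) (s ^ 242) ^ 14 * tv s 5 ^ 4 /
        (s ^ 242 * tv s 1 * tv s 2 ^ 3 * tv s 3 ^ 3 * tv s 4 ^ 10) * S := by
  obtain ⟨hx, hu, -, -⟩ := C.ne
  have hd := tv_disc hs hs0 C
  obtain ⟨⟨h1, h2, h3, h4, h5, -, -, -⟩, -, -, -, -, -, -, -⟩ := C
  have hJ : poch (s ^ 242) (s ^ 242) ≠ 0 :=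
    poch_self_ne_zero (norm_pow_lt_one hs (by norm_num)) (pow_ne_zero _ hs0)
  generalize poch (s ^ 242) (s ^ 242) = J at *
  generalize eulerT (tv s 1) (tv s 2) (tv s 3) (tv s 4) (tv s 5) = e at *
  generalize (x ^ 2 * y - 3 * x ^ 3 - 4 * x * y + 2 * x ^ 2 + y) = d at *
  generalize tv s 1 = t1 at *
  generalize tv s 2 = t2 at *
  generalize tv s 3 = t3 at *
  generalize tv s 4 = t4 at *
  generalize tv s 5 = t5 at *
  have hq0 : s ^ 242 ≠ 0 := pow_ne_zero _ hs0
  generalize s ^ 242 = q at *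
  have hd2 : d = t2 ^ 2 * t3 ^ 4 * t4 ^ 2 * t5 ^ 4 * q * (x * u) / J ^ 12 := by
    rw [eq_div_iff (pow_ne_zero _ hJ), hd]; ring
  have hS : S = d * (t1 * t2 * t4 ^ 8 / (t3 * t5 ^ 8 * x * u) * T) / e := by
    rw [eq_div_iff he, ← h]; ring
  rw [hS, hd2]
  field_simp

/-- Extraction of the residue class `7` modulo `11` from a combination of generating functions. -/
theorem hasSum_line {D : ℕ → ℂ} {W : ℂ → ℂ} {c1 c2 c3 c4 s : ℂ}
    {T : ℂ → ℂ → ℂ → ℂ → ℂ → ℂ} {comp : ℂ → ℂ → ℂ → ℂ → Fin 11 → ℂ}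
    (hT : ∀ {t1 t2 t3 t4 t5 x u y z : ℂ}, Coord t1 t2 t3 t4 t5 x u y z →
      eulerT t1 t2 t3 t4 t5 * ∑ r : Fin 11, (t4 / t5) ^ (r : ℕ) * comp x u y z r =
      (x ^ 2 * y - 3 * x ^ 3 - 4 * x * y + 2 * x ^ 2 + y) *
      (t1 * t2 * t4 ^ 8 / (t3 * t5 ^ 8 * x * u) * T t1 t2 t3 t4 t5))
    (hs : ‖s‖ < 1) (hs0 : s ≠ 0)
    (hD : ∀ v : ℂ, ‖v‖ = ‖s‖ → HasSum (fun n => D n * v ^ (2 * n)) (W v))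
    (hW : ∀ v : ℂ, ‖v‖ = ‖s‖ → W v * poch (v ^ 2) (v ^ 2) =
      (c2 * mockTerm v 2 + c1 * mockTerm v 1 + c3 * mockTerm v 3 + c4 * mockTerm v 4) *
        eulerT (tv v 1) (tv v 2) (tv v 3) (tv v 4) (tv v 5) + poch (v ^ 242) (v ^ 242) ^ 3 *
        T (tv v 1) (tv v 2) (tv v 3) (tv v 4) (tv v 5) - c1 * (v ^ 2)⁻¹ * poch (v ^ 2) (v ^ 2))
    {x u y z : ℂ} (C : Coord (tv s 1) (tv s 2) (tv s 3) (tv s 4) (tv s 5) x u y z) :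
    HasSum (fun m => D (11 * m + 7) * s ^ (2 * (11 * m + 7)))
      (poch (s ^ 242) (s ^ 242) ^ 14 /
        (s ^ 252 * tv s 1 * tv s 2 ^ 3 * tv s 3 ^ 3 * tv s 4 ^ 3 * tv s 5 ^ 3) *
        comp x u y z 7) := by
  obtain ⟨⟨h1, h2, h3, h4, h5, -, -, -⟩, ex, eu, ey, ez, -, -, -⟩ := id C
  have hJ : poch (s ^ 242) (s ^ 242) ≠ 0 :=
    poch_self_ne_zero (norm_pow_lt_one hs (by norm_num)) (pow_ne_zero _ hs0)
  have H := hasSum_residue_seven (D := D) (s := s)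
    (a := c1 * mockTerm s 1 / (s ^ 10 * poch (s ^ 242) (s ^ 242)) - c1 * (s ^ 2)⁻¹)
    (b := c2 * mockTerm s 2 / (s ^ 10 * poch (s ^ 242) (s ^ 242)))
    (c := c3 * mockTerm s 3 / (s ^ 10 * poch (s ^ 242) (s ^ 242)))
    (d := c4 * mockTerm s 4 / (s ^ 10 * poch (s ^ 242) (s ^ 242)))
    (g := fun r => poch (s ^ 242) (s ^ 242) ^ 14 * tv s 5 ^ 4 /
        (s ^ 252 * tv s 1 * tv s 2 ^ 3 * tv s 3 ^ 3 * tv s 4 ^ 10) *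
        ((tv s 4 / tv s 5) ^ (r : ℕ) * comp x u y z r)) (fun η hη => ?_)
  · convert H using 1
    rw [show ((7 : Fin 11) : ℕ) = 7 from rfl, div_pow]
    field_simp
  · have hη0 := root_ne_zero hη
    have hn : ‖η * s‖ = ‖s‖ := by
      have : ‖η‖ ^ 11 = 1 := by rw [← norm_pow, hη, norm_one]
      rw [norm_mul, (pow_eq_one_iff_of_nonneg (norm_nonneg _) (by norm_num)).mp this, one_mul]
    have hv : ‖η * s‖ < 1 := by rw [hn]; exact hs
    have hv0 : η * s ≠ 0 := mul_ne_zero hη0 hs0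
    have hE0 : poch ((η * s) ^ 2) ((η * s) ^ 2) ≠ 0 :=
      poch_self_ne_zero (norm_pow_lt_one hv (by norm_num)) (pow_ne_zero _ hv0)
    have hE := euler_dissection hv hv0
    have he : eulerT (tv (η * s) 1) (tv (η * s) 2) (tv (η * s) 3) (tv (η * s) 4) (tv (η * s) 5)
        ≠ 0 := fun h0 => hE0 (by rw [hE, h0, mul_zero])
    have e1 : tv (η * s) 1 = η * tv s 1 := by
      rw [tv_root hη, root_zpow_congr hη (b := 1) 0 (by norm_num), pow_one]
    have e2 : tv (η * s) 2 = η ^ 4 * tv s 2 := by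
      rw [tv_root hη, root_zpow_congr hη (b := 4) 0 (by norm_num)]
    have e3 : tv (η * s) 3 = η ^ 9 * tv s 3 := by
      rw [tv_root hη, root_zpow_congr hη (b := 9) 0 (by norm_num)]
    have e4 : tv (η * s) 4 = η ^ 5 * tv s 4 := by
      rw [tv_root hη, root_zpow_congr hη (b := 5) 1 (by norm_num)]
    have e5 : tv (η * s) 5 = η ^ 3 * tv s 5 := by
      rw [tv_root hη, root_zpow_congr hη (b := 3) 2 (by norm_num)]
    have C' : Coord (tv (η * s) 1) (tv (η * s) 2) (tv (η * s) 3) (tv (η * s) 4) (tv (η * s) 5)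
        x u y z := by
      have := (thetaRel_tv hv hv0).coord
      convert this using 1
      · rw [ex, e1, e2, e3, e4, e5]
        field_simp
        exact hη.symm
      · rw [eu, e1, e3, e4, e5]
        field_simp
      · rw [ey, e1, e2, e3, e5]
        field_simp
        exact hη.symm
      · rw [ez, e1, e2, e4, e5]
        field_simp
        exact hη.symm
    have hq := quotient_eq hv hv0 he C' (hT C')
    have hWv : W (η * s) = _ := eq_div_of_mul_eq hE0 (hW _ hn)
    have m1 : mockTerm (η * s) 1 = η ^ 8 * mockTerm s 1 := by
      rw [mockTerm_root hη, root_zpow_congr hη (b := 8) (-1) (by norm_num)]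
    have m2 : mockTerm (η * s) 2 = η ^ 10 * mockTerm s 2 := by
      rw [mockTerm_root hη, root_zpow_congr hη (b := 10) (-2) (by norm_num)]
    have m3 : mockTerm (η * s) 3 = η ^ 6 * mockTerm s 3 := by
      rw [mockTerm_root hη, root_zpow_congr hη (b := 6) (-3) (by norm_num)]
    have m4 : mockTerm (η * s) 4 = η ^ 7 * mockTerm s 4 := by
      rw [mockTerm_root hη, root_zpow_congr hη (b := 7) (-5) (by norm_num)]
    have hS : ∑ r : Fin 11, (η ^ 2) ^ (r : ℕ) * (poch (s ^ 242) (s ^ 242) ^ 14 * tv s 5 ^ 4 /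
        (s ^ 252 * tv s 1 * tv s 2 ^ 3 * tv s 3 ^ 3 * tv s 4 ^ 10) *
        ((tv s 4 / tv s 5) ^ (r : ℕ) * comp x u y z r)) =
        poch ((η * s) ^ 242) ((η * s) ^ 242) ^ 14 * tv (η * s) 5 ^ 4 /
        ((η * s) ^ 242 * tv (η * s) 1 * tv (η * s) 2 ^ 3 * tv (η * s) 3 ^ 3 *
          tv (η * s) 4 ^ 10) *
        (∑ r : Fin 11, (tv (η * s) 4 / tv (η * s) 5) ^ (r : ℕ) * comp x u y z r) /
        (η * s) ^ 10 := by
      rw [mul_div_right_comm (poch ((η * s) ^ 242) ((η * s) ^ 242) ^ 14 * tv (η * s) 5 ^ 4 / _),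
        Finset.mul_sum]
      refine Finset.sum_congr rfl fun r _ => ?_
      have hr : tv (η * s) 4 / tv (η * s) 5 = η ^ 2 * (tv s 4 / tv s 5) := by
        rw [e4, e5]; field_simp
      have hp : poch ((η * s) ^ 242) ((η * s) ^ 242) ^ 14 * tv (η * s) 5 ^ 4 /
          ((η * s) ^ 242 * tv (η * s) 1 * tv (η * s) 2 ^ 3 * tv (η * s) 3 ^ 3 *
            tv (η * s) 4 ^ 10) / (η * s) ^ 10 = poch (s ^ 242) (s ^ 242) ^ 14 * tv s 5 ^ 4 /
          (s ^ 252 * tv s 1 * tv s 2 ^ 3 * tv s 3 ^ 3 * tv s 4 ^ 10) := by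
        rw [root_pow_period hη, e1, e2, e3, e4, e5]
        have h88 : η ^ 88 = 1 := by rw [show η ^ 88 = (η ^ 11) ^ 8 by ring, hη, one_pow]
        generalize poch (s ^ 242) (s ^ 242) = J
        field_simp
        rw [h88, mul_one]
      rw [hr, hp, mul_pow]
      ring
    rw [hS, ← hq]
    convert hD _ hn using 1
    rw [hWv, hE, m1, m2, m3, m4]
    generalize eulerT (tv (η * s) 1) (tv (η * s) 2) (tv (η * s) 3) (tv (η * s) 4)
      (tv (η * s) 5) = e at *
    generalize T (tv (η * s) 1) (tv (η * s) 2) (tv (η * s) 3) (tv (η * s) 4)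
      (tv (η * s) 5) = T' at *
    rw [root_pow_period hη]
    generalize poch (s ^ 242) (s ^ 242) = J at *
    generalize mockTerm s 1 = M1
    generalize mockTerm s 2 = M2
    generalize mockTerm s 3 = M3
    generalize mockTerm s 4 = M4
    rw [sub_div, mul_div_assoc (c1 * ((η * s) ^ 2)⁻¹), div_self
      (mul_ne_zero (mul_ne_zero (pow_ne_zero _ hv0) hJ) he), mul_one]
    have hi2 : ((η * s) ^ 2)⁻¹ = η ^ 9 * (s ^ 2)⁻¹ := by
      rw [inv_eq_iff_eq_inv]; field_simp; rw [hη]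
    have hi10 : ((η * s) ^ 10)⁻¹ = η * (s ^ 10)⁻¹ := by
      rw [inv_eq_iff_eq_inv]; field_simp; rw [hη]
    have hsplit : ((c2 * (η ^ 10 * M2) + c1 * (η ^ 8 * M1) + c3 * (η ^ 6 * M3) +
        c4 * (η ^ 7 * M4)) * e + J ^ 3 * T') / ((η * s) ^ 10 * J * e) =
        (c2 * (η ^ 10 * M2) + c1 * (η ^ 8 * M1) + c3 * (η ^ 6 * M3) +
        c4 * (η ^ 7 * M4)) * ((η * s) ^ 10)⁻¹ / J + J ^ 2 * T' / e * ((η * s) ^ 10)⁻¹ := by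
      generalize η * s = w at *
      field_simp
    rw [hsplit, hi2, div_eq_mul_inv _ ((η * s) ^ 10), hi10]
    simp only [div_eq_mul_inv, mul_inv]
    linear_combination (-(c2 * M2 * (s ^ 10)⁻¹ * J⁻¹)) * hη

end

/-- A function on the open unit disc given by a power series with nonnegative coefficients. -/
def NonnegSeries (f : ℂ → ℂ) : Prop :=
  ∃ c : ℕ → ℝ, (∀ n, 0 ≤ c n) ∧ ∀ Q : ℂ, ‖Q‖ < 1 → HasSum (fun n => (c n : ℂ) * Q ^ n) (f Q)

namespace NonnegSeries

theorem congr {f g : ℂ → ℂ} (hf : NonnegSeries f) (h : ∀ Q : ℂ, ‖Q‖ < 1 → f Q = g Q) :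
    NonnegSeries g := by
  obtain ⟨c, hc, H⟩ := hf
  exact ⟨c, hc, fun Q hQ => h Q hQ ▸ H Q hQ⟩

theorem monomial {a : ℝ} (ha : 0 ≤ a) (k : ℕ) : NonnegSeries fun Q => a * Q ^ k := by
  refine ⟨fun n => if n = k then a else 0, fun n => by dsimp only; split_ifs <;> simp [ha], fun Q _ => ?_⟩
  convert hasSum_single k (f := fun n => (((if n = k then a else 0 : ℝ) : ℂ)) * Q ^ n) ?_ using 1
  · simp
  · intro n hn; simp [hn]

theorem one : NonnegSeries fun _ => 1 :=
  (monomial zero_le_one 0).congr fun Q _ => by simp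

theorem add {f g : ℂ → ℂ} (hf : NonnegSeries f) (hg : NonnegSeries g) :
    NonnegSeries fun Q => f Q + g Q := by
  obtain ⟨c, hc, H⟩ := hf
  obtain ⟨d, hd, K⟩ := hg
  refine ⟨fun n => c n + d n, fun n => add_nonneg (hc n) (hd n), fun Q hQ => ?_⟩
  convert (H Q hQ).add (K Q hQ) using 2
  push_cast; ring

theorem mul {f g : ℂ → ℂ} (hf : NonnegSeries f) (hg : NonnegSeries g) :
    NonnegSeries fun Q => f Q * g Q := by
  obtain ⟨c, hc, H⟩ := hf
  obtain ⟨d, hd, K⟩ := hg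
  refine ⟨fun n => ∑ kl ∈ Finset.HasAntidiagonal.antidiagonal n, c kl.1 * d kl.2,
    fun n => Finset.sum_nonneg fun kl _ => mul_nonneg (hc _) (hd _), fun Q hQ => ?_⟩
  have h1 := (H Q hQ).summable.norm
  have h2 := (K Q hQ).summable.norm
  have e : ∀ n, ((∑ kl ∈ Finset.HasAntidiagonal.antidiagonal n, c kl.1 * d kl.2 : ℝ) : ℂ) * Q ^ n =
      ∑ kl ∈ Finset.HasAntidiagonal.antidiagonal n, ((c kl.1 : ℂ) * Q ^ kl.1) * ((d kl.2 : ℂ) * Q ^ kl.2) := by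
    intro n
    push_cast
    rw [Finset.sum_mul]
    refine Finset.sum_congr rfl fun kl hkl => ?_
    rw [← Finset.HasAntidiagonal.mem_antidiagonal.mp hkl, pow_add]; ring
  beta_reduce
  rw [← (H Q hQ).tsum_eq, ← (K Q hQ).tsum_eq,
    tsum_mul_tsum_eq_tsum_sum_antidiagonal_of_summable_norm h1 h2]
  simp only [e]
  exact (summable_norm_sum_mul_antidiagonal_of_summable_norm h1 h2).of_norm.hasSum

theorem pow {f : ℂ → ℂ} (hf : NonnegSeries f) (k : ℕ) : NonnegSeries fun Q => f Q ^ k := by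
  induction k with
  | zero => exact one.congr fun Q _ => by simp
  | succ k ih => exact (ih.mul hf).congr fun Q _ => by rw [pow_succ]

theorem of_tendsto_sum {G : ℕ → ℂ → ℂ} {F : ℂ → ℂ} (hG : ∀ i, NonnegSeries (G i))
    (hF : ∀ Q : ℂ, ‖Q‖ < 1 → Tendsto (fun N => ∑ i ∈ Finset.range N, G i Q) atTop (𝓝 (F Q))) :
    NonnegSeries F := by
  choose d hd H using hG
  have hr : ∀ r : ℝ, 0 ≤ r → r < 1 → Summable fun x : ℕ × ℕ => d x.1 x.2 * r ^ x.2 := by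
    intro r hr0 hr1
    have hn : ‖(r : ℂ)‖ < 1 := by simpa [abs_of_nonneg hr0] using hr1
    have hH : ∀ i, HasSum (fun n => d i n * r ^ n) (G i r).re := fun i => by
      have := Complex.hasSum_re (H i r hn)
      convert this using 2 with n
      rw [← Complex.ofReal_pow, ← Complex.ofReal_mul, Complex.ofReal_re]
    rw [summable_prod_of_nonneg (fun x => mul_nonneg (hd _ _) (pow_nonneg hr0 _))]
    refine ⟨fun i => (hH i).summable, ?_⟩
    simp only [fun i => (hH i).tsum_eq]
    have h0 : ∀ i, 0 ≤ (G i r).re := fun i =>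
      (hH i).nonneg fun n => mul_nonneg (hd _ _) (pow_nonneg hr0 _)
    refine ((hasSum_iff_tendsto_nat_of_nonneg h0 (F r).re).mpr ?_).summable
    have := (Complex.continuous_re.tendsto _).comp (hF r hn)
    refine this.congr fun N => ?_
    simp
  refine ⟨fun n => ∑' i, d i n, fun n => tsum_nonneg fun i => hd i n, fun Q hQ => ?_⟩
  have hs : Summable fun x : ℕ × ℕ => (d x.1 x.2 : ℂ) * Q ^ x.2 := by
    refine Summable.of_norm ((hr ‖Q‖ (norm_nonneg _) hQ).congr fun x => ?_)
    rw [norm_mul, norm_pow, Complex.norm_real, Real.norm_of_nonneg (hd _ _)]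
  have h1 : HasSum (fun i => G i Q) (∑' x : ℕ × ℕ, (d x.1 x.2 : ℂ) * Q ^ x.2) :=
    hs.hasSum.prod_fiberwise fun i => H i Q hQ
  rw [tendsto_nhds_unique (hF Q hQ) h1.tendsto_sum_nat]
  have hswap := (Equiv.prodComm ℕ ℕ).hasSum_iff.mpr hs.hasSum
  refine hswap.prod_fiberwise fun n => ?_
  have hc : Summable fun i => d i n := by
    have := (hr (1 / 2) (by norm_num) (by norm_num)).comp_injective
      (i := fun i : ℕ => (i, n)) (fun a b h => by simpa using h)
    exact (summable_mul_right_iff (by positivity : (1 / 2 : ℝ) ^ n ≠ 0)).mp this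
  exact (Complex.hasSum_ofReal.mpr hc.hasSum).mul_right (Q ^ n)

theorem of_tendsto_prod {g : ℕ → ℂ → ℂ} {F : ℂ → ℂ} (hg : ∀ i, NonnegSeries (g i))
    (hF : ∀ Q : ℂ, ‖Q‖ < 1 →
      Tendsto (fun N => ∏ i ∈ Finset.range N, (1 + g i Q)) atTop (𝓝 (F Q))) :
    NonnegSeries F := by
  have hp : ∀ N, NonnegSeries fun Q => ∏ i ∈ Finset.range N, (1 + g i Q) := by
    intro N
    induction N with
    | zero => exact one.congr fun Q _ => by simp
    | succ N ih => exact (ih.mul (one.add (hg N))).congr fun Q _ => by rw [Finset.prod_range_succ]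
  have h1 : NonnegSeries fun Q => F Q - 1 := by
    refine of_tendsto_sum (fun i => (hp i).mul (hg i)) fun Q hQ => ?_
    refine ((hF Q hQ).sub_const 1).congr fun N => ?_
    induction N with
    | zero => simp
    | succ N ih => rw [Finset.sum_range_succ, ← ih, Finset.prod_range_succ]; ring
  exact (one.add h1).congr fun Q _ => by ring

theorem geometric {k : ℕ} (hk : k ≠ 0) : NonnegSeries fun Q => 1 / (1 - Q ^ k) := by
  refine of_tendsto_sum (G := fun i Q => (Q ^ k) ^ i)
    (fun i => (monomial zero_le_one (k * i)).congr fun Q _ => by simp [pow_mul]) fun Q hQ => ?_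
  rw [one_div]
  exact (hasSum_geometric_of_norm_lt_one (by
    rw [norm_pow]; exact pow_lt_one₀ (norm_nonneg _) hQ hk)).tendsto_sum_nat

theorem geometric_tail {k : ℕ} (hk : k ≠ 0) : NonnegSeries fun Q => Q ^ k / (1 - Q ^ k) :=
  ((monomial zero_le_one k).mul (geometric hk)).congr fun Q _ => by
    simp [div_eq_mul_inv]

end NonnegSeries

theorem one_sub_pow_ne_zero {Q : ℂ} (hQ : ‖Q‖ < 1) {k : ℕ} (hk : k ≠ 0) : 1 - Q ^ k ≠ 0 := by
  intro h
  have h1 : ‖Q ^ k‖ < 1 := by rw [norm_pow]; exact pow_lt_one₀ (norm_nonneg _) hQ hk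
  rw [← sub_eq_zero.mp h] at h1
  simp at h1

theorem poch_pow_ne_zero {Q : ℂ} (hQ : ‖Q‖ < 1) {k a : ℕ} (hk : k ≠ 0) (ha : a ≠ 0) :
    poch (Q ^ k) (Q ^ a) ≠ 0 :=
  poch_ne_zero (by rw [norm_pow]; exact pow_lt_one₀ (norm_nonneg _) hQ hk) fun n h => by
    rw [← pow_mul, ← pow_add] at h
    exact one_sub_pow_ne_zero hQ (by omega : a + k * n ≠ 0) (by rw [h, sub_self])

theorem tendsto_poch {P : ℂ} (hP : ‖P‖ < 1) (x : ℂ) :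
    Tendsto (fun N => ∏ i ∈ Finset.range N, (1 - x * P ^ i)) atTop (𝓝 (poch P x)) :=
  (multipliable_poch hP x).hasProd.tendsto_prod_nat

theorem nonnegSeries_inv_poch {k a : ℕ} (hk : k ≠ 0) (ha : a ≠ 0) :
    NonnegSeries fun Q => 1 / poch (Q ^ k) (Q ^ a) := by
  refine .of_tendsto_prod (g := fun i Q => Q ^ (a + k * i) / (1 - Q ^ (a + k * i)))
    (fun i => .geometric_tail (by omega)) fun Q hQ => ?_
  have h := (tendsto_poch (by rw [norm_pow]; exact pow_lt_one₀ (norm_nonneg _) hQ hk)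
    (Q ^ a)).inv₀ (poch_pow_ne_zero hQ hk ha)
  rw [one_div]
  refine h.congr fun N => ?_
  rw [← Finset.prod_inv_distrib]
  refine Finset.prod_congr rfl fun i _ => ?_
  have := one_sub_pow_ne_zero hQ (by omega : a + k * i ≠ 0)
  rw [← pow_mul, ← pow_add]
  field_simp
  ring

theorem nonnegSeries_poch_div {k a b : ℕ} (hk : k ≠ 0) (ha : a ≠ 0) (hb : b ≠ 0) :
    NonnegSeries fun Q => poch (Q ^ (2 * k)) (Q ^ (a + b)) /
      (poch (Q ^ k) (Q ^ a) * poch (Q ^ k) (Q ^ b)) := by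
  refine .of_tendsto_prod (g := fun i Q => Q ^ (a + k * i) / (1 - Q ^ (a + k * i)) +
    Q ^ (b + k * i) / (1 - Q ^ (b + k * i)))
    (fun i => (NonnegSeries.geometric_tail (by omega)).add (.geometric_tail (by omega)))
    fun Q hQ => ?_
  have hn : ∀ {j : ℕ}, j ≠ 0 → ‖Q ^ j‖ < 1 := fun hj => by
    rw [norm_pow]; exact pow_lt_one₀ (norm_nonneg _) hQ hj
  have h := (tendsto_poch (hn (by omega : 2 * k ≠ 0)) (Q ^ (a + b))).div
    ((tendsto_poch (hn hk) (Q ^ a)).mul (tendsto_poch (hn hk) (Q ^ b)))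
    (mul_ne_zero (poch_pow_ne_zero hQ hk ha) (poch_pow_ne_zero hQ hk hb))
  refine h.congr fun N => ?_
  simp only [Pi.div_apply]
  rw [← Finset.prod_mul_distrib, ← Finset.prod_div_distrib]
  refine Finset.prod_congr rfl fun i _ => ?_
  have h1 := one_sub_pow_ne_zero hQ (by omega : a + k * i ≠ 0)
  have h2 := one_sub_pow_ne_zero hQ (by omega : b + k * i ≠ 0)
  have e : Q ^ (a + b) * (Q ^ (2 * k)) ^ i = Q ^ (a + k * i) * Q ^ (b + k * i) := by
    rw [← pow_mul, ← pow_add, ← pow_add]; congr 1; ring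
  rw [← pow_mul Q k i, ← pow_add Q a (k * i), ← pow_add Q b (k * i), e]
  beta_reduce
  generalize Q ^ (a + k * i) = v at h1 ⊢
  generalize Q ^ (b + k * i) = w at h2 ⊢
  field_simp
  ring

/-- The product `(1 - P ^ (2 n + 1)) (1 - P ^ (2 n + 2))` form of Euler's product. -/
theorem poch_self_eq_mul {P : ℂ} (hP : ‖P‖ < 1) :
    poch P P = poch (P ^ 2) P * poch (P ^ 2) (P ^ 2) := by
  have hP2 : ‖P ^ 2‖ < 1 := by rw [norm_pow]; exact pow_lt_one₀ (norm_nonneg _) hP two_ne_zero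
  have h := (tendsto_poch hP2 P).mul (tendsto_poch hP2 (P ^ 2))
  have h2 := (tendsto_poch hP P).comp (tendsto_id.const_mul_atTop' (r := 2) (by norm_num))
  refine tendsto_nhds_unique h2 (h.congr fun N => ?_)
  simp only [Function.comp, id]
  induction N with
  | zero => simp
  | succ N ih =>
    rw [Finset.prod_range_succ, Finset.prod_range_succ, mul_mul_mul_comm, ih,
      show 2 * (N + 1) = 2 * N + 1 + 1 by ring, Finset.prod_range_succ, Finset.prod_range_succ]
    ring

/-- A quotient of Euler's product by theta-type products has nonnegative coefficients. -/
theorem nonnegSeries_eta_quotient : NonnegSeries fun Q => poch (Q ^ 11) (Q ^ 11) /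
    (poch (Q ^ 11) (Q ^ 1) * poch (Q ^ 11) (Q ^ 10) *
      (poch (Q ^ 11) (Q ^ 2) * poch (Q ^ 11) (Q ^ 9))) := by
  refine (((nonnegSeries_poch_div (k := 11) (a := 1) (b := 10) (by norm_num) (by norm_num)
    (by norm_num)).mul (nonnegSeries_poch_div (k := 11) (a := 2) (b := 20) (by norm_num)
    (by norm_num) (by norm_num))).mul (.geometric (k := 9) (by norm_num))).congr fun Q hQ => ?_
  have hP : ‖Q ^ 11‖ < 1 := by rw [norm_pow]; exact pow_lt_one₀ (norm_nonneg _) hQ (by norm_num)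
  rw [poch_self_eq_mul hP, poch_eq_mul hP (Q ^ 9)]
  rw [show Q ^ 11 * Q ^ 9 = Q ^ 20 by ring, show (Q ^ 11) ^ 2 = Q ^ 22 by ring]
  norm_num only
  rw [div_mul_div_comm, div_mul_div_comm]
  congr 1 <;> ring

/-- The generating functions of the extracted residue class have nonnegative coefficients. -/
theorem nonnegSeries_theta_quotient (e m2 m3 m4 m5 : ℕ) : NonnegSeries fun Q =>
    11 * Q ^ e * (poch (Q ^ 11) (Q ^ 11) /
    (poch (Q ^ 11) (Q ^ 1) * poch (Q ^ 11) (Q ^ 10) *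
      (poch (Q ^ 11) (Q ^ 2) * poch (Q ^ 11) (Q ^ 9)))) *
    (1 / (poch (Q ^ 11) (Q ^ 2) * poch (Q ^ 11) (Q ^ 9))) ^ m2 *
    (1 / (poch (Q ^ 11) (Q ^ 3) * poch (Q ^ 11) (Q ^ 8))) ^ m3 *
    (1 / (poch (Q ^ 11) (Q ^ 4) * poch (Q ^ 11) (Q ^ 7))) ^ m4 *
    (1 / (poch (Q ^ 11) (Q ^ 5) * poch (Q ^ 11) (Q ^ 6))) ^ m5 := by
  have h : ∀ {a b : ℕ}, a ≠ 0 → b ≠ 0 →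
      NonnegSeries fun Q => 1 / (poch (Q ^ 11) (Q ^ a) * poch (Q ^ 11) (Q ^ b)) :=
    fun ha hb => ((nonnegSeries_inv_poch (k := 11) (by norm_num) ha).mul
      (nonnegSeries_inv_poch (k := 11) (by norm_num) hb)).congr fun Q _ => by
        rw [div_mul_div_comm, one_mul]
  have h2 := (h (a := 2) (b := 9) (by norm_num) (by norm_num)).pow m2
  have h3 := (h (a := 3) (b := 8) (by norm_num) (by norm_num)).pow m3
  have h4 := (h (a := 4) (b := 7) (by norm_num) (by norm_num)).pow m4
  have h5 := (h (a := 5) (b := 6) (by norm_num) (by norm_num)).pow m5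
  refine ((((((NonnegSeries.monomial (a := 11) (by norm_num) e).mul
    nonnegSeries_eta_quotient).mul h2).mul h3).mul h4).mul h5).congr fun Q _ => ?_
  push_cast; rfl

/-- A power series that agrees near `0` with a series with nonnegative coefficients has
nonnegative coefficients. -/
theorem NonnegSeries.coeff_nonneg {f : ℂ → ℂ} (hf : NonnegSeries f) {d : ℕ → ℝ} {δ : ℝ}
    (hδ : 0 < δ) (h : ∀ Q : ℂ, Q ≠ 0 → ‖Q‖ < δ → HasSum (fun n => (d n : ℂ) * Q ^ n) (f Q))
    (n : ℕ) : 0 ≤ d n := by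
  obtain ⟨c, hc, H⟩ := hf
  have hps : ∀ (a : ℕ → ℝ) (g : ℂ → ℂ), (∀ᶠ Q in 𝓝 0, HasSum (fun n => (a n : ℂ) * Q ^ n) (g Q)) →
      HasFPowerSeriesAt g (FormalMultilinearSeries.ofScalars ℂ fun n => (a n : ℂ)) 0 := by
    intro a g hg
    rw [hasFPowerSeriesAt_iff]
    filter_upwards [hg] with Q hQ
    simpa [FormalMultilinearSeries.coeff_ofScalars, mul_comm] using hQ
  have h1 := hps c f (by
    filter_upwards [Metric.ball_mem_nhds (0 : ℂ) one_pos] with Q hQ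
    exact H Q (by simpa using hQ))
  have h2 := hps d (fun Q => ∑' n, (d n : ℂ) * Q ^ n) (by
    filter_upwards [Metric.ball_mem_nhds (0 : ℂ) hδ] with Q hQ
    by_cases h0 : Q = 0
    · subst h0
      exact (summable_of_ne_finset_zero (s := {0}) fun n hn => by
        simp at hn; simp [hn]).hasSum
    · exact (h Q h0 (by simpa using hQ)).summable.hasSum)
  have he : (fun Q => ∑' n, (d n : ℂ) * Q ^ n) =ᶠ[𝓝 0] f := by
    rw [← ContinuousAt.eventuallyEq_nhds_iff_eventuallyEq_nhdsNE h2.continuousAt h1.continuousAt]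
    filter_upwards [self_mem_nhdsWithin, mem_nhdsWithin_of_mem_nhds
      (Metric.ball_mem_nhds (0 : ℂ) hδ)] with Q h0 hQ
    exact (h Q h0 (by simpa using hQ)).tsum_eq
  have := congrArg (fun p => FormalMultilinearSeries.coeff p n)
    (h2.eq_formalMultilinearSeries_of_eventually h1 he)
  simp only [FormalMultilinearSeries.coeff_ofScalars] at this
  rw [Complex.ofReal_injective this]
  exact hc n

section

theorem tv_eq_poch {s : ℂ} (hs0 : s ≠ 0) {a b c : ℕ} (hab : a + b = 11) (hc : a * b = c) :
    tv s a = poch (s ^ 242) (s ^ 242) *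
      (poch ((s ^ 22) ^ 11) ((s ^ 22) ^ a) * poch ((s ^ 22) ^ 11) ((s ^ 22) ^ b)) / s ^ c := by
  have e1 : s ^ ((a : ℤ) * (a - 11)) = (s ^ c)⁻¹ := by
    rw [← zpow_natCast, ← zpow_neg, ← hc]; congr 1
    have : (b : ℤ) = 11 - a := by omega
    push_cast; rw [this]; ring
  have e2 : s ^ (22 * (a : ℤ)) = (s ^ 22) ^ a := by
    rw [zpow_mul, zpow_natCast]; norm_cast
  have e3 : s ^ 242 / (s ^ 22) ^ a = (s ^ 22) ^ b := by
    rw [div_eq_iff (pow_ne_zero _ (pow_ne_zero _ hs0)), ← pow_add, add_comm b, hab]; ring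
  rw [tv, theta, e1, e2, e3, show (s ^ 22) ^ 11 = s ^ 242 by ring]
  field_simp

theorem theta_quotient_eq {s : ℂ} (hs : ‖s‖ < 1) (hs0 : s ≠ 0) {e m2 m3 m4 m5 : ℕ}
    (hm : m2 + m3 + m4 + m5 = 11)
    (he : 28 + 18 * m2 + 24 * m3 + 28 * m4 + 30 * m5 = 266 + 22 * e) :
    11 * poch (s ^ 242) (s ^ 242) ^ 14 / (s ^ 252 * tv s 1 * tv s 2 * tv s 2 ^ m2 * tv s 3 ^ m3 *
      tv s 4 ^ m4 * tv s 5 ^ m5) = s ^ 14 *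
    (11 * (s ^ 22) ^ e * (poch ((s ^ 22) ^ 11) ((s ^ 22) ^ 11) /
    (poch ((s ^ 22) ^ 11) ((s ^ 22) ^ 1) * poch ((s ^ 22) ^ 11) ((s ^ 22) ^ 10) *
      (poch ((s ^ 22) ^ 11) ((s ^ 22) ^ 2) * poch ((s ^ 22) ^ 11) ((s ^ 22) ^ 9)))) *
    (1 / (poch ((s ^ 22) ^ 11) ((s ^ 22) ^ 2) * poch ((s ^ 22) ^ 11) ((s ^ 22) ^ 9))) ^ m2 *
    (1 / (poch ((s ^ 22) ^ 11) ((s ^ 22) ^ 3) * poch ((s ^ 22) ^ 11) ((s ^ 22) ^ 8))) ^ m3 *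
    (1 / (poch ((s ^ 22) ^ 11) ((s ^ 22) ^ 4) * poch ((s ^ 22) ^ 11) ((s ^ 22) ^ 7))) ^ m4 *
    (1 / (poch ((s ^ 22) ^ 11) ((s ^ 22) ^ 5) * poch ((s ^ 22) ^ 11) ((s ^ 22) ^ 6))) ^ m5) := by
  have hJ : poch (s ^ 242) (s ^ 242) ≠ 0 :=
    poch_self_ne_zero (norm_pow_lt_one hs (by norm_num)) (pow_ne_zero _ hs0)
  have t1 := tv_eq_poch hs0 (a := 1) (b := 10) (c := 10) rfl rfl
  have t2 := tv_eq_poch hs0 (a := 2) (b := 9) (c := 18) rfl rfl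
  have t3 := tv_eq_poch hs0 (a := 3) (b := 8) (c := 24) rfl rfl
  have t4 := tv_eq_poch hs0 (a := 4) (b := 7) (c := 28) rfl rfl
  have t5 := tv_eq_poch hs0 (a := 5) (b := 6) (c := 30) rfl rfl
  norm_num only [Nat.cast_one, Nat.cast_ofNat] at t1 t2 t3 t4 t5
  have n1 := tv_ne_zero hs hs0 (n := 1) (by norm_num)
  have n2 := tv_ne_zero hs hs0 (n := 2) (by norm_num)
  have n3 := tv_ne_zero hs hs0 (n := 3) (by norm_num)
  have n4 := tv_ne_zero hs hs0 (n := 4) (by norm_num)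
  have n5 := tv_ne_zero hs hs0 (n := 5) (by norm_num)
  have hQ : (s ^ 22) ^ 11 = s ^ 242 := by ring
  rw [hQ] at t1 t2 t3 t4 t5 ⊢
  have hj : poch (s ^ 242) (s ^ 242) ^ 14 = poch (s ^ 242) (s ^ 242) ^ 3 *
      poch (s ^ 242) (s ^ 242) ^ m2 * poch (s ^ 242) (s ^ 242) ^ m3 *
      poch (s ^ 242) (s ^ 242) ^ m4 * poch (s ^ 242) (s ^ 242) ^ m5 := by
    rw [← pow_add, ← pow_add, ← pow_add, ← pow_add]; congr 1; omega
  have hσ : (s ^ 22) ^ e = s ^ 28 * (s ^ 18) ^ m2 * (s ^ 24) ^ m3 * (s ^ 28) ^ m4 *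
      (s ^ 30) ^ m5 / s ^ 266 := by
    rw [eq_div_iff (pow_ne_zero _ hs0)]
    simp only [← pow_mul, ← pow_add]; congr 1; omega
  rw [hj, hσ]
  generalize poch (s ^ 242) (s ^ 242) = J at *
  generalize poch (s ^ 242) ((s ^ 22) ^ 1) * poch (s ^ 242) ((s ^ 22) ^ 10) = A1 at *
  generalize poch (s ^ 242) ((s ^ 22) ^ 2) * poch (s ^ 242) ((s ^ 22) ^ 9) = A2 at *
  generalize poch (s ^ 242) ((s ^ 22) ^ 3) * poch (s ^ 242) ((s ^ 22) ^ 8) = A3 at *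
  generalize poch (s ^ 242) ((s ^ 22) ^ 4) * poch (s ^ 242) ((s ^ 22) ^ 7) = A4 at *
  generalize poch (s ^ 242) ((s ^ 22) ^ 5) * poch (s ^ 242) ((s ^ 22) ^ 6) = A5 at *
  have a1 : A1 ≠ 0 := by rintro rfl; simp [t1] at n1
  have a2 : A2 ≠ 0 := by rintro rfl; simp [t2] at n2
  have a3 : A3 ≠ 0 := by rintro rfl; simp [t3] at n3
  have a4 : A4 ≠ 0 := by rintro rfl; simp [t4] at n4
  have a5 : A5 ≠ 0 := by rintro rfl; simp [t5] at n5
  rw [t1, t2, t3, t4, t5]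
  simp only [div_pow, mul_pow, one_pow]
  have p0 : ∀ k m : ℕ, (s ^ k) ^ m ≠ 0 := fun k m => pow_ne_zero _ (pow_ne_zero _ hs0)
  have q2 := p0 18 m2
  have q3 := p0 24 m3
  have q4 := p0 28 m4
  have q5 := p0 30 m5
  generalize (s ^ 18) ^ m2 = σ2 at *
  generalize (s ^ 24) ^ m3 = σ3 at *
  generalize (s ^ 28) ^ m4 = σ4 at *
  generalize (s ^ 30) ^ m5 = σ5 at *
  field_simp

/-- Nonnegativity of the coefficients in the residue class `7` modulo `11` of a combination of
generating functions, when the corresponding component is a monomial. -/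
theorem coeff_residue_seven_nonneg {d : ℕ → ℝ} {W : ℂ → ℂ} {c1 c2 c3 c4 : ℂ} {δ : ℝ}
    {T : ℂ → ℂ → ℂ → ℂ → ℂ → ℂ} {comp : ℂ → ℂ → ℂ → ℂ → Fin 11 → ℂ}
    (e m2 m3 m4 m5 : ℕ) (hm : m2 + m3 + m4 + m5 = 11)
    (he : 28 + 18 * m2 + 24 * m3 + 28 * m4 + 30 * m5 = 266 + 22 * e)
    (hT : ∀ {t1 t2 t3 t4 t5 x u y z : ℂ}, Coord t1 t2 t3 t4 t5 x u y z →
      eulerT t1 t2 t3 t4 t5 * ∑ r : Fin 11, (t4 / t5) ^ (r : ℕ) * comp x u y z r =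
      (x ^ 2 * y - 3 * x ^ 3 - 4 * x * y + 2 * x ^ 2 + y) *
      (t1 * t2 * t4 ^ 8 / (t3 * t5 ^ 8 * x * u) * T t1 t2 t3 t4 t5))
    (hc : ∀ {t1 t2 t3 t4 t5 x u y z : ℂ}, Coord t1 t2 t3 t4 t5 x u y z →
      comp x u y z 7 / (t2 ^ 3 * t3 ^ 3 * t4 ^ 3 * t5 ^ 3) =
        11 / (t2 * t2 ^ m2 * t3 ^ m3 * t4 ^ m4 * t5 ^ m5))
    (hδ : 0 < δ) (hδ1 : δ ≤ 1)
    (hD : ∀ v : ℂ, v ≠ 0 → ‖v‖ < δ → HasSum (fun n => (d n : ℂ) * v ^ (2 * n)) (W v))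
    (hW : ∀ v : ℂ, v ≠ 0 → ‖v‖ < δ → W v * poch (v ^ 2) (v ^ 2) =
      (c2 * mockTerm v 2 + c1 * mockTerm v 1 + c3 * mockTerm v 3 + c4 * mockTerm v 4) *
        eulerT (tv v 1) (tv v 2) (tv v 3) (tv v 4) (tv v 5) + poch (v ^ 242) (v ^ 242) ^ 3 *
        T (tv v 1) (tv v 2) (tv v 3) (tv v 4) (tv v 5) - c1 * (v ^ 2)⁻¹ * poch (v ^ 2) (v ^ 2))
    (n : ℕ) : 0 ≤ d (11 * n + 7) := by
  refine (nonnegSeries_theta_quotient e m2 m3 m4 m5).coeff_nonneg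
    (d := fun n => d (11 * n + 7)) (pow_pos hδ 22) (fun Q hQ0 hQ => ?_) n
  obtain ⟨s, rfl⟩ := IsAlgClosed.exists_pow_nat_eq Q (n := 22) (by norm_num)
  have hs0 : s ≠ 0 := by rintro rfl; simp at hQ0
  have hsδ : ‖s‖ < δ := by
    rw [norm_pow] at hQ
    exact lt_of_pow_lt_pow_left₀ 22 hδ.le hQ
  have hs := hsδ.trans_le hδ1
  have hv0 : ∀ v : ℂ, ‖v‖ = ‖s‖ → v ≠ 0 := fun v hv h => hs0 (by simpa [h] using hv.symm)
  have C := (thetaRel_tv hs hs0).coord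
  have H := hasSum_line hT hs hs0 (fun v hv => hD v (hv0 v hv) (hv ▸ hsδ))
    (fun v hv => hW v (hv0 v hv) (hv ▸ hsδ)) C
  have hs14 : s ^ 14 ≠ 0 := pow_ne_zero _ hs0
  have hf : (fun m => (d (11 * m + 7) : ℂ) * s ^ (2 * (11 * m + 7))) =
      fun m => s ^ 14 * ((d (11 * m + 7) : ℂ) * (s ^ 22) ^ m) := by
    funext m
    rw [← pow_mul]; ring
  have e1 : ∀ a b c d e f g h : ℂ, a / (b * c * d * e * f * g) * h =
      a / (b * c) * (h / (d * e * f * g)) := fun a b c d e f g h => by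
    simp only [div_eq_mul_inv, mul_inv]; ring
  rw [hf, e1, hc C] at H
  refine (hasSum_mul_left_iff hs14).mp ?_
  rw [← theta_quotient_eq hs hs0 hm he]
  have hv : ∀ a b c : ℂ, a / b * (11 / c) = 11 * a / (b * c) := fun a b c => by
    rw [div_mul_div_comm, mul_comm a]
  rw [hv] at H
  simpa only [mul_assoc] using H

section
variable {d : ℕ → ℝ} {W : ℂ → ℂ} {δ : ℝ} (hδ : 0 < δ) (hδ1 : δ ≤ 1)
  (hD : ∀ v : ℂ, v ≠ 0 → ‖v‖ < δ → HasSum (fun n => (d n : ℂ) * v ^ (2 * n)) (W v))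
include hδ hδ1 hD

theorem coeff_nonneg_line_zero (hW : ∀ v : ℂ, v ≠ 0 → ‖v‖ < δ → W v * poch (v ^ 2) (v ^ 2) =
    -2 * (∑' n, bt v 3 10 n) + 2 * (∑' n, bt v 3 13 n) + 4 * (∑' n, bt v 3 7 n) + 3 *
    (∑' n, bt v 3 4 n) + 6 * (∑' n, bt v 1 0 n) - 2 * (∑' n, bt v 1 1 n) + 1
    - 2 * (v ^ 2)⁻¹ * poch (v ^ 2) (v ^ 2)) (n : ℕ) : 0 ≤ d (11 * n + 7) := by
  refine coeff_residue_seven_nonneg (c2 := -2) (c1 := 2) (c3 := 4) (c4 := 3)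
    (T := thetaPart0) 2 2 3 3 3 (by norm_num) (by norm_num) eulerT_mul_comp0
    (fun {t1 t2 t3 t4 t5 x u y z} C => ?_) hδ hδ1 hD (fun v hv0 hv => ?_) n
  · obtain ⟨⟨h1, h2, h3, h4, h5, -, -, -⟩, ex, eu, ey, ez, -, -, -⟩ := C
    rw [show comp0 x u y z 7 = 11 from rfl]
    field_simp
  · rw [hW v hv0 hv]
    linear_combination line_0 (hv.trans_le hδ1) hv0

theorem coeff_nonneg_line_one (hW : ∀ v : ℂ, v ≠ 0 → ‖v‖ < δ → W v * poch (v ^ 2) (v ^ 2) =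
    -5 * (∑' n, bt v 3 10 n) - 6 * (∑' n, bt v 3 13 n) - 12 * (∑' n, bt v 3 7 n) - 9 * (∑' n, bt v 3 4 n) - 1 * (∑' n, bt v 1 0 n) - 7 * (∑' n, bt v 1 1 n) + 5
    - (-6) * (v ^ 2)⁻¹ * poch (v ^ 2) (v ^ 2)) (n : ℕ) : 0 ≤ d (11 * n + 7) := by
  refine coeff_residue_seven_nonneg (c2 := -5) (c1 := -6) (c3 := -12) (c4 := -9)
    (T := thetaPart1) 1 3 5 2 1 (by norm_num) (by norm_num) eulerT_mul_comp1
    (fun {t1 t2 t3 t4 t5 x u y z} C => ?_) hδ hδ1 hD (fun v hv0 hv => ?_) n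
  · obtain ⟨⟨h1, h2, h3, h4, h5, -, -, -⟩, ex, eu, ey, ez, -, -, -⟩ := C
    rw [show comp1 x u y z 7 = 11 * (u ^ 2 / z) from rfl, eu, ez]
    field_simp
  · rw [hW v hv0 hv]
    linear_combination line_1 (hv.trans_le hδ1) hv0

theorem coeff_nonneg_line_two (hW : ∀ v : ℂ, v ≠ 0 → ‖v‖ < δ → W v * poch (v ^ 2) (v ^ 2) =
    12 * (∑' n, bt v 3 10 n) + 10 * (∑' n, bt v 3 13 n) + 9 * (∑' n, bt v 3 7 n) + 4 * (∑' n, bt v 3 4 n) - 12 * (∑' n, bt v 1 0 n) + 4 * (∑' n, bt v 1 1 n) - 18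
    - 10 * (v ^ 2)⁻¹ * poch (v ^ 2) (v ^ 2)) (n : ℕ) : 0 ≤ d (11 * n + 7) := by
  refine coeff_residue_seven_nonneg (c2 := 12) (c1 := 10) (c3 := 9) (c4 := 4)
    (T := thetaPart2) 2 1 5 3 2 (by norm_num) (by norm_num) eulerT_mul_comp2
    (fun {t1 t2 t3 t4 t5 x u y z} C => ?_) hδ hδ1 hD (fun v hv0 hv => ?_) n
  · obtain ⟨⟨h1, h2, h3, h4, h5, -, -, -⟩, ex, eu, ey, ez, -, -, -⟩ := C
    rw [show comp2 x u y z 7 = 11 * (u / x) from rfl, eu, ex]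
    field_simp
  · rw [hW v hv0 hv]
    linear_combination line_2 (hv.trans_le hδ1) hv0

theorem coeff_nonneg_line_three (hW : ∀ v : ℂ, v ≠ 0 → ‖v‖ < δ → W v * poch (v ^ 2) (v ^ 2) =
    -4 * (∑' n, bt v 3 10 n) - 7 * (∑' n, bt v 3 13 n) - 3 * (∑' n, bt v 3 7 n) + 6 * (∑' n, bt v 3 4 n) + 8
    - (-7) * (v ^ 2)⁻¹ * poch (v ^ 2) (v ^ 2)) (n : ℕ) : 0 ≤ d (11 * n + 7) := by
  refine coeff_residue_seven_nonneg (c2 := -4) (c1 := -7) (c3 := -3) (c4 := 6)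
    (T := thetaPart3) 3 0 3 4 4 (by norm_num) (by norm_num) eulerT_mul_comp3
    (fun {t1 t2 t3 t4 t5 x u y z} C => ?_) hδ hδ1 hD (fun v hv0 hv => ?_) n
  · obtain ⟨⟨h1, h2, h3, h4, h5, -, -, -⟩, ex, eu, ey, ez, -, -, -⟩ := C
    rw [show comp3 x u y z 7 = 11 * (z / (x * u)) from rfl, ex, eu, ez]
    field_simp
  · rw [hW v hv0 hv]
    linear_combination line_3 (hv.trans_le hδ1) hv0

end

end

section

/-- The generating function of the partitions, viewed as multisets of positive integers, that
satisfy a predicate. -/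
noncomputable def gf (q : ℂ) (p : Multiset ℕ → Prop) : ℂ :=
  ∑' m : Multiset ℕ, {m | 0 ∉ m ∧ p m}.indicator (fun m => q ^ m.sum) m

/-- Partitions of all sizes as multisets of positive integers. -/
def sigmaPartitionEquiv : (Σ n, Nat.Partition n) ≃ {m : Multiset ℕ // 0 ∉ m} where
  toFun x := ⟨x.2.parts, fun h => lt_irrefl _ (x.2.parts_pos h)⟩
  invFun m := ⟨m.1.sum, ⟨m.1, fun {i} hi => Nat.pos_of_ne_zero fun h => m.2 (h ▸ hi), rfl⟩⟩
  left_inv := by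
    rintro ⟨n, ⟨parts, hpos, rfl⟩⟩
    rfl
  right_inv m := rfl

theorem card_partition_le (n : ℕ) : Fintype.card (Nat.Partition n) ≤ 2 ^ n := by
  refine (Fintype.card_le_of_surjective _ Nat.Partition.ofComposition_surj).trans ?_
  rw [composition_card]
  exact Nat.pow_le_pow_right (by norm_num) (Nat.sub_le _ _)

section
variable {q : ℂ} (hq : ‖q‖ < 1 / 2)
include hq

theorem summable_sigma_partition :
    Summable fun x : (Σ n, Nat.Partition n) => ‖q‖ ^ x.1 := by
  rw [summable_sigma_of_nonneg fun x => by positivity]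
  refine ⟨fun n => Summable.of_finite, ?_⟩
  have hg : Summable fun n : ℕ => (2 * ‖q‖) ^ n :=
    summable_geometric_of_lt_one (by positivity) (by linarith)
  refine hg.of_nonneg_of_le (fun n => by positivity) fun n => ?_
  dsimp only
  rw [tsum_fintype, Finset.sum_const, Finset.card_univ, nsmul_eq_mul, mul_pow]
  gcongr
  exact_mod_cast card_partition_le n

theorem summable_multiset : Summable ({m : Multiset ℕ | 0 ∉ m}.indicator fun m => ‖q‖ ^ m.sum) := by
  refine (summable_subtype_iff_indicator (f := fun m : Multiset ℕ => ‖q‖ ^ m.sum)).1 ?_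
  refine sigmaPartitionEquiv.summable_iff.1 ?_
  refine (summable_sigma_partition hq).congr ?_
  rintro ⟨n, π⟩
  simp [sigmaPartitionEquiv, π.parts_sum]

omit hq in
theorem norm_indicator_le (p : Multiset ℕ → Prop) (m : Multiset ℕ) :
    ‖{m | 0 ∉ m ∧ p m}.indicator (fun m => q ^ m.sum) m‖ ≤
      {m : Multiset ℕ | 0 ∉ m}.indicator (fun m => ‖q‖ ^ m.sum) m := by
  rw [norm_indicator_eq_indicator_norm]
  simp only [norm_pow]
  exact Set.indicator_le_indicator_of_subset (fun m hm => hm.1) (fun m => by positivity) m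

theorem summable_gf (p : Multiset ℕ → Prop) :
    Summable ({m | 0 ∉ m ∧ p m}.indicator fun m => q ^ m.sum) :=
  Summable.of_norm_bounded (summable_multiset hq) (norm_indicator_le p)

theorem hasSum_gf (p : Multiset ℕ → Prop) [DecidablePred p] :
    HasSum (fun n : ℕ => (((Finset.univ.filter fun π : Nat.Partition n => p π.parts).card : ℕ) : ℂ)
      * q ^ n) (gf q p) := by
  have h1 := (summable_gf hq p).hasSum
  have h2 : HasSum ((fun m => {m | 0 ∉ m ∧ p m}.indicator (fun m => q ^ m.sum) m) ∘
      (fun x : {m : Multiset ℕ // 0 ∉ m} => x.1)) (gf q p) := by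
    refine (Function.Injective.hasSum_iff Subtype.val_injective ?_).2 h1
    intro m hm
    refine Set.indicator_of_notMem (fun h => hm ⟨⟨m, h.1⟩, rfl⟩) _
  rw [← sigmaPartitionEquiv.hasSum_iff] at h2
  refine h2.sigma fun n => ?_
  have h3 := hasSum_fintype fun π : Nat.Partition n => if p π.parts then q ^ n else 0
  rw [← Finset.sum_filter, Finset.sum_const, nsmul_eq_mul] at h3
  refine h3.congr_fun ?_
  intro π
  have h0 : 0 ∉ π.parts := fun h => lt_irrefl _ (π.parts_pos h)
  simp [sigmaPartitionEquiv, Set.indicator_apply, h0, π.parts_sum]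

theorem norm_gf_le (p : Multiset ℕ → Prop) :
    ‖gf q p‖ ≤ ∑' m, {m : Multiset ℕ | 0 ∉ m}.indicator (fun m => ‖q‖ ^ m.sum) m :=
  tsum_of_norm_bounded (summable_multiset hq).hasSum (norm_indicator_le p)

theorem gf_split (p r : Multiset ℕ → Prop) :
    gf q p = gf q (fun m => p m ∧ r m) + gf q (fun m => p m ∧ ¬ r m) := by
  rw [gf, gf, gf, ← (summable_gf hq _).tsum_add (summable_gf hq _)]
  congr 1; ext m
  by_cases h0 : 0 ∈ m <;> by_cases hp : p m <;> by_cases hr : r m <;>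
    simp [h0, hp, hr]

theorem tendsto_gf {p : ℕ → Multiset ℕ → Prop} {r : Multiset ℕ → Prop}
    (h : ∀ N m, 0 ∉ m → m.sum < N → (p N m ↔ r m)) :
    Tendsto (fun N => gf q (p N)) atTop (𝓝 (gf q r)) := by
  refine tendsto_tsum_of_dominated_convergence (summable_multiset hq) (fun m => ?_)
    (Eventually.of_forall fun N m => norm_indicator_le (p N) m)
  refine tendsto_const_nhds.congr' ?_
  filter_upwards [eventually_gt_atTop m.sum] with N hN
  by_cases h0 : 0 ∈ m
  · simp [h0]
  · have hpr := h N m h0 hN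
    by_cases hr : r m
    · simp [h0, hr, hpr.2 hr]
    · simp [h0, hr, mt hpr.1 hr]

end

theorem gf_congr {q : ℂ} {p r : Multiset ℕ → Prop} (h : ∀ m, 0 ∉ m → (p m ↔ r m)) :
    gf q p = gf q r := by
  have he : {m | 0 ∉ m ∧ p m} = {m | 0 ∉ m ∧ r m} :=
    Set.ext fun m => and_congr_right fun h0 => h m h0
  rw [gf, gf, he]

theorem gf_false {q : ℂ} {p : Multiset ℕ → Prop} (h : ∀ m, 0 ∉ m → ¬ p m) : gf q p = 0 := by
  rw [gf_congr (r := fun _ => False) fun m hm => by simp [h m hm]]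
  simp [gf]

theorem gf_singleton {q : ℂ} (m₀ : Multiset ℕ) (h0 : 0 ∉ m₀) :
    gf q (fun m => m = m₀) = q ^ m₀.sum := by
  rw [gf, tsum_eq_single m₀ fun m hm => by simp [hm]]
  simp [h0]

theorem gf_bij {q : ℂ} {p r : Multiset ℕ → Prop} (f g : Multiset ℕ → Multiset ℕ) (a b : ℕ)
    (hf : ∀ m, 0 ∉ m → p m → 0 ∉ f m ∧ r (f m) ∧ (f m).sum + b = m.sum + a ∧ g (f m) = m)
    (hg : ∀ m, 0 ∉ m → r m → 0 ∉ g m ∧ p (g m) ∧ f (g m) = m) :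
    q ^ b * gf q r = q ^ a * gf q p := by
  let e : {m | 0 ∉ m ∧ p m} ≃ {m | 0 ∉ m ∧ r m} :=
    { toFun := fun m => ⟨f m.1, (hf m.1 m.2.1 m.2.2).1, (hf m.1 m.2.1 m.2.2).2.1⟩
      invFun := fun m => ⟨g m.1, (hg m.1 m.2.1 m.2.2).1, (hg m.1 m.2.1 m.2.2).2.1⟩
      left_inv := fun m => Subtype.ext (hf m.1 m.2.1 m.2.2).2.2.2
      right_inv := fun m => Subtype.ext (hg m.1 m.2.1 m.2.2).2.2 }
  rw [gf, gf, ← tsum_subtype, ← tsum_subtype, ← tsum_mul_left, ← tsum_mul_left,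
    ← e.tsum_eq]
  congr 1; ext m
  have h := (hf m.1 m.2.1 m.2.2).2.2.1
  change q ^ b * q ^ (f m.1).sum = q ^ a * q ^ m.1.sum
  rw [← pow_add, ← pow_add, add_comm b, h, add_comm a]

theorem gf_erase {q : ℂ} {t : ℕ} (ht : t ≠ 0) {p r : Multiset ℕ → Prop}
    (h : ∀ m, 0 ∉ m → (r (t ::ₘ m) ↔ p m)) (hr : ∀ m, 0 ∉ m → r m → t ∈ m) :
    gf q r = q ^ t * gf q p := by
  rw [← gf_bij (q := q) (p := p) (r := r) (fun m => t ::ₘ m) (fun m => m.erase t) t 0]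
  · simp
  · intro m h0 hp
    refine ⟨by simp [h0, ht.symm], (h m h0).2 hp, by simp [add_comm], by simp⟩
  · intro m h0 hm
    have ht' := hr m h0 hm
    have h0' : 0 ∉ m.erase t := fun h => h0 (Multiset.mem_of_mem_erase h)
    refine ⟨h0', (h _ h0').1 ?_, Multiset.cons_erase ht'⟩
    rwa [Multiset.cons_erase ht']

/-- The finite `q`-Pochhammer symbol `(q; q)_n`. -/
noncomputable def fpoch (q : ℂ) (n : ℕ) : ℂ := ∏ i ∈ Finset.range n, (1 - q ^ (i + 1))

theorem fpoch_zero (q : ℂ) : fpoch q 0 = 1 := by simp [fpoch]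

theorem fpoch_succ (q : ℂ) (n : ℕ) : fpoch q (n + 1) = fpoch q n * (1 - q ^ (n + 1)) :=
  Finset.prod_range_succ _ _

theorem one_sub_pow_succ_ne_zero {q : ℂ} (hq : ‖q‖ < 1) (n : ℕ) : 1 - q ^ (n + 1) ≠ 0 := by
  intro h
  have h1 : ‖q ^ (n + 1)‖ < 1 := by
    rw [norm_pow]; exact pow_lt_one₀ (norm_nonneg _) hq (by omega)
  rw [← sub_eq_zero.1 h] at h1
  simp at h1

theorem fpoch_ne_zero {q : ℂ} (hq : ‖q‖ < 1) (n : ℕ) : fpoch q n ≠ 0 :=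
  Finset.prod_ne_zero_iff.2 fun i _ => one_sub_pow_succ_ne_zero hq i

theorem tendsto_fpoch {q : ℂ} (hq : ‖q‖ < 1) : Tendsto (fpoch q) atTop (𝓝 (poch q q)) := by
  have h := (multipliable_poch hq q).hasProd.tendsto_prod_nat
  simp only [← pow_succ'] at h
  have he : poch q q = ∏' n, (1 - q ^ (n + 1)) := by simp only [poch, ← pow_succ']
  rw [he]
  exact h

theorem gf_ge_eq {q : ℂ} (hq : ‖q‖ < 1 / 2) (N : ℕ) :
    gf q (fun m => ∀ x ∈ m, N < x) = fpoch q N * gf q (fun _ => True) := by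
  induction N with
  | zero =>
    rw [fpoch_zero, one_mul]
    refine gf_congr fun m h0 => ?_
    simp only [iff_true]
    exact fun x hx => Nat.pos_of_ne_zero fun h => h0 (h ▸ hx)
  | succ N ih =>
    have h1 := gf_split hq (fun m => ∀ x ∈ m, N < x) (fun m => N + 1 ∈ m)
    have h2 : gf q (fun m => (∀ x ∈ m, N < x) ∧ N + 1 ∈ m) = q ^ (N + 1) *
        gf q (fun m => ∀ x ∈ m, N < x) :=
      gf_erase (by omega) (fun m _ => by simp) fun m _ h => h.2
    have h3 : gf q (fun m => (∀ x ∈ m, N < x) ∧ N + 1 ∉ m) =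
        gf q (fun m => ∀ x ∈ m, N + 1 < x) := by
      refine gf_congr fun m _ => ⟨fun h x hx => ?_, fun h => ⟨fun x hx => ?_, fun hx => ?_⟩⟩
      · have := h.1 x hx
        have : x ≠ N + 1 := fun e => h.2 (e ▸ hx)
        omega
      · have := h x hx; omega
      · have := h _ hx; omega
    rw [h2, h3] at h1
    rw [fpoch_succ]
    linear_combination (1 - q ^ (N + 1)) * ih - h1

/-- Euler's product for the partition generating function. -/
theorem poch_mul_gf {q : ℂ} (hq : ‖q‖ < 1 / 2) : poch q q * gf q (fun _ => True) = 1 := by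
  have h1 := (tendsto_fpoch (q := q) (by linarith)).mul_const (gf q (fun _ => True))
  have h2 : Tendsto (fun N => gf q (fun m => ∀ x ∈ m, N < x)) atTop
      (𝓝 (gf q fun m => m = 0)) := by
    refine tendsto_gf hq fun N m h0 hN => ⟨fun h => ?_, fun h => by simp [h]⟩
    refine Multiset.eq_zero_of_forall_notMem fun x hx => ?_
    have := h x hx
    have := Multiset.le_sum_of_mem hx
    omega
  simp only [gf_ge_eq hq] at h2
  have h3 := tendsto_nhds_unique h1 h2
  rw [h3, gf_singleton 0 (by simp)]
  simp

end

section

theorem sup_mem {m : Multiset ℕ} (h : m ≠ 0) : m.sup ∈ m := by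
  induction m using Multiset.induction_on with
  | empty => exact absurd rfl h
  | cons a m ih =>
    rw [Multiset.sup_cons]
    by_cases hm : m = 0
    · simp [hm]
    · rcases le_total a m.sup with h' | h'
      · rw [sup_eq_right.2 h']; exact Multiset.mem_cons_of_mem (ih hm)
      · rw [sup_eq_left.2 h']; exact Multiset.mem_cons_self _ _

theorem filter_add_replicate {m : Multiset ℕ} (h0 : 0 ∉ m) :
    m.filter (1 < ·) + Multiset.replicate (m.count 1) 1 = m := by
  have h : m.filter (· = 1) = m.filter (fun x => ¬ 1 < x) := by
    refine Multiset.filter_congr fun x hx => ?_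
    have : x ≠ 0 := fun h => h0 (h ▸ hx)
    omega
  rw [← Multiset.filter_eq', h, Multiset.filter_add_not]

/-- The parts of a partition, decreased by one. -/
def shrink (m : Multiset ℕ) : Multiset ℕ := (m.filter (1 < ·)).map (· - 1)

theorem map_shrink (m : Multiset ℕ) : (shrink m).map (· + 1) = m.filter (1 < ·) := by
  rw [shrink, Multiset.map_map]
  conv_rhs => rw [← Multiset.map_id (m.filter (1 < ·))]
  refine Multiset.map_congr rfl fun x hx => ?_
  have := (Multiset.mem_filter.1 hx).2
  simp only [Function.comp, id]
  omega

theorem map_shrink_add {m : Multiset ℕ} (h0 : 0 ∉ m) :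
    (shrink m).map (· + 1) + Multiset.replicate (m.count 1) 1 = m := by
  rw [map_shrink, filter_add_replicate h0]

theorem sum_map_succ (m : Multiset ℕ) : (m.map (· + 1)).sum = m.sum + m.card := by
  rw [Multiset.sum_map_add]; simp

theorem card_shrink {m : Multiset ℕ} (h0 : 0 ∉ m) : (shrink m).card + m.count 1 = m.card := by
  have h := congrArg Multiset.card (map_shrink_add h0)
  simpa using h

theorem sum_shrink {m : Multiset ℕ} (h0 : 0 ∉ m) : (shrink m).sum + m.card = m.sum := by
  have h := congrArg Multiset.sum (map_shrink_add h0)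
  have h1 := card_shrink h0
  rw [Multiset.sum_add, sum_map_succ] at h
  simp at h
  omega

theorem shrink_map_succ {m : Multiset ℕ} (h0 : 0 ∉ m) (k : ℕ) :
    shrink (m.map (· + 1) + Multiset.replicate k 1) = m := by
  have h1 : (m.map (· + 1)).filter (1 < ·) = m.map (· + 1) := by
    refine Multiset.filter_eq_self.2 fun x hx => ?_
    obtain ⟨y, hy, rfl⟩ := Multiset.mem_map.1 hx
    have : y ≠ 0 := fun h => h0 (h ▸ hy)
    omega
  have h2 : (Multiset.replicate k 1).filter (1 < ·) = 0 := by
    refine Multiset.filter_eq_nil.2 fun x hx => ?_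
    rw [Multiset.eq_of_mem_replicate hx]; omega
  rw [shrink, Multiset.filter_add, h1, h2, add_zero, Multiset.map_map]
  simp

theorem zero_notMem_shrink (m : Multiset ℕ) : 0 ∉ shrink m := by
  intro h
  obtain ⟨y, hy, h⟩ := Multiset.mem_map.1 h
  have := (Multiset.mem_filter.1 hy).2
  omega

theorem sup_shrink_le (m : Multiset ℕ) : (shrink m).sup ≤ m.sup - 1 := by
  refine Multiset.sup_le.2 fun x hx => ?_
  obtain ⟨y, hy, rfl⟩ := Multiset.mem_map.1 hx
  have := Multiset.le_sup (Multiset.mem_filter.1 hy).1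
  omega

/-- Dyson's map. -/
def dyson (a b : ℕ) (m : Multiset ℕ) : Multiset ℕ :=
  if m.card + a - b = 0 then 0 else (m.card + a - b) ::ₘ shrink m

/-- The inverse of Dyson's map. -/
def dysonInv (a b : ℕ) (m : Multiset ℕ) : Multiset ℕ :=
  (m.erase m.sup).map (· + 1) + Multiset.replicate (m.sup + b - a - (m.card - 1)) 1

theorem sup_pos {m : Multiset ℕ} (h0 : 0 ∉ m) (h : m ≠ 0) : 0 < m.sup :=
  Nat.pos_of_ne_zero fun h' => h0 (h' ▸ sup_mem h)

/-- Dyson's adjoint, with shift `a - b`. -/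
theorem gf_dyson (q : ℂ) {a b : ℕ} (h1 : b ≠ a) (h2 : b ≠ a + 1) :
    q ^ b * gf q (fun m => (m = 0 → a < b) ∧ m.card + a ≤ m.sup + b + 1) =
      q ^ a * gf q (fun m => m.sup + b ≤ m.card + a + 1) := by
  refine gf_bij (dyson a b) (dysonInv a b) a b (fun m h0 hp => ?_) (fun m h0 hr => ?_)
  · have hc : m.card = 0 ∨ 0 < m.sup := by
      rcases eq_or_ne m 0 with h | h
      · simp [h]
      · exact Or.inr (sup_pos h0 h)
    have hs := sup_shrink_le m
    have hsum := sum_shrink h0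
    have hcard := card_shrink h0
    have hm := map_shrink_add h0
    by_cases ht : m.card + a - b = 0
    · have hz : shrink m = 0 := by
        by_contra hz
        have := sup_pos (zero_notMem_shrink m) hz
        omega
      rw [hz] at hsum hcard hm
      simp only [Multiset.sum_zero, Multiset.card_zero, Multiset.map_zero, zero_add] at hsum hcard hm
      have hd : dyson a b m = 0 := if_pos ht
      rw [hd]
      refine ⟨by simp, ⟨fun _ => by omega, by simp; omega⟩, by simp; omega, ?_⟩
      rw [dysonInv]
      simp only [Multiset.erase_zero, Multiset.map_zero, Multiset.card_zero, Multiset.sup_zero,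
        zero_add]
      conv_rhs => rw [← hm]
      congr 1
      simp only [bot_eq_zero]
      omega
    · have hd : dyson a b m = (m.card + a - b) ::ₘ shrink m := if_neg ht
      have hsup : ((m.card + a - b) ::ₘ shrink m).sup = m.card + a - b := by
        rw [Multiset.sup_cons, sup_eq_left]
        omega
      rw [hd]
      refine ⟨?_, ⟨by simp, ?_⟩, ?_, ?_⟩
      · rw [Multiset.mem_cons, not_or]
        exact ⟨Ne.symm ht, zero_notMem_shrink m⟩
      · rw [hsup, Multiset.card_cons]; omega
      · rw [Multiset.sum_cons]; omega
      · rw [dysonInv, hsup, Multiset.erase_cons_head, Multiset.card_cons]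
        conv_rhs => rw [← hm]
        congr 2
        omega
  · rcases eq_or_ne m 0 with h | h
    · subst h
      have hab := hr.1 rfl
      have hd : dysonInv a b 0 = Multiset.replicate (b - a) 1 := by
        simp [dysonInv]
      have hsup : (Multiset.replicate (b - a) 1).sup ≤ 1 :=
        Multiset.sup_le.2 fun x hx => (Multiset.eq_of_mem_replicate hx).le
      rw [hd]
      refine ⟨fun h => ?_, ?_, ?_⟩
      · exact absurd (Multiset.eq_of_mem_replicate h) (by omega)
      · rw [Multiset.card_replicate]; omega
      · rw [dyson, Multiset.card_replicate, if_pos (by omega)]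
    · have hM := sup_mem h
      have hM0 := sup_pos h0 h
      have hc := Multiset.card_erase_of_mem hM
      have hc0 : 0 < m.card := Multiset.card_pos.2 h
      have he0 : 0 ∉ m.erase m.sup := fun h => h0 (Multiset.mem_of_mem_erase h)
      have hcard : (dysonInv a b m).card = m.sup + b - a := by
        rw [dysonInv, Multiset.card_add, Multiset.card_map, hc, Multiset.card_replicate,
          Nat.pred_eq_sub_one]
        omega
      have hle : ∀ x ∈ dysonInv a b m, 0 < x ∧ x ≤ m.sup + 1 := by
        intro x hx
        rcases Multiset.mem_add.1 hx with hx | hx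
        · obtain ⟨y, hy, rfl⟩ := Multiset.mem_map.1 hx
          have := Multiset.le_sup (Multiset.mem_of_mem_erase hy)
          omega
        · rw [Multiset.eq_of_mem_replicate hx]
          omega
      have hsup : (dysonInv a b m).sup ≤ m.sup + 1 := Multiset.sup_le.2 fun x hx => (hle x hx).2
      refine ⟨fun h => lt_irrefl _ (hle 0 h).1, by omega, ?_⟩
      rw [dyson, hcard, if_neg (by omega), dysonInv, shrink_map_succ he0,
        show m.sup + b - a + a - b = m.sup by omega, Multiset.cons_erase hM]

section
variable {q : ℂ} (hq : ‖q‖ < 1 / 2)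
include hq

theorem gf_not (p : Multiset ℕ → Prop) :
    gf q (fun m => ¬ p m) = gf q (fun _ => True) - gf q p := by
  have h := gf_split hq (fun _ => True) p
  simp only [true_and] at h
  rw [h]; ring

theorem gf_rank_ge_succ (k : ℕ) : gf q (fun m => m.card + (k + 1) ≤ m.sup) =
    q ^ (k + 2) * (gf q (fun _ => True) - gf q fun m => m.card + (k + 4) ≤ m.sup) := by
  have h := gf_dyson q (a := k + 2) (b := 0) (by omega) (by omega)
  rw [pow_zero, one_mul] at h
  rw [← gf_not hq]
  refine Eq.trans (gf_congr fun m _ => ?_) (h.trans (congrArg _ (gf_congr fun m _ => ?_)))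
  · refine ⟨fun h => ⟨fun h' => ?_, by omega⟩, fun h => by omega⟩
    subst h'
    simp at h
  · omega

theorem gf_rank_ge_zero : gf q (fun m => m.card ≤ m.sup) =
    q * (gf q (fun _ => True) - gf q fun m => m.card + 3 ≤ m.sup) + 1 := by
  have h := gf_dyson q (a := 1) (b := 0) (by omega) (by omega)
  rw [pow_zero, one_mul, pow_one] at h
  have hs := gf_split hq (fun m => m.card ≤ m.sup) (fun m => m = 0)
  have h0 : gf q (fun m => m.card ≤ m.sup ∧ m = 0) = 1 := by
    rw [gf_congr (r := fun m => m = 0) fun m _ => ?_, gf_singleton 0 (by simp)]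
    · simp
    · refine ⟨fun h => h.2, fun h => ⟨by simp [h], h⟩⟩
  rw [hs, h0, ← gf_not hq, add_comm]
  congr 1
  refine Eq.trans (gf_congr fun m _ => ?_) (h.trans (congrArg _ (gf_congr fun m _ => ?_)))
  · refine ⟨fun h => ⟨fun h' => absurd h' h.2, by omega⟩, fun h => ⟨by omega, fun h' => ?_⟩⟩
    exact absurd (h.1 h') (by omega)
  · omega

theorem gf_rank_le_neg_succ (k : ℕ) : gf q (fun m => m.sup + (k + 1) ≤ m.card) =
    q ^ (k + 2) * (gf q (fun _ => True) - gf q fun m => m.sup + (k + 4) ≤ m.card) := by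
  have h := gf_dyson q (a := 0) (b := k + 2) (by omega) (by omega)
  rw [pow_zero, one_mul] at h
  rw [← gf_not hq]
  refine Eq.trans (gf_congr fun m _ => ?_) (h.symm.trans (congrArg _ (gf_congr fun m _ => ?_)))
  · omega
  · exact ⟨fun h => by omega, fun h => ⟨fun _ => by omega, by omega⟩⟩

end

end

section

/-- The terms of the partial theta series `∑ (-1)^(j-1) q^(j(κj-1)/2 + bj)`, `j ≥ 1`, `q = v²`. -/
noncomputable def tt (v : ℂ) (κ : ℕ) (b : ℤ) (j : ℕ) : ℂ :=
  (-1) ^ j * v ^ (((j : ℤ) + 1) * (κ * (j + 1) - 1 + 2 * b))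

/-- The terms of `∑ (-1)^(j-1) q^(j(κj-1)/2 + bj) / (1 - q^(11 * j))`, `j ≥ 1`, `q = v²`. -/
noncomputable def vt (v : ℂ) (κ : ℕ) (b : ℤ) (j : ℕ) : ℂ :=
  tt v κ b j / (1 - (v ^ 22) ^ (j + 1))

section
variable {v : ℂ} (hv : ‖v‖ < 1 / 2) (hv0 : v ≠ 0)
include hv hv0

omit hv0 in
theorem norm_lt_one_of_half : ‖v ^ 22‖ < 1 := by
  rw [norm_pow]; exact pow_lt_one₀ (norm_nonneg _) (by linarith) (by norm_num)

theorem summable_norm_vt {κ : ℕ} {b : ℤ} (hb : 1 - (κ : ℤ) ≤ b) :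
    Summable fun j => ‖vt v κ b j‖ := by
  have hn : 0 < ‖v‖ := norm_pos_iff.2 hv0
  have hg : Summable fun j : ℕ => ‖v‖ ^ (-(κ : ℤ)) * ‖v‖ ^ j * 2 :=
    ((summable_geometric_of_lt_one (norm_nonneg v) (by linarith)).mul_left _).mul_right _
  refine hg.of_nonneg_of_le (fun _ => norm_nonneg _) fun j => ?_
  rw [vt, tt, norm_div, norm_mul, norm_pow, norm_neg, norm_one, one_pow, one_mul, norm_zpow,
    div_eq_mul_inv]
  have h1 : ‖v‖ ^ (((j : ℤ) + 1) * (κ * (j + 1) - 1 + 2 * b)) ≤ ‖v‖ ^ (-(κ : ℤ)) * ‖v‖ ^ j := by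
    rw [← zpow_natCast ‖v‖ j, ← zpow_add₀ hn.ne']
    refine zpow_le_zpow_right_of_le_one₀ hn (by linarith) ?_
    rcases j with _ | j
    · push_cast; linarith
    · push_cast
      have hκ : (0 : ℤ) ≤ κ := by positivity
      have hj : (0 : ℤ) ≤ j := by positivity
      nlinarith [mul_nonneg hκ hj, mul_nonneg hj hj, mul_nonneg (mul_nonneg hκ hj) hj]
  have h2 : ‖1 - (v ^ 22) ^ (j + 1)‖⁻¹ ≤ 2 := by
    rw [inv_le_comm₀ (norm_pos_iff.2 (one_sub_pow_succ_ne_zero (norm_lt_one_of_half hv) j))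
      (by norm_num)]
    have h3 : ‖(v ^ 22) ^ (j + 1)‖ ≤ 1 / 2 := by
      rw [← pow_mul, norm_pow]
      calc ‖v‖ ^ (22 * (j + 1)) ≤ ‖v‖ ^ 1 :=
            pow_le_pow_of_le_one hn.le (by linarith) (by omega)
        _ ≤ 1 / 2 := by rw [pow_one]; exact hv.le
    have h4 := norm_sub_norm_le (1 : ℂ) ((v ^ 22) ^ (j + 1))
    rw [norm_one] at h4
    linarith
  gcongr

theorem summable_vt {κ : ℕ} {b : ℤ} (hb : 1 - (κ : ℤ) ≤ b) : Summable (vt v κ b) :=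
  (summable_norm_vt hv hv0 hb).of_norm

omit hv in
theorem tt_add (κ : ℕ) (b c : ℤ) (j : ℕ) : tt v κ (b + c) j = tt v κ b j * (v ^ (2 * c)) ^ (j + 1) := by
  rw [tt, tt, mul_assoc, ← zpow_natCast (v ^ (2 * c)), ← zpow_mul, ← zpow_add₀ hv0]
  congr 2; push_cast; ring

omit hv in
theorem vt_add (κ : ℕ) (b c : ℤ) (j : ℕ) : vt v κ (b + c) j = vt v κ b j * (v ^ (2 * c)) ^ (j + 1) := by
  rw [vt, vt, tt_add hv0]; ring

theorem vt_sub (κ : ℕ) (b : ℤ) (j : ℕ) : vt v κ b j - vt v κ (b + 11) j = tt v κ b j := by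
  have h := one_sub_pow_succ_ne_zero (norm_lt_one_of_half hv) j
  rw [vt_add hv0, vt, show v ^ (2 * (11 : ℤ)) = v ^ 22 by norm_cast]
  field_simp

theorem tsum_vt_sub {κ : ℕ} {b : ℤ} (hb : 1 - (κ : ℤ) ≤ b) :
    (∑' j, vt v κ b j) - ∑' j, vt v κ (b + 11) j = ∑' j, tt v κ b j := by
  rw [← (summable_vt hv hv0 hb).tsum_sub (summable_vt hv hv0 (by linarith))]
  simp only [vt_sub hv hv0]

theorem summable_tt {κ : ℕ} {b : ℤ} (hb : 1 - (κ : ℤ) ≤ b) : Summable (tt v κ b) := by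
  refine ((summable_vt hv hv0 hb).sub (summable_vt (b := b + 11) hv hv0 (by linarith))).congr
    fun j => ?_
  exact vt_sub hv hv0 κ b j

theorem tsum_tt_rec {κ : ℕ} {b : ℤ} (hb : 1 - (κ : ℤ) ≤ b) :
    ∑' j, tt v κ b j = v ^ ((κ : ℤ) - 1 + 2 * b) * (1 - ∑' j, tt v κ (b + κ) j) := by
  rw [(summable_tt hv hv0 hb).tsum_eq_zero_add, mul_sub, ← tsum_mul_left, sub_eq_add_neg,
    ← tsum_neg]
  congr 1
  · simp [tt]
  · congr 1; ext j
    rw [tt, tt, mul_left_comm, ← zpow_add₀ hv0, pow_succ, mul_neg_one, neg_mul]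
    congr 3; push_cast; ring

theorem tendsto_tsum_vt {κ : ℕ} {b : ℤ} (hb : 1 - (κ : ℤ) ≤ b) :
    Tendsto (fun N : ℕ => ∑' j, vt v κ (b + N) j) atTop (𝓝 0) := by
  rw [← tsum_zero (α := ℂ) (β := ℕ)]
  have h2 : ‖v ^ 2‖ < 1 := by
    rw [norm_pow]; exact pow_lt_one₀ (norm_nonneg _) (by linarith) (by norm_num)
  have h3 : ∀ N : ℕ, v ^ (2 * (N : ℤ)) = (v ^ 2) ^ N := fun N => by
    rw [← pow_mul]; norm_cast
  refine tendsto_tsum_of_dominated_convergence (summable_norm_vt hv hv0 hb) (fun j => ?_)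
    (Eventually.of_forall fun N j => ?_)
  · have h1 : Tendsto (fun N : ℕ => vt v κ b j * ((v ^ 2) ^ N) ^ (j + 1)) atTop
        (𝓝 (vt v κ b j * 0 ^ (j + 1))) :=
      ((tendsto_pow_atTop_nhds_zero_of_norm_lt_one h2).pow (j + 1)).const_mul _
    simpa [vt_add hv0, h3] using h1
  · rw [vt_add hv0, h3, norm_mul, norm_pow, norm_pow]
    exact mul_le_of_le_one_right (norm_nonneg _)
      (pow_le_one₀ (by positivity) (pow_le_one₀ (norm_nonneg _) h2.le))

theorem tendsto_tsum_tt {κ : ℕ} {b : ℤ} (hb : 1 - (κ : ℤ) ≤ b) :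
    Tendsto (fun N : ℕ => ∑' j, tt v κ (b + N) j) atTop (𝓝 0) := by
  have h := (tendsto_tsum_vt hv hv0 hb).sub
    (tendsto_tsum_vt hv hv0 (b := b + 11) (by linarith : 1 - (κ : ℤ) ≤ b + 11))
  rw [sub_zero] at h
  refine h.congr fun N => ?_
  rw [← tsum_vt_sub hv hv0 (b := b + N) (by linarith [(Nat.cast_nonneg N : (0 : ℤ) ≤ N)]),
    show b + N + 11 = b + 11 + (N : ℤ) by ring]

/-- A null sequence satisfying the recursion of the partial theta series is a multiple of it. -/
theorem eq_tsum_tt {κ β : ℕ} (hκ : 0 < κ) {X : ℕ → ℂ} {p : ℂ}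
    (hX : ∀ k : ℕ, X k = v ^ ((κ : ℤ) - 1 + 2 * (β + k)) * (p - X (k + κ)))
    (h0 : Tendsto X atTop (𝓝 0)) (k : ℕ) : X k = p * ∑' j, tt v κ (β + k) j := by
  have hb : ∀ k : ℕ, 1 - (κ : ℤ) ≤ β + k := fun k => by
    have : (1 : ℤ) ≤ κ := by exact_mod_cast hκ
    have : (0 : ℤ) ≤ β := by positivity
    have : (0 : ℤ) ≤ k := by positivity
    linarith
  set D : ℕ → ℂ := fun k => X k - p * ∑' j, tt v κ (β + k) j with hD
  have hD0 : Tendsto D atTop (𝓝 0) := by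
    have h := h0.sub ((tendsto_tsum_tt hv hv0 (b := (β : ℤ)) (by simpa using hb 0)).const_mul p)
    simpa using h
  have hrec : ∀ k, ‖D k‖ ≤ ‖D (k + κ)‖ := fun k => by
    have h : D k = -(v ^ ((κ : ℤ) - 1 + 2 * (β + k)) * D (k + κ)) := by
      simp only [hD]
      rw [hX k, tsum_tt_rec hv hv0 (hb k), Nat.cast_add, add_assoc]
      ring
    rw [h, norm_neg, norm_mul]
    refine mul_le_of_le_one_left (norm_nonneg _) ?_
    have he : (0 : ℤ) ≤ (κ : ℤ) - 1 + 2 * (β + k) := by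
      have := hb k
      omega
    obtain ⟨e, he⟩ := Int.eq_ofNat_of_zero_le he
    rw [he, zpow_natCast, norm_pow]
    exact pow_le_one₀ (norm_nonneg _) (by linarith)
  have hit : ∀ i, ‖D k‖ ≤ ‖D (k + κ * i)‖ := fun i => by
    induction i with
    | zero => simp
    | succ i ih =>
      refine ih.trans ((hrec _).trans (le_of_eq ?_))
      rw [mul_add, mul_one, add_assoc]
  have hlim : Tendsto (fun i => ‖D (k + κ * i)‖) atTop (𝓝 0) := by
    have h1 : Tendsto (fun i => k + κ * i) atTop atTop :=
      tendsto_atTop_mono (fun i => show i ≤ k + κ * i by nlinarith) tendsto_id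
    simpa using (hD0.comp h1).norm
  have hz : ‖D k‖ ≤ 0 := ge_of_tendsto' hlim hit
  exact sub_eq_zero.1 (norm_le_zero_iff.1 hz)

/-- The bilateral sums in terms of unilateral ones. -/
theorem tsum_bt_eq {κ : ℕ} {c : ℤ} (h1 : 1 - (κ : ℤ) ≤ 11 - c) (h2 : 1 - (κ : ℤ) ≤ c + 1) :
    ∑' n, bt v κ c n = (∑' j, vt v κ (11 - c) j) - ∑' j, vt v κ (c + 1) j := by
  have hp : ∀ j : ℕ, bt v κ c ((j : ℤ) + 1) = -vt v κ (c + 1) j := fun j => by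
    rw [bt, vt, tt, show v ^ (22 * ((j : ℤ) + 1)) = (v ^ 22) ^ (j + 1) by rw [← pow_mul]; norm_cast,
      ← neg_div, ← neg_mul]
    congr 2
    · rw [← Nat.cast_succ, zpow_natCast, pow_succ, mul_neg_one]
    · congr 1; ring
  have hn : ∀ j : ℕ, bt v κ c (-((j : ℤ) + 1)) = vt v κ (11 - c) j := fun j => by
    have h := one_sub_pow_succ_ne_zero (norm_lt_one_of_half hv) j
    have hx : (v ^ 22) ^ (j + 1) ≠ 0 := by positivity
    rw [bt, vt, tt,
      show v ^ (22 * (-((j : ℤ) + 1))) = ((v ^ 22) ^ (j + 1))⁻¹ by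
        rw [← pow_mul, mul_neg, zpow_neg]; norm_cast,
      show ((j : ℤ) + 1) * (κ * (j + 1) - 1 + 2 * (11 - c)) =
        κ * (-((j : ℤ) + 1)) ^ 2 + (2 * c + 1) * (-((j : ℤ) + 1)) + 22 * ((j : ℤ) + 1) by ring,
      zpow_add₀ hv0 _ (22 * ((j : ℤ) + 1)),
      show v ^ (22 * ((j : ℤ) + 1)) = (v ^ 22) ^ (j + 1) by rw [← pow_mul]; norm_cast,
      show (-1 : ℂ) ^ (-((j : ℤ) + 1)) = -(-1) ^ j by
        rw [zpow_neg, ← inv_zpow, ← Nat.cast_succ, zpow_natCast, pow_succ]; norm_num]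
    generalize (v ^ 22) ^ (j + 1) = x at *
    generalize v ^ (κ * (-((j : ℤ) + 1)) ^ 2 + (2 * c + 1) * (-((j : ℤ) + 1))) = y
    have h' : 1 - x⁻¹ = -(1 - x) / x := by field_simp; ring
    rw [h']
    field_simp
  have hz : bt v κ c 0 = 0 := by simp [bt]
  have hsum : HasSum (bt v κ c) (0 + (-∑' j, vt v κ (c + 1) j) + ∑' j, vt v κ (11 - c) j) := by
    have hs1 : HasSum (fun j : ℕ => bt v κ c (j : ℤ)) (0 + (-∑' j, vt v κ (c + 1) j)) := by
      have h3 := (summable_vt hv hv0 h2).hasSum.neg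
      rw [← hasSum_nat_add_iff' 1]
      simpa [hp, hz] using h3
    have hs2 : HasSum (fun j : ℕ => bt v κ c (-((j : ℤ) + 1))) (∑' j, vt v κ (11 - c) j) := by
      simpa only [hn] using (summable_vt hv hv0 h1).hasSum
    exact HasSum.of_nat_of_neg_add_one hs1 hs2
  rw [hsum.tsum_eq]; ring

/-- Residue classes of a statistic, restricted to large values. -/
theorem gf_residue_tail {κ b : ℕ} {st : Multiset ℕ → ℤ} (hκ : 0 < κ)
    (hst : ∀ m, 0 ∉ m → st m ≤ m.sum)
    (h : ∀ k : ℕ, b ≤ k → gf (v ^ 2) (fun m => st m = k) = gf (v ^ 2) (fun _ => True) *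
      ((∑' j, tt v κ k j) - ∑' j, tt v κ (k + 1) j)) :
    gf (v ^ 2) (fun m => (b : ℤ) ≤ st m ∧ st m % 11 = b % 11) = gf (v ^ 2) (fun _ => True) *
      ((∑' j, vt v κ b j) - ∑' j, vt v κ (b + 1) j) := by
  have hq : ‖v ^ 2‖ < 1 / 2 := by
    rw [norm_pow]; nlinarith [norm_nonneg v]
  have hκ' : (1 : ℤ) ≤ κ := by exact_mod_cast hκ
  set P := gf (v ^ 2) (fun _ => True)
  set Y : ℕ → ℂ := fun N => gf (v ^ 2) (fun m => ((b + 11 * N : ℕ) : ℤ) ≤ st m ∧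
    st m % 11 = b % 11) with hY
  set Z : ℕ → ℂ := fun N => Y N - P * ((∑' j, vt v κ ((b + 11 * N : ℕ) : ℤ) j) -
    ∑' j, vt v κ (((b + 11 * N : ℕ) : ℤ) + 1) j) with hZ
  have hstep : ∀ N, Z (N + 1) = Z N := fun N => by
    have hs := gf_split hq (fun m => ((b + 11 * N : ℕ) : ℤ) ≤ st m ∧ st m % 11 = b % 11)
      (fun m => st m = ((b + 11 * N : ℕ) : ℤ))
    have e1 : gf (v ^ 2) (fun m => (((b + 11 * N : ℕ) : ℤ) ≤ st m ∧ st m % 11 = b % 11) ∧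
        st m = ((b + 11 * N : ℕ) : ℤ)) = gf (v ^ 2) (fun m => st m = ((b + 11 * N : ℕ) : ℤ)) :=
      gf_congr fun m _ => by push_cast; omega
    have e2 : gf (v ^ 2) (fun m => (((b + 11 * N : ℕ) : ℤ) ≤ st m ∧ st m % 11 = b % 11) ∧
        ¬ st m = ((b + 11 * N : ℕ) : ℤ)) = Y (N + 1) :=
      gf_congr fun m _ => by push_cast; omega
    rw [e1, e2, h _ (by omega)] at hs
    have hb0 : (0 : ℤ) ≤ ((b + 11 * N : ℕ) : ℤ) := by positivity
    have h1 := tsum_vt_sub hv hv0 (κ := κ) (b := ((b + 11 * N : ℕ) : ℤ)) (by linarith)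
    have h2 := tsum_vt_sub hv hv0 (κ := κ) (b := ((b + 11 * N : ℕ) : ℤ) + 1) (by linarith)
    have e3 : ((b + 11 * (N + 1) : ℕ) : ℤ) = ((b + 11 * N : ℕ) : ℤ) + 11 := by push_cast; ring
    have e4 : ((b + 11 * (N + 1) : ℕ) : ℤ) + 1 = ((b + 11 * N : ℕ) : ℤ) + 1 + 11 := by
      push_cast; ring
    simp only [hZ]
    rw [e4, e3]
    have hYN : Y N = gf (v ^ 2) (fun m => ((b + 11 * N : ℕ) : ℤ) ≤ st m ∧ st m % 11 = b % 11) := rfl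
    linear_combination hYN - hs + P * (h1 - h2)
  have hconst : ∀ N, Z N = Z 0 := fun N => by
    induction N with
    | zero => rfl
    | succ N ih => rw [hstep, ih]
  have hY0 : Tendsto Y atTop (𝓝 0) := by
    have h1 := tendsto_gf hq (p := fun N m => ((b + 11 * N : ℕ) : ℤ) ≤ st m ∧
      st m % 11 = b % 11) (r := fun _ => False) fun N m h0 hN => by
        have := hst m h0
        simp only [iff_false]
        push_cast
        omega
    rwa [gf_false fun _ _ h => h] at h1
  have hsub : Tendsto (fun N : ℕ => 11 * N) atTop atTop :=
    tendsto_atTop_mono (fun N => show N ≤ 11 * N by omega) tendsto_id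
  have hV : ∀ c : ℤ, 0 ≤ c → Tendsto (fun N : ℕ => ∑' j, vt v κ (c + ((11 * N : ℕ) : ℤ)) j) atTop
      (𝓝 0) := fun c hc => (tendsto_tsum_vt hv hv0 (by linarith)).comp hsub
  have hZ0 : Tendsto Z atTop (𝓝 0) := by
    have h1 := hY0.sub (((hV b (by positivity)).sub (hV (b + 1) (by positivity))).const_mul P)
    rw [sub_zero, mul_zero, sub_zero] at h1
    refine h1.congr fun N => ?_
    simp only [hZ]
    rw [show ((b + 11 * N : ℕ) : ℤ) = b + ((11 * N : ℕ) : ℤ) by push_cast; ring, add_right_comm]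
  have hz : Z 0 = 0 := tendsto_nhds_unique
    (tendsto_const_nhds.congr fun N => (hconst N).symm) hZ0
  simpa [hZ, hY] using sub_eq_zero.1 hz

end

end

section

/-- The generating function of the partitions with exactly `k` parts larger than `ω`. -/
noncomputable def gfAbove (q : ℂ) (ω k : ℕ) : ℂ := gf q fun m => m.countP (ω < ·) = k

theorem countP_map_succ (ω : ℕ) (m : Multiset ℕ) :
    (m.map fun x => if ω < x then x + 1 else x).countP (ω + 1 < ·) = m.countP (ω < ·) := by
  induction m using Multiset.induction_on with
  | empty => simp
  | cons a m ih =>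
    rw [Multiset.map_cons, Multiset.countP_cons, Multiset.countP_cons, ih]
    congr 1
    split_ifs <;> omega

theorem sum_map_succ_above (ω : ℕ) (m : Multiset ℕ) :
    (m.map fun x => if ω < x then x + 1 else x).sum = m.sum + m.countP (ω < ·) := by
  induction m using Multiset.induction_on with
  | empty => simp
  | cons a m ih =>
    rw [Multiset.map_cons, Multiset.countP_cons, Multiset.sum_cons, Multiset.sum_cons, ih]
    split_ifs <;> omega

theorem gf_skip (q : ℂ) (ω k : ℕ) :
    gf q (fun m => m.countP (ω + 1 < ·) = k ∧ ω + 1 ∉ m) = q ^ k * gfAbove q ω k := by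
  have h := gf_bij (q := q) (p := fun m => m.countP (ω < ·) = k)
    (r := fun m => m.countP (ω + 1 < ·) = k ∧ ω + 1 ∉ m)
    (fun m => m.map fun x => if ω < x then x + 1 else x)
    (fun m => m.map fun x => if ω < x then x - 1 else x) k 0
    (fun m h0 hp => ⟨fun h => ?_, ⟨?_, fun h => ?_⟩, ?_, ?_⟩) (fun m h0 hr => ?_)
  · rwa [pow_zero, one_mul] at h
  · obtain ⟨x, hx, h⟩ := Multiset.mem_map.1 h
    split_ifs at h
    exact h0 (h ▸ hx)
  · rw [countP_map_succ, hp]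
  · obtain ⟨x, hx, h⟩ := Multiset.mem_map.1 h
    split_ifs at h <;> omega
  · rw [sum_map_succ_above, hp, add_zero]
  · rw [Multiset.map_map]
    conv_rhs => rw [← Multiset.map_id m]
    refine Multiset.map_congr rfl fun x _ => ?_
    simp only [Function.comp, id]
    split_ifs <;> omega
  · have hfg : (m.map fun x => if ω < x then x - 1 else x).map
        (fun x => if ω < x then x + 1 else x) = m := by
      rw [Multiset.map_map]
      conv_rhs => rw [← Multiset.map_id m]
      refine Multiset.map_congr rfl fun x hx => ?_
      have : x ≠ ω + 1 := fun h => hr.2 (h ▸ hx)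
      simp only [Function.comp, id]
      split_ifs <;> omega
    refine ⟨fun h => ?_, ?_, hfg⟩
    · obtain ⟨x, hx, h⟩ := Multiset.mem_map.1 h
      have h1 : x ≠ ω + 1 := fun h => hr.2 (h ▸ hx)
      have h2 : x ≠ 0 := fun h => h0 (h ▸ hx)
      split_ifs at h <;> omega
    · rw [← countP_map_succ, hfg, hr.1]

theorem countP_zero {m : Multiset ℕ} (h0 : 0 ∉ m) : m.countP (0 < ·) = m.card :=
  Multiset.countP_eq_card.2 fun _ hx => Nat.pos_of_ne_zero fun h => h0 (h ▸ hx)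

section
variable {q : ℂ} (hq : ‖q‖ < 1 / 2)
include hq

theorem gfAbove_zero (k : ℕ) : gfAbove q 0 k = q ^ k / fpoch q k := by
  have hq1 : ‖q‖ < 1 := by linarith
  induction k with
  | zero =>
    rw [gfAbove, gf_congr (r := fun m => m = 0) fun m h0 => ?_, gf_singleton 0 (by simp)]
    · simp [fpoch]
    · rw [countP_zero h0, Multiset.card_eq_zero]
  | succ k ih =>
    have hs := gf_split hq (fun m => m.countP (0 < ·) = k + 1) (fun m => 1 ∈ m)
    have h1 : gf q (fun m => m.countP (0 < ·) = k + 1 ∧ 1 ∈ m) = q ^ 1 * gfAbove q 0 k := by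
      refine gf_erase (by omega) (fun m h0 => ?_) fun m _ h => h.2
      rw [Multiset.countP_cons_of_pos _ (by norm_num : 0 < 1)]
      simp
    have h2 : gf q (fun m => m.countP (0 < ·) = k + 1 ∧ 1 ∉ m) =
        q ^ (k + 1) * gfAbove q 0 (k + 1) := by
      rw [← gf_skip]
      refine gf_congr fun m h0 => and_congr_left fun h => ?_
      have h3 : m.countP (1 < ·) = m.countP (0 < ·) := by
        refine Multiset.countP_congr rfl fun x hx => ?_
        have h1 : x ≠ 1 := fun h' => h (h' ▸ hx)
        have h2 : x ≠ 0 := fun h' => h0 (h' ▸ hx)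
        simp only [eq_iff_iff]
        omega
      rw [zero_add, h3]
    rw [h1, h2] at hs
    have hne := one_sub_pow_succ_ne_zero hq1 k
    have hne' := fpoch_ne_zero hq1 k
    have hs' : gfAbove q 0 (k + 1) * (1 - q ^ (k + 1)) = q * gfAbove q 0 k := by
      have hd : gf q (fun m => m.countP (0 < ·) = k + 1) = gfAbove q 0 (k + 1) := rfl
      linear_combination hs - hd
    rw [eq_div_of_mul_eq hne hs', ih, fpoch_succ]
    field_simp
    ring

theorem gfAbove_eq (ω k : ℕ) :
    gfAbove q ω k = q ^ ((ω + 1) * k) / (fpoch q ω * fpoch q k) := by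
  have hq1 : ‖q‖ < 1 := by linarith
  induction ω with
  | zero => rw [gfAbove_zero hq]; simp [fpoch_zero]
  | succ ω ih =>
    have hs := gf_split hq (fun m => m.countP (ω + 1 < ·) = k) (fun m => ω + 1 ∈ m)
    have h1 : gf q (fun m => m.countP (ω + 1 < ·) = k ∧ ω + 1 ∈ m) =
        q ^ (ω + 1) * gfAbove q (ω + 1) k := by
      refine gf_erase (by omega) (fun m h0 => ?_) fun m _ h => h.2
      rw [Multiset.countP_cons_of_neg _ (lt_irrefl _)]
      simp
    rw [h1, gf_skip] at hs
    have hne := one_sub_pow_succ_ne_zero hq1 ω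
    have hne1 := fpoch_ne_zero hq1 ω
    have hne2 := fpoch_ne_zero hq1 k
    have hs' : gfAbove q (ω + 1) k * (1 - q ^ (ω + 1)) = q ^ k * gfAbove q ω k := by
      have hd : gf q (fun m => m.countP (ω + 1 < ·) = k) = gfAbove q (ω + 1) k := rfl
      linear_combination hs - hd
    rw [eq_div_of_mul_eq hne hs', ih, fpoch_succ, show (ω + 1 + 1) * k = (ω + 1) * k + k by ring]
    field_simp
    ring

theorem gf_count_one {ω : ℕ} (hω : 1 ≤ ω) (j k : ℕ) :
    gf q (fun m => m.count 1 = j ∧ m.countP (ω < ·) = k) = q ^ j * (1 - q) * gfAbove q ω k := by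
  induction j with
  | zero =>
    have hs := gf_split hq (fun m => m.countP (ω < ·) = k) (fun m => 1 ∈ m)
    have h1 : gf q (fun m => m.countP (ω < ·) = k ∧ 1 ∈ m) = q ^ 1 * gfAbove q ω k := by
      refine gf_erase (by omega) (fun m h0 => ?_) fun m _ h => h.2
      rw [Multiset.countP_cons_of_neg _ (by omega)]
      simp
    have h2 : gf q (fun m => m.countP (ω < ·) = k ∧ 1 ∉ m) =
        gf q (fun m => m.count 1 = 0 ∧ m.countP (ω < ·) = k) := by
      refine gf_congr fun m _ => ?_
      rw [Multiset.count_eq_zero, and_comm]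
    have hd : gf q (fun m => m.countP (ω < ·) = k) = gfAbove q ω k := rfl
    linear_combination hd - hs - h1 - h2
  | succ j ih =>
    have h := gf_erase (q := q) (t := 1) (p := fun m => m.count 1 = j ∧ m.countP (ω < ·) = k)
      (r := fun m => m.count 1 = j + 1 ∧ m.countP (ω < ·) = k) one_ne_zero (fun m _ => by
        rw [Multiset.count_cons_self, Multiset.countP_cons_of_neg _ (by omega), add_left_inj])
      fun m _ h => Multiset.count_pos.1 (by omega)
    rw [h, ih]
    ring

/-- The number of ones larger than any bound contributes nothing in the limit. -/
theorem tendsto_sum_gf (p : Multiset ℕ → Prop) (st : Multiset ℕ → ℕ)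
    (hst : ∀ m, 0 ∉ m → st m ≤ m.sum) :
    Tendsto (fun N => ∑ i ∈ Finset.range N, gf q (fun m => p m ∧ st m = i)) atTop
      (𝓝 (gf q p)) := by
  have h1 : ∀ N, ∑ i ∈ Finset.range N, gf q (fun m => p m ∧ st m = i) =
      gf q (fun m => p m ∧ st m < N) := fun N => by
    induction N with
    | zero => rw [gf_false (p := fun m => p m ∧ st m < 0) (by simp)]; simp
    | succ N ih =>
      rw [Finset.sum_range_succ, ih, gf_split hq (fun m => p m ∧ st m < N + 1) (fun m => st m < N)]
      congr 1
      · exact gf_congr fun m _ => ⟨fun h => ⟨⟨h.1, by omega⟩, h.2⟩, fun h => ⟨h.1.1, h.2⟩⟩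
      · exact gf_congr fun m _ => ⟨fun h => ⟨⟨h.1, by omega⟩, by omega⟩,
          fun h => ⟨h.1.1, by omega⟩⟩
  simp only [h1]
  refine tendsto_gf hq fun N m h0 hN => ?_
  have := hst m h0
  exact ⟨fun h => h.1, fun h => ⟨h, by omega⟩⟩

theorem norm_inv_fpoch_le (n : ℕ) : ‖(fpoch q n)⁻¹‖ ≤
    ∑' m, {m : Multiset ℕ | 0 ∉ m}.indicator (fun m => ‖q‖ ^ m.sum) m := by
  have h := gfAbove_eq hq n 0
  rw [mul_zero, pow_zero, fpoch_zero, mul_one, one_div] at h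
  rw [← h]
  exact norm_gf_le hq _

theorem norm_gfAbove_le (ω k : ℕ) : ‖gfAbove q ω (ω + k)‖ ≤ ‖q‖ ^ ω * ‖q‖ ^ k *
    (∑' m, {m : Multiset ℕ | 0 ∉ m}.indicator (fun m => ‖q‖ ^ m.sum) m) ^ 2 := by
  have h1 := norm_inv_fpoch_le hq ω
  have h2 := norm_inv_fpoch_le hq (ω + k)
  rw [gfAbove_eq hq, div_eq_mul_inv, mul_inv, norm_mul, norm_mul, norm_pow, ← pow_add, pow_two]
  have h3 : ‖q‖ ^ ((ω + 1) * (ω + k)) ≤ ‖q‖ ^ (ω + k) :=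
    pow_le_pow_of_le_one (norm_nonneg _) (by linarith) (by nlinarith)
  gcongr
  exact (norm_nonneg _).trans h1

theorem summable_gfAbove (k : ℕ) : Summable fun ω => gfAbove q ω (ω + k) := by
  refine Summable.of_norm_bounded (g := fun ω => ‖q‖ ^ ω * ‖q‖ ^ k *
    (∑' m, {m : Multiset ℕ | 0 ∉ m}.indicator (fun m => ‖q‖ ^ m.sum) m) ^ 2) ?_
    fun ω => norm_gfAbove_le hq ω k
  exact ((summable_geometric_of_lt_one (norm_nonneg _) (by linarith)).mul_right _).mul_right _

theorem summable_pow_mul_gfAbove (k : ℕ) : Summable fun ω => q ^ ω * gfAbove q ω (ω + k) := by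
  refine Summable.of_norm_bounded (summable_gfAbove hq k).norm fun ω => ?_
  rw [norm_mul, norm_pow]
  exact mul_le_of_le_one_left (norm_nonneg _) (pow_le_one₀ (norm_nonneg _) (by linarith))

theorem tendsto_tsum_gfAbove : Tendsto (fun k => ∑' ω, gfAbove q ω (ω + k)) atTop (𝓝 0) := by
  rw [← tsum_zero (α := ℂ) (β := ℕ)]
  set B := ∑' m, {m : Multiset ℕ | 0 ∉ m}.indicator (fun m => ‖q‖ ^ m.sum) m
  have hq1 : ‖q‖ < 1 := by linarith
  refine tendsto_tsum_of_dominated_convergence (bound := fun ω => ‖q‖ ^ ω * B ^ 2)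
    ((summable_geometric_of_lt_one (norm_nonneg _) hq1).mul_right _) (fun ω => ?_)
    (Eventually.of_forall fun k ω => ?_)
  · refine squeeze_zero_norm (fun k => norm_gfAbove_le hq ω k) ?_
    have h := ((tendsto_pow_atTop_nhds_zero_of_lt_one (norm_nonneg q) hq1).const_mul
      (‖q‖ ^ ω)).mul_const (B ^ 2)
    simpa using h
  · refine (norm_gfAbove_le hq ω k).trans ?_
    have : ‖q‖ ^ k ≤ 1 := pow_le_one₀ (norm_nonneg _) hq1.le
    have h2 : ‖q‖ ^ ω * ‖q‖ ^ k ≤ ‖q‖ ^ ω := mul_le_of_le_one_right (by positivity) this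
    gcongr

theorem tsum_gfAbove_sub (k : ℕ) :
    (∑' ω, gfAbove q ω (ω + k)) - ∑' ω, gfAbove q ω (ω + (k + 1)) =
      (1 - q) * ∑' ω, q ^ ω * gfAbove q ω (ω + k) := by
  have hq1 : ‖q‖ < 1 := by linarith
  have s1 := summable_gfAbove hq k
  have s2 := summable_pow_mul_gfAbove hq k
  have hu := (s1.sub s2).tsum_eq_zero_add
  rw [s1.tsum_sub s2] at hu
  have hu' := ((summable_nat_add_iff 1).2 (s1.sub s2)).tsum_add (s2.mul_left q)
  rw [tsum_mul_left] at hu'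
  have hterm : ∀ ω, (gfAbove q (ω + 1) (ω + 1 + k) - q ^ (ω + 1) * gfAbove q (ω + 1) (ω + 1 + k)) +
      q * (q ^ ω * gfAbove q ω (ω + k)) = gfAbove q ω (ω + (k + 1)) := fun ω => by
    have h1 := one_sub_pow_succ_ne_zero hq1 ω
    have h2 := one_sub_pow_succ_ne_zero hq1 (ω + k)
    have h3 := fpoch_ne_zero hq1 ω
    have h4 := fpoch_ne_zero hq1 (ω + k)
    rw [gfAbove_eq hq, gfAbove_eq hq, gfAbove_eq hq, show ω + 1 + k = ω + k + 1 by ring,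
      ← add_assoc, fpoch_succ, fpoch_succ]
    field_simp
    ring
  simp only [hterm] at hu'
  simp only [zero_add, pow_zero, one_mul, sub_self] at hu
  linear_combination hu - hu'

theorem sum_pow_div_fpoch (ω N : ℕ) :
    ∑ k ∈ Finset.range (N + 1), q ^ ((ω + 2) * k) / fpoch q k =
      (1 - q ^ (ω + 1)) * ∑ k ∈ Finset.range N, q ^ ((ω + 1) * k) / fpoch q k +
        q ^ ((ω + 1) * N) / fpoch q N := by
  have hq1 : ‖q‖ < 1 := by linarith
  induction N with
  | zero => simp
  | succ N ih =>
    rw [Finset.sum_range_succ, ih, Finset.sum_range_succ _ N, fpoch_succ]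
    have h1 := one_sub_pow_succ_ne_zero hq1 N
    have h2 := fpoch_ne_zero hq1 N
    field_simp
    ring

theorem sum_pow_div_fpoch_zero (N : ℕ) :
    ∑ k ∈ Finset.range (N + 1), q ^ k / fpoch q k = 1 / fpoch q N := by
  have hq1 : ‖q‖ < 1 := by linarith
  induction N with
  | zero => simp
  | succ N ih =>
    rw [Finset.sum_range_succ, ih, fpoch_succ]
    have h1 := one_sub_pow_succ_ne_zero hq1 N
    have h2 := fpoch_ne_zero hq1 N
    field_simp
    ring

theorem sum_gfAbove (k N : ℕ) : ∑ i ∈ Finset.range (N + k + 1), gfAbove q N i =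
    ∑ s ∈ Finset.range (N + 1), q ^ (s * (s + k)) / (fpoch q s * fpoch q (s + k)) := by
  have hq1 : ‖q‖ < 1 := by linarith
  have hF : ∀ N M, ∑ i ∈ Finset.range M, gfAbove q N i =
      (∑ i ∈ Finset.range M, q ^ ((N + 1) * i) / fpoch q i) / fpoch q N := fun N M => by
    rw [Finset.sum_div]
    refine Finset.sum_congr rfl fun i _ => ?_
    rw [gfAbove_eq hq, div_div, mul_comm (fpoch q i)]
  induction N with
  | zero =>
    have := sum_pow_div_fpoch_zero hq k
    rw [hF]
    simp only [zero_add, one_mul, this]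
    simp [fpoch_zero]
  | succ N ih =>
    rw [Finset.sum_range_succ _ (N + 1), ← ih, hF, hF,
      show N + 1 + k + 1 = (N + k + 1) + 1 by ring, show N + 1 + 1 = N + 2 by ring,
      sum_pow_div_fpoch hq, show N + 1 + k = N + k + 1 by ring, fpoch_succ _ N]
    have h1 := one_sub_pow_succ_ne_zero hq1 N
    have h2 := fpoch_ne_zero hq1 N
    have h3 := fpoch_ne_zero hq1 (N + k + 1)
    field_simp

/-- The Durfee rectangle identity. -/
theorem tendsto_durfee (k : ℕ) : Tendsto (fun N => ∑ s ∈ Finset.range (N + 1),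
    q ^ (s * (s + k)) / (fpoch q s * fpoch q (s + k))) atTop (𝓝 (gf q fun _ => True)) := by
  have h1 : ∀ ω N, ∑ i ∈ Finset.range N, gfAbove q ω i =
      gf q (fun m => m.countP (ω < ·) < N) := fun ω N => by
    induction N with
    | zero => rw [gf_false (p := fun m => m.countP (ω < ·) < 0) (by simp)]; simp
    | succ N ih =>
      rw [Finset.sum_range_succ, ih, gf_split hq (fun m => m.countP (ω < ·) < N + 1)
        (fun m => m.countP (ω < ·) < N)]
      congr 1
      · exact gf_congr fun m _ => by omega
      · exact gf_congr fun m _ => by omega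
  simp only [← sum_gfAbove hq, h1]
  refine tendsto_gf hq fun N m h0 hN => ?_
  have : m.countP (N < ·) = 0 := by
    refine Multiset.countP_eq_zero.2 fun x hx => ?_
    have := Multiset.le_sum_of_mem hx
    omega
  rw [this]
  simp

theorem tsum_gfAbove_rec (k : ℕ) : ∑' ω, gfAbove q ω (ω + k) =
    q ^ k * (gf q (fun _ => True) - ∑' ω, gfAbove q ω (ω + (k + 1))) := by
  have hq1 : ‖q‖ < 1 := by linarith
  have h1 := ((tendsto_durfee hq k).const_mul (q ^ k))
  have h2 := ((summable_gfAbove hq k).hasSum.tendsto_sum_nat.comp (tendsto_add_atTop_nat 1)).add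
    ((summable_gfAbove hq (k + 1)).hasSum.tendsto_sum_nat.const_mul (q ^ k))
  have h3 : ∀ N, q ^ k * ∑ s ∈ Finset.range (N + 1),
      q ^ (s * (s + k)) / (fpoch q s * fpoch q (s + k)) =
      ∑ ω ∈ Finset.range (N + 1), gfAbove q ω (ω + k) +
        q ^ k * ∑ ω ∈ Finset.range N, gfAbove q ω (ω + (k + 1)) := fun N => by
    induction N with
    | zero => simp [gfAbove_eq hq]; ring
    | succ N ih =>
      have r1 := Finset.sum_range_succ
        (fun s => q ^ (s * (s + k)) / (fpoch q s * fpoch q (s + k))) (N + 1)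
      have r2 := Finset.sum_range_succ (fun ω => gfAbove q ω (ω + k)) (N + 1)
      have r3 := Finset.sum_range_succ (fun ω => gfAbove q ω (ω + (k + 1))) N
      have e : q ^ k * (q ^ ((N + 1) * (N + 1 + k)) / (fpoch q (N + 1) * fpoch q (N + 1 + k))) =
          gfAbove q (N + 1) (N + 1 + k) + q ^ k * gfAbove q N (N + (k + 1)) := by
        have h1 := one_sub_pow_succ_ne_zero hq1 N
        have h3 := fpoch_ne_zero hq1 N
        have h4 := fpoch_ne_zero hq1 (N + k + 1)
        rw [gfAbove_eq hq, gfAbove_eq hq, show N + 1 + k = N + k + 1 by ring, ← add_assoc,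
          fpoch_succ q N]
        field_simp
        ring
      rw [r1, r2, r3]
      linear_combination ih + e
  have h4 := tendsto_nhds_unique (h1.congr h3) h2
  linear_combination -h4

end

end

section

/-- The crank of the partition with parts `m`. -/
def crank (m : Multiset ℕ) : ℤ :=
  if m.count 1 = 0 then (m.sup : ℤ)
  else ((m.filter fun x => m.count 1 < x).card : ℤ) - (m.count 1 : ℤ)

theorem crank_of_count_eq_zero {m : Multiset ℕ} (h : m.count 1 = 0) : crank m = m.sup := if_pos h

theorem crank_of_count_eq {m : Multiset ℕ} {ω : ℕ} (hω : 1 ≤ ω) (h : m.count 1 = ω) :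
    crank m = m.countP (ω < ·) - ω := by
  subst h
  rw [crank, if_neg (by omega), Multiset.countP_eq_card_filter]

theorem sup_le_sum (m : Multiset ℕ) : m.sup ≤ m.sum :=
  Multiset.sup_le.2 fun _ hx => Multiset.le_sum_of_mem hx

theorem card_le_sum {m : Multiset ℕ} (h0 : 0 ∉ m) : m.card ≤ m.sum := by
  have := sum_shrink h0
  omega

theorem abs_crank_le {m : Multiset ℕ} (h0 : 0 ∉ m) : |crank m| ≤ m.sum := by
  have h1 := sup_le_sum m
  have h2 := card_le_sum h0
  have h3 := Multiset.count_le_card 1 m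
  rw [crank, abs_le]
  split_ifs with h
  · omega
  · have h4 := Multiset.card_le_card (Multiset.filter_le (fun x => m.count 1 < x) m)
    omega

theorem abs_rank_le {m : Multiset ℕ} (h0 : 0 ∉ m) : |(m.sup : ℤ) - m.card| ≤ m.sum := by
  have h1 := sup_le_sum m
  have h2 := card_le_sum h0
  rw [abs_le]
  omega

section
variable {q : ℂ} (hq : ‖q‖ < 1 / 2)
include hq

theorem gf_no_ones (k : ℕ) : gf q (fun m => m.count 1 = 0 ∧ m.sup = k) =
    (1 - q) * gfAbove q 0 k + if k = 0 then q else if k = 1 then -q else 0 := by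
  have hq1 : ‖q‖ < 1 := by linarith
  obtain rfl | rfl | ⟨k, rfl⟩ : k = 0 ∨ k = 1 ∨ ∃ j, k = j + 2 := by
    obtain _ | _ | k := k
    · exact Or.inl rfl
    · exact Or.inr (Or.inl rfl)
    · exact Or.inr (Or.inr ⟨k, rfl⟩)
  · have h : gf q (fun m => m.count 1 = 0 ∧ m.sup = 0) = gf q (fun m => m = 0) := by
      refine gf_congr fun m h0 => ⟨fun h => ?_, fun h => by simp [h]⟩
      by_contra h1
      exact (sup_pos h0 h1).ne' h.2
    rw [h, gf_singleton 0 (by simp), gfAbove_zero hq]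
    simp [fpoch_zero]
  · rw [gf_false, gfAbove_zero hq]
    · have := one_sub_pow_succ_ne_zero hq1 0
      rw [fpoch_succ, fpoch_zero, if_neg one_ne_zero, if_pos rfl]
      simp only [zero_add, pow_one, one_mul] at this ⊢
      field_simp
      ring
    · rintro m h0 ⟨h1, h2⟩
      have h3 : m ≠ 0 := by
        rintro rfl
        simp at h2
      exact Multiset.count_eq_zero.1 h1 (h2 ▸ sup_mem h3)
  · have h := gf_erase (q := q) (t := k + 2)
      (p := fun m => m.count 1 = 0 ∧ m.countP (k + 2 < ·) = 0)
      (r := fun m => m.count 1 = 0 ∧ m.sup = k + 2) (by omega) (fun m _ => by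
        rw [Multiset.count_cons_of_ne (by omega), Multiset.sup_cons, Multiset.countP_eq_zero,
          sup_eq_left, Multiset.sup_le]
        simp only [not_lt]) fun m _ h => by
        have h3 : m ≠ 0 := by
          rintro rfl
          simp at h
        exact h.2 ▸ sup_mem h3
    rw [h, gf_count_one hq (by omega), gfAbove_eq hq, gfAbove_zero hq, if_neg (by omega),
      if_neg (by omega), fpoch_zero]
    simp only [mul_zero, pow_zero, one_mul, mul_one, add_zero]
    ring

theorem gf_crank_eq (k : ℕ) : gf q (fun m => crank m = k) =
    (∑' ω, gfAbove q ω (ω + k)) - (∑' ω, gfAbove q ω (ω + (k + 1))) +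
      if k = 0 then q else if k = 1 then -q else 0 := by
  set c : ℂ := if k = 0 then q else if k = 1 then -q else 0 with hc
  have h1 := tendsto_sum_gf hq (fun m => crank m = k) (fun m => m.count 1) fun m h0 =>
    (Multiset.count_le_card 1 m).trans (card_le_sum h0)
  have h2 : ∀ i, gf q (fun m => crank m = k ∧ m.count 1 = i) =
      (1 - q) * (q ^ i * gfAbove q i (i + k)) + if i = 0 then c else 0 := fun i => by
    obtain rfl | hi := Nat.eq_zero_or_pos i
    · rw [if_pos rfl, pow_zero, one_mul, zero_add, hc, ← gf_no_ones hq]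
      refine gf_congr fun m _ => ?_
      rw [and_comm]
      refine and_congr_right fun h => ?_
      rw [crank_of_count_eq_zero h, Nat.cast_inj]
    · rw [if_neg hi.ne', add_zero, ← mul_assoc, mul_comm (1 - q), ← gf_count_one hq hi]
      refine gf_congr fun m _ => ?_
      rw [and_comm]
      refine and_congr_right fun h => ?_
      rw [crank_of_count_eq hi h]
      omega
  simp only [h2] at h1
  have h3 := (((summable_pow_mul_gfAbove hq k).hasSum.mul_left (1 - q)).add
    (hasSum_ite_eq 0 c)).tendsto_sum_nat
  rw [tendsto_nhds_unique h1 h3, tsum_gfAbove_sub hq]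

theorem gf_crank_eq_neg (k : ℕ) : gf q (fun m => crank m = -((k + 1 : ℕ) : ℤ)) =
    (∑' ω, gfAbove q ω (ω + (k + 1))) - (∑' ω, gfAbove q ω (ω + (k + 1 + 1))) := by
  have h1 := tendsto_sum_gf hq (fun m => crank m = -((k + 1 : ℕ) : ℤ))
    (fun m => m.count 1 - (k + 1)) fun m h0 =>
    (Nat.sub_le _ _).trans ((Multiset.count_le_card 1 m).trans (card_le_sum h0))
  have h2 : ∀ i, gf q (fun m => crank m = -((k + 1 : ℕ) : ℤ) ∧ m.count 1 - (k + 1) = i) =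
      (1 - q) * (q ^ i * gfAbove q i (i + (k + 1))) := fun i => by
    have h3 : gf q (fun m => crank m = -((k + 1 : ℕ) : ℤ) ∧ m.count 1 - (k + 1) = i) =
        gf q (fun m => m.count 1 = i + k + 1 ∧ m.countP (i + k + 1 < ·) = i) := by
      refine gf_congr fun m _ => ⟨fun ⟨h, h'⟩ => ?_, fun ⟨h, h'⟩ => ?_⟩
      · obtain hz | hz := Nat.eq_zero_or_pos (m.count 1)
        · rw [crank_of_count_eq_zero hz] at h
          omega
        · have hc := crank_of_count_eq hz rfl
          have : m.count 1 = i + k + 1 := by omega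
          rw [this] at hc
          exact ⟨this, by omega⟩
      · rw [crank_of_count_eq (by omega) h]
        omega
    rw [h3, gf_count_one hq (by omega), gfAbove_eq hq, gfAbove_eq hq]
    have e : q ^ (i + k + 1) * q ^ ((i + k + 1 + 1) * i) =
      q ^ i * q ^ ((i + 1) * (i + (k + 1))) := by ring
    rw [← add_assoc i k 1, div_eq_mul_inv, div_eq_mul_inv, mul_comm (fpoch q i)]
    linear_combination (1 - q) * (fpoch q (i + k + 1) * fpoch q i)⁻¹ * e
  simp only [h2] at h1
  have h3 := ((summable_pow_mul_gfAbove hq (k + 1)).hasSum.mul_left (1 - q)).tendsto_sum_nat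
  rw [tendsto_nhds_unique h1 h3, tsum_gfAbove_sub hq]

theorem gf_rank_eq (k : ℕ) : gf q (fun m => (m.sup : ℤ) - m.card = (k + 1 : ℕ)) =
    gf q (fun m => m.card + (k + 1) ≤ m.sup) - gf q fun m => m.card + (k + 1 + 1) ≤ m.sup := by
  have h := gf_split hq (fun m => m.card + (k + 1) ≤ m.sup) fun m => m.card + (k + 1 + 1) ≤ m.sup
  have h1 := gf_congr (q := q) (p := fun m => m.card + (k + 1) ≤ m.sup ∧
    m.card + (k + 1 + 1) ≤ m.sup) (r := fun m => m.card + (k + 1 + 1) ≤ m.sup)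
    fun m _ => by omega
  have h2 := gf_congr (q := q) (p := fun m => m.card + (k + 1) ≤ m.sup ∧
    ¬ m.card + (k + 1 + 1) ≤ m.sup) (r := fun m => (m.sup : ℤ) - m.card = (k + 1 : ℕ))
    fun m _ => by omega
  linear_combination -h1 - h - h2

theorem gf_rank_eq_neg (k : ℕ) : gf q (fun m => (m.sup : ℤ) - m.card = -((k + 1 : ℕ) : ℤ)) =
    gf q (fun m => m.sup + (k + 1) ≤ m.card) - gf q fun m => m.sup + (k + 1 + 1) ≤ m.card := by
  have h := gf_split hq (fun m => m.sup + (k + 1) ≤ m.card) fun m => m.sup + (k + 1 + 1) ≤ m.card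
  have h1 := gf_congr (q := q) (p := fun m => m.sup + (k + 1) ≤ m.card ∧
    m.sup + (k + 1 + 1) ≤ m.card) (r := fun m => m.sup + (k + 1 + 1) ≤ m.card)
    fun m _ => by omega
  have h2 := gf_congr (q := q) (p := fun m => m.sup + (k + 1) ≤ m.card ∧
    ¬ m.sup + (k + 1 + 1) ≤ m.card) (r := fun m => (m.sup : ℤ) - m.card = -((k + 1 : ℕ) : ℤ))
    fun m _ => by omega
  linear_combination -h1 - h - h2

theorem gf_rank_eq_zero : gf q (fun m => (m.sup : ℤ) - m.card = 0) = gf q (fun _ => True) -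
    gf q (fun m => m.card + 1 ≤ m.sup) - gf q fun m => m.sup + 1 ≤ m.card := by
  have h := gf_not hq fun m => m.card + 1 ≤ m.sup
  have h0 := gf_split hq (fun m => ¬ m.card + 1 ≤ m.sup) fun m => m.sup + 1 ≤ m.card
  have h1 := gf_congr (q := q) (p := fun m => ¬ m.card + 1 ≤ m.sup ∧ m.sup + 1 ≤ m.card)
    (r := fun m => m.sup + 1 ≤ m.card) fun m _ => by omega
  have h2 := gf_congr (q := q) (p := fun m => ¬ m.card + 1 ≤ m.sup ∧ ¬ m.sup + 1 ≤ m.card)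
    (r := fun m => (m.sup : ℤ) - m.card = 0) fun m _ => by omega
  linear_combination h - h0 - h1 - h2

end

section
variable {v : ℂ} (hv : ‖v‖ < 1 / 2) (hv0 : v ≠ 0)
include hv

theorem norm_sq_lt_half : ‖v ^ 2‖ < 1 / 2 := by
  rw [norm_pow]
  nlinarith [norm_nonneg v]

include hv0

theorem tsum_gfAbove_eq (k : ℕ) : ∑' ω, gfAbove (v ^ 2) ω (ω + k) =
    gf (v ^ 2) (fun _ => True) * ∑' j, tt v 1 k j := by
  have hq := norm_sq_lt_half hv
  have h := eq_tsum_tt hv hv0 (κ := 1) (β := 0) one_pos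
    (X := fun k => ∑' ω, gfAbove (v ^ 2) ω (ω + k)) (p := gf (v ^ 2) fun _ => True)
    (fun k => ?_) (tendsto_tsum_gfAbove hq) k
  · simpa using h
  · have e : v ^ (((1 : ℕ) : ℤ) - 1 + 2 * (((0 : ℕ) : ℤ) + k)) = (v ^ 2) ^ k := by
      rw [← pow_mul, ← zpow_natCast]
      congr 1
      push_cast
      ring
    rw [e]
    exact tsum_gfAbove_rec hq k

theorem gf_rank_ge_eq (k : ℕ) : gf (v ^ 2) (fun m => m.card + (k + 1) ≤ m.sup) =
    gf (v ^ 2) (fun _ => True) * ∑' j, tt v 3 ((k + 1 : ℕ) : ℤ) j := by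
  have hq := norm_sq_lt_half hv
  have h := eq_tsum_tt hv hv0 (κ := 3) (β := 1) (by norm_num)
    (X := fun k => gf (v ^ 2) fun m => m.card + (k + 1) ≤ m.sup) (p := gf (v ^ 2) fun _ => True)
    (fun k => ?_) ?_ k
  · rw [h]
    push_cast
    rw [add_comm (1 : ℤ)]
  · have e : v ^ (((3 : ℕ) : ℤ) - 1 + 2 * (((1 : ℕ) : ℤ) + k)) = (v ^ 2) ^ (k + 2) := by
      rw [← pow_mul, ← zpow_natCast]
      congr 1
      push_cast
      ring
    rw [e]
    exact gf_rank_ge_succ hq k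
  · have h := tendsto_gf hq (p := fun k m => m.card + (k + 1) ≤ m.sup) (r := fun _ => False)
      fun N m _ hN => by
        have := sup_le_sum m
        exact iff_false_intro (by omega)
    rwa [gf_false fun _ _ => not_false] at h

theorem gf_rank_le_eq (k : ℕ) : gf (v ^ 2) (fun m => m.sup + (k + 1) ≤ m.card) =
    gf (v ^ 2) (fun _ => True) * ∑' j, tt v 3 ((k + 1 : ℕ) : ℤ) j := by
  have hq := norm_sq_lt_half hv
  have h := eq_tsum_tt hv hv0 (κ := 3) (β := 1) (by norm_num)
    (X := fun k => gf (v ^ 2) fun m => m.sup + (k + 1) ≤ m.card) (p := gf (v ^ 2) fun _ => True)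
    (fun k => ?_) ?_ k
  · rw [h]
    push_cast
    rw [add_comm (1 : ℤ)]
  · have e : v ^ (((3 : ℕ) : ℤ) - 1 + 2 * (((1 : ℕ) : ℤ) + k)) = (v ^ 2) ^ (k + 2) := by
      rw [← pow_mul, ← zpow_natCast]
      congr 1
      push_cast
      ring
    rw [e]
    exact gf_rank_le_neg_succ hq k
  · have h := tendsto_gf hq (p := fun k m => m.sup + (k + 1) ≤ m.card) (r := fun _ => False)
      fun N m h0 hN => by
        have := card_le_sum h0
        exact iff_false_intro (by omega)
    rwa [gf_false fun _ _ => not_false] at h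

/-- The generating function of a residue class modulo 11 of a statistic whose individual level
sets have partial theta generating functions. -/
theorem gf_residue_class {κ b : ℕ} {st : Multiset ℕ → ℤ} {c : ℂ} (hκ : 0 < κ)
    (hst : ∀ m, 0 ∉ m → |st m| ≤ m.sum)
    (h : ∀ k : ℕ, gf (v ^ 2) (fun m => st m = ((k + 1 : ℕ) : ℤ)) = gf (v ^ 2) (fun _ => True) *
      ((∑' j, tt v κ ((k + 1 : ℕ) : ℤ) j) - ∑' j, tt v κ (((k + 1 : ℕ) : ℤ) + 1) j) +
        if k = 0 then c else 0)
    (h' : ∀ k : ℕ, gf (v ^ 2) (fun m => st m = -((k + 1 : ℕ) : ℤ)) = gf (v ^ 2) (fun _ => True) *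
      ((∑' j, tt v κ ((k + 1 : ℕ) : ℤ) j) - ∑' j, tt v κ (((k + 1 : ℕ) : ℤ) + 1) j))
    (hb : 1 ≤ b) (hb' : b ≤ 10) : gf (v ^ 2) (fun m => st m % 11 = b % 11) =
      gf (v ^ 2) (fun _ => True) * ((∑' n, bt v κ b n) - ∑' n, bt v κ (b - 1) n) +
        if b = 1 then c else 0 := by
  have hq := norm_sq_lt_half hv
  have hκ' : (1 : ℤ) ≤ κ := by exact_mod_cast hκ
  have tail : ∀ b : ℕ, 2 ≤ b → gf (v ^ 2) (fun m => (b : ℤ) ≤ st m ∧ st m % 11 = b % 11) =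
      gf (v ^ 2) (fun _ => True) * ((∑' j, vt v κ b j) - ∑' j, vt v κ (b + 1) j) := fun b hb =>
    gf_residue_tail hv hv0 hκ (fun m h0 => (le_abs_self _).trans (hst m h0)) fun k hk => by
      obtain ⟨k, rfl⟩ : ∃ j, k = j + 1 := ⟨k - 1, by omega⟩
      rw [h k, if_neg (by omega), add_zero]
  have pos : gf (v ^ 2) (fun m => (b : ℤ) ≤ st m ∧ st m % 11 = b % 11) =
      gf (v ^ 2) (fun _ => True) * ((∑' j, vt v κ b j) - ∑' j, vt v κ (b + 1) j) +
        if b = 1 then c else 0 := by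
    obtain rfl | hb2 : b = 1 ∨ 2 ≤ b := by omega
    · have hs := gf_split hq (fun m => ((1 : ℕ) : ℤ) ≤ st m ∧ st m % 11 = ((1 : ℕ) : ℤ) % 11)
        fun m => st m = ((0 + 1 : ℕ) : ℤ)
      have e1 := gf_congr (q := v ^ 2) (p := fun m => (((1 : ℕ) : ℤ) ≤ st m ∧
        st m % 11 = ((1 : ℕ) : ℤ) % 11) ∧ st m = ((0 + 1 : ℕ) : ℤ))
        (r := fun m => st m = ((0 + 1 : ℕ) : ℤ)) fun m _ => by omega
      have e2 := gf_congr (q := v ^ 2) (p := fun m => (((1 : ℕ) : ℤ) ≤ st m ∧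
        st m % 11 = ((1 : ℕ) : ℤ) % 11) ∧ ¬ st m = ((0 + 1 : ℕ) : ℤ))
        (r := fun m => ((12 : ℕ) : ℤ) ≤ st m ∧ st m % 11 = ((12 : ℕ) : ℤ) % 11)
        fun m _ => by omega
      have t1 := tsum_vt_sub hv hv0 (κ := κ) (b := 1) (by omega)
      have t2 := tsum_vt_sub hv hv0 (κ := κ) (b := 2) (by omega)
      have h0 := h 0
      have h12 := tail 12 (by omega)
      norm_num at hs e1 e2 t1 t2 h0 h12 ⊢
      rw [hs, e1, e2, h0, h12, ← t1, ← t2]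
      ring
    · rw [tail b hb2, if_neg (by omega), add_zero]
  have neg : gf (v ^ 2) (fun m => ((11 - b : ℕ) : ℤ) ≤ -st m ∧
      -st m % 11 = ((11 - b : ℕ) : ℤ) % 11) = gf (v ^ 2) (fun _ => True) *
        ((∑' j, vt v κ ((11 - b : ℕ) : ℤ) j) - ∑' j, vt v κ (((11 - b : ℕ) : ℤ) + 1) j) :=
    gf_residue_tail hv hv0 (st := fun m => -st m) hκ
      (fun m h0 => (neg_le_abs _).trans (hst m h0)) fun k hk => by
      obtain ⟨k, rfl⟩ : ∃ j, k = j + 1 := ⟨k - 1, by omega⟩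
      rw [← h' k]
      exact gf_congr fun m _ => by omega
  have hs := gf_split hq (fun m => st m % 11 = b % 11) fun m => (b : ℤ) ≤ st m
  have e1 := gf_congr (q := v ^ 2) (p := fun m => st m % 11 = b % 11 ∧ (b : ℤ) ≤ st m)
    (r := fun m => (b : ℤ) ≤ st m ∧ st m % 11 = b % 11) fun m _ => and_comm
  have e2 := gf_congr (q := v ^ 2) (p := fun m => st m % 11 = b % 11 ∧ ¬ (b : ℤ) ≤ st m)
    (r := fun m => ((11 - b : ℕ) : ℤ) ≤ -st m ∧ -st m % 11 = ((11 - b : ℕ) : ℤ) % 11)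
    fun m _ => by omega
  rw [hs, e1, e2, pos, neg, tsum_bt_eq hv hv0 (by omega) (by omega),
    tsum_bt_eq hv hv0 (by omega) (by omega), Nat.cast_sub (by omega),
    show (11 : ℤ) - (b - 1) = 11 - b + 1 by ring, sub_add_cancel]
  push_cast
  ring

theorem gf_residue_zero {κ : ℕ} {st : Multiset ℕ → ℤ} {c : ℂ} (hκ : 0 < κ)
    (hst : ∀ m, 0 ∉ m → |st m| ≤ m.sum)
    (h0 : gf (v ^ 2) (fun m => st m = 0) =
      gf (v ^ 2) (fun _ => True) * (1 - 2 * ∑' j, tt v κ 1 j) - c)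
    (h : ∀ k : ℕ, gf (v ^ 2) (fun m => st m = ((k + 1 : ℕ) : ℤ)) = gf (v ^ 2) (fun _ => True) *
      ((∑' j, tt v κ ((k + 1 : ℕ) : ℤ) j) - ∑' j, tt v κ (((k + 1 : ℕ) : ℤ) + 1) j) +
        if k = 0 then c else 0)
    (h' : ∀ k : ℕ, gf (v ^ 2) (fun m => st m = -((k + 1 : ℕ) : ℤ)) = gf (v ^ 2) (fun _ => True) *
      ((∑' j, tt v κ ((k + 1 : ℕ) : ℤ) j) - ∑' j, tt v κ (((k + 1 : ℕ) : ℤ) + 1) j)) :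
    gf (v ^ 2) (fun m => st m % 11 = 0) =
      gf (v ^ 2) (fun _ => True) * (2 * (∑' n, bt v κ 0 n) + 1) - c := by
  have hq := norm_sq_lt_half hv
  have hκ' : (1 : ℤ) ≤ κ := by exact_mod_cast hκ
  have pos := gf_residue_tail hv hv0 (st := st) (b := 11) hκ
    (fun m h0 => (le_abs_self _).trans (hst m h0)) fun k hk => by
      obtain ⟨k, rfl⟩ : ∃ j, k = j + 1 := ⟨k - 1, by omega⟩
      rw [h k, if_neg (by omega), add_zero]
  have neg := gf_residue_tail hv hv0 (st := fun m => -st m) (b := 11) hκ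
    (fun m h0 => (neg_le_abs _).trans (hst m h0)) fun k hk => by
      obtain ⟨k, rfl⟩ : ∃ j, k = j + 1 := ⟨k - 1, by omega⟩
      rw [← h' k]
      exact gf_congr fun m _ => by omega
  have s1 := gf_split hq (fun m => st m % 11 = 0) fun m => ((11 : ℕ) : ℤ) ≤ st m
  have s2 := gf_split hq (fun m => st m % 11 = 0 ∧ ¬ ((11 : ℕ) : ℤ) ≤ st m)
    fun m => ((11 : ℕ) : ℤ) ≤ -st m
  have e1 := gf_congr (q := v ^ 2) (p := fun m => st m % 11 = 0 ∧ ((11 : ℕ) : ℤ) ≤ st m)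
    (r := fun m => ((11 : ℕ) : ℤ) ≤ st m ∧ st m % 11 = ((11 : ℕ) : ℤ) % 11) fun m _ => by omega
  have e2 := gf_congr (q := v ^ 2)
    (p := fun m => (st m % 11 = 0 ∧ ¬ ((11 : ℕ) : ℤ) ≤ st m) ∧ ((11 : ℕ) : ℤ) ≤ -st m)
    (r := fun m => ((11 : ℕ) : ℤ) ≤ -st m ∧ -st m % 11 = ((11 : ℕ) : ℤ) % 11)
    fun m _ => by omega
  have e3 := gf_congr (q := v ^ 2)
    (p := fun m => (st m % 11 = 0 ∧ ¬ ((11 : ℕ) : ℤ) ≤ st m) ∧ ¬ ((11 : ℕ) : ℤ) ≤ -st m)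
    (r := fun m => st m = 0) fun m _ => by omega
  have t1 := tsum_vt_sub hv hv0 (κ := κ) (b := 1) (by omega)
  rw [s1, s2, e1, e2, e3, pos, neg, h0, tsum_bt_eq hv hv0 (by omega) (by omega), ← t1]
  norm_num
  ring

end

end

section
variable {v : ℂ} (hv : ‖v‖ < 1 / 2) (hv0 : v ≠ 0)
include hv hv0

theorem gf_crank_pos (k : ℕ) : gf (v ^ 2) (fun m => crank m = ((k + 1 : ℕ) : ℤ)) =
    gf (v ^ 2) (fun _ => True) * ((∑' j, tt v 1 ((k + 1 : ℕ) : ℤ) j) -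
      ∑' j, tt v 1 (((k + 1 : ℕ) : ℤ) + 1) j) + if k = 0 then -v ^ 2 else 0 := by
  have h := gf_crank_eq (norm_sq_lt_half hv) (k + 1)
  rw [tsum_gfAbove_eq hv hv0, tsum_gfAbove_eq hv hv0, if_neg (Nat.succ_ne_zero k)] at h
  rw [h, mul_sub, Nat.cast_succ (k + 1)]
  simp only [add_eq_right]

theorem gf_crank_neg (k : ℕ) : gf (v ^ 2) (fun m => crank m = -((k + 1 : ℕ) : ℤ)) =
    gf (v ^ 2) (fun _ => True) * ((∑' j, tt v 1 ((k + 1 : ℕ) : ℤ) j) -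
      ∑' j, tt v 1 (((k + 1 : ℕ) : ℤ) + 1) j) := by
  rw [gf_crank_eq_neg (norm_sq_lt_half hv), tsum_gfAbove_eq hv hv0, tsum_gfAbove_eq hv hv0,
    mul_sub, Nat.cast_succ (k + 1)]

theorem gf_crank_zero : gf (v ^ 2) (fun m => crank m = 0) =
    gf (v ^ 2) (fun _ => True) * (1 - 2 * ∑' j, tt v 1 1 j) - (-v ^ 2) := by
  have h := gf_crank_eq (norm_sq_lt_half hv) 0
  rw [tsum_gfAbove_eq hv hv0, tsum_gfAbove_eq hv hv0, if_pos rfl] at h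
  have t := tsum_tt_rec hv hv0 (κ := 1) (b := 0) (by norm_num)
  norm_num at h t
  rw [h, t]
  ring

theorem gf_rank_pos (k : ℕ) : gf (v ^ 2) (fun m => (m.sup : ℤ) - m.card = ((k + 1 : ℕ) : ℤ)) =
    gf (v ^ 2) (fun _ => True) * ((∑' j, tt v 3 ((k + 1 : ℕ) : ℤ) j) -
      ∑' j, tt v 3 (((k + 1 : ℕ) : ℤ) + 1) j) + if k = 0 then 0 else 0 := by
  rw [gf_rank_eq (norm_sq_lt_half hv), gf_rank_ge_eq hv hv0, gf_rank_ge_eq hv hv0,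
    mul_sub, Nat.cast_succ (k + 1), ite_self, add_zero]

theorem gf_rank_neg (k : ℕ) : gf (v ^ 2) (fun m => (m.sup : ℤ) - m.card = -((k + 1 : ℕ) : ℤ)) =
    gf (v ^ 2) (fun _ => True) * ((∑' j, tt v 3 ((k + 1 : ℕ) : ℤ) j) -
      ∑' j, tt v 3 (((k + 1 : ℕ) : ℤ) + 1) j) := by
  rw [gf_rank_eq_neg (norm_sq_lt_half hv), gf_rank_le_eq hv hv0, gf_rank_le_eq hv hv0,
    mul_sub, Nat.cast_succ (k + 1)]

theorem gf_rank_zero : gf (v ^ 2) (fun m => (m.sup : ℤ) - m.card = 0) =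
    gf (v ^ 2) (fun _ => True) * (1 - 2 * ∑' j, tt v 3 1 j) - 0 := by
  have h1 := gf_rank_ge_eq hv hv0 0
  have h2 := gf_rank_le_eq hv hv0 0
  have h := gf_rank_eq_zero (norm_sq_lt_half hv)
  norm_num at h h1 h2 ⊢
  rw [h, h1, h2]
  ring

/-- The product `(q; q)_∞` in terms of partial theta functions. -/
theorem poch_eq_tsum_tt :
    poch (v ^ 2) (v ^ 2) = 1 - (∑' j, tt v 3 0 j) - ∑' j, tt v 3 1 j := by
  have hq := norm_sq_lt_half hv
  have h0 := poch_mul_gf hq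
  have h1 := gf_rank_ge_zero hq
  have h2 := gf_rank_ge_eq hv hv0 2
  have h3 := gf_rank_le_eq hv hv0 0
  have h4 := gf_not hq fun m => m.card ≤ m.sup
  have h5 := gf_congr (q := v ^ 2) (p := fun m => ¬ m.card ≤ m.sup)
    (r := fun m => m.sup + (0 + 1) ≤ m.card) fun m _ => by omega
  have t := tsum_tt_rec hv hv0 (κ := 3) (b := 0) (by norm_num)
  norm_num at h1 h2 h3 h4 h5 t
  have t' : ∑' j, tt v 3 0 j = v ^ 2 * (1 - ∑' j, tt v 3 3 j) := t
  have h6 : gf (v ^ 2) (fun _ => True) * (1 - (∑' j, tt v 3 0 j) - ∑' j, tt v 3 1 j) = 1 := by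
    linear_combination -h4 + h5 + h3 + h1 - v ^ 2 * h2 - gf (v ^ 2) (fun _ => True) * t'
  linear_combination (1 - (∑' j, tt v 3 0 j) - ∑' j, tt v 3 1 j) * h0 -
    poch (v ^ 2) (v ^ 2) * h6

theorem tsum_bt_three_two : ∑' n, bt v 3 2 n =
    (∑' n, bt v 3 13 n) - (v ^ 2)⁻¹ * poch (v ^ 2) (v ^ 2) - 1 := by
  have t0 := tsum_tt_rec hv hv0 (κ := 3) (b := 0) (by norm_num)
  have t2 := tsum_tt_rec hv hv0 (κ := 3) (b := -2) (by norm_num)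
  have s3 := tsum_vt_sub hv hv0 (κ := 3) (b := 3) (by norm_num)
  have s2 := tsum_vt_sub hv hv0 (κ := 3) (b := -2) (by norm_num)
  rw [poch_eq_tsum_tt hv hv0, tsum_bt_eq hv hv0 (by norm_num) (by norm_num),
    tsum_bt_eq hv hv0 (by norm_num) (by norm_num)]
  norm_num at t0 t2 s2 s3 ⊢
  have t0' : ∑' j, tt v 3 0 j = v ^ 2 * (1 - ∑' j, tt v 3 3 j) := t0
  have hi : (v ^ 2)⁻¹ * v ^ 2 = 1 := inv_mul_cancel₀ (pow_ne_zero 2 hv0)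
  linear_combination -s3 - s2 - t2 - (v ^ 2)⁻¹ * t0' - (1 - ∑' j, tt v 3 3 j) * hi

theorem tsum_bt_three_reflect {c : ℤ} (h1 : -2 ≤ 11 - c) (h2 : -2 ≤ c + 1) :
    ∑' n, bt v 3 (10 - c) n = -∑' n, bt v 3 c n := by
  rw [tsum_bt_eq hv hv0 (by push_cast; omega) (by push_cast; omega),
    tsum_bt_eq hv hv0 (by push_cast; omega) (by push_cast; omega),
    show 11 - (10 - c) = c + 1 by ring, show 10 - c + 1 = 11 - c by ring]
  ring

end

end RankCrank

open RankCrank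

theorem rankCount_eq (a : ℤ) (n : ℕ) : rankCount a 11 n = (Finset.univ.filter
    fun π : Nat.Partition n => ((π.parts.sup : ℤ) - π.parts.card) % 11 = a % 11).card := rfl

theorem hasSum_rankCount {v : ℂ} (hv : ‖v‖ < 1 / 2) (hv0 : v ≠ 0) {b : ℕ} (hb : 1 ≤ b)
    (hb' : b ≤ 10) : HasSum (fun n => (rankCount b 11 n : ℂ) * v ^ (2 * n))
      (gf (v ^ 2) (fun _ => True) * ((∑' n, bt v 3 b n) - ∑' n, bt v 3 (b - 1) n)) := by
  have h := gf_residue_class hv hv0 (κ := 3) (by norm_num) (fun m h0 => abs_rank_le h0)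
    (gf_rank_pos hv hv0) (gf_rank_neg hv hv0) hb hb'
  rw [ite_self, add_zero] at h
  have h1 := hasSum_gf (norm_sq_lt_half hv)
    fun m => ((m.sup : ℤ) - m.card) % 11 = (b : ℤ) % 11
  rw [h] at h1
  refine h1.congr_fun fun n => ?_
  rw [pow_mul, rankCount_eq]

theorem hasSum_rankCount_zero {v : ℂ} (hv : ‖v‖ < 1 / 2) (hv0 : v ≠ 0) :
    HasSum (fun n => (rankCount 0 11 n : ℂ) * v ^ (2 * n))
      (gf (v ^ 2) (fun _ => True) * (2 * (∑' n, bt v 3 0 n) + 1)) := by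
  have h := gf_residue_zero hv hv0 (κ := 3) (by norm_num) (fun m h0 => abs_rank_le h0)
    (gf_rank_zero hv hv0) (gf_rank_pos hv hv0) (gf_rank_neg hv hv0)
  rw [sub_zero] at h
  have h1 := hasSum_gf (norm_sq_lt_half hv) fun m => ((m.sup : ℤ) - m.card) % 11 = 0
  rw [h] at h1
  refine h1.congr_fun fun n => ?_
  rw [pow_mul, rankCount_eq]
  rfl

theorem card_crank_one (a : ℤ) (ha : a = 0 ∨ a = 1) : (Finset.univ.filter
    fun π : Nat.Partition 1 => crank π.parts % 11 = a).card = 0 := by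
  rw [Finset.card_eq_zero, Finset.filter_eq_empty_iff]
  intro π _
  have h1 : π.parts = {1} := by
    rw [Subsingleton.elim π (Nat.Partition.indiscrete 1)]
    rfl
  rw [h1]
  have h2 : crank {1} = -1 := by decide
  rw [h2]
  omega

theorem crankCount_zero_eq (n : ℕ) : crankCount 0 n = ((Finset.univ.filter
    fun π : Nat.Partition n => crank π.parts % 11 = 0).card : ℤ) - if n = 1 then 1 else 0 := by
  by_cases h : n = 1
  · subst h
    rw [card_crank_one 0 (Or.inl rfl)]
    rfl
  · rw [if_neg h, crankCount, if_neg h, sub_zero]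
    rfl

theorem crankCount_one_eq (n : ℕ) : crankCount 1 n = ((Finset.univ.filter
    fun π : Nat.Partition n => crank π.parts % 11 = ((1 : ℕ) : ℤ) % 11).card : ℤ) +
      if n = 1 then 1 else 0 := by
  by_cases h : n = 1
  · subst h
    rw [show ((1 : ℕ) : ℤ) % 11 = 1 from rfl, card_crank_one 1 (Or.inr rfl)]
    rfl
  · rw [if_neg h, crankCount, if_neg h, add_zero]
    rfl

theorem hasSum_crankCount_zero {v : ℂ} (hv : ‖v‖ < 1 / 2) (hv0 : v ≠ 0) :
    HasSum (fun n => (crankCount 0 n : ℂ) * v ^ (2 * n))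
      (gf (v ^ 2) (fun _ => True) * (2 * (∑' n, bt v 1 0 n) + 1)) := by
  have h := gf_residue_zero hv hv0 (κ := 1) one_pos (fun m h0 => abs_crank_le h0)
    (gf_crank_zero hv hv0) (gf_crank_pos hv hv0) (gf_crank_neg hv hv0)
  have h1 := (hasSum_gf (norm_sq_lt_half hv) fun m => crank m % 11 = 0).sub
    (hasSum_ite_eq 1 (v ^ 2))
  rw [h, sub_neg_eq_add, add_sub_cancel_right] at h1
  refine h1.congr_fun fun n => ?_
  rw [crankCount_zero_eq]
  split_ifs with hn
  · subst hn
    push_cast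
    ring
  · push_cast
    ring

theorem hasSum_crankCount_one {v : ℂ} (hv : ‖v‖ < 1 / 2) (hv0 : v ≠ 0) :
    HasSum (fun n => (crankCount 1 n : ℂ) * v ^ (2 * n))
      (gf (v ^ 2) (fun _ => True) * ((∑' n, bt v 1 1 n) - ∑' n, bt v 1 0 n)) := by
  have h := gf_residue_class hv hv0 (κ := 1) (b := 1) one_pos (fun m h0 => abs_crank_le h0)
    (gf_crank_pos hv hv0) (gf_crank_neg hv hv0) le_rfl (by norm_num)
  have h1 := (hasSum_gf (norm_sq_lt_half hv) fun m => crank m % 11 = ((1 : ℕ) : ℤ) % 11).add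
    (hasSum_ite_eq 1 (v ^ 2))
  rw [h, if_pos rfl, neg_add_cancel_right, Nat.cast_one, sub_self] at h1
  refine h1.congr_fun fun n => ?_
  rw [crankCount_one_eq]
  split_ifs with hn
  · subst hn
    push_cast
    ring
  · push_cast
    ring

/-- The generating function of an integral combination of rank and crank counts. -/
theorem hasSum_rank_crank {v : ℂ} (hv : ‖v‖ < 1 / 2) (hv0 : v ≠ 0) (a₀ a₁ a₃ a₄ a₅ b₀ b₁ : ℤ) :
    HasSum (fun n => (((a₀ * rankCount 0 11 n + a₁ * rankCount 1 11 n + a₁ * rankCount 2 11 n +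
        a₃ * rankCount 3 11 n + a₄ * rankCount 4 11 n + a₅ * rankCount 5 11 n +
        b₀ * crankCount 0 n + b₁ * crankCount 1 n : ℤ) : ℝ) : ℂ) * v ^ (2 * n))
      (gf (v ^ 2) (fun _ => True) * (-(2 * a₀ - a₁) * (∑' n, bt v 3 10 n) +
        (a₁ - a₃) * ((∑' n, bt v 3 13 n) - (v ^ 2)⁻¹ * poch (v ^ 2) (v ^ 2) - 1) -
        (a₃ - a₄) * (∑' n, bt v 3 7 n) + (a₄ - a₅) * (∑' n, bt v 3 4 n) + a₀ +
        (2 * b₀ - b₁) * (∑' n, bt v 1 0 n) + b₁ * (∑' n, bt v 1 1 n) + b₀)) := by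
  have r0 := (hasSum_rankCount_zero hv hv0).mul_left (a₀ : ℂ)
  have r1 := (hasSum_rankCount hv hv0 (b := 1) (by norm_num) (by norm_num)).mul_left (a₁ : ℂ)
  have r2 := (hasSum_rankCount hv hv0 (b := 2) (by norm_num) (by norm_num)).mul_left (a₁ : ℂ)
  have r3 := (hasSum_rankCount hv hv0 (b := 3) (by norm_num) (by norm_num)).mul_left (a₃ : ℂ)
  have r4 := (hasSum_rankCount hv hv0 (b := 4) (by norm_num) (by norm_num)).mul_left (a₄ : ℂ)
  have r5 := (hasSum_rankCount hv hv0 (b := 5) (by norm_num) (by norm_num)).mul_left (a₅ : ℂ)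
  have c0 := (hasSum_crankCount_zero hv hv0).mul_left (b₀ : ℂ)
  have c1 := (hasSum_crankCount_one hv hv0).mul_left (b₁ : ℂ)
  have h := ((((((r0.add r1).add r2).add r3).add r4).add r5).add c0).add c1
  have e0 := tsum_bt_three_reflect hv hv0 (c := 10) (by norm_num) (by norm_num)
  have e3 := tsum_bt_three_reflect hv hv0 (c := 7) (by norm_num) (by norm_num)
  have e5 := tsum_bt_three_reflect hv hv0 (c := 5) (by norm_num) (by norm_num)
  have e2 := tsum_bt_three_two hv hv0
  norm_num at h e0 e3 e5
  have e5' : ∑' n, bt v 3 5 n = 0 := by linear_combination e5 / 2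
  rw [e0, e3, e5', e2] at h
  have e : ∀ {x y : ℂ} {f : ℕ → ℂ}, HasSum f x → x = y → HasSum f y := fun h e => e ▸ h
  refine e (h.congr_fun fun n => ?_) ?_
  · push_cast
    ring
  · ring

/-- Rank-crank inequalities for the residue 7 modulo 11. -/
theorem rank_crank_inequalities_residue_seven (n : ℕ) :
    ((rankCount 0 11 (11  *  n  +  7) : ℤ)  +  2 * (rankCount 4 11 (11  *  n  +  7) : ℤ)  +  2 * crankCount 0 (11  *  n  +  7) ≥ 2 * (rankCount 3 11 (11  *  n  +  7) : ℤ)  +  (rankCount 5 11 (11  *  n  +  7) : ℤ)  +  2 * crankCount 1 (11  *  n  +  7))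
    ∧ (3 * (rankCount 0 11 (11  *  n  +  7) : ℤ)  +  (rankCount 1 11 (11  *  n  +  7) : ℤ)  +  (rankCount 2 11 (11  *  n  +  7) : ℤ)  +  7 * (rankCount 3 11 (11  *  n  +  7) : ℤ)  +  4 * (rankCount 5 11 (11  *  n  +  7) : ℤ) ≥ 5 * (rankCount 4 11 (11  *  n  +  7) : ℤ)  +  4 * crankCount 0 (11  *  n  +  7)  +  7 * crankCount 1 (11  *  n  +  7))
    ∧ (4 * (rankCount 1 11 (11  *  n  +  7) : ℤ)  +  4 * (rankCount 2 11 (11  *  n  +  7) : ℤ)  +  3 * (rankCount 4 11 (11  *  n  +  7) : ℤ)  +  4 * crankCount 1 (11  *  n  +  7) ≥ 4 * (rankCount 0 11 (11  *  n  +  7) : ℤ)  +  6 * (rankCount 3 11 (11  *  n  +  7) : ℤ)  +  (rankCount 5 11 (11  *  n  +  7) : ℤ)  +  4 * crankCount 0 (11  *  n  +  7))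
    ∧ ((rankCount 0 11 (11  *  n  +  7) : ℤ)  +  5 * (rankCount 3 11 (11  *  n  +  7) : ℤ)  +  2 * (rankCount 4 11 (11  *  n  +  7) : ℤ) ≥ 2 * (rankCount 1 11 (11  *  n  +  7) : ℤ)  +  2 * (rankCount 2 11 (11  *  n  +  7) : ℤ)  +  4 * (rankCount 5 11 (11  *  n  +  7) : ℤ)) := by
  have hE : ∀ v : ℂ, ‖v‖ < 1 / 2 → gf (v ^ 2) (fun _ => True) * poch (v ^ 2) (v ^ 2) = 1 :=
    fun v hv => by rw [mul_comm]; exact poch_mul_gf (norm_sq_lt_half hv)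
  have h0 := coeff_nonneg_line_zero (δ := 1 / 2) (by norm_num) (by norm_num)
    (fun v hv0 hv => hasSum_rank_crank hv hv0 1 0 (-2) 2 (-1) 2 (-2)) (fun v hv0 hv => by
      push_cast
      linear_combination (-(2 * 1 - 0) * (∑' n, bt v 3 10 n) +
        (0 - (-2)) * ((∑' n, bt v 3 13 n) - (v ^ 2)⁻¹ * poch (v ^ 2) (v ^ 2) - 1) -
        ((-2) - 2) * (∑' n, bt v 3 7 n) + (2 - (-1)) * (∑' n, bt v 3 4 n) + 1 +
        (2 * 2 - (-2)) * (∑' n, bt v 1 0 n) + (-2) * (∑' n, bt v 1 1 n) + 2) * hE v hv) n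
  have h1 := coeff_nonneg_line_one (δ := 1 / 2) (by norm_num) (by norm_num)
    (fun v hv0 hv => hasSum_rank_crank hv hv0 3 1 7 (-5) 4 (-4) (-7)) (fun v hv0 hv => by
      push_cast
      linear_combination (-(2 * 3 - 1) * (∑' n, bt v 3 10 n) +
        (1 - 7) * ((∑' n, bt v 3 13 n) - (v ^ 2)⁻¹ * poch (v ^ 2) (v ^ 2) - 1) -
        (7 - (-5)) * (∑' n, bt v 3 7 n) + ((-5) - 4) * (∑' n, bt v 3 4 n) + 3 +
        (2 * (-4) - (-7)) * (∑' n, bt v 1 0 n) + (-7) * (∑' n, bt v 1 1 n) + (-4)) * hE v hv) n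
  have h2 := coeff_nonneg_line_two (δ := 1 / 2) (by norm_num) (by norm_num)
    (fun v hv0 hv => hasSum_rank_crank hv hv0 (-4) 4 (-6) 3 (-1) (-4) 4) (fun v hv0 hv => by
      push_cast
      linear_combination (-(2 * (-4) - 4) * (∑' n, bt v 3 10 n) +
        (4 - (-6)) * ((∑' n, bt v 3 13 n) - (v ^ 2)⁻¹ * poch (v ^ 2) (v ^ 2) - 1) -
        ((-6) - 3) * (∑' n, bt v 3 7 n) + (3 - (-1)) * (∑' n, bt v 3 4 n) + (-4) +
        (2 * (-4) - 4) * (∑' n, bt v 1 0 n) + 4 * (∑' n, bt v 1 1 n) + (-4)) * hE v hv) n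
  have h3 := coeff_nonneg_line_three (δ := 1 / 2) (by norm_num) (by norm_num)
    (fun v hv0 hv => hasSum_rank_crank hv hv0 1 (-2) 5 2 (-4) 0 0) (fun v hv0 hv => by
      push_cast
      linear_combination (-(2 * 1 - (-2)) * (∑' n, bt v 3 10 n) +
        ((-2) - 5) * ((∑' n, bt v 3 13 n) - (v ^ 2)⁻¹ * poch (v ^ 2) (v ^ 2) - 1) -
        (5 - 2) * (∑' n, bt v 3 7 n) + (2 - (-4)) * (∑' n, bt v 3 4 n) + 1 +
        (2 * 0 - 0) * (∑' n, bt v 1 0 n) + 0 * (∑' n, bt v 1 1 n) + 0) * hE v hv) n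
  rw [Int.cast_nonneg_iff] at h0 h1 h2 h3
  refine ⟨?_, ?_, ?_, ?_⟩ <;> linarith
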